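/- For every M ∈ ℕ and ε > 0 there exist a constant B = B(M) and thresholds N₀, R₀ such that the following holds. Let N ≥ N₀ and R ≥ R₀ be reals with R ≤ N^{1/4}·(log N)^{−B}, let h be a positive integer with h ≤ R, let H₁, H₂ ⊆ {1,…,h} with |Hᵢ| = kᵢ and |H₁ ∩ H₂| = r, let H = H₁ ∪ H₂, let h₀ ∈ {1,…,h} with h₀ ∉ H, and let l₁, l₂ ≥ 0 be integers with k₁ + k₂ + l₁ + l₂ ≤ M. Then |Σ_{N < n ≤ 2N} θ(n+h₀)·Λ_R(n;H₁,k₁+l₁)·Λ_R(n;H₂,k₂+l₂) − C(l₁+l₂,l₁)·((log R)^{r+l₁+l₂}/(r+l₁+l₂)!)·𝔖(H ∪ {h₀})·N| ≤ ε·N·(log R)^{r+l₁+l₂}, where C(l₁+l₂,l₁) is the binomial coefficient. -/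

import Mathlib

open Finset

/-- The sieve weight Λ_R(n; H, a) = (1/a!) Σ_{d | P(n,H), d ≤ R} μ(d) (log (R/d))^a,
where P(n,H) = ∏_{h ∈ H} (n+h). -/
noncomputable def lamR (R : ℝ) (n : ℕ) (H : Finset ℕ) (a : ℕ) : ℝ :=
  (1 / (Nat.factorial a : ℝ)) *
    ∑ d ∈ (∏ h ∈ H, (n + h)).divisors.filter (fun d : ℕ => (d : ℝ) ≤ R),
      (ArithmeticFunction.moebius d : ℝ) * (Real.log (R / d)) ^ a

/-- |Ω_H(p)|: the number of residue classes mod p occupied by the elements of H. -/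
def residCard (H : Finset ℕ) (p : ℕ) : ℕ := (H.image (fun h => h % p)).card

/-- The singular series 𝔖(H) = ∏_p (1 - |Ω_H(p)|/p) (1 - 1/p)^{-|H|}. -/
noncomputable def singSeries (H : Finset ℕ) : ℝ :=
  ∏' p : Nat.Primes,
    ((1 - (residCard H (p : ℕ) : ℝ) / (p : ℕ)) * ((1 - 1 / ((p : ℕ) : ℝ)) ^ H.card)⁻¹)

/-- θ(n) = log n if n is prime, 0 otherwise. -/
noncomputable def theta (n : ℕ) : ℝ := if Nat.Prime n then Real.log n else 0

/-! ### Growth of Dirichlet series with bounded partial sums -/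

theorem one_add_log_pow_le (k : ℕ) {δ : ℝ} (hδ : 0 < δ) :
    ∃ C : ℝ, 1 ≤ C ∧ ∀ u : ℝ, 1 ≤ u → (1 + Real.log u) ^ k ≤ C * u ^ δ := by
  rcases Nat.eq_zero_or_pos k with rfl | hk
  · exact ⟨1, le_rfl, fun u hu => by simpa using Real.one_le_rpow hu hδ.le⟩
  set d : ℝ := min 1 (δ / k) with hd
  have hk' : (0 : ℝ) < k := by exact_mod_cast hk
  have hd0 : 0 < d := lt_min one_pos (div_pos hδ hk')
  have hd1 : d ≤ 1 := min_le_left _ _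
  have hdk : d * k ≤ δ := by
    have : d ≤ δ / k := min_le_right _ _
    rwa [le_div_iff₀ hk'] at this
  refine ⟨(1 / d) ^ k, one_le_pow₀ (by rw [le_div_iff₀ hd0]; linarith), fun u hu => ?_⟩
  have hlog : 0 ≤ Real.log u := Real.log_nonneg hu
  have hu0 : 0 < u := by linarith
  have h1 : 1 + Real.log u ≤ 1 / d * u ^ d := by
    rw [Real.rpow_def_of_pos hu0, div_mul_eq_mul_div, one_mul, le_div_iff₀ hd0]
    have := Real.add_one_le_exp (Real.log u * d)
    nlinarith
  calc (1 + Real.log u) ^ k ≤ (1 / d * u ^ d) ^ k := by gcongr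
    _ = (1 / d) ^ k * u ^ (d * k) := by
        rw [mul_pow, Real.rpow_mul hu0.le, Real.rpow_natCast]
    _ ≤ _ := by gcongr

/-- The function `u ↦ (log u)^k u^{-s}`. -/
noncomputable def logCpow (k : ℕ) (s : ℂ) (u : ℝ) : ℂ := (Real.log u : ℂ) ^ k * (u : ℂ) ^ (-s)

theorem norm_logCpow {k : ℕ} {s : ℂ} {u : ℝ} (hu : 1 ≤ u) :
    ‖logCpow k s u‖ = (Real.log u) ^ k * u ^ (-s.re) := by
  have hlog : 0 ≤ Real.log u := Real.log_nonneg hu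
  rw [logCpow, norm_mul, norm_pow, Complex.norm_real, Real.norm_of_nonneg hlog,
    Complex.norm_cpow_eq_rpow_re_of_pos (by linarith)]
  simp

theorem hasDerivAt_ofReal_cpow_neg {s : ℂ} {u : ℝ} (hu : 0 < u) :
    HasDerivAt (fun u : ℝ => (u : ℂ) ^ (-s)) (-s * (u : ℂ) ^ (-s - 1)) u := by
  have h1 : HasDerivAt (fun z : ℂ => z ^ (-s)) (-s * (u : ℂ) ^ (-s - 1) * 1) (u : ℂ) :=
    (hasDerivAt_id' (u : ℂ)).cpow_const (Or.inl (by simpa using hu))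
  simpa using h1.comp_ofReal

theorem hasDerivAt_logCpow {k : ℕ} {s : ℂ} {u : ℝ} (hu : 0 < u) :
    HasDerivAt (logCpow k s)
      ((k * (Real.log u : ℂ) ^ (k - 1) * ((u⁻¹ : ℝ) : ℂ)) * (u : ℂ) ^ (-s) +
        (Real.log u : ℂ) ^ k * (-s * (u : ℂ) ^ (-s - 1))) u := by
  have h1 : HasDerivAt (fun u : ℝ => ((Real.log u : ℝ) : ℂ)) ((u⁻¹ : ℝ) : ℂ) u :=
    (Real.hasDerivAt_log hu.ne').ofReal_comp
  exact (h1.pow k).mul (hasDerivAt_ofReal_cpow_neg hu)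

theorem norm_deriv_logCpow_le {k : ℕ} {s : ℂ} (hs : 1 ≤ s.re) {u : ℝ} (hu : 1 ≤ u) :
    ‖deriv (logCpow k s) u‖ ≤ (k + ‖s‖) * (1 + Real.log u) ^ k * u ^ (-2 : ℝ) := by
  have hu0 : 0 < u := by linarith
  have hlog : 0 ≤ Real.log u := Real.log_nonneg hu
  rw [(hasDerivAt_logCpow hu0).deriv]
  have e1 : ‖(u : ℂ) ^ (-s)‖ ≤ u ^ (-1 : ℝ) := by
    rw [Complex.norm_cpow_eq_rpow_re_of_pos hu0]
    exact Real.rpow_le_rpow_of_exponent_le hu (by simpa using hs)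
  have e2 : ‖(u : ℂ) ^ (-s - 1)‖ ≤ u ^ (-2 : ℝ) := by
    rw [Complex.norm_cpow_eq_rpow_re_of_pos hu0]
    exact Real.rpow_le_rpow_of_exponent_le hu (by simp; linarith)
  have e3 : u⁻¹ * u ^ (-1 : ℝ) = u ^ (-2 : ℝ) := by
    rw [← Real.rpow_neg_one, ← Real.rpow_add hu0]; norm_num
  have e4 : Real.log u ^ (k - 1) ≤ (1 + Real.log u) ^ k :=
    (pow_le_pow_left₀ hlog (by linarith) _).trans
      (pow_le_pow_right₀ (by linarith) (Nat.sub_le _ _))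
  have e5 : Real.log u ^ k ≤ (1 + Real.log u) ^ k := pow_le_pow_left₀ hlog (by linarith) _
  refine (norm_add_le _ _).trans ?_
  simp only [norm_mul, norm_pow, Complex.norm_real, Real.norm_of_nonneg hlog, norm_neg,
    Real.norm_of_nonneg (inv_nonneg.2 hu0.le), Complex.norm_natCast]
  calc _ ≤ (k * (1 + Real.log u) ^ k * u⁻¹) * u ^ (-1 : ℝ) +
        (1 + Real.log u) ^ k * (‖s‖ * u ^ (-2 : ℝ)) := by gcongr
    _ = _ := by rw [mul_assoc _ u⁻¹, e3]; ring

theorem norm_logCpow_sub_le {k : ℕ} {s : ℂ} (hs : 1 ≤ s.re) {n u : ℝ} (hn : 1 ≤ n)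
    (hu : n ≤ u) (hu1 : u ≤ n + 1) :
    ‖logCpow k s u - logCpow k s n‖ ≤
      (k + ‖s‖) * (1 + Real.log (n + 1)) ^ k * n ^ (-2 : ℝ) := by
  have key := (convex_Icc n (n + 1)).norm_image_sub_le_of_norm_deriv_le (f := logCpow k s)
    (C := (k + ‖s‖) * (1 + Real.log (n + 1)) ^ k * n ^ (-2 : ℝ)) (x := n) (y := u)
    (fun x hx => (hasDerivAt_logCpow (by linarith [hx.1])).differentiableAt)
    (fun x hx => ?_) ⟨le_rfl, by linarith⟩ ⟨hu, hu1⟩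
  · refine key.trans ?_
    have hpos : 0 ≤ (k + ‖s‖) * (1 + Real.log (n + 1)) ^ k * n ^ (-2 : ℝ) := by
      have := Real.log_nonneg (show (1:ℝ) ≤ n + 1 by linarith)
      positivity
    have : ‖u - n‖ ≤ 1 := by rw [Real.norm_of_nonneg (by linarith)]; linarith
    exact mul_le_of_le_one_right hpos this
  · refine (norm_deriv_logCpow_le hs (hn.trans hx.1)).trans ?_
    have h0 := Real.log_nonneg (hn.trans hx.1)
    have hx0 : 0 < x := by linarith [hx.1]
    have h1 : Real.log x ≤ Real.log (n + 1) := Real.log_le_log hx0 hx.2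
    have h2 : x ^ (-2 : ℝ) ≤ n ^ (-2 : ℝ) :=
      Real.rpow_le_rpow_of_nonpos (by linarith) hx.1 (by norm_num)
    have := Real.log_nonneg (show (1:ℝ) ≤ n + 1 by linarith)
    gcongr

theorem sum_Ico_by_parts (f g : ℕ → ℂ) {a b : ℕ} (hab : a ≤ b) :
    ∑ n ∈ Ico a b, f n * g n = (∑ n ∈ range b, f n) * g b - (∑ n ∈ range a, f n) * g a
      - ∑ n ∈ Ico a b, (∑ m ∈ range (n + 1), f m) * (g (n + 1) - g n) := by
  induction b, hab using Nat.le_induction with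
  | base => simp
  | succ b hab ih =>
    rw [sum_Ico_succ_top hab, sum_Ico_succ_top hab, ih, sum_range_succ]
    ring

theorem norm_sum_Ico_mul_le {f g : ℕ → ℂ} {B : ℝ} (hf : ∀ N, ‖∑ n ∈ range N, f n‖ ≤ B)
    {a b : ℕ} (hab : a ≤ b) :
    ‖∑ n ∈ Ico a b, f n * g n‖ ≤
      B * (‖g b‖ + ‖g a‖ + ∑ n ∈ Ico a b, ‖g (n + 1) - g n‖) := by
  have hB : 0 ≤ B := (norm_nonneg _).trans (hf 0)
  rw [sum_Ico_by_parts f g hab]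
  refine (norm_sub_le _ _).trans ?_
  rw [mul_add, mul_add]
  gcongr
  · refine (norm_sub_le _ _).trans ?_
    rw [norm_mul, norm_mul]
    gcongr <;> apply hf
  · rw [mul_sum]
    refine (norm_sum_le _ _).trans (sum_le_sum fun n _ => ?_)
    rw [norm_mul]; gcongr; apply hf

theorem log_pow_le_of_le {k : ℕ} {C δ u : ℝ} (h : (1 + Real.log u) ^ k ≤ C * u ^ δ) (hu : 1 ≤ u) :
    (Real.log u) ^ k ≤ C * u ^ δ :=
  (pow_le_pow_left₀ (Real.log_nonneg hu) (by linarith) _).trans h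

theorem norm_logCpow_le {k : ℕ} {C δ : ℝ} {s : ℂ} (hs : 1 ≤ s.re)
    (hC : ∀ u : ℝ, 1 ≤ u → (1 + Real.log u) ^ k ≤ C * u ^ δ) {u : ℝ} (hu : 1 ≤ u) :
    ‖logCpow k s u‖ ≤ C * u ^ (δ - 1) := by
  have hu0 : 0 < u := by linarith
  rw [norm_logCpow hu, sub_eq_add_neg, Real.rpow_add hu0, ← mul_assoc]
  have h1 := log_pow_le_of_le (hC u hu) hu
  have h2 : u ^ (-s.re) ≤ u ^ (-1 : ℝ) := Real.rpow_le_rpow_of_exponent_le hu (by linarith)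
  have := Real.log_nonneg hu
  gcongr
  exact (pow_nonneg this k).trans h1

theorem norm_logCpow_sub_le' {k : ℕ} {C δ : ℝ} {s : ℂ} (hs : 1 ≤ s.re) (hδ : 0 ≤ δ) (hδ1 : δ ≤ 1)
    (hC0 : 0 ≤ C)
    (hC : ∀ u : ℝ, 1 ≤ u → (1 + Real.log u) ^ k ≤ C * u ^ δ) {n u : ℝ} (hn : 1 ≤ n)
    (hu : n ≤ u) (hu1 : u ≤ n + 1) :
    ‖logCpow k s u - logCpow k s n‖ ≤ 2 * C * (k + ‖s‖) * n ^ (δ - 2) := by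
  refine (norm_logCpow_sub_le hs hn hu hu1).trans ?_
  have hn0 : 0 < n := by linarith
  have h1 : (1 + Real.log (n + 1)) ^ k ≤ C * (2 * n ^ δ) := by
    refine (hC (n + 1) (by linarith)).trans ?_
    gcongr
    calc (n + 1) ^ δ ≤ (2 * n) ^ δ := by gcongr; linarith
      _ = 2 ^ δ * n ^ δ := Real.mul_rpow (by norm_num) hn0.le
      _ ≤ 2 ^ (1 : ℝ) * n ^ δ := by gcongr; norm_num
      _ = _ := by norm_num
  calc _ ≤ (k + ‖s‖) * (C * (2 * n ^ δ)) * n ^ (-2 : ℝ) := by gcongr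
    _ = _ := by rw [sub_eq_add_neg, Real.rpow_add hn0]; ring

/-- The sum `∑ 1/n^{1+δ}`. -/
noncomputable def zetaSum (δ : ℝ) : ℝ := ∑' n : ℕ, 1 / (n : ℝ) ^ (1 + δ)

theorem sum_one_div_le_zetaSum {δ : ℝ} (hδ : 0 < δ) (S : Finset ℕ) :
    ∑ n ∈ S, 1 / (n : ℝ) ^ (1 + δ) ≤ zetaSum δ :=
  (Real.summable_one_div_nat_rpow.2 (by linarith)).sum_le_tsum _ fun n _ => by positivity

theorem zetaSum_nonneg (δ : ℝ) : 0 ≤ zetaSum δ := tsum_nonneg fun n => by positivity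

theorem sum_rpow_head_le {δ : ℝ} (hδ : 0 < δ) {Y : ℝ} (hY : 0 ≤ Y)
    {S : Finset ℕ} (hS : ∀ n ∈ S, 1 ≤ n ∧ (n:ℝ) ≤ Y) :
    ∑ n ∈ S, (n : ℝ) ^ (δ - 1) ≤ zetaSum δ * Y ^ (2 * δ) := by
  calc ∑ n ∈ S, (n : ℝ) ^ (δ - 1) ≤ ∑ n ∈ S, 1 / (n : ℝ) ^ (1 + δ) * Y ^ (2 * δ) := by
        refine sum_le_sum fun n hn => ?_
        have hn1 : (0 : ℝ) < n := by exact_mod_cast (hS n hn).1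
        have : (n : ℝ) ^ (δ - 1) = 1 / (n : ℝ) ^ (1 + δ) * (n : ℝ) ^ (2 * δ) := by
          rw [one_div, ← Real.rpow_neg hn1.le, ← Real.rpow_add hn1]; ring_nf
        rw [this]
        gcongr
        exact (hS n hn).2
    _ = (∑ n ∈ S, 1 / (n : ℝ) ^ (1 + δ)) * Y ^ (2 * δ) := by rw [sum_mul]
    _ ≤ _ := by gcongr; exact sum_one_div_le_zetaSum hδ S

theorem sum_rpow_tail_le {δ : ℝ} (hδ : 0 < δ) (hδ1 : 2 * δ ≤ 1) {Y : ℝ} (hY : 0 < Y) {S : Finset ℕ}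
    (hS : ∀ n ∈ S, Y ≤ (n:ℝ)) :
    ∑ n ∈ S, (n : ℝ) ^ (δ - 2) ≤ zetaSum δ * Y ^ (2 * δ - 1) := by
  calc ∑ n ∈ S, (n : ℝ) ^ (δ - 2) ≤ ∑ n ∈ S, 1 / (n : ℝ) ^ (1 + δ) * Y ^ (2 * δ - 1) := by
        refine sum_le_sum fun n hn => ?_
        have hn1 : (0 : ℝ) < n := hY.trans_le (hS n hn)
        have : (n : ℝ) ^ (δ - 2) = 1 / (n : ℝ) ^ (1 + δ) * (n : ℝ) ^ (2 * δ - 1) := by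
          rw [one_div, ← Real.rpow_neg hn1.le, ← Real.rpow_add hn1]; ring_nf
        rw [this]
        exact mul_le_mul_of_nonneg_left
          (Real.rpow_le_rpow_of_nonpos hY (hS n hn) (by linarith)) (by positivity)
    _ = (∑ n ∈ S, 1 / (n : ℝ) ^ (1 + δ)) * Y ^ (2 * δ - 1) := by rw [sum_mul]
    _ ≤ _ := by gcongr; exact sum_one_div_le_zetaSum hδ S

theorem logCpow_zero {k : ℕ} {s : ℂ} (hs : 1 ≤ s.re) : logCpow k s 0 = 0 := by
  have : -s ≠ 0 := by
    intro h
    have := congrArg Complex.re h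
    simp at this; linarith
  simp [logCpow, Complex.zero_cpow this]

theorem norm_le_im_add_two {s : ℂ} (h1 : 1 ≤ s.re) (h2 : s.re ≤ 2) : ‖s‖ ≤ |s.im| + 2 := by
  refine (Complex.norm_le_abs_re_add_abs_im s).trans ?_
  rw [abs_of_nonneg (by linarith)]; linarith

theorem norm_sum_head_le {k : ℕ} {C δ : ℝ} {s : ℂ} (hs : 1 ≤ s.re) (hδ : 0 < δ) (hC0 : 0 ≤ C)
    (hC : ∀ u : ℝ, 1 ≤ u → (1 + Real.log u) ^ k ≤ C * u ^ δ) {f : ℕ → ℂ} (hf : ∀ n, ‖f n‖ ≤ 1)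
    {Z : ℕ} {Y : ℝ} (hY0 : 0 ≤ Y) (hY : (Z : ℝ) ≤ Y + 1) :
    ‖∑ n ∈ range Z, f n * logCpow k s n‖ ≤ C * zetaSum δ * Y ^ (2 * δ) := by
  have : ∑ n ∈ range Z, f n * logCpow k s n =
      ∑ n ∈ (range Z).filter (fun n => 1 ≤ n), f n * logCpow k s n := by
    rw [sum_filter]
    refine sum_congr rfl fun n _ => ?_
    split_ifs with h
    · rfl
    · have : n = 0 := by omega
      subst this
      simp [logCpow_zero hs]
  rw [this, mul_assoc]
  refine (norm_sum_le _ _).trans ?_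
  calc _ ≤ ∑ n ∈ (range Z).filter (fun n => 1 ≤ n), C * (n : ℝ) ^ (δ - 1) := by
        refine sum_le_sum fun n hn => ?_
        have hn1 : (1 : ℝ) ≤ n := by exact_mod_cast (mem_filter.1 hn).2
        rw [norm_mul]
        have h2 := norm_logCpow_le hs hC hn1
        calc _ ≤ 1 * ‖logCpow k s n‖ := by gcongr; exact hf n
          _ ≤ _ := by simpa using h2
    _ ≤ _ := by
        rw [← mul_sum]
        gcongr
        refine sum_rpow_head_le hδ hY0 fun n hn => ?_
        rw [mem_filter, mem_range] at hn
        refine ⟨hn.2, ?_⟩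
        have : ((n + 1 : ℕ) : ℝ) ≤ Z := by exact_mod_cast hn.1
        push_cast at this
        linarith

theorem norm_sum_bounded_le (k : ℕ) {ε : ℝ} (hε : 0 < ε) : ∃ C : ℝ, 0 < C ∧
    ∀ (f : ℕ → ℂ) (B : ℝ) (s : ℂ), 1 ≤ B → (∀ n, ‖f n‖ ≤ 1) →
      (∀ N, ‖∑ n ∈ range N, f n‖ ≤ B) → 1 ≤ s.re → s.re ≤ 2 → ∀ Z : ℕ,
      ‖∑ n ∈ range Z, f n * logCpow k s n‖ ≤ C * (B * (|s.im| + 2)) ^ ε := by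
  set δ : ℝ := min (ε / 2) (1 / 2) with hδd
  have hδ : 0 < δ := lt_min (by linarith) (by norm_num)
  have hδ1 : 2 * δ ≤ 1 := by linarith [min_le_right (ε / 2) (1 / 2 : ℝ)]
  have hδε : 2 * δ ≤ ε := by linarith [min_le_left (ε / 2) (1 / 2 : ℝ)]
  obtain ⟨C, hC1, hC⟩ := one_add_log_pow_le k hδ
  have hW := zetaSum_nonneg δ
  refine ⟨C * zetaSum δ + 2 * C + 2 * C * (k + 1) * zetaSum δ, by positivity, ?_⟩
  intro f B s hB hf hS h1 h2 Z
  set τ : ℝ := |s.im| + 2 with hτ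
  have hτ2 : 2 ≤ τ := by have := abs_nonneg s.im; linarith
  have hsτ : ‖s‖ ≤ τ := norm_le_im_add_two h1 h2
  set Y : ℝ := B * τ with hY
  have hY1 : 2 ≤ Y := by nlinarith
  set a : ℕ := ⌈Y⌉₊ with ha
  have haY : Y ≤ a := Nat.le_ceil _
  have haY1 : (a : ℝ) ≤ Y + 1 := (Nat.ceil_lt_add_one (by linarith)).le
  have hYε : Y ^ (2 * δ) ≤ Y ^ ε := Real.rpow_le_rpow_of_exponent_le (by linarith) hδε
  rcases le_total Z a with hZ | hZ
  · refine (norm_sum_head_le h1 hδ (by linarith) hC hf (Y := Y) (by linarith) ?_).trans ?_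
    · exact le_trans (by exact_mod_cast hZ) haY1
    · have : 0 ≤ 2 * C + 2 * C * (k + 1) * zetaSum δ := by positivity
      gcongr ?_ * ?_
      linarith
  rw [← sum_range_add_sum_Ico _ hZ]
  refine (norm_add_le _ _).trans ?_
  have hhead := norm_sum_head_le h1 hδ (by linarith) hC hf (Y := Y) (by linarith) haY1
  have htail := norm_sum_Ico_mul_le (g := fun n => logCpow k s n) hS hZ
  have hg : ∀ b : ℕ, Y ≤ b → ‖logCpow k s b‖ ≤ C * Y ^ (2 * δ - 1) := by
    intro b hb
    refine (norm_logCpow_le h1 hC (by linarith)).trans ?_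
    gcongr
    calc (b : ℝ) ^ (δ - 1) ≤ Y ^ (δ - 1) :=
          Real.rpow_le_rpow_of_nonpos (by linarith) hb (by linarith)
      _ ≤ _ := Real.rpow_le_rpow_of_exponent_le (by linarith) (by linarith)
  have hdiff : ∑ n ∈ Ico a Z, ‖logCpow k s ((n + 1 : ℕ) : ℝ) - logCpow k s n‖ ≤
      2 * C * (k + τ) * (zetaSum δ * Y ^ (2 * δ - 1)) := by
    refine le_trans ?_ (mul_le_mul_of_nonneg_left
      (sum_rpow_tail_le hδ hδ1 (by linarith) (S := Ico a Z) (Y := Y) fun n hn => ?_) (by positivity))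
    · rw [mul_sum]
      refine sum_le_sum fun n hn => ?_
      have hn1 : (1 : ℝ) ≤ n := by
        have : (a : ℝ) ≤ n := by exact_mod_cast (mem_Ico.1 hn).1
        linarith
      refine (norm_logCpow_sub_le' h1 hδ.le (by linarith) (by linarith) hC hn1
        (by push_cast; linarith) (by push_cast; linarith)).trans ?_
      gcongr
    · exact haY.trans (by exact_mod_cast (mem_Ico.1 hn).1)
  have hYY : Y * Y ^ (2 * δ - 1) = Y ^ (2 * δ) := by
    rw [← Real.rpow_one_add' (by linarith) (by linarith)]; ring_nf
  have hBY : B * Y ^ (2 * δ - 1) ≤ Y ^ (2 * δ) := by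
    rw [← hYY]; gcongr; nlinarith
  have hBτ : B * ((k + τ) * Y ^ (2 * δ - 1)) ≤ (k + 1) * Y ^ (2 * δ) := by
    have : B * ((k + τ) * Y ^ (2 * δ - 1)) = k * (B * Y ^ (2 * δ - 1)) + Y * Y ^ (2 * δ - 1) := by
      rw [hY]; ring
    rw [this, hYY, add_mul, one_mul]
    gcongr
  have htail2 : ‖∑ n ∈ Ico a Z, f n * logCpow k s n‖ ≤
      (2 * C + 2 * C * (k + 1) * zetaSum δ) * Y ^ (2 * δ) := by
    refine htail.trans ?_
    calc _ ≤ B * (C * Y ^ (2 * δ - 1) + C * Y ^ (2 * δ - 1) +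
          2 * C * (k + τ) * (zetaSum δ * Y ^ (2 * δ - 1))) := by
          gcongr
          · exact hg Z (haY.trans (by exact_mod_cast hZ))
          · exact hg a haY
      _ = 2 * C * (B * Y ^ (2 * δ - 1)) +
          2 * C * zetaSum δ * (B * ((k + τ) * Y ^ (2 * δ - 1))) := by ring
      _ ≤ 2 * C * Y ^ (2 * δ) + 2 * C * zetaSum δ * ((k + 1) * Y ^ (2 * δ)) := by gcongr
      _ = _ := by ring
  calc _ ≤ (C * zetaSum δ + 2 * C + 2 * C * (k + 1) * zetaSum δ) * Y ^ (2 * δ) := by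
        rw [add_assoc, add_mul]; exact add_le_add hhead htail2
    _ ≤ _ := by gcongr

/-- The antiderivative of `(log u)^k u^{-s}`. -/
noncomputable def logCpowPrim : ℕ → ℂ → ℝ → ℂ
  | 0, s, u => (u : ℂ) ^ (-(s - 1)) / (1 - s)
  | k + 1, s, u => (Real.log u : ℂ) ^ (k + 1) * (u : ℂ) ^ (-(s - 1)) / (1 - s) -
      (k + 1) / (1 - s) * logCpowPrim k s u

theorem hasDerivAt_logCpowPrim (k : ℕ) {s : ℂ} (hs : s ≠ 1) {u : ℝ} (hu : 0 < u) :
    HasDerivAt (logCpowPrim k s) (logCpow k s u) u := by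
  have hs1 : 1 - s ≠ 0 := sub_ne_zero.2 (Ne.symm hs)
  have hu' : (u : ℂ) ≠ 0 := by exact_mod_cast hu.ne'
  have h0 : (u : ℂ) ^ (-(s - 1) - 1) = (u : ℂ) ^ (-s) := by ring_nf
  have h1 : (u : ℂ) ^ (-(s - 1)) = u * (u : ℂ) ^ (-s) := by
    have := Complex.cpow_add (x := (u : ℂ)) 1 (-s) hu'
    rw [Complex.cpow_one] at this
    rw [← this]; ring_nf
  induction k with
  | zero =>
    have := (hasDerivAt_ofReal_cpow_neg (s := s - 1) hu).div_const (1 - s)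
    rw [h0] at this
    refine this.congr_deriv ?_
    simp only [logCpow, pow_zero, one_mul]
    field_simp; ring
  | succ k ih =>
    have hd := ((hasDerivAt_logCpow (k := k + 1) (s := s - 1) hu).div_const (1 - s)).sub
      (ih.const_mul (((k : ℂ) + 1) / (1 - s)))
    refine HasDerivAt.congr_deriv hd ?_
    rw [h0, h1]
    simp only [logCpow, Nat.add_sub_cancel, Complex.ofReal_inv]
    push_cast
    field_simp
    ring

theorem norm_logCpowPrim_le (k : ℕ) {s : ℂ} (hs : 1 ≤ ‖1 - s‖) {u : ℝ} (hu : 1 ≤ u) :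
    ‖logCpowPrim k s u‖ ≤ (k + 1).factorial * (1 + Real.log u) ^ k * u ^ (1 - s.re) := by
  have hlog := Real.log_nonneg hu
  have hu0 : 0 < u := by linarith
  have hn : ‖(u : ℂ) ^ (-(s - 1))‖ = u ^ (1 - s.re) := by
    rw [Complex.norm_cpow_eq_rpow_re_of_pos hu0]; simp
  have hp : 0 ≤ u ^ (1 - s.re) := by positivity
  induction k with
  | zero =>
    simp only [logCpowPrim, norm_div, hn]
    simpa using div_le_self hp hs
  | succ k ih =>
    simp only [logCpowPrim]
    refine (norm_sub_le _ _).trans ?_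
    rw [norm_div, norm_mul, hn, norm_mul, norm_div, norm_pow, Complex.norm_real,
      Real.norm_of_nonneg hlog]
    have e1 : Real.log u ^ (k + 1) ≤ (1 + Real.log u) ^ (k + 1) :=
      pow_le_pow_left₀ hlog (by linarith) _
    have e2 : (1 + Real.log u) ^ k ≤ (1 + Real.log u) ^ (k + 1) :=
      pow_le_pow_right₀ (by linarith) (Nat.le_succ _)
    have e3 : ‖((k : ℂ) + 1)‖ = k + 1 := by
      exact_mod_cast Complex.norm_natCast (k + 1)
    calc _ ≤ Real.log u ^ (k + 1) * u ^ (1 - s.re) +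
        (k + 1) * ((k + 1).factorial * (1 + Real.log u) ^ k * u ^ (1 - s.re)) := by
          rw [e3]
          gcongr
          · exact div_le_self (by positivity) hs
          · exact div_le_self (by positivity) hs
      _ ≤ (1 + Real.log u) ^ (k + 1) * u ^ (1 - s.re) +
        (k + 1) * ((k + 1).factorial * (1 + Real.log u) ^ (k + 1) * u ^ (1 - s.re)) := by
          gcongr
      _ ≤ _ := by
        have h1 : (1 : ℝ) ≤ (k + 1).factorial := by exact_mod_cast Nat.one_le_iff_ne_zero.2 (Nat.factorial_ne_zero _)
        have h2 : ((k + 1 + 1).factorial : ℝ) = (k + 2) * (k + 1).factorial := by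
          rw [Nat.factorial_succ]; push_cast; ring
        rw [h2]
        have : 0 ≤ (1 + Real.log u) ^ (k + 1) * u ^ (1 - s.re) := by positivity
        nlinarith [mul_le_mul_of_nonneg_right h1 this]

theorem norm_logCpowPrim_sub_le {k : ℕ} {C δ : ℝ} {s : ℂ} (hs : 1 ≤ s.re) (hs1 : s ≠ 1)
    (hδ : 0 ≤ δ) (hδ1 : δ ≤ 1) (hC0 : 0 ≤ C)
    (hC : ∀ u : ℝ, 1 ≤ u → (1 + Real.log u) ^ k ≤ C * u ^ δ) {n : ℝ} (hn : 1 ≤ n) :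
    ‖logCpow k s n - (logCpowPrim k s (n + 1) - logCpowPrim k s n)‖ ≤
      2 * C * (k + ‖s‖) * n ^ (δ - 2) := by
  have hd : ∀ x : ℝ, 0 < x → HasDerivAt (fun u : ℝ => logCpowPrim k s u - logCpow k s n * (u : ℂ))
      (logCpow k s x - logCpow k s n) x := by
    intro x hx
    have := (hasDerivAt_logCpowPrim k hs1 hx).sub
      (((hasDerivAt_id' (x : ℂ)).comp_ofReal).const_mul (logCpow k s n))
    exact this.congr_deriv (by simp)
  have key := (convex_Icc n (n + 1)).norm_image_sub_le_of_norm_deriv_le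
    (f := fun u : ℝ => logCpowPrim k s u - logCpow k s n * (u : ℂ))
    (C := 2 * C * (k + ‖s‖) * n ^ (δ - 2)) (x := n) (y := n + 1)
    (fun x hx => (hd x (by linarith [hx.1])).differentiableAt)
    (fun x hx => ?_) ⟨le_rfl, by linarith⟩ ⟨by linarith, le_rfl⟩
  · rw [norm_sub_rev]
    have e : logCpowPrim k s (n + 1) - logCpowPrim k s n - logCpow k s n =
      logCpowPrim k s (n + 1) - logCpow k s n * ((n + 1 : ℝ) : ℂ) -
        (logCpowPrim k s n - logCpow k s n * (n : ℂ)) := by push_cast; ring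
    rw [e]
    simpa using key
  · rw [(hd x (by linarith [hx.1])).deriv]
    exact norm_logCpow_sub_le' hs hδ hδ1 hC0 hC hn hx.1 hx.2

theorem norm_sum_zeta_le (k : ℕ) {ε : ℝ} (hε : 0 < ε) : ∃ C : ℝ, 0 < C ∧
    ∀ (s : ℂ), 1 ≤ s.re → s.re ≤ 2 → 1 ≤ |s.im| → ∀ Z : ℕ, 1 ≤ Z →
      ‖∑ n ∈ range Z, logCpow k s n‖ ≤ C * (|s.im| + 2) ^ ε + ‖logCpowPrim k s Z‖ := by
  set δ : ℝ := min (ε / 2) (1 / 2) with hδd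
  have hδ : 0 < δ := lt_min (by linarith) (by norm_num)
  have hδ1 : 2 * δ ≤ 1 := by linarith [min_le_right (ε / 2) (1 / 2 : ℝ)]
  have hδε : 2 * δ ≤ ε := by linarith [min_le_left (ε / 2) (1 / 2 : ℝ)]
  obtain ⟨C, hC1, hC⟩ := one_add_log_pow_le k hδ
  have hW := zetaSum_nonneg δ
  refine ⟨C * zetaSum δ + 2 * C * (k + 1) * zetaSum δ + 2 * (k + 1).factorial * C,
    by positivity, ?_⟩
  intro s h1 h2 him Z hZ1
  set Y : ℝ := |s.im| + 2 with hY
  have hY2 : 2 ≤ Y := by have := abs_nonneg s.im; linarith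
  have hsτ : ‖s‖ ≤ Y := norm_le_im_add_two h1 h2
  have hs1 : 1 ≤ ‖1 - s‖ := by
    refine him.trans ?_
    simpa using Complex.abs_im_le_norm (1 - s)
  have hsne : s ≠ 1 := by
    rintro rfl; simp at hs1; linarith
  set a : ℕ := ⌈Y⌉₊ with ha
  have haY : Y ≤ a := Nat.le_ceil _
  have haY1 : (a : ℝ) ≤ Y + 1 := (Nat.ceil_lt_add_one (by linarith)).le
  have hYε : Y ^ (2 * δ) ≤ Y ^ ε := Real.rpow_le_rpow_of_exponent_le (by linarith) hδε
  have hone : ∀ n : ℕ, ‖(fun _ => 1 : ℕ → ℂ) n‖ ≤ 1 := by simp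
  rcases le_total Z a with hZ | hZ
  · have := norm_sum_head_le (f := fun _ => 1) h1 hδ (by linarith) hC hone (Y := Y) (by linarith)
      (le_trans (by exact_mod_cast hZ : (Z : ℝ) ≤ a) haY1)
    simp only [one_mul] at this
    have h3 : 0 ≤ 2 * C * (k + 1) * zetaSum δ + 2 * (k + 1).factorial * C := by positivity
    calc _ ≤ _ := this
      _ ≤ (C * zetaSum δ + (2 * C * (k + 1) * zetaSum δ + 2 * (k + 1).factorial * C)) * Y ^ ε := by
        gcongr; linarith
      _ ≤ _ := by rw [← add_assoc]; linarith [norm_nonneg (logCpowPrim k s Z)]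
  rw [← sum_range_add_sum_Ico _ hZ]
  have hhead := norm_sum_head_le (f := fun _ => 1) h1 hδ (by linarith) hC hone (Y := Y)
    (by linarith) haY1
  simp only [one_mul] at hhead
  have htel : ∑ n ∈ Ico a Z, logCpow k s n = (logCpowPrim k s Z - logCpowPrim k s a) +
      ∑ n ∈ Ico a Z, (logCpow k s n - (logCpowPrim k s (n + 1) - logCpowPrim k s n)) := by
    have h := sum_Ico_sub (fun n : ℕ => logCpowPrim k s n) hZ
    push_cast at h
    rw [sum_sub_distrib, h]; ring
  have hdiff : ‖∑ n ∈ Ico a Z, (logCpow k s n - (logCpowPrim k s (n + 1) - logCpowPrim k s n))‖ ≤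
      2 * C * (k + Y) * (zetaSum δ * Y ^ (2 * δ - 1)) := by
    refine (norm_sum_le _ _).trans ?_
    refine le_trans ?_ (mul_le_mul_of_nonneg_left
      (sum_rpow_tail_le hδ hδ1 (by linarith) (S := Ico a Z) (Y := Y) fun n hn => ?_) (by positivity))
    · rw [mul_sum]
      refine sum_le_sum fun n hn => ?_
      have hn1 : (1 : ℝ) ≤ n := by
        have : (a : ℝ) ≤ n := by exact_mod_cast (mem_Ico.1 hn).1
        linarith
      refine (norm_logCpowPrim_sub_le h1 hsne hδ.le (by linarith) (by linarith) hC hn1).trans ?_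
      gcongr
    · exact haY.trans (by exact_mod_cast (mem_Ico.1 hn).1)
  have hYY : Y * Y ^ (2 * δ - 1) = Y ^ (2 * δ) := by
    rw [← Real.rpow_one_add' (by linarith) (by linarith)]; ring_nf
  have h5 : (k + Y) * Y ^ (2 * δ - 1) ≤ (k + 1) * Y ^ (2 * δ) := by
    rw [← hYY]
    have : 0 ≤ Y ^ (2 * δ - 1) := by positivity
    have hk : (0 : ℝ) ≤ k := by positivity
    rw [← mul_assoc]
    gcongr
    nlinarith
  have h6 : ‖logCpowPrim k s a‖ ≤ 2 * (k + 1).factorial * C * Y ^ (2 * δ) := by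
    have ha1 : (1 : ℝ) ≤ a := by linarith
    refine (norm_logCpowPrim_le k hs1 ha1).trans ?_
    have h7 : (a : ℝ) ^ (1 - s.re) ≤ 1 := Real.rpow_le_one_of_one_le_of_nonpos ha1 (by linarith)
    have h8 : (a : ℝ) ^ δ ≤ 2 * Y ^ (2 * δ) := by
      calc (a : ℝ) ^ δ ≤ (2 * Y) ^ δ := by gcongr; linarith
        _ = 2 ^ δ * Y ^ δ := Real.mul_rpow (by norm_num) (by linarith)
        _ ≤ 2 ^ (1 : ℝ) * Y ^ (2 * δ) := by
          gcongr
          · norm_num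
          · linarith
          · linarith
          · linarith
        _ = _ := by norm_num
    have h9 := hC a ha1
    calc _ ≤ (k + 1).factorial * (C * (a : ℝ) ^ δ) * 1 := by gcongr
      _ ≤ (k + 1).factorial * (C * (2 * Y ^ (2 * δ))) * 1 := by gcongr
      _ = _ := by ring
  have h10 : ‖∑ n ∈ Ico a Z, logCpow k s n‖ ≤ ‖logCpowPrim k s Z‖ +
      2 * (k + 1).factorial * C * Y ^ (2 * δ) + 2 * C * zetaSum δ * ((k + 1) * Y ^ (2 * δ)) := by
    rw [htel]
    refine (norm_add_le _ _).trans (add_le_add ((norm_sub_le _ _).trans (add_le_add le_rfl h6)) ?_)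
    refine hdiff.trans ?_
    calc _ = 2 * C * zetaSum δ * ((k + Y) * Y ^ (2 * δ - 1)) := by ring
      _ ≤ _ := by gcongr
  calc _ ≤ C * zetaSum δ * Y ^ (2 * δ) + (‖logCpowPrim k s Z‖ +
      2 * (k + 1).factorial * C * Y ^ (2 * δ) + 2 * C * zetaSum δ * ((k + 1) * Y ^ (2 * δ))) :=
        (norm_add_le _ _).trans (add_le_add hhead h10)
    _ = (C * zetaSum δ + 2 * C * (k + 1) * zetaSum δ + 2 * (k + 1).factorial * C) * Y ^ (2 * δ)
      + ‖logCpowPrim k s Z‖ := by ring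
    _ ≤ _ := by gcongr

/-! ### Derivatives of `L`-series to the right of the line `Re s = 1` -/

open LSeries in
theorem logMul_iterate_apply (f : ℕ → ℂ) (k n : ℕ) :
    (logMul^[k] f) n = (Real.log n : ℂ) ^ k * f n := by
  induction k with
  | zero => simp
  | succ k ih =>
    rw [Function.iterate_succ_apply', logMul, ih, ← Complex.natCast_log]
    ring

open LSeries in
theorem term_logMul_iterate (f : ℕ → ℂ) (k n : ℕ) {s : ℂ} (hs : 1 ≤ s.re) :
    term (logMul^[k] f) s n = f n * logCpow k s n := by
  rcases Nat.eq_zero_or_pos n with rfl | hn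
  · simp [logCpow_zero hs]
  · rw [term_of_ne_zero hn.ne', logMul_iterate_apply, logCpow, Complex.cpow_neg]
    push_cast
    rw [div_eq_mul_inv]
    ring

theorem abscissa_lt_of_norm_le_one {f : ℕ → ℂ} (hf : ∀ n, ‖f n‖ ≤ 1) {s : ℂ} (hs : 1 < s.re) :
    LSeries.abscissaOfAbsConv f < s.re :=
  lt_of_le_of_lt (LSeries.abscissaOfAbsConv_le_of_le_const ⟨1, fun n _ => hf n⟩)
    (by exact_mod_cast hs)

theorem hasSum_iteratedDeriv_LSeries {f : ℕ → ℂ} {s : ℂ} (hs : 1 < s.re)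
    (hf : LSeries.abscissaOfAbsConv f < s.re) (k : ℕ) :
    HasSum (fun n : ℕ => f n * logCpow k s n) ((-1) ^ k * iteratedDeriv k (LSeries f) s) := by
  rw [LSeries_iteratedDeriv k hf, ← mul_assoc, ← mul_pow]
  simp only [mul_neg, mul_one, neg_neg, one_pow, one_mul]
  have hsum : LSeriesSummable (LSeries.logMul^[k] f) s :=
    LSeriesSummable_of_abscissaOfAbsConv_lt_re
      (by rwa [LSeries.absicssaOfAbsConv_logPowMul])
  have h := hsum.LSeriesHasSum
  unfold LSeriesHasSum at h
  rwa [show LSeries.term (LSeries.logMul^[k] f) s = _ from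
    funext fun n => term_logMul_iterate f k n hs.le] at h

theorem norm_le_of_hasSum_range_le {a : ℕ → ℂ} {S : ℂ} (h : HasSum a S) {c : ℝ}
    (hc : ∀ Z, ‖∑ n ∈ range Z, a n‖ ≤ c) : ‖S‖ ≤ c :=
  le_of_tendsto' h.tendsto_sum_nat.norm hc

theorem norm_iteratedDeriv_LSeries_le (k : ℕ) {ε : ℝ} (hε : 0 < ε) : ∃ C : ℝ, 0 < C ∧
    ∀ (f : ℕ → ℂ) (B : ℝ) (s : ℂ), 1 ≤ B → (∀ n, ‖f n‖ ≤ 1) →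
      (∀ N, ‖∑ n ∈ range N, f n‖ ≤ B) → 1 < s.re → s.re ≤ 2 →
      ‖iteratedDeriv k (LSeries f) s‖ ≤ C * (B * (|s.im| + 2)) ^ ε := by
  obtain ⟨C, hC, h⟩ := norm_sum_bounded_le k hε
  refine ⟨C, hC, fun f B s hB hf hS h1 h2 => ?_⟩
  have := norm_le_of_hasSum_range_le
    (hasSum_iteratedDeriv_LSeries h1 (abscissa_lt_of_norm_le_one hf h1) k)
    (h f B s hB hf hS h1.le h2)
  simpa using this

open Filter Topology in
theorem tendsto_logCpowPrim_atTop (k : ℕ) {s : ℂ} (hs : 1 ≤ ‖1 - s‖) (h1 : 1 < s.re) :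
    Tendsto (fun Z : ℕ => ‖logCpowPrim k s Z‖) atTop (𝓝 0) := by
  obtain ⟨C, hC1, hC⟩ := one_add_log_pow_le k (δ := (s.re - 1) / 2) (by linarith)
  have hlim : Tendsto (fun Z : ℕ => (k + 1).factorial * C * (Z : ℝ) ^ (-((s.re - 1) / 2))) atTop
      (𝓝 ((k + 1).factorial * C * 0)) :=
    ((tendsto_rpow_neg_atTop (by linarith)).comp tendsto_natCast_atTop_atTop).const_mul _
  rw [mul_zero] at hlim
  refine tendsto_of_tendsto_of_tendsto_of_le_of_le' tendsto_const_nhds hlim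
    (Eventually.of_forall fun _ => norm_nonneg _) ?_
  filter_upwards [eventually_ge_atTop 1] with Z hZ
  have hZ1 : (1 : ℝ) ≤ Z := by exact_mod_cast hZ
  refine (norm_logCpowPrim_le k hs hZ1).trans ?_
  calc _ ≤ (k + 1).factorial * (C * (Z : ℝ) ^ ((s.re - 1) / 2)) * (Z : ℝ) ^ (1 - s.re) := by
        gcongr; exact hC _ hZ1
    _ = _ := by
        rw [← mul_assoc, mul_assoc (_ * C), ← Real.rpow_add (by linarith)]
        ring_nf

open Filter Topology in
theorem norm_iteratedDeriv_zeta_le (k : ℕ) {ε : ℝ} (hε : 0 < ε) : ∃ C : ℝ, 0 < C ∧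
    ∀ (s : ℂ), 1 < s.re → s.re ≤ 2 → 1 ≤ |s.im| →
      ‖iteratedDeriv k (LSeries 1) s‖ ≤ C * (|s.im| + 2) ^ ε := by
  obtain ⟨C, hC, h⟩ := norm_sum_zeta_le k hε
  refine ⟨C, hC, fun s h1 h2 him => ?_⟩
  have hs1 : 1 ≤ ‖1 - s‖ := him.trans (by simpa using Complex.abs_im_le_norm (1 - s))
  have hsum := hasSum_iteratedDeriv_LSeries h1
    (abscissa_lt_of_norm_le_one (f := 1) (by simp) h1) k
  have hl := hsum.tendsto_sum_nat.norm
  have hr := (tendsto_logCpowPrim_atTop k hs1 h1).const_add (C * (|s.im| + 2) ^ ε)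
  rw [add_zero] at hr
  have := le_of_tendsto_of_tendsto hl hr (by
    filter_upwards [eventually_ge_atTop 1] with Z hZ
    simpa using h s h1.le h2 him Z hZ)
  simpa using this

/-! ### Partial sums of periodic functions -/

theorem norm_sum_periodic_le {q : ℕ} (hq : 0 < q) {f : ℕ → ℂ} (hf : ∀ n, ‖f n‖ ≤ 1)
    (hper : ∀ n, f (n + q) = f n) (h0 : ∑ n ∈ range q, f n = 0) (N : ℕ) :
    ‖∑ n ∈ range N, f n‖ ≤ q := by
  induction N using Nat.strong_induction_on with
  | _ N ih =>
    rcases lt_or_ge N q with h | h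
    · refine (norm_sum_le _ _).trans ?_
      calc ∑ n ∈ range N, ‖f n‖ ≤ ∑ n ∈ range N, 1 := sum_le_sum fun n _ => hf n
        _ = N := by simp
        _ ≤ q := by exact_mod_cast h.le
    · obtain ⟨m, rfl⟩ := Nat.exists_eq_add_of_le h
      rw [sum_range_add, h0, zero_add]
      simp only [add_comm q _, hper]
      exact ih m (by omega)

theorem sum_range_zmod {q : ℕ} [NeZero q] (F : ZMod q → ℂ) :
    ∑ n ∈ range q, F n = ∑ a : ZMod q, F a := by
  refine sum_bij (fun n _ => (n : ZMod q)) (fun _ _ => mem_univ _) ?_ ?_ (fun _ _ => rfl)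
  · intro a ha b hb hab
    rw [mem_range] at ha hb
    have := (ZMod.natCast_eq_natCast_iff' a b q).1 hab
    rwa [Nat.mod_eq_of_lt ha, Nat.mod_eq_of_lt hb] at this
  · intro b _
    exact ⟨b.val, mem_range.2 b.val_lt, ZMod.natCast_zmod_val b⟩

theorem norm_sum_range_char_le {q : ℕ} [NeZero q] {χ : DirichletCharacter ℂ q} (hχ : χ ≠ 1)
    (N : ℕ) : ‖∑ n ∈ range N, χ n‖ ≤ q := by
  refine norm_sum_periodic_le (Nat.pos_of_ne_zero (NeZero.ne q)) (fun n => χ.norm_le_one n)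
    (fun n => by simp) ?_ N
  rw [sum_range_zmod (fun a => χ a)]
  exact MulChar.sum_eq_zero_of_ne_one hχ

/-! ### The zeta function near its pole -/

/-- The entire function `(s-1)ζ(s)`. -/
noncomputable def zetaOne : ℂ → ℂ := DirichletCharacter.LFunctionTrivChar₁ 1

theorem zetaOne_of_ne_one {s : ℂ} (hs : s ≠ 1) : zetaOne s = (s - 1) * riemannZeta s := by
  simp [zetaOne, Function.update_of_ne hs, DirichletCharacter.LFunctionTrivChar]

theorem zetaOne_one : zetaOne 1 = 1 := by simp [zetaOne]

theorem differentiable_zetaOne : Differentiable ℂ zetaOne :=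
  DirichletCharacter.differentiable_LFunctionTrivChar₁ 1

theorem zetaOne_ne_zero {s : ℂ} (hs : 1 ≤ s.re) : zetaOne s ≠ 0 := by
  rcases eq_or_ne s 1 with rfl | h
  · simp [zetaOne_one]
  · rw [zetaOne_of_ne_one h]
    exact mul_ne_zero (sub_ne_zero.2 h) (riemannZeta_ne_zero_of_one_le_re hs)

theorem exists_norm_zeta_le : ∃ K : ℝ, 0 < K ∧ ∀ s : ℂ, 1 < s.re → s.re ≤ 2 → |s.im| ≤ 1 →
    ‖riemannZeta s‖ ≤ K / ‖s - 1‖ := by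
  obtain ⟨K, hK⟩ := (isCompact_closedBall (0 : ℂ) 3).exists_bound_of_continuousOn
    differentiable_zetaOne.continuous.continuousOn
  refine ⟨max K 1, by positivity, fun s h1 h2 h3 => ?_⟩
  have hs : s ≠ 1 := by rintro rfl; simp at h1
  have hs' : 0 < ‖s - 1‖ := norm_pos_iff.2 (sub_ne_zero.2 hs)
  rw [le_div_iff₀ hs', mul_comm, ← norm_mul, ← zetaOne_of_ne_one hs]
  refine (hK s ?_).trans (le_max_left _ _)
  rw [mem_closedBall_zero_iff]
  have := norm_le_im_add_two h1.le h2
  linarith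

theorem norm_zeta_le {ε : ℝ} (hε : 0 < ε) : ∃ C : ℝ, 0 < C ∧ ∀ s : ℂ, 1 < s.re → s.re ≤ 2 →
    s.im ≠ 0 → ‖LSeries 1 s‖ ≤ C * (|s.im| + 2) ^ ε * (1 + 1 / |s.im|) := by
  obtain ⟨C, hC, h⟩ := norm_iteratedDeriv_zeta_le 0 hε
  obtain ⟨K, hK, hK'⟩ := exists_norm_zeta_le
  refine ⟨C + K, by positivity, fun s h1 h2 h3 => ?_⟩
  have h0 : 0 < |s.im| := abs_pos.2 h3
  have hτ : 1 ≤ (|s.im| + 2) ^ ε := Real.one_le_rpow (by linarith) hε.le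
  rcases le_total 1 |s.im| with him | him
  · have := h s h1 h2 him
    rw [iteratedDeriv_zero] at this
    have h5 : 0 ≤ 1 / |s.im| := by positivity
    calc _ ≤ C * (|s.im| + 2) ^ ε * 1 := by linarith
      _ ≤ _ := by gcongr <;> linarith
  · rw [LSeries_one_eq_riemannZeta h1]
    refine (hK' s h1 h2 him).trans ?_
    have h4 : |s.im| ≤ ‖s - 1‖ := by simpa using Complex.abs_im_le_norm (s - 1)
    calc K / ‖s - 1‖ ≤ K / |s.im| := by gcongr
      _ = K * 1 * (1 / |s.im|) := by ring
      _ ≤ _ := by gcongr <;> linarith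

theorem norm_LSeries_one_char_le {ε : ℝ} (hε : 0 < ε) : ∃ C : ℝ, 0 < C ∧
    ∀ (q : ℕ) [NeZero q] (s : ℂ), 1 < s.re → s.re ≤ 2 → s.im ≠ 0 →
    ‖LSeries (fun n => (1 : DirichletCharacter ℂ q) n) s‖ ≤
      C * (q * (|s.im| + 2)) ^ ε * (1 + 1 / |s.im|) := by
  obtain ⟨C, hC, h⟩ := norm_zeta_le hε
  obtain ⟨C', hC', h'⟩ := norm_iteratedDeriv_LSeries_le 0 hε
  refine ⟨C + 2 * C', by positivity, fun q _ s h1 h2 h3 => ?_⟩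
  have hq : 0 < q := Nat.pos_of_ne_zero (NeZero.ne q)
  have hq1 : (1 : ℝ) ≤ q := by exact_mod_cast hq
  set χ : DirichletCharacter ℂ q := 1 with hχ
  set c : ℂ := (∑ n ∈ range q, χ n) / q with hc
  have hcn : ‖c‖ ≤ 1 := by
    rw [hc, norm_div, Complex.norm_natCast, div_le_one (by linarith)]
    refine (norm_sum_le _ _).trans ?_
    calc _ ≤ ∑ n ∈ range q, (1 : ℝ) := sum_le_sum fun n _ => χ.norm_le_one n
      _ = q := by simp
  set f : ℕ → ℂ := fun n => (χ n - c) / 2 with hf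
  have hf1 : ∀ n, ‖f n‖ ≤ 1 := by
    intro n
    rw [hf, norm_div]
    have h4 := norm_sub_le (χ n) c
    have h5 := χ.norm_le_one (n : ZMod q)
    simp only [Complex.norm_ofNat]
    rw [div_le_one (by norm_num)]
    linarith
  have hS : ∀ N, ‖∑ n ∈ range N, f n‖ ≤ q := by
    refine norm_sum_periodic_le hq hf1 (fun n => by simp [hf]) ?_
    rw [hf, ← sum_div, sum_sub_distrib, sum_const, card_range, hc, nsmul_eq_mul,
      mul_div_cancel₀ _ (by exact_mod_cast hq.ne')]
    simp
  have e : (fun n : ℕ => χ n) = (2 : ℂ) • f + c • (1 : ℕ → ℂ) := by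
    funext n
    simp [hf]; ring
  have hsf : LSeriesSummable f s := LSeriesSummable_of_abscissaOfAbsConv_lt_re
    (abscissa_lt_of_norm_le_one hf1 h1)
  have hs1 : LSeriesSummable 1 s := LSeriesSummable_of_abscissaOfAbsConv_lt_re
    (abscissa_lt_of_norm_le_one (by simp) h1)
  rw [e, LSeries_add (hsf.smul 2) (hs1.smul c), LSeries_smul, LSeries_smul]
  have h4 := h' f q s hq1 hf1 hS h1 h2
  rw [iteratedDeriv_zero] at h4
  have h5 := h s h1 h2 h3
  have h6 : 0 < |s.im| := abs_pos.2 h3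
  have h7 : 0 ≤ 1 / |s.im| := by positivity
  calc _ ≤ 2 * ‖LSeries f s‖ + ‖c‖ * ‖LSeries 1 s‖ := by
        refine (norm_add_le _ _).trans ?_
        simp
    _ ≤ 2 * (C' * (q * (|s.im| + 2)) ^ ε * 1) +
        1 * (C * (q * (|s.im| + 2)) ^ ε * (1 + 1 / |s.im|)) := by
        gcongr
        · linarith
        · refine h5.trans ?_
          gcongr
          nlinarith
    _ ≤ 2 * (C' * (q * (|s.im| + 2)) ^ ε * (1 + 1 / |s.im|)) +
        1 * (C * (q * (|s.im| + 2)) ^ ε * (1 + 1 / |s.im|)) := by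
        gcongr; linarith
    _ = _ := by ring

/-! ### Lower bounds for `L`-series to the right of `Re s = 1` -/

theorem exists_norm_LSeries_le_div : ∃ K : ℝ, 1 ≤ K ∧ ∀ (f : ℕ → ℂ) (s : ℂ), (∀ n, ‖f n‖ ≤ 1) →
    1 < s.re → s.re ≤ 2 → ‖LSeries f s‖ ≤ K / (s.re - 1) := by
  obtain ⟨K, hK, h⟩ := exists_norm_zeta_le
  refine ⟨max K 1, le_max_right _ _, fun f s hf h1 h2 => ?_⟩
  have hre : (1 : ℝ) < ((s.re : ℝ) : ℂ).re := by simpa using h1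
  have hz := h (s.re : ℂ) hre (by simpa using h2) (by simp)
  rw [← LSeries_one_eq_riemannZeta hre] at hz
  have hnorm : ∀ n, ‖LSeries.term f s n‖ ≤ ‖LSeries.term 1 (s.re : ℂ) n‖ := by
    intro n
    rw [LSeries.norm_term_eq, LSeries.norm_term_eq]
    split_ifs with hn
    · exact le_rfl
    · simp only [Pi.one_apply, norm_one, Complex.ofReal_re]
      gcongr
      exact hf n
  have hs1 : LSeriesSummable 1 (s.re : ℂ) := LSeriesSummable_one_iff.2 hre
  have heq : ∀ n, LSeries.term 1 (s.re : ℂ) n = (‖LSeries.term 1 (s.re : ℂ) n‖ : ℂ) := by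
    intro n
    rw [LSeries.norm_term_eq, LSeries.term_def]
    split_ifs with hn
    · simp
    · simp only [Pi.one_apply, norm_one, Complex.ofReal_re]
      push_cast
      rw [Complex.ofReal_cpow (by positivity)]
      simp
  have hsum : ‖LSeries 1 (s.re : ℂ)‖ = ∑' n, ‖LSeries.term 1 (s.re : ℂ) n‖ := by
    rw [LSeries, tsum_congr heq, ← Complex.ofReal_tsum, Complex.norm_real, Real.norm_of_nonneg]
    exact tsum_nonneg fun _ => norm_nonneg _
  have h3 : ‖((s.re : ℝ) : ℂ) - 1‖ = s.re - 1 := by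
    rw [← Complex.ofReal_one, ← Complex.ofReal_sub, Complex.norm_real,
      Real.norm_of_nonneg (by linarith)]
  rw [h3] at hz
  have h4 : 0 < s.re - 1 := by linarith
  calc ‖LSeries f s‖ ≤ ∑' n, ‖LSeries.term 1 (s.re : ℂ) n‖ :=
        tsum_of_norm_bounded hs1.norm.hasSum hnorm
    _ ≤ K / (s.re - 1) := by rw [← hsum]; exact hz
    _ ≤ _ := by gcongr; exact le_max_left _ _

theorem norm_LSeries_sub_le {f : ℕ → ℂ} (hf : ∀ n, ‖f n‖ ≤ 1) {E : ℝ} {T : Set ℂ}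
    (hT : Convex ℝ T) (hT1 : ∀ s ∈ T, 1 < s.re)
    (hE : ∀ s ∈ T, ‖iteratedDeriv 1 (LSeries f) s‖ ≤ E) {s s' : ℂ} (hs : s ∈ T) (hs' : s' ∈ T) :
    ‖LSeries f s' - LSeries f s‖ ≤ E * ‖s' - s‖ := by
  refine hT.norm_image_sub_le_of_norm_deriv_le (𝕜 := ℂ) (fun x hx => ?_) (fun x hx => ?_) hs hs'
  · exact (LSeries_hasDerivAt (abscissa_lt_of_norm_le_one hf (hT1 x hx))).differentiableAt
  · rw [← iteratedDeriv_one]; exact hE x hx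

theorem lower_bound_core {a : ℝ → ℝ} {K D E : ℝ} (hK : 1 ≤ K) (hD : 1 ≤ D) (hE : 1 ≤ E)
    (ha : ∀ x, 0 < x → x ≤ 1 → 0 ≤ a x)
    (h1 : ∀ x, 0 < x → x ≤ 1 → 1 ≤ (K / x) ^ 3 * a x ^ 4 * D)
    (h2 : ∀ x x', 0 < x → x ≤ x' → x' ≤ 1 → a x' - a x ≤ E * (x' - x)) {x : ℝ} (hx : 0 < x)
    (hx1 : x ≤ 1) : 1 ≤ 16 * K ^ 3 * D * E ^ 3 * a x := by
  have hKp : 1 ≤ K ^ 3 := one_le_pow₀ hK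
  have hEp : 1 ≤ E ^ 4 := one_le_pow₀ hE
  set W : ℝ := 16 * K ^ 3 * D * E ^ 4 with hW
  have hW1 : 1 ≤ W := by
    have : 1 ≤ K ^ 3 * D := one_le_mul_of_one_le_of_one_le hKp hD
    have : 1 ≤ K ^ 3 * D * E ^ 4 := one_le_mul_of_one_le_of_one_le this hEp
    rw [hW]; nlinarith
  set x0 : ℝ := 1 / W with hx0
  have hx0p : 0 < x0 := by positivity
  have hx01 : x0 ≤ 1 := by rw [hx0, div_le_one (by linarith)]; exact hW1
  have hx0W : x0 * W = 1 := by rw [hx0]; field_simp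
  have big : ∀ x, x0 ≤ x → x ≤ 1 → 2 * x0 * E ≤ a x := by
    intro x hx hx1
    have hxp : 0 < x := hx0p.trans_le hx
    have h3 := h1 x hxp hx1
    have h4 : x ^ 3 ≤ K ^ 3 * a x ^ 4 * D := by
      rw [div_pow, div_mul_eq_mul_div, div_mul_eq_mul_div, le_div_iff₀ (by positivity)] at h3
      linarith
    have h5 : x0 ^ 3 ≤ x ^ 3 := by gcongr
    have h6 : (2 * x0 * E) ^ 4 * (K ^ 3 * D) = x0 ^ 3 := by
      have : (2 * x0 * E) ^ 4 * (K ^ 3 * D) = x0 ^ 3 * (x0 * W) := by rw [hW]; ring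
      rw [this, hx0W, mul_one]
    have h7 : (2 * x0 * E) ^ 4 ≤ a x ^ 4 := by
      have hp : 0 < K ^ 3 * D := by positivity
      refine le_of_mul_le_mul_right ?_ hp
      rw [h6]; linarith
    exact le_of_pow_le_pow_left₀ (by norm_num) (ha x hxp hx1) h7
  have key : x0 * E ≤ a x := by
    rcases le_total x0 x with h | h
    · have := big x h hx1
      have : 0 ≤ x0 * E := by positivity
      linarith
    · have h3 := big x0 le_rfl hx01
      have h4 := h2 x x0 hx h hx01
      nlinarith
  have h8 : 16 * K ^ 3 * D * E ^ 3 * (x0 * E) = 1 := by rw [← hx0W, hW]; ring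
  rw [← h8]
  gcongr

theorem exists_one_le_mul_norm_LSeries : ∃ C : ℝ, 1 ≤ C ∧ ∀ (q : ℕ) [NeZero q]
    (χ : DirichletCharacter ℂ q) (y D E : ℝ), 1 ≤ D → 1 ≤ E →
    (∀ s : ℂ, 1 < s.re → s.re ≤ 2 → s.im = 2 * y → ‖LSeries (fun n => (χ ^ 2) n) s‖ ≤ D) →
    (∀ s : ℂ, 1 < s.re → s.re ≤ 2 → s.im = y → ‖iteratedDeriv 1 (LSeries (fun n => χ n)) s‖ ≤ E) →
    ∀ s : ℂ, 1 < s.re → s.re ≤ 2 → s.im = y →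
      1 ≤ C * D * E ^ 3 * ‖LSeries (fun n => χ n) s‖ := by
  obtain ⟨K, hK, h⟩ := exists_norm_LSeries_le_div
  refine ⟨16 * K ^ 3, by nlinarith [one_le_pow₀ hK (n := 3)], ?_⟩
  intro q _ χ y D E hD hE hD' hE' s hs1 hs2 hsy
  set a : ℝ → ℝ := fun x => ‖LSeries (fun n => χ n) (1 + x + Complex.I * y)‖ with ha
  have hre : ∀ x : ℝ, ((1 : ℂ) + x + Complex.I * y).re = 1 + x := by intro x; simp
  have him : ∀ x : ℝ, ((1 : ℂ) + x + Complex.I * y).im = y := by intro x; simp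
  have hχ : ∀ n : ℕ, ‖χ n‖ ≤ 1 := fun n => χ.norm_le_one _
  have e : s = 1 + ((s.re - 1 : ℝ) : ℂ) + Complex.I * y := by
    apply Complex.ext <;> simp [hsy]
  rw [e]
  refine lower_bound_core (a := a) hK hD hE (fun x _ _ => norm_nonneg _) ?_ ?_
    (by linarith) (by linarith)
  · intro x hx hx1
    have h341 := χ.norm_LSeries_product_ge_one hx y
    rw [norm_mul, norm_mul, norm_pow, norm_pow] at h341
    refine h341.le.trans ?_
    have e1 := h (fun n => (1 : DirichletCharacter ℂ q) n) (1 + x)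
      (fun n => DirichletCharacter.norm_le_one _ _) (by simpa using hx) (by simp; linarith)
    have e2 := hD' (1 + x + 2 * Complex.I * y) (by simpa using hx) (by simp; linarith) (by simp)
    have e3 : ((1 : ℂ) + x).re - 1 = x := by simp
    rw [e3] at e1
    gcongr
  · intro x x' hx hxx hx1
    have := norm_LSeries_sub_le (T := {s : ℂ | 1 < s.re ∧ s.re ≤ 2 ∧ s.im = y}) hχ ?_
      (fun s hs => hs.1) (fun s hs => hE' s hs.1 hs.2.1 hs.2.2)
      (s := 1 + x + Complex.I * y) (s' := 1 + x' + Complex.I * y)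
      ⟨by rw [hre]; linarith, by rw [hre]; linarith, him x⟩
      ⟨by rw [hre]; linarith, by rw [hre]; linarith, him x'⟩
    · refine (norm_sub_norm_le _ _).trans (this.trans ?_)
      have e4 : (1 + (x' : ℂ) + Complex.I * y) - (1 + x + Complex.I * y) = ((x' - x : ℝ) : ℂ) := by
        push_cast; ring
      rw [e4, Complex.norm_real, Real.norm_of_nonneg (by linarith)]
    · exact (convex_halfSpace_re_gt 1).inter
        ((convex_halfSpace_re_le 2).inter (convex_hyperplane (f := Complex.im)
          (IsLinearMap.mk (by simp) (by simp)) y))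

theorem one_le_tau {q : ℕ} [NeZero q] (y : ℝ) : 1 ≤ (q : ℝ) * (|y| + 2) := by
  have hq : (1 : ℝ) ≤ q := by exact_mod_cast Nat.pos_of_ne_zero (NeZero.ne q)
  nlinarith [abs_nonneg y]

theorem tau_two_le {q : ℕ} {y ε : ℝ} (hε : 0 ≤ ε) (hε1 : ε ≤ 1) :
    ((q : ℝ) * (|2 * y| + 2)) ^ ε ≤ 2 * ((q : ℝ) * (|y| + 2)) ^ ε := by
  have h0 := abs_nonneg y
  have h2 : |2 * y| = 2 * |y| := by rw [abs_mul]; norm_num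
  calc ((q : ℝ) * (|2 * y| + 2)) ^ ε ≤ (2 * ((q : ℝ) * (|y| + 2))) ^ ε := by
        refine Real.rpow_le_rpow (by positivity) ?_ hε
        have hq : (0 : ℝ) ≤ q := by positivity
        rw [h2]; nlinarith
    _ = 2 ^ ε * ((q : ℝ) * (|y| + 2)) ^ ε := Real.mul_rpow (by norm_num) (by positivity)
    _ ≤ 2 ^ (1 : ℝ) * ((q : ℝ) * (|y| + 2)) ^ ε := by gcongr; norm_num
    _ = _ := by norm_num

theorem combine_rpow {X ε c c' D0 C : ℝ} (hX : 1 ≤ X) (hD0 : 0 ≤ D0) (hC : 0 ≤ C) (hc : 0 ≤ c)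
    {A : ℝ} (hA : 0 ≤ A) (h : 1 ≤ C * (c * X ^ (ε / 4) * D0) * (c' * X ^ (ε / 4)) ^ 3 * A) :
    1 ≤ C * c * c' ^ 3 * X ^ ε * D0 * A := by
  have hX0 : 0 ≤ X := by linarith
  have : X ^ ε = X ^ (ε / 4) * (X ^ (ε / 4)) ^ 3 := by
    rw [← pow_succ', ← Real.rpow_natCast, ← Real.rpow_mul hX0]; norm_num
  rw [this]
  refine h.trans (le_of_eq ?_)
  ring

theorem one_le_mul_norm_LSeries_of_sq_ne_one {ε : ℝ} (hε : 0 < ε) (hε1 : ε ≤ 1) :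
    ∃ C : ℝ, 1 ≤ C ∧
    ∀ (q : ℕ) [NeZero q] (χ : DirichletCharacter ℂ q), χ ^ 2 ≠ 1 →
      ∀ s : ℂ, 1 < s.re → s.re ≤ 2 →
      1 ≤ C * (q * (|s.im| + 2)) ^ ε * ‖LSeries (fun n => χ n) s‖ := by
  obtain ⟨C, hC, h⟩ := exists_one_le_mul_norm_LSeries
  obtain ⟨C0, hC0, h0⟩ := norm_iteratedDeriv_LSeries_le 0 (ε := ε / 4) (by linarith)
  obtain ⟨C1, hC1, h1⟩ := norm_iteratedDeriv_LSeries_le 1 (ε := ε / 4) (by linarith)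
  set c := max (C0 * 2) 1 with hc
  set c' := max C1 1 with hc'
  have hc1 : 1 ≤ c := le_max_right _ _
  have hc'1 : 1 ≤ c' := le_max_right _ _
  refine ⟨C * c * c' ^ 3, ?_, ?_⟩
  · exact one_le_mul_of_one_le_of_one_le (one_le_mul_of_one_le_of_one_le hC hc1)
      (one_le_pow₀ hc'1)
  intro q _ χ hχ2 s hs1 hs2
  have hχ : χ ≠ 1 := by rintro rfl; simp at hχ2
  have hq : (1 : ℝ) ≤ q := by exact_mod_cast Nat.pos_of_ne_zero (NeZero.ne q)
  have hX : 1 ≤ (q : ℝ) * (|s.im| + 2) := one_le_tau _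
  have hXε : 1 ≤ ((q : ℝ) * (|s.im| + 2)) ^ (ε / 4) := Real.one_le_rpow hX (by linarith)
  have key := h q χ s.im (c * (q * (|s.im| + 2)) ^ (ε / 4) * 1) (c' * (q * (|s.im| + 2)) ^ (ε / 4))
    (by rw [mul_one]; exact one_le_mul_of_one_le_of_one_le hc1 hXε)
    (one_le_mul_of_one_le_of_one_le hc'1 hXε) ?_ ?_ s hs1 hs2 rfl
  · have := combine_rpow hX zero_le_one (by linarith) (by linarith) (norm_nonneg _) key
    simpa using this
  · intro w hw1 hw2 hwy
    have := h0 (fun n => (χ ^ 2) n) q w hq (fun n => DirichletCharacter.norm_le_one _ _)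
      (norm_sum_range_char_le hχ2) hw1 hw2
    rw [iteratedDeriv_zero, hwy] at this
    refine this.trans ?_
    calc _ ≤ C0 * (2 * (q * (|s.im| + 2)) ^ (ε / 4)) := by
          gcongr; exact tau_two_le (by linarith) (by linarith)
      _ = C0 * 2 * (q * (|s.im| + 2)) ^ (ε / 4) * 1 := by ring
      _ ≤ _ := by gcongr; exact le_max_left _ _
  · intro w hw1 hw2 hwy
    have := h1 (fun n => χ n) q w hq (fun n => DirichletCharacter.norm_le_one _ _)
      (norm_sum_range_char_le hχ) hw1 hw2
    rw [hwy] at this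
    refine this.trans ?_
    gcongr; exact le_max_left _ _

theorem one_le_mul_norm_LSeries_of_sq_eq_one {ε : ℝ} (hε : 0 < ε) (hε1 : ε ≤ 1) :
    ∃ C : ℝ, 1 ≤ C ∧
    ∀ (q : ℕ) [NeZero q] (χ : DirichletCharacter ℂ q), χ ^ 2 = 1 → χ ≠ 1 →
      ∀ s : ℂ, 1 < s.re → s.re ≤ 2 → s.im ≠ 0 →
      1 ≤ C * (q * (|s.im| + 2)) ^ ε * (1 + 1 / |s.im|) * ‖LSeries (fun n => χ n) s‖ := by
  obtain ⟨C, hC, h⟩ := exists_one_le_mul_norm_LSeries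
  obtain ⟨C0, hC0, h0⟩ := norm_LSeries_one_char_le (ε := ε / 4) (by linarith)
  obtain ⟨C1, hC1, h1⟩ := norm_iteratedDeriv_LSeries_le 1 (ε := ε / 4) (by linarith)
  set c := max (C0 * 2) 1 with hc
  set c' := max C1 1 with hc'
  have hc1 : 1 ≤ c := le_max_right _ _
  have hc'1 : 1 ≤ c' := le_max_right _ _
  refine ⟨C * c * c' ^ 3, ?_, ?_⟩
  · exact one_le_mul_of_one_le_of_one_le (one_le_mul_of_one_le_of_one_le hC hc1)
      (one_le_pow₀ hc'1)
  intro q _ χ hχ2 hχ s hs1 hs2 hsi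
  have hq : (1 : ℝ) ≤ q := by exact_mod_cast Nat.pos_of_ne_zero (NeZero.ne q)
  have hX : 1 ≤ (q : ℝ) * (|s.im| + 2) := one_le_tau _
  have hXε : 1 ≤ ((q : ℝ) * (|s.im| + 2)) ^ (ε / 4) := Real.one_le_rpow hX (by linarith)
  have hi : 0 < |s.im| := abs_pos.2 hsi
  have hi' : 1 ≤ 1 + 1 / |s.im| := by have : 0 ≤ 1 / |s.im| := by positivity
                                      linarith
  have key := h q χ s.im (c * (q * (|s.im| + 2)) ^ (ε / 4) * (1 + 1 / |s.im|))
    (c' * (q * (|s.im| + 2)) ^ (ε / 4))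
    (one_le_mul_of_one_le_of_one_le (one_le_mul_of_one_le_of_one_le hc1 hXε) hi')
    (one_le_mul_of_one_le_of_one_le hc'1 hXε) ?_ ?_ s hs1 hs2 rfl
  · exact combine_rpow hX (by linarith) (by linarith) (by linarith) (norm_nonneg _) key
  · intro w hw1 hw2 hwy
    have := h0 q w hw1 hw2 (by rw [hwy]; simpa using hsi)
    rw [hwy] at this
    rw [hχ2]
    refine this.trans ?_
    have h3 : 1 / |2 * s.im| ≤ 1 / |s.im| := by
      rw [abs_mul]; gcongr; norm_num; linarith
    calc _ ≤ C0 * (2 * (q * (|s.im| + 2)) ^ (ε / 4)) * (1 + 1 / |s.im|) := by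
          gcongr; exact tau_two_le (by linarith) (by linarith)
      _ = C0 * 2 * (q * (|s.im| + 2)) ^ (ε / 4) * (1 + 1 / |s.im|) := by ring
      _ ≤ _ := by gcongr; exact le_max_left _ _
  · intro w hw1 hw2 hwy
    have := h1 (fun n => χ n) q w hq (fun n => DirichletCharacter.norm_le_one _ _)
      (norm_sum_range_char_le hχ) hw1 hw2
    rw [hwy] at this
    refine this.trans ?_
    gcongr; exact le_max_left _ _

theorem LSeries_char_one : LSeries (fun n => (1 : DirichletCharacter ℂ 1) n) = LSeries 1 := by
  congr 1
  funext n
  rw [MulChar.one_apply (isUnit_of_subsingleton _)]; rfl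

theorem one_le_mul_norm_zeta {ε : ℝ} (hε : 0 < ε) (hε1 : ε ≤ 1) : ∃ C : ℝ, 1 ≤ C ∧
    ∀ s : ℂ, 1 < s.re → s.re ≤ 2 → 1 ≤ |s.im| →
      1 ≤ C * (|s.im| + 2) ^ ε * ‖LSeries 1 s‖ := by
  obtain ⟨C, hC, h⟩ := exists_one_le_mul_norm_LSeries
  obtain ⟨C0, hC0, h0⟩ := norm_iteratedDeriv_zeta_le 0 (ε := ε / 4) (by linarith)
  obtain ⟨C1, hC1, h1⟩ := norm_iteratedDeriv_zeta_le 1 (ε := ε / 4) (by linarith)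
  set c := max (C0 * 2) 1 with hc
  set c' := max C1 1 with hc'
  have hc1 : 1 ≤ c := le_max_right _ _
  have hc'1 : 1 ≤ c' := le_max_right _ _
  refine ⟨C * c * c' ^ 3, ?_, ?_⟩
  · exact one_le_mul_of_one_le_of_one_le (one_le_mul_of_one_le_of_one_le hC hc1)
      (one_le_pow₀ hc'1)
  intro s hs1 hs2 hsi
  have hX : 1 ≤ |s.im| + 2 := by linarith
  have hXε : 1 ≤ (|s.im| + 2) ^ (ε / 4) := Real.one_le_rpow hX (by linarith)
  have key := h 1 1 s.im (c * (|s.im| + 2) ^ (ε / 4) * 1) (c' * (|s.im| + 2) ^ (ε / 4))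
    (by rw [mul_one]; exact one_le_mul_of_one_le_of_one_le hc1 hXε)
    (one_le_mul_of_one_le_of_one_le hc'1 hXε) ?_ ?_ s hs1 hs2 rfl
  · have := combine_rpow hX zero_le_one (by linarith) (by linarith) (norm_nonneg _) key
    rw [LSeries_char_one] at this
    simpa using this
  · intro w hw1 hw2 hwy
    have h4 : |w.im| = 2 * |s.im| := by rw [hwy, abs_mul]; norm_num
    have := h0 w hw1 hw2 (by linarith)
    rw [iteratedDeriv_zero, hwy] at this
    rw [one_pow, LSeries_char_one]
    refine this.trans ?_
    have h5 := tau_two_le (q := 1) (y := s.im) (ε := ε / 4) (by linarith) (by linarith)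
    simp only [Nat.cast_one, one_mul] at h5
    calc _ ≤ C0 * (2 * (|s.im| + 2) ^ (ε / 4)) := by gcongr
      _ = C0 * 2 * (|s.im| + 2) ^ (ε / 4) * 1 := by ring
      _ ≤ _ := by gcongr; exact le_max_left _ _
  · intro w hw1 hw2 hwy
    rw [LSeries_char_one]
    have := h1 w hw1 hw2 (by rwa [hwy])
    rw [hwy] at this
    refine this.trans ?_
    gcongr; exact le_max_left _ _

theorem estermann_lower_bound {G : ℂ → ℂ} (hG : Differentiable ℂ G) {K b : ℝ} (hb : 0 < b)
    (hbK : b ≤ K) (hK : ∀ s ∈ Metric.sphere (2 : ℂ) (3 / 2), ‖dslope G 1 s‖ ≤ K)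
    (hF : ∀ m, 0 ≤ ((-1) ^ m * iteratedDeriv m (fun s => G s / (s - 1)) 2).re)
    (hF0 : b ≤ (G 2).re) {α : ℝ} (hα : 7 / 8 ≤ α) (hα1 : α < 1) (hGα : 0 ≤ (G α).re) {M : ℕ}
    (hM : 4 * K * (3 / 4) ^ M ≤ b / 2) :
    (1 - α) * b / 2 ≤ (G 1).re * (2 - α) ^ M := by
  set E : ℂ → ℂ := dslope G 1 with hE
  have hEd : Differentiable ℂ E := by
    have := (Complex.differentiableOn_dslope (f := G) (s := Set.univ) (c := 1) Filter.univ_mem).2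
      hG.differentiableOn
    exact differentiableOn_univ.1 this
  have hEeq : ∀ s : ℂ, s ≠ 1 → E s = (s - 1)⁻¹ * (G s - G 1) := by
    intro s hs
    rw [hE, dslope_of_ne _ hs, slope_def_module, smul_eq_mul]
  have hder : ∀ n, iteratedDeriv n E 2 =
      iteratedDeriv n (fun s => G s / (s - 1)) 2 - G 1 * ((-1) ^ n * n.factorial) := by
    intro n
    have hnb : E =ᶠ[nhds 2] fun s => G s / (s - 1) - G 1 * (1 * s - 1)⁻¹ := by
      have : {s : ℂ | s ≠ 1} ∈ nhds (2 : ℂ) := isOpen_ne.mem_nhds (by norm_num)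
      filter_upwards [this] with s hs
      rw [hEeq s hs]
      have : s - 1 ≠ 0 := sub_ne_zero.2 hs
      field_simp
    rw [Filter.EventuallyEq.iteratedDeriv_eq n hnb]
    have hc1 : ContDiffAt ℂ n (fun s : ℂ => (1 * s - 1)⁻¹) 2 := by
      refine ContDiffAt.inv (by fun_prop) (by norm_num)
    have hc2 : ContDiffAt ℂ n (fun s : ℂ => G s / (s - 1)) 2 := by
      refine ContDiffAt.div (hG.contDiff.contDiffAt) (by fun_prop) (by norm_num)
    have h1 := iter_deriv_inv_linear_sub (𝕜 := ℂ) n 1 1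
    rw [iteratedDeriv_fun_sub hc2 (contDiffAt_const.mul hc1), iteratedDeriv_const_mul_field,
      iteratedDeriv_eq_iterate (f := fun s : ℂ => (1 * s - 1)⁻¹), h1]
    congr 1
    have : ((1 : ℂ) * 2 - 1) = 1 := by norm_num
    simp only [this]
    simp
  have hsum := Complex.hasSum_taylorSeries_on_ball (f := E) (c := 2) (r := 3 / 2)
    (z := (α : ℂ)) hEd.differentiableOn (by
      rw [Metric.mem_ball, dist_comm, dist_eq_norm, show (2 : ℂ) - α = ((2 - α : ℝ) : ℂ) by push_cast; rfl,
        Complex.norm_real, Real.norm_eq_abs, abs_of_pos (by linarith)]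
      linarith)
  have hre := Complex.hasSum_re hsum
  set e : ℕ → ℝ := fun n => ((n.factorial : ℂ)⁻¹ * ((-1) ^ n * iteratedDeriv n E 2)).re with he
  have hterm : ∀ n, ((n.factorial : ℂ)⁻¹ • ((α : ℂ) - 2) ^ n • iteratedDeriv n E 2).re =
      e n * (2 - α) ^ n := by
    intro n
    have : (n.factorial : ℂ)⁻¹ • ((α : ℂ) - 2) ^ n • iteratedDeriv n E 2 =
        ((n.factorial : ℂ)⁻¹ * ((-1) ^ n * iteratedDeriv n E 2)) * (((2 - α) ^ n : ℝ) : ℂ) := by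
      push_cast
      rw [show (α : ℂ) - 2 = (-1) * (2 - α) by ring, mul_pow]
      simp only [smul_eq_mul]; ring
    rw [this, Complex.re_mul_ofReal]
  simp_rw [hterm] at hre
  have hebound : ∀ n, |e n| ≤ K * (2 / 3) ^ n := by
    intro n
    have h1 := Complex.norm_iteratedDeriv_le_of_forall_mem_sphere_norm_le (F := ℂ) n (c := 2)
      (R := 3 / 2) (C := K) (f := E) (by norm_num) hEd.diffContOnCl hK
    refine (Complex.abs_re_le_norm _).trans ?_
    rw [norm_mul, norm_mul, norm_pow, norm_neg, norm_one, one_pow, one_mul, norm_inv,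
      Complex.norm_natCast]
    have hf : (0 : ℝ) < n.factorial := by exact_mod_cast n.factorial_pos
    rw [inv_mul_le_iff₀ hf]
    refine h1.trans (le_of_eq ?_)
    rw [show (2 / 3 : ℝ) = (3 / 2)⁻¹ by norm_num, inv_pow]; ring
  have hel : ∀ n, -(G 1).re ≤ e n := by
    intro n
    have hf : (0 : ℝ) < n.factorial := by exact_mod_cast n.factorial_pos
    have : (n.factorial : ℂ)⁻¹ * ((-1) ^ n * iteratedDeriv n E 2) =
        ((n.factorial : ℝ)⁻¹ : ℝ) * ((-1) ^ n * iteratedDeriv n (fun s => G s / (s - 1)) 2) - G 1 := by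
      rw [hder]
      have hf' : (n.factorial : ℂ) ≠ 0 := by exact_mod_cast n.factorial_pos.ne'
      push_cast
      rw [mul_sub, mul_sub]
      congr 1
      have : ((-1 : ℂ)) ^ n * (-1) ^ n = 1 := by rw [← mul_pow]; norm_num
      field_simp
      linear_combination (G 1) * this
    rw [he]
    simp only
    rw [this, Complex.sub_re, Complex.re_ofReal_mul]
    have := mul_nonneg (inv_nonneg.2 hf.le) (hF n)
    linarith
  have he0 : b - (G 1).re ≤ e 0 := by
    have : e 0 = (G 2).re - (G 1).re := by
      have h := hEeq 2 (by norm_num)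
      norm_num at h
      simp [he, h]
    linarith
  have hM0 : M ≠ 0 := by
    rintro rfl
    simp at hM; linarith
  set w := 2 - α with hw
  have hw1 : 1 < w := by linarith
  have hw2 : w ≤ 9 / 8 := by linarith
  -- head and tail
  have hsplit := hre.summable.sum_add_tsum_nat_add M
  rw [hre.tsum_eq] at hsplit
  have htail : |∑' i, e (i + M) * w ^ (i + M)| ≤ 4 * K * (3 / 4) ^ M := by
    have hg : HasSum (fun i : ℕ => K * (3 / 4) ^ M * (3 / 4 : ℝ) ^ i) (K * (3 / 4) ^ M * (1 - 3 / 4)⁻¹) :=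
      (hasSum_geometric_of_lt_one (by norm_num) (by norm_num)).mul_left _
    have := tsum_of_norm_bounded hg (f := fun i => e (i + M) * w ^ (i + M)) (fun i => by
      rw [Real.norm_eq_abs, abs_mul, abs_of_pos (pow_pos (by linarith : 0 < w) _)]
      calc |e (i + M)| * w ^ (i + M) ≤ K * (2 / 3) ^ (i + M) * (9 / 8) ^ (i + M) := by
            refine mul_le_mul (hebound _) (pow_le_pow_left₀ (by linarith) hw2 _) (by positivity) ?_
            have : 0 < K := by linarith
            positivity
        _ = K * (3 / 4) ^ M * (3 / 4 : ℝ) ^ i := by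
            rw [mul_assoc, ← mul_pow, mul_assoc, ← pow_add, add_comm M i]; norm_num)
    rw [Real.norm_eq_abs] at this
    refine this.trans (le_of_eq ?_)
    norm_num; ring
  have hhead : b - (G 1).re * ((w ^ M - 1) / (w - 1)) ≤ ∑ i ∈ range M, e i * w ^ i := by
    rw [← geom_sum_eq (by linarith : w ≠ 1), mul_sum]
    obtain ⟨m, rfl⟩ := Nat.exists_eq_succ_of_ne_zero hM0
    rw [sum_range_succ', sum_range_succ']
    have : ∑ i ∈ range m, -((G 1).re * w ^ (i + 1)) ≤ ∑ i ∈ range m, e (i + 1) * w ^ (i + 1) := by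
      refine sum_le_sum fun i _ => ?_
      have := mul_le_mul_of_nonneg_right (hel (i + 1)) (pow_pos (by linarith : 0 < w) (i + 1)).le
      linarith
    rw [sum_neg_distrib] at this
    simp only [pow_zero, mul_one]
    linarith
  have hEα : (E α).re ≤ (G 1).re / (1 - α) := by
    have hne : (α : ℂ) ≠ 1 := by exact_mod_cast hα1.ne
    rw [hEeq _ hne, show ((α : ℂ) - 1)⁻¹ = (((α - 1)⁻¹ : ℝ) : ℂ) by push_cast; rfl,
      Complex.re_ofReal_mul, Complex.sub_re, inv_mul_eq_div, le_div_iff₀ (by linarith)]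
    have : ((G α).re - (G 1).re) / (α - 1) * (1 - α) = (G 1).re - (G α).re := by
      have : α - 1 ≠ 0 := by linarith
      field_simp; ring
    rw [this]; linarith
  have h1 := abs_le.1 htail
  have hkey : b / 2 ≤ (G 1).re / (1 - α) + (G 1).re * ((w ^ M - 1) / (w - 1)) := by linarith [h1.1]
  have hw3 : w - 1 = 1 - α := by rw [hw]; ring
  rw [hw3] at hkey
  have : (G 1).re / (1 - α) + (G 1).re * ((w ^ M - 1) / (1 - α)) = (G 1).re * w ^ M / (1 - α) := by
    ring
  rw [this, le_div_iff₀ (by linarith)] at hkey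
  linarith

theorem iteratedDeriv_nonneg_of_logDeriv {f : ℂ → ℂ} {p : ℕ → ℝ} (hp : ∀ n, 0 ≤ p n)
    (hps : LSeries.abscissaOfAbsConv (fun n => (p n : ℂ)) ≤ 1)
    (hf : DifferentiableOn ℂ f {s | 1 < s.re})
    (hder : ∀ s : ℂ, 1 < s.re → deriv f s = -(LSeries (fun n => (p n : ℂ)) s * f s))
    (hf2 : ∃ r : ℝ, 0 ≤ r ∧ f 2 = r) (m : ℕ) :
    ∃ r : ℝ, 0 ≤ r ∧ (-1) ^ m * iteratedDeriv m f 2 = r := by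
  have hopen : IsOpen {s : ℂ | 1 < s.re} := isOpen_lt continuous_const Complex.continuous_re
  have h2 : (2 : ℂ) ∈ {s : ℂ | 1 < s.re} := by simp
  have habs : LSeries.abscissaOfAbsConv (fun n => (p n : ℂ)) < (2 : ℂ).re :=
    hps.trans_lt (by norm_num; exact_mod_cast (by norm_num : (1 : ℝ) < 2))
  have hP : ∀ k, ∃ r : ℝ, 0 ≤ r ∧
      (-1) ^ k * iteratedDeriv k (LSeries (fun n => (p n : ℂ))) 2 = r := by
    intro k
    have h := hasSum_iteratedDeriv_LSeries (s := 2) (by simp) habs k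
    have hterm : ∀ n : ℕ, (p n : ℂ) * logCpow k 2 n =
        ((p n * ((Real.log n) ^ k * (n : ℝ) ^ (-2 : ℝ)) : ℝ) : ℂ) := by
      intro n
      rw [logCpow]
      push_cast
      rw [Complex.ofReal_cpow (by positivity)]
      push_cast; rfl
    simp_rw [hterm] at h
    refine ⟨∑' n, p n * ((Real.log n) ^ k * (n : ℝ) ^ (-2 : ℝ)), tsum_nonneg fun n => ?_, ?_⟩
    · have := hp n
      have := Real.log_natCast_nonneg n
      positivity
    · rw [Complex.ofReal_tsum]
      exact h.tsum_eq.symm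
  have hPan : ContDiffAt ℂ ⊤ (LSeries (fun n => (p n : ℂ))) 2 := by
    have hd : DifferentiableOn ℂ (LSeries (fun n => (p n : ℂ))) {s | 1 < s.re} := by
      refine (LSeries_differentiableOn _).mono fun s hs => ?_
      exact hps.trans_lt (by exact_mod_cast hs)
    exact (hd.analyticAt (hopen.mem_nhds h2)).contDiffAt
  have hfan : ContDiffAt ℂ ⊤ f 2 := (hf.analyticAt (hopen.mem_nhds h2)).contDiffAt
  induction m using Nat.strong_induction_on with
  | _ m ih =>
    rcases m with _ | m
    · simpa using hf2
    have hev : deriv f =ᶠ[nhds 2] fun s => -(LSeries (fun n => (p n : ℂ)) s * f s) := by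
      filter_upwards [hopen.mem_nhds h2] with s hs using hder s hs
    rw [iteratedDeriv_succ', hev.iteratedDeriv_eq, iteratedDeriv_fun_neg,
      iteratedDeriv_fun_mul (hPan.of_le (by exact_mod_cast le_top)) (hfan.of_le (by exact_mod_cast le_top))]
    choose r hr0 hr using hP
    choose! u hu0 hu using ih
    refine ⟨∑ i ∈ range (m + 1), m.choose i * r i * u (m - i), sum_nonneg fun i _ => ?_, ?_⟩
    · have := hr0 i
      have := hu0 (m - i) (by omega)
      positivity
    · push_cast
      rw [pow_succ, mul_assoc, mul_neg, neg_mul, one_mul, neg_neg, mul_sum]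
      refine sum_congr rfl fun i hi => ?_
      rw [← hr i, ← hu (m - i) (by omega)]
      have : (-1 : ℂ) ^ m = (-1) ^ i * (-1) ^ (m - i) := by
        rw [← pow_add]; congr 1; have := mem_range.1 hi; omega
      rw [this]; ring

theorem norm_natCast_cpow_neg_sub_le {s : ℂ} (hs : 0 < s.re) (n : ℕ) :
    ‖((n + 2 : ℕ) : ℂ) ^ (-s) - ((n + 1 : ℕ) : ℂ) ^ (-s)‖ ≤ ‖s‖ * ((n : ℝ) + 1) ^ (-s.re - 1) := by
  have hder : ∀ u ∈ Set.Icc ((n : ℝ) + 1) (n + 2), HasDerivWithinAt (fun u : ℝ => (u : ℂ) ^ (-s))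
      ((-s) * (u : ℂ) ^ (-s - 1)) (Set.Icc ((n : ℝ) + 1) (n + 2)) u := by
    intro u hu
    have hu0 : 0 < u := by have := hu.1; have : (0 : ℝ) ≤ n := n.cast_nonneg; linarith
    have hs0 : s ≠ 0 := by rintro rfl; simp at hs
    have h := (hasDerivAt_ofReal_cpow_const' (x := u) (r := -s - 1) hu0.ne' (by
      intro h; apply hs0; linear_combination -h)).const_mul (-s)
    refine (h.congr_deriv rfl).hasDerivWithinAt.congr_of_mem (fun v hv => ?_) hu
    have : -s ≠ 0 := neg_ne_zero.2 hs0
    simp only [sub_add_cancel]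
    field_simp
  have hb : ∀ u ∈ Set.Icc ((n : ℝ) + 1) (n + 2), ‖(-s) * (u : ℂ) ^ (-s - 1)‖ ≤
      ‖s‖ * ((n : ℝ) + 1) ^ (-s.re - 1) := by
    intro u hu
    have hn : (0 : ℝ) ≤ n := n.cast_nonneg
    have hu0 : 0 < u := by have := hu.1; linarith
    rw [norm_mul, norm_neg, Complex.norm_cpow_eq_rpow_re_of_pos hu0]
    refine mul_le_mul_of_nonneg_left ?_ (norm_nonneg _)
    have : (-s - 1).re = -s.re - 1 := by simp
    rw [this]
    exact Real.rpow_le_rpow_of_nonpos (by linarith) hu.1 (by linarith)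
  have h := (convex_Icc ((n : ℝ) + 1) (n + 2)).norm_image_sub_le_of_norm_hasDerivWithin_le hder hb
    (x := (n : ℝ) + 1) (y := n + 2) (by constructor <;> linarith) (by constructor <;> linarith)
  have h1 : ‖(n : ℝ) + 2 - (n + 1)‖ = 1 := by
    rw [show (n : ℝ) + 2 - (n + 1) = 1 by ring]; simp
  rw [h1, mul_one] at h
  simpa using h

/-- The terms of the series for `L(s, χ)` after partial summation. -/
noncomputable def charTerm {q : ℕ} (χ : DirichletCharacter ℂ q) (n : ℕ) (s : ℂ) : ℂ :=
  (∑ m ∈ range (n + 2), χ m) * (((n + 1 : ℕ) : ℂ) ^ (-s) - ((n + 2 : ℕ) : ℂ) ^ (-s))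

theorem norm_charTerm_le {q : ℕ} [NeZero q] {χ : DirichletCharacter ℂ q} (hχ : χ ≠ 1) (n : ℕ)
    {s : ℂ} (hs : 1 / 4 < s.re) : ‖charTerm χ n s‖ ≤ q * (‖s‖ * ((n : ℝ) + 1) ^ (-(5 / 4) : ℝ)) := by
  rw [charTerm, norm_mul, norm_sub_rev]
  refine mul_le_mul (norm_sum_range_char_le hχ _) ?_ (norm_nonneg _) (by positivity)
  refine (norm_natCast_cpow_neg_sub_le (by linarith) n).trans ?_
  refine mul_le_mul_of_nonneg_left ?_ (norm_nonneg _)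
  exact Real.rpow_le_rpow_of_exponent_le (by have : (0 : ℝ) ≤ n := n.cast_nonneg
                                             linarith) (by linarith)

theorem summable_succ_rpow : Summable fun n : ℕ => ((n : ℝ) + 1) ^ (-(5 / 4) : ℝ) := by
  have h : Summable fun n : ℕ => (n : ℝ) ^ (-(5 / 4) : ℝ) := Real.summable_nat_rpow.2 (by norm_num)
  simpa using (summable_nat_add_iff 1).2 h

theorem summable_charTerm {q : ℕ} [NeZero q] {χ : DirichletCharacter ℂ q} (hχ : χ ≠ 1)
    {s : ℂ} (hs : 1 / 4 < s.re) : Summable fun n => charTerm χ n s :=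
  Summable.of_norm_bounded ((summable_succ_rpow.mul_left ‖s‖).mul_left _)
    (fun n => norm_charTerm_le hχ n hs)

open Filter Topology in
theorem LFunction_eq_tsum_charTerm_of_one_lt {q : ℕ} [NeZero q] {χ : DirichletCharacter ℂ q}
    (hχ : χ ≠ 1) {s : ℂ} (hs : 1 < s.re) :
    χ.LFunction s = ∑' n, charTerm χ n s := by
  rw [DirichletCharacter.LFunction_eq_LSeries χ hs]
  have h1 := (summable_charTerm hχ (s := s) (by linarith)).hasSum.tendsto_sum_nat
  have h2 := (hasSum_iteratedDeriv_LSeries hs (abscissa_lt_of_norm_le_one (f := fun n => χ n)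
    (fun n => χ.norm_le_one _) hs) 0).tendsto_sum_nat
  simp only [pow_zero, iteratedDeriv_zero, one_mul] at h2
  have h3 : Tendsto (fun N : ℕ => ‖(∑ m ∈ range (N + 1), χ m) * ((N + 1 : ℕ) : ℂ) ^ (-s)‖) atTop (𝓝 0) := by
    have : Tendsto (fun N : ℕ => (q : ℝ) * ((N + 1 : ℕ) : ℝ) ^ (-s.re)) atTop (𝓝 (q * 0)) := by
      refine Tendsto.const_mul _ ?_
      have h := (tendsto_rpow_neg_atTop (y := s.re) (by linarith)).comp tendsto_natCast_atTop_atTop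
      exact h.comp (tendsto_add_atTop_nat 1)
    rw [mul_zero] at this
    refine squeeze_zero (fun _ => norm_nonneg _) (fun N => ?_) this
    rw [norm_mul, Complex.norm_natCast_cpow_of_pos (by omega)]
    exact mul_le_mul_of_nonneg_right (norm_sum_range_char_le hχ _) (by positivity)
  have h4 := tendsto_zero_iff_norm_tendsto_zero.2 h3
  have h5 := h1.add h4
  rw [add_zero] at h5
  refine tendsto_nhds_unique (h2.comp (tendsto_add_atTop_nat 1)) (h5.congr fun N => ?_)
  have h0 : ((0 : ℕ) : ℂ) ^ (-s) = 0 := by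
    rw [Nat.cast_zero, Complex.zero_cpow]
    intro h; rw [neg_eq_zero] at h; rw [h] at hs; simp at hs; linarith
  have hlc : ∀ n : ℕ, logCpow 0 s n = (n : ℂ) ^ (-s) := fun n => by simp [logCpow]
  simp only [Function.comp, hlc, charTerm]
  induction N with
  | zero =>
    have hq : q ≠ 1 := by rintro rfl; exact hχ χ.level_one
    have := χ.map_zero' hq
    simp [this]
  | succ N ih =>
    rw [sum_range_succ, sum_range_succ _ (N + 1), sum_range_succ _ (N + 1), ← ih]
    rw [show N + 1 + 1 = N + 2 from rfl]
    ring

theorem LFunction_eq_tsum_charTerm {q : ℕ} [NeZero q] {χ : DirichletCharacter ℂ q}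
    (hχ : χ ≠ 1) {s : ℂ} (hs : 1 / 4 < s.re) (hs4 : ‖s‖ < 4) :
    χ.LFunction s = ∑' n, charTerm χ n s := by
  set U : Set ℂ := {s : ℂ | 1 / 4 < s.re} ∩ Metric.ball 0 4 with hU
  have hUo : IsOpen U :=
    (isOpen_lt continuous_const Complex.continuous_re).inter Metric.isOpen_ball
  have hUc : Convex ℝ U := (convex_halfSpace_re_gt _).inter (convex_ball _ _)
  have hH : DifferentiableOn ℂ (fun w => ∑' n, charTerm χ n w) U := by
    refine Complex.differentiableOn_tsum_of_summable_norm
      ((summable_succ_rpow.mul_left 4).mul_left (q : ℝ)) (fun n => ?_) hUo (fun n w hw => ?_)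
    · unfold charTerm
      have h1 : ((n + 1 : ℕ) : ℂ) ≠ 0 := by exact_mod_cast n.succ_ne_zero
      have h2 : ((n + 2 : ℕ) : ℂ) ≠ 0 := by exact_mod_cast (n + 1).succ_ne_zero
      intro w hw
      refine DifferentiableAt.differentiableWithinAt ?_
      refine DifferentiableAt.const_mul (DifferentiableAt.sub ?_ ?_) _
      · exact (differentiableAt_id.neg).const_cpow (Or.inl h1)
      · exact (differentiableAt_id.neg).const_cpow (Or.inl h2)
    · refine (norm_charTerm_le hχ n hw.1).trans ?_
      have : ‖w‖ ≤ 4 := by have := hw.2; rw [mem_ball_zero_iff] at this; exact this.le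
      gcongr
  have hL : DifferentiableOn ℂ χ.LFunction U :=
    (DirichletCharacter.differentiable_LFunction hχ).differentiableOn
  have h2 : (2 : ℂ) ∈ U := ⟨by simp; norm_num, by simp; norm_num⟩
  refine (hL.analyticOnNhd hUo).eqOn_of_preconnected_of_eventuallyEq (hH.analyticOnNhd hUo)
    hUc.isPreconnected h2 ?_ ⟨hs, by simpa using hs4⟩
  have : {s : ℂ | 1 < s.re} ∈ nhds (2 : ℂ) :=
    (isOpen_lt continuous_const Complex.continuous_re).mem_nhds (by simp)
  filter_upwards [this] with w hw using LFunction_eq_tsum_charTerm_of_one_lt hχ hw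

theorem exists_norm_LFunction_le : ∃ C : ℝ, 1 ≤ C ∧ ∀ (q : ℕ) [NeZero q]
    (χ : DirichletCharacter ℂ q), χ ≠ 1 → ∀ s : ℂ, 1 / 4 < s.re → ‖s‖ < 4 →
    ‖χ.LFunction s‖ ≤ C * q := by
  refine ⟨max 1 (4 * ∑' n : ℕ, ((n : ℝ) + 1) ^ (-(5 / 4) : ℝ)), le_max_left _ _, ?_⟩
  intro q _ χ hχ s hs hs4
  rw [LFunction_eq_tsum_charTerm hχ hs hs4]
  have h := tsum_of_norm_bounded ((summable_succ_rpow.mul_left ‖s‖).mul_left (q : ℝ)).hasSum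
    (fun n => norm_charTerm_le hχ n hs)
  refine h.trans ?_
  rw [tsum_mul_left, tsum_mul_left, mul_comm]
  gcongr
  refine le_trans ?_ (le_max_right _ _)
  gcongr

theorem LFunction_im_eq_zero {q : ℕ} [NeZero q] {χ : DirichletCharacter ℂ q} (hχ : χ ≠ 1)
    (hr : ∀ a, (χ a).im = 0) {σ : ℝ} (h1 : 1 / 4 < σ) (h4 : σ < 4) :
    (χ.LFunction (σ : ℂ)).im = 0 := by
  rw [LFunction_eq_tsum_charTerm hχ (by simpa using h1) (by
    rw [Complex.norm_real, Real.norm_eq_abs, abs_lt]; constructor <;> linarith)]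
  rw [Complex.im_tsum (summable_charTerm hχ (by simpa using h1))]
  refine (tsum_congr fun n => ?_).trans tsum_zero
  have hcp : ∀ m : ℕ, ((m : ℂ) ^ (-(σ : ℂ))) = (((m : ℝ) ^ (-σ) : ℝ) : ℂ) := by
    intro m
    rw [Complex.ofReal_cpow m.cast_nonneg]; push_cast; rfl
  rw [charTerm, hcp, hcp, ← Complex.ofReal_sub, Complex.im_mul_ofReal, Complex.im_sum]
  simp [hr]

theorem exists_pow_bound {α b K : ℝ} (hα : 7 / 8 ≤ α) (hα1 : α < 1) (hb : 0 < b) (hbK : b ≤ K) :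
    ∃ M : ℕ, 4 * K * (3 / 4) ^ M ≤ b / 2 ∧ (2 - α) ^ M ≤ 3 * (8 * K / b) ^ (4 * (1 - α)) := by
  have hX : 1 < 8 * K / b := by rw [lt_div_iff₀ hb]; linarith
  set X := 8 * K / b with hXd
  have hl : 0 < Real.log X := Real.log_pos hX
  refine ⟨⌈4 * Real.log X⌉₊, ?_, ?_⟩
  · have h1 : (3 / 4 : ℝ) ^ ⌈4 * Real.log X⌉₊ ≤ X⁻¹ := by
      have h2 : (3 / 4 : ℝ) ≤ Real.exp (-(1 / 4)) := by
        have := Real.add_one_le_exp (-(1 / 4 : ℝ)); linarith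
      calc (3 / 4 : ℝ) ^ ⌈4 * Real.log X⌉₊ ≤ (Real.exp (-(1 / 4))) ^ ⌈4 * Real.log X⌉₊ := by gcongr
        _ = Real.exp (⌈4 * Real.log X⌉₊ * (-(1 / 4))) := by rw [← Real.exp_nat_mul]
        _ ≤ Real.exp (-Real.log X) := by
            apply Real.exp_le_exp.2
            have := Nat.le_ceil (4 * Real.log X); linarith
        _ = X⁻¹ := by rw [Real.exp_neg, Real.exp_log (by linarith)]
    have hK : 0 < K := by linarith
    calc 4 * K * (3 / 4) ^ ⌈4 * Real.log X⌉₊ ≤ 4 * K * X⁻¹ := by gcongr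
      _ = b / 2 := by rw [hXd]; field_simp; norm_num
  · have h0 : 0 < 1 - α := by linarith
    have h2 : 2 - α ≤ Real.exp (1 - α) := by
      have := Real.add_one_le_exp (1 - α); linarith
    have h3 : Real.exp 1 ≤ 3 := by have := Real.exp_one_lt_d9; linarith
    have h4 : (⌈4 * Real.log X⌉₊ : ℝ) ≤ 4 * Real.log X + 1 :=
      (Nat.ceil_lt_add_one (by positivity)).le
    calc (2 - α) ^ ⌈4 * Real.log X⌉₊ ≤ (Real.exp (1 - α)) ^ ⌈4 * Real.log X⌉₊ :=
          pow_le_pow_left₀ (by linarith) h2 _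
      _ = Real.exp (⌈4 * Real.log X⌉₊ * (1 - α)) := by rw [← Real.exp_nat_mul]
      _ ≤ Real.exp (1 + Real.log X * (4 * (1 - α))) := by
          apply Real.exp_le_exp.2
          have := mul_le_mul_of_nonneg_right h4 h0.le
          nlinarith
      _ ≤ 3 * X ^ (4 * (1 - α)) := by
          rw [Real.exp_add, Real.rpow_def_of_pos (by linarith)]
          gcongr

theorem exists_siegel_core : ∃ C : ℝ, 1 ≤ C ∧ ∀ (A : ℂ → ℂ) (a : ℕ → ℝ) (K α : ℝ),
    Differentiable ℂ A →
    (∀ s : ℂ, 1 < s.re → LSeriesSummable (fun n => (a n : ℂ)) s) →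
    (∀ s : ℂ, 1 < s.re → deriv A s = -(LSeries (fun n => (a n : ℂ)) s * A s)) →
    (∀ n, 0 ≤ ArithmeticFunction.vonMangoldt n + a n) →
    (∃ r : ℝ, 1 / 27 ≤ r ∧ A 2 = r) → 1 ≤ K →
    (∀ s : ℂ, 1 / 4 < s.re → ‖s‖ < 4 → ‖A s‖ ≤ K) →
    7 / 8 ≤ α → α < 1 → 0 ≤ (zetaOne α * A α).re →
    1 - α ≤ C * (A 1).re * (C * K) ^ (4 * (1 - α)) := by
  obtain ⟨Z, hZ⟩ := (isCompact_closedBall (2 : ℂ) (3 / 2)).exists_bound_of_continuousOn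
    differentiable_zetaOne.continuous.continuousOn
  set Z' := max Z 1 with hZ'
  have hZ1 : 1 ≤ Z' := le_max_right _ _
  refine ⟨8 * 27 * 4 * Z', by linarith, ?_⟩
  intro A a K α hA ha hd hp ⟨r, hr, hA2⟩ hK1 hK hα hα1 hG
  have hb : (0 : ℝ) < 1 / 27 := by norm_num
  set K' := 4 * Z' * K with hK'
  have hKK : 1 / 27 ≤ K' := by nlinarith
  obtain ⟨M, hM1, hM2⟩ := exists_pow_bound hα hα1 hb hKK
  have hζ2 : ∃ z : ℝ, 1 ≤ z ∧ zetaOne 2 = z := by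
    refine ⟨(Real.pi ^ 2 / 6), by have := Real.pi_gt_three; nlinarith, ?_⟩
    rw [zetaOne_of_ne_one (by norm_num), riemannZeta_two]; push_cast; ring
  obtain ⟨z, hz1, hz⟩ := hζ2
  have hP : ∀ s : ℂ, 1 < s.re → LSeriesSummable (fun n => ((ArithmeticFunction.vonMangoldt n + a n : ℝ) : ℂ)) s ∧
      LSeries (fun n => ((ArithmeticFunction.vonMangoldt n + a n : ℝ) : ℂ)) s =
       LSeries (fun n => (ArithmeticFunction.vonMangoldt n : ℂ)) s + LSeries (fun n => (a n : ℂ)) s := by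
    intro s hs
    have h1 := ArithmeticFunction.LSeriesSummable_vonMangoldt hs
    have he : (fun n => ((ArithmeticFunction.vonMangoldt n + a n : ℝ) : ℂ)) =
      (fun n => (ArithmeticFunction.vonMangoldt n : ℂ)) + (fun n => (a n : ℂ)) := by
      funext n; simp
    rw [he]
    exact ⟨h1.add (ha s hs), LSeries_add h1 (ha s hs)⟩
  have hev : ∀ s : ℂ, 1 < s.re → (fun s => (zetaOne s * A s) / (s - 1)) =ᶠ[nhds s]
      fun s => riemannZeta s * A s := by
    intro s hs
    filter_upwards [(isOpen_lt continuous_const Complex.continuous_re).mem_nhds hs] with w hw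
    have hw1 : w ≠ 1 := by rintro rfl; simp at hw
    rw [zetaOne_of_ne_one hw1]
    have : w - 1 ≠ 0 := sub_ne_zero.2 hw1
    field_simp
  have hdζ : ∀ s : ℂ, 1 < s.re → DifferentiableAt ℂ (fun s => riemannZeta s * A s) s := by
    intro s hs
    have hw1 : s ≠ 1 := by rintro rfl; simp at hs
    exact (differentiableAt_riemannZeta hw1).mul (hA s)
  have hest := estermann_lower_bound (G := fun s => zetaOne s * A s)
    (differentiable_zetaOne.mul hA) (K := K') hb hKK (fun s hs => ?_) (fun m => ?_) ?_ hα hα1 hG hM1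
  · rw [zetaOne_one, one_mul] at hest
    have hA1 : 0 < (A 1).re := by
      by_contra h
      have h1 : (A 1).re * (2 - α) ^ M ≤ 0 :=
        mul_nonpos_of_nonpos_of_nonneg (not_lt.1 h) (pow_nonneg (by linarith) _)
      have : 0 < (1 - α) * (1 / 27) / 2 := by
        have : 0 < 1 - α := by linarith
        positivity
      linarith
    have h8 : 8 * K' / (1 / 27) = 8 * 27 * 4 * Z' * K := by rw [hK']; ring
    rw [h8] at hM2
    have h2 := mul_le_mul_of_nonneg_left hM2 hA1.le
    set Y := (8 * 27 * 4 * Z' * K) ^ (4 * (1 - α))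
    have hY : 0 ≤ Y := by positivity
    have : 0 ≤ (A 1).re * Y := by positivity
    nlinarith
  · rw [mem_sphere_iff_norm] at hs
    have hs1 : s ≠ 1 := by rintro rfl; norm_num at hs
    have hsb : s ∈ Metric.closedBall (2 : ℂ) (3 / 2) := by
      rw [mem_closedBall_iff_norm, hs]
    have hre : 1 / 2 ≤ s.re := by
      have := (Complex.abs_re_le_norm (s - 2)); rw [hs] at this
      have := (abs_le.1 this).1; simp at this; linarith
    have hn : ‖s‖ < 4 := by
      have : ‖s‖ ≤ ‖s - 2‖ + ‖(2 : ℂ)‖ := by simpa using norm_add_le (s - 2) 2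
      rw [hs] at this; norm_num at this; linarith
    have hn1 : 1 / 2 ≤ ‖s - 1‖ := by
      have := norm_sub_norm_le (s - 2) (-1)
      rw [hs] at this; norm_num at this
      have h : s - 2 + 1 = s - 1 := by ring
      rw [h] at this; linarith
    rw [dslope_of_ne _ hs1, slope_def_module, smul_eq_mul, norm_mul, norm_inv, zetaOne_one, one_mul]
    have hA1 := hK 1 (by norm_num) (by norm_num)
    have hAs := hK s (by linarith) hn
    have hzs : ‖zetaOne s‖ ≤ Z' := (hZ s hsb).trans (le_max_left _ _)
    have h1 : ‖zetaOne s * A s - A 1‖ ≤ Z' * K + K := by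
      refine (norm_sub_le _ _).trans (add_le_add ?_ hA1)
      rw [norm_mul]; gcongr
    have h2 : ‖s - 1‖⁻¹ ≤ 2 := by
      rw [inv_le_comm₀ (by linarith) (by norm_num)]; linarith
    calc ‖s - 1‖⁻¹ * ‖zetaOne s * A s - A 1‖ ≤ 2 * (Z' * K + K) := by gcongr
      _ ≤ K' := by rw [hK']; nlinarith
  · suffices h : ∃ u : ℝ, 0 ≤ u ∧
        (-1) ^ m * iteratedDeriv m (fun s => (zetaOne s * A s) / (s - 1)) 2 = u by
      obtain ⟨u, hu0, hu⟩ := h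
      rw [hu]; simpa using hu0
    refine iteratedDeriv_nonneg_of_logDeriv hp ?_ ?_ ?_ ?_ m
    · refine LSeries.abscissaOfAbsConv_le_of_forall_lt_LSeriesSummable fun y hy => ?_
      exact (hP y (by simpa using hy)).1
    · intro s hs
      exact ((hdζ s hs).congr_of_eventuallyEq (hev s hs)).differentiableWithinAt
    · intro s hs
      have hw1 : s ≠ 1 := by rintro rfl; simp at hs
      have h0 : zetaOne s * A s / (s - 1) = riemannZeta s * A s := (hev s hs).self_of_nhds
      rw [(hev s hs).deriv_eq, h0, (hP s hs).2,
        ArithmeticFunction.LSeries_vonMangoldt_eq_deriv_riemannZeta_div hs,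
        deriv_fun_mul (differentiableAt_riemannZeta hw1) (hA s), hd s hs]
      have := riemannZeta_ne_zero_of_one_lt_re hs
      field_simp; ring
    · refine ⟨z * r, by positivity, ?_⟩
      rw [hz, hA2]; push_cast; norm_num
  · rw [hz, hA2, ← Complex.ofReal_mul, Complex.ofReal_re]; nlinarith

theorem quadratic_re {q : ℕ} {χ : DirichletCharacter ℂ q} (hχ : χ ^ 2 = 1) (a : ZMod q) :
    χ a = ((χ a).re : ℂ) ∧ -1 ≤ (χ a).re ∧ (χ a).re ≤ 1 := by
  rcases MulChar.isQuadratic_iff_sq_eq_one.2 hχ a with h | h | h <;> rw [h] <;> norm_num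

theorem LFunction_two_of_quadratic {q : ℕ} [NeZero q] {χ : DirichletCharacter ℂ q}
    (hχ : χ ^ 2 = 1) (hχ1 : χ ≠ 1) : ∃ r : ℝ, 1 / 3 ≤ r ∧ χ.LFunction 2 = r := by
  have him : (χ.LFunction 2).im = 0 := by
    have := LFunction_im_eq_zero hχ1 (fun a => by rw [(quadratic_re hχ a).1]; simp) (σ := 2)
      (by norm_num) (by norm_num)
    simpa using this
  refine ⟨(χ.LFunction 2).re, ?_, by apply Complex.ext <;> simp [him]⟩
  rw [DirichletCharacter.LFunction_eq_LSeries χ (by norm_num)]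
  have h2 := Complex.hasSum_re (hasSum_iteratedDeriv_LSeries (s := 2) (by norm_num)
    (abscissa_lt_of_norm_le_one (f := fun n => χ n) (fun n => χ.norm_le_one _) (by norm_num)) 0)
  simp only [pow_zero, iteratedDeriv_zero, one_mul] at h2
  have h3 := h2.add hasSum_zeta_two
  have ht : ∀ n : ℕ, ((χ n) * logCpow 0 2 n).re = (χ n).re * (1 / (n : ℝ) ^ 2) := by
    intro n
    have : logCpow 0 2 n = ((1 / (n : ℝ) ^ 2 : ℝ) : ℂ) := by
      rw [logCpow, Complex.cpow_neg]; simp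
    rw [this, Complex.re_mul_ofReal]
  have h4 : (2 : ℝ) ≤ (LSeries (fun n => χ n) 2).re + Real.pi ^ 2 / 6 := by
    refine le_trans (le_of_eq ?_) (sum_le_hasSum {1} (fun n _ => ?_) h3)
    · rw [sum_singleton, ht]; norm_num
    · rw [ht]
      have := (quadratic_re hχ (n : ZMod q)).2.1
      have h5 : 0 ≤ 1 / (n : ℝ) ^ 2 := by positivity
      nlinarith
  have := Real.pi_lt_d2
  have := Real.pi_pos
  nlinarith

/-- `A` is a finite product of `L`-functions, `a` the coefficients of `-A'/A`. -/
structure LogDerivData (A : ℂ → ℂ) (a : ℕ → ℝ) (b K : ℝ) : Prop where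
  diff : Differentiable ℂ A
  summable : ∀ s : ℂ, 1 < s.re → LSeriesSummable (fun n => (a n : ℂ)) s
  deriv_eq : ∀ s : ℂ, 1 < s.re → deriv A s = -(LSeries (fun n => (a n : ℂ)) s * A s)
  two : ∃ r : ℝ, b ≤ r ∧ A 2 = r
  bound : ∀ s : ℂ, 1 / 4 < s.re → ‖s‖ < 4 → ‖A s‖ ≤ K

theorem LogDerivData.mul {A A' : ℂ → ℂ} {a a' : ℕ → ℝ} {b b' K K' : ℝ} (h : LogDerivData A a b K)
    (h' : LogDerivData A' a' b' K') (hb : 0 ≤ b) (hb' : 0 ≤ b') (hK : 0 ≤ K) :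
    LogDerivData (fun s => A s * A' s) (fun n => a n + a' n) (b * b') (K * K') where
  diff := h.diff.mul h'.diff
  summable s hs := by
    have := (h.summable s hs).add (h'.summable s hs)
    convert this using 2
    simp
  deriv_eq s hs := by
    have : (fun n => ((a n + a' n : ℝ) : ℂ)) = (fun n => (a n : ℂ)) + fun n => (a' n : ℂ) := by
      funext n; simp
    rw [this, LSeries_add (h.summable s hs) (h'.summable s hs),
      deriv_fun_mul (h.diff s) (h'.diff s), h.deriv_eq s hs, h'.deriv_eq s hs]
    ring
  two := by
    obtain ⟨r, hr, hA⟩ := h.two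
    obtain ⟨r', hr', hA'⟩ := h'.two
    exact ⟨r * r', mul_le_mul hr hr' hb' (hb.trans hr), by rw [hA, hA']; push_cast; rfl⟩
  bound s hs hs' := by
    rw [norm_mul]
    exact mul_le_mul (h.bound s hs hs') (h'.bound s hs hs') (norm_nonneg _) hK

theorem logDerivData_LFunction {C : ℝ} (hC : ∀ (q : ℕ) [NeZero q]
    (χ : DirichletCharacter ℂ q), χ ≠ 1 → ∀ s : ℂ, 1 / 4 < s.re → ‖s‖ < 4 →
    ‖χ.LFunction s‖ ≤ C * q) {q : ℕ} [NeZero q] {χ : DirichletCharacter ℂ q} (hχ : χ ^ 2 = 1)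
    (hχ1 : χ ≠ 1) : LogDerivData χ.LFunction
      (fun n => (χ n).re * ArithmeticFunction.vonMangoldt n) (1 / 3) (C * q) := by
  have he : (fun n : ℕ => (((χ n).re * ArithmeticFunction.vonMangoldt n : ℝ) : ℂ)) =
      (fun n : ℕ => χ n) * fun n => (ArithmeticFunction.vonMangoldt n : ℂ) := by
    funext n
    rw [Complex.ofReal_mul, ← (quadratic_re hχ (n : ZMod q)).1]; rfl
  refine ⟨DirichletCharacter.differentiable_LFunction hχ1, fun s hs => ?_, fun s hs => ?_,
    LFunction_two_of_quadratic hχ hχ1, hC q χ hχ1⟩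
  · rw [he]; exact DirichletCharacter.LSeriesSummable_twist_vonMangoldt χ hs
  · rw [he, DirichletCharacter.LSeries_twist_vonMangoldt_eq χ hs,
      DirichletCharacter.deriv_LFunction_eq_deriv_LSeries χ hs,
      DirichletCharacter.LFunction_eq_LSeries χ hs]
    have := DirichletCharacter.LSeries_ne_zero_of_one_lt_re χ hs
    field_simp

open Filter Topology in
theorem exists_norm_LFunction_one_le {ε : ℝ} (hε : 0 < ε) : ∃ C : ℝ, 0 < C ∧ ∀ (q : ℕ) [NeZero q]
    (χ : DirichletCharacter ℂ q), χ ≠ 1 → ‖χ.LFunction 1‖ ≤ C * (q : ℝ) ^ ε := by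
  obtain ⟨C, hC, h⟩ := norm_iteratedDeriv_LSeries_le 0 hε
  refine ⟨C * 2 ^ ε, by positivity, fun q _ χ hχ => ?_⟩
  have hq : (1 : ℝ) ≤ q := by exact_mod_cast Nat.pos_of_ne_zero (NeZero.ne q)
  have hc : Tendsto (fun σ : ℝ => ‖χ.LFunction (σ : ℂ)‖) (𝓝[>] 1) (𝓝 ‖χ.LFunction 1‖) := by
    have h1 : Continuous fun σ : ℝ => ‖χ.LFunction (σ : ℂ)‖ :=
      ((DirichletCharacter.differentiable_LFunction hχ).continuous.comp Complex.continuous_ofReal).norm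
    simpa using (h1.tendsto 1).mono_left nhdsWithin_le_nhds
  refine le_of_tendsto hc ?_
  filter_upwards [Ioc_mem_nhdsGT (show (1 : ℝ) < 2 by norm_num)] with σ hσ
  have hσ1 : 1 < (σ : ℂ).re := by simpa using hσ.1
  have := h (fun n => χ n) q (σ : ℂ) hq (fun n => χ.norm_le_one _) (norm_sum_range_char_le hχ) hσ1
    (by simpa using hσ.2)
  rw [iteratedDeriv_zero, ← DirichletCharacter.LFunction_eq_LSeries χ hσ1] at this
  refine this.trans (le_of_eq ?_)
  rw [Complex.ofReal_im, abs_zero, zero_add, Real.mul_rpow (by linarith) (by norm_num)]; ring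

theorem LFunction_re_pos_of_ne_zero {q : ℕ} [NeZero q] {χ : DirichletCharacter ℂ q}
    (hχ : χ ^ 2 = 1) (hχ1 : χ ≠ 1) {α : ℝ} (hα : 7 / 8 ≤ α) (hα1 : α < 1)
    (h : ∀ β : ℝ, α ≤ β → β < 1 → χ.LFunction (β : ℂ) ≠ 0) : 0 < (χ.LFunction (α : ℂ)).re := by
  have him : ∀ σ : ℝ, 1 / 4 < σ → σ < 4 → (χ.LFunction (σ : ℂ)).im = 0 := fun σ h1 h2 =>
    LFunction_im_eq_zero hχ1 (fun a => by rw [(quadratic_re hχ a).1]; simp) h1 h2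
  have hcont : Continuous fun σ : ℝ => (χ.LFunction (σ : ℂ)).re :=
    Complex.continuous_re.comp
      ((DirichletCharacter.differentiable_LFunction hχ1).continuous.comp Complex.continuous_ofReal)
  by_contra hneg
  obtain ⟨r, hr, h2⟩ := LFunction_two_of_quadratic hχ hχ1
  obtain ⟨β, ⟨hβ1, hβ2⟩, hβ⟩ := intermediate_value_Icc (by linarith : α ≤ 2) hcont.continuousOn
    (show (0 : ℝ) ∈ Set.Icc _ _ from ⟨not_lt.1 hneg, by
      simp only [Complex.ofReal_ofNat, h2, Complex.ofReal_re]; linarith⟩)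
  have hz : χ.LFunction (β : ℂ) = 0 :=
    Complex.ext hβ (him β (by linarith) (by linarith))
  rcases lt_or_ge β 1 with hb | hb
  · exact h β hβ1 hb hz
  · exact DirichletCharacter.LFunction_ne_zero_of_one_le_re (s := (β : ℂ)) χ (.inl hχ1) (by simpa using hb) hz

theorem exists_product_character {q₁ q₂ : ℕ} [NeZero q₁] [NeZero q₂] (χ₁ : DirichletCharacter ℂ q₁)
    (χ₂ : DirichletCharacter ℂ q₂) (h₁ : χ₁.IsPrimitive) (h₂ : χ₂.IsPrimitive) (hne : q₁ ≠ q₂)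
    (hs₁ : χ₁ ^ 2 = 1) (hs₂ : χ₂ ^ 2 = 1) :
    ∃ χ : DirichletCharacter ℂ (q₁ * q₂), χ ≠ 1 ∧ χ ^ 2 = 1 ∧
      ∀ n : ℕ, χ n = χ₁ n * χ₂ n := by
  refine ⟨χ₁.changeLevel (dvd_mul_right q₁ q₂) * χ₂.changeLevel (dvd_mul_left q₂ q₁), ?_, ?_, ?_⟩
  · intro h
    have h3 := eq_inv_of_mul_eq_one_left h
    have h4 := congrArg DirichletCharacter.conductor h3
    rw [DirichletCharacter.conductor_inv, DirichletCharacter.conductor_changeLevel,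
      DirichletCharacter.conductor_changeLevel, h₁, h₂] at h4
    exact hne h4
  · rw [mul_pow, ← map_pow, ← map_pow, hs₁, hs₂, map_one, map_one, one_mul]
  · intro n
    rw [MulChar.mul_apply]
    by_cases hn : IsCoprime (n : ℤ) ((q₁ * q₂ : ℕ) : ℤ)
    · have e1 := χ₁.changeLevel_eq_cast_of_dvd' (dvd_mul_right q₁ q₂) hn
      have e2 := χ₂.changeLevel_eq_cast_of_dvd' (dvd_mul_left q₂ q₁) hn
      simp only [Int.cast_natCast] at e1 e2
      rw [e1, e2]
    · have z1 := ((χ₁.changeLevel (dvd_mul_right q₁ q₂)).apply_eq_zero_iff n).2 hn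
      simp only [Int.cast_natCast] at z1
      rw [z1, zero_mul]
      push_cast at hn
      rw [IsCoprime.mul_right_iff, not_and_or] at hn
      rcases hn with hn | hn
      · have := (χ₁.apply_eq_zero_iff n).2 hn
        simp only [Int.cast_natCast] at this
        rw [this, zero_mul]
      · have := (χ₂.apply_eq_zero_iff n).2 hn
        simp only [Int.cast_natCast] at this
        rw [this, mul_zero]

theorem siegel_aux : ∃ δ : ℝ, 0 < δ ∧ ∀ ε : ℝ, 0 < ε → ε < δ → ∃ c : ℝ, 0 < c ∧
    ∀ (q : ℕ) [NeZero q] (χ : DirichletCharacter ℂ q), χ.IsPrimitive → χ ^ 2 = 1 → χ ≠ 1 →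
      c ≤ ‖χ.LFunction 1‖ * (q : ℝ) ^ (9 * ε) := by
  obtain ⟨C, hC1, hC⟩ := exists_siegel_core
  obtain ⟨D, hD1, hD⟩ := exists_norm_LFunction_le
  have hz : ∀ᶠ α : ℝ in nhds 1, 0 < (zetaOne (α : ℂ)).re := by
    have hc : Continuous fun σ : ℝ => (zetaOne (σ : ℂ)).re :=
      Complex.continuous_re.comp (differentiable_zetaOne.continuous.comp Complex.continuous_ofReal)
    exact hc.continuousAt.eventually (lt_mem_nhds (by simp [zetaOne_one]))
  obtain ⟨δ, hδ, hzδ⟩ := Metric.eventually_nhds_iff.1 hz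
  refine ⟨min δ (1 / 8), by positivity, fun ε hε hεδ => ?_⟩
  have hε1 : ε < δ := hεδ.trans_le (min_le_left _ _)
  have hε2 : ε < 1 / 8 := hεδ.trans_le (min_le_right _ _)
  by_cases hcase : ∃ (q : ℕ) (_ : NeZero q) (χ : DirichletCharacter ℂ q), χ.IsPrimitive ∧ χ ^ 2 = 1 ∧
      χ ≠ 1 ∧ ∃ β : ℝ, 1 - ε ≤ β ∧ β < 1 ∧ χ.LFunction (β : ℂ) = 0
  · obtain ⟨q₁, _, χ₁, hp₁, hs₁, hn₁, β, hβ, hβ1, hβ0⟩ := hcase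
    obtain ⟨E, hE, hE1⟩ := exists_norm_LFunction_one_le hε
    have hq₁ : (1 : ℝ) ≤ q₁ := by exact_mod_cast Nat.pos_of_ne_zero (NeZero.ne q₁)
    -- the characters of modulus `q₁`
    obtain ⟨c₀, hc₀, hc₀'⟩ : ∃ c : ℝ, 0 < c ∧ ∀ χ : DirichletCharacter ℂ q₁, χ ≠ 1 →
        c ≤ ‖χ.LFunction 1‖ := by
      classical
      set S := (Finset.univ.filter fun χ : DirichletCharacter ℂ q₁ => χ ≠ 1)
      have hSne : S.Nonempty := ⟨χ₁, by simp [S, hn₁]⟩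
      obtain ⟨χm, hm, hmin⟩ := S.exists_min_image (fun χ => ‖χ.LFunction 1‖) hSne
      refine ⟨‖χm.LFunction 1‖, norm_pos_iff.2
        (DirichletCharacter.LFunction_apply_one_ne_zero (by simpa [S] using hm)), fun χ hχ => ?_⟩
      exact hmin χ (by simp [S, hχ])
    set W := C * (‖χ₁.LFunction 1‖ * (E * (q₁ : ℝ) ^ ε)) * (C * (D ^ 3 * (q₁:ℝ) ^ 2)) ^ (4 * (1 - β)) with hW
    have hW0 : 0 < W := by
      have := norm_pos_iff.2 (DirichletCharacter.LFunction_apply_one_ne_zero hn₁)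
      positivity
    refine ⟨min c₀ ((1 - β) / W), lt_min hc₀ (div_pos (by linarith) hW0), ?_⟩
    intro q₂ _ χ₂ hp₂ hs₂ hn₂
    have hq₂ : (1 : ℝ) ≤ q₂ := by exact_mod_cast Nat.pos_of_ne_zero (NeZero.ne q₂)
    have hpow1 : 1 ≤ (q₂ : ℝ) ^ (9 * ε) := Real.one_le_rpow hq₂ (by linarith)
    rcases eq_or_ne q₁ q₂ with heq | hne
    · subst heq
      refine (min_le_left _ _).trans ?_
      have := hc₀' χ₂ hn₂
      nlinarith
    · refine (min_le_right _ _).trans ?_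
      rw [div_le_iff₀ hW0]
      obtain ⟨χ₃, hn₃, hs₃, hχ₃⟩ := exists_product_character χ₁ χ₂ hp₁ hp₂ hne hs₁ hs₂
      have d := ((logDerivData_LFunction hD hs₁ hn₁).mul (logDerivData_LFunction hD hs₂ hn₂)
        (by norm_num) (by norm_num) (by positivity)).mul (logDerivData_LFunction hD hs₃ hn₃)
        (by norm_num) (by norm_num) (by positivity)
      have h := hC _ _ (D * q₁ * (D * q₂) * (D * (q₁ * q₂ : ℕ))) β d.diff d.summable d.deriv_eq
        (fun n => ?_) (by convert d.two using 3; norm_num) ?_ d.bound (by linarith) hβ1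
        (by simp [hβ0])
      · refine h.trans ?_
        have h1 : (χ₁.LFunction 1 * χ₂.LFunction 1 * χ₃.LFunction 1).re ≤
            ‖χ₁.LFunction 1‖ * ‖χ₂.LFunction 1‖ * (E * (q₁ : ℝ) ^ ε * (q₂ : ℝ) ^ ε) := by
          refine (Complex.re_le_norm _).trans ?_
          rw [norm_mul, norm_mul]
          gcongr
          refine (hE1 _ χ₃ hn₃).trans (le_of_eq ?_)
          push_cast
          rw [Real.mul_rpow (by positivity) (by positivity)]; ring
        have h2 : (C * (D * q₁ * (D * q₂) * (D * (q₁ * q₂ : ℕ)))) ^ (4 * (1 - β)) ≤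
            (C * (D ^ 3 * (q₁:ℝ) ^ 2)) ^ (4 * (1 - β)) * (q₂ : ℝ) ^ (8 * ε) := by
          have : C * (D * q₁ * (D * q₂) * (D * (q₁ * q₂ : ℕ))) =
              (C * (D ^ 3 * (q₁:ℝ) ^ 2)) * (q₂ : ℝ) ^ (2 : ℝ) := by
            rw [Real.rpow_two]; push_cast; ring
          rw [this, Real.mul_rpow (by positivity) (by positivity), ← Real.rpow_mul (by linarith)]
          exact mul_le_mul_of_nonneg_left
            (Real.rpow_le_rpow_of_exponent_le hq₂ (by linarith)) (by positivity)
        have h3 : (q₂ : ℝ) ^ (9 * ε) = (q₂ : ℝ) ^ ε * (q₂ : ℝ) ^ (8 * ε) := by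
          rw [← Real.rpow_add (by linarith)]; ring_nf
        calc _ ≤ C * (‖χ₁.LFunction 1‖ * ‖χ₂.LFunction 1‖ * (E * (q₁ : ℝ) ^ ε * (q₂ : ℝ) ^ ε)) *
              ((C * (D ^ 3 * (q₁:ℝ) ^ 2)) ^ (4 * (1 - β)) * (q₂ : ℝ) ^ (8 * ε)) := by
              gcongr
          _ = _ := by rw [h3, hW]; ring
      · rw [hχ₃]
        have e1 := quadratic_re hs₁ (n : ZMod q₁)
        have e2 := quadratic_re hs₂ (n : ZMod q₂)
        have : (χ₁ n * χ₂ n).re = (χ₁ n).re * (χ₂ n).re := by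
          conv_lhs => rw [e1.1, e2.1]
          rw [← Complex.ofReal_mul, Complex.ofReal_re]
        rw [this]
        have hΛ := ArithmeticFunction.vonMangoldt_nonneg (n := n)
        have h1 : 0 ≤ 1 + (χ₁ n).re := by linarith
        have h2 : 0 ≤ 1 + (χ₂ n).re := by linarith
        have := mul_nonneg hΛ (mul_nonneg h1 h2)
        linarith
      · have : (1 : ℝ) ≤ (q₁ * q₂ : ℕ) := by push_cast; exact one_le_mul_of_one_le_of_one_le hq₁ hq₂
        exact one_le_mul_of_one_le_of_one_le (one_le_mul_of_one_le_of_one_le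
          (one_le_mul_of_one_le_of_one_le hD1 hq₁) (one_le_mul_of_one_le_of_one_le hD1 hq₂))
          (one_le_mul_of_one_le_of_one_le hD1 this)
  · push Not at hcase
    refine ⟨ε / (C * (C * D) ^ (4 * ε)), by positivity, ?_⟩
    intro q _ χ hp hs hn
    have hq : (1 : ℝ) ≤ q := by exact_mod_cast Nat.pos_of_ne_zero (NeZero.ne q)
    have d := logDerivData_LFunction hD hs hn
    have hpos := LFunction_re_pos_of_ne_zero hs hn (α := 1 - ε) (by linarith) (by linarith)
      (fun β h1 h2 => hcase q ‹_› χ hp hs hn β h1 h2)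
    have him : (χ.LFunction ((1 - ε : ℝ) : ℂ)).im = 0 :=
      LFunction_im_eq_zero hn (fun a => by rw [(quadratic_re hs a).1]; simp) (by linarith) (by linarith)
    have hzp := hzδ (y := 1 - ε) (by rw [Real.dist_eq, show 1 - ε - 1 = -ε by ring, abs_neg, abs_of_pos hε]; exact hε1)
    have h := hC _ _ (D * q) (1 - ε) d.diff d.summable d.deriv_eq
      (fun n => ?_) ?_ (one_le_mul_of_one_le_of_one_le hD1 hq) d.bound (by linarith) (by linarith) ?_
    · rw [div_le_iff₀ (by positivity)]
      have h0 : 1 - (1 - ε) = ε := by ring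
      rw [h0] at h
      refine h.trans ?_
      have h1 : (χ.LFunction 1).re ≤ ‖χ.LFunction 1‖ := Complex.re_le_norm _
      have h2 : (C * (D * q)) ^ (4 * ε) ≤ (C * D) ^ (4 * ε) * (q : ℝ) ^ (9 * ε) := by
        rw [← mul_assoc, Real.mul_rpow (by positivity) (by positivity)]
        exact mul_le_mul_of_nonneg_left
          (Real.rpow_le_rpow_of_exponent_le hq (by linarith)) (by positivity)
      calc _ ≤ C * ‖χ.LFunction 1‖ * ((C * D) ^ (4 * ε) * (q : ℝ) ^ (9 * ε)) := by gcongr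
        _ = _ := by ring
    · have e1 := quadratic_re hs (n : ZMod q)
      have hΛ := ArithmeticFunction.vonMangoldt_nonneg (n := n)
      nlinarith [e1.2.1]
    · obtain ⟨r, hr, h⟩ := d.two
      exact ⟨r, by linarith, h⟩
    · rw [Complex.mul_re, him, mul_zero, sub_zero]; positivity

/-- Siegel's lower bound for `L(1, χ)`, `χ` a real primitive character. -/
theorem siegel {ε : ℝ} (hε : 0 < ε) : ∃ c : ℝ, 0 < c ∧ ∀ (q : ℕ) [NeZero q]
    (χ : DirichletCharacter ℂ q), χ.IsPrimitive → χ ^ 2 = 1 → χ ≠ 1 →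
      c ≤ ‖χ.LFunction 1‖ * (q : ℝ) ^ ε := by
  obtain ⟨δ, hδ, h⟩ := siegel_aux
  obtain ⟨c, hc, h⟩ := h (min (ε / 9) (δ / 2)) (by positivity)
    ((min_le_right _ _).trans_lt (by linarith))
  refine ⟨c, hc, fun q _ χ hp hs hn => (h q χ hp hs hn).trans ?_⟩
  have hq : (1 : ℝ) ≤ q := by exact_mod_cast Nat.pos_of_ne_zero (NeZero.ne q)
  refine mul_le_mul_of_nonneg_left (Real.rpow_le_rpow_of_exponent_le hq ?_) (norm_nonneg _)
  have := min_le_left (ε / 9) (δ / 2)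
  linarith

theorem norm_LFunction_one_sub_le {q : ℕ} [NeZero q] {χ : DirichletCharacter ℂ q} (hχ : χ ≠ 1)
    {s : ℂ} {E : ℝ} (hs1 : 1 < s.re) (hs2 : s.re ≤ 2)
    (hE : ∀ w : ℂ, 1 < w.re → w.re ≤ 2 → |w.im| ≤ |s.im| →
      ‖iteratedDeriv 1 (LSeries (fun n => χ n)) w‖ ≤ E) :
    ‖χ.LFunction 1 - LSeries (fun n => χ n) s‖ ≤ E * ‖1 - s‖ := by
  set T : Set ℂ := Complex.re ⁻¹' Set.Ioc 1 2 ∩ Complex.im ⁻¹' Set.Icc (-|s.im|) |s.im| with hTdef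
  have hT : Convex ℝ T := ((convex_Ioc 1 2).is_linear_preimage Complex.reLm.isLinear).inter
    ((convex_Icc _ _).is_linear_preimage Complex.imLm.isLinear)
  have hsT : s ∈ T := ⟨⟨hs1, hs2⟩, neg_abs_le _, le_abs_self _⟩
  have key : ∀ δ : ℝ, 0 < δ → δ ≤ 1 → ‖χ.LFunction ((1 + δ : ℝ) : ℂ) - LSeries (fun n => χ n) s‖ ≤
      E * ‖((1 + δ : ℝ) : ℂ) - s‖ := by
    intro δ h0 h1
    rw [DirichletCharacter.LFunction_eq_LSeries _ (by simpa using h0)]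
    refine norm_LSeries_sub_le (T := T) (fun n => DirichletCharacter.norm_le_one _ _) hT
      (fun w hw => hw.1.1) (fun w hw => hE w hw.1.1 hw.1.2 (abs_le.2 hw.2)) hsT ?_
    refine ⟨⟨?_, ?_⟩, ?_, ?_⟩ <;> simp [h0]; linarith
  have hcont : Continuous fun δ : ℝ => ((1 + δ : ℝ) : ℂ) := by fun_prop
  have hL : Continuous χ.LFunction := (DirichletCharacter.differentiable_LFunction hχ).continuous
  have h1 : Filter.Tendsto (fun δ : ℝ => ‖χ.LFunction ((1 + δ : ℝ) : ℂ) - LSeries (fun n => χ n) s‖)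
      (nhdsWithin 0 (Set.Ioi 0)) (nhds ‖χ.LFunction 1 - LSeries (fun n => χ n) s‖) := by
    have : Continuous fun δ : ℝ => ‖χ.LFunction ((1 + δ : ℝ) : ℂ) - LSeries (fun n => χ n) s‖ :=
      ((hL.comp hcont).sub continuous_const).norm
    have := this.tendsto 0
    rw [add_zero, Complex.ofReal_one] at this
    exact this.mono_left nhdsWithin_le_nhds
  have h2 : Filter.Tendsto (fun δ : ℝ => E * ‖((1 + δ : ℝ) : ℂ) - s‖)
      (nhdsWithin 0 (Set.Ioi 0)) (nhds (E * ‖1 - s‖)) := by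
    have : Continuous fun δ : ℝ => E * ‖((1 + δ : ℝ) : ℂ) - s‖ :=
      continuous_const.mul (hcont.sub continuous_const).norm
    have := this.tendsto 0
    rw [add_zero, Complex.ofReal_one] at this
    exact this.mono_left nhdsWithin_le_nhds
  refine le_of_tendsto_of_tendsto h1 h2 ?_
  filter_upwards [Ioc_mem_nhdsGT (zero_lt_one' ℝ)] with δ hδ
  exact key δ hδ.1 hδ.2

/-- Lower bound for `L(s, χ)`, `χ` primitive and non-principal, to the right of the line `1`. -/
theorem one_le_mul_norm_LSeries {ε : ℝ} (hε : 0 < ε) (hε1 : ε ≤ 1) :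
    ∃ C : ℝ, 1 ≤ C ∧
    ∀ (q : ℕ) [NeZero q] (χ : DirichletCharacter ℂ q), χ.IsPrimitive → χ ≠ 1 →
      ∀ s : ℂ, 1 < s.re → s.re ≤ 2 →
      1 ≤ C * (q * (|s.im| + 2)) ^ ε * ‖LSeries (fun n => χ n) s‖ := by
  obtain ⟨C0, hC0, h0⟩ := one_le_mul_norm_LSeries_of_sq_ne_one hε hε1
  obtain ⟨C1, hC1, h1⟩ := one_le_mul_norm_LSeries_of_sq_eq_one (ε := ε / 3) (by positivity)
    (by linarith)
  obtain ⟨c, hc, hS⟩ := siegel (ε := ε / 3) (by positivity)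
  obtain ⟨E, hE, hD⟩ := norm_iteratedDeriv_LSeries_le 1 (ε := ε / 3) (by positivity)
  obtain ⟨K, hK, hKL⟩ := exists_norm_LSeries_le_div
  set C : ℝ := C0 + 2 / c + C1 * (1 + 4 * E / c) + K * (4 * E / c) with hC
  have p1 : 0 ≤ 2 / c := by positivity
  have p2 : 0 ≤ C1 * (1 + 4 * E / c) := by positivity
  have p3 : 0 ≤ K * (4 * E / c) := by positivity
  refine ⟨C, by linarith, fun q _ χ hp hχ s hs1 hs2 => ?_⟩
  have hq : (1 : ℝ) ≤ q := by exact_mod_cast Nat.pos_of_ne_zero (NeZero.ne q)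
  set X := (q : ℝ) * (|s.im| + 2) with hX
  have hX1 : 1 ≤ X := one_le_tau _
  set Y := X ^ (ε / 3) with hY
  have hY1 : 1 ≤ Y := Real.one_le_rpow hX1 (by linarith)
  have hXY : X ^ ε = Y ^ 3 := by
    rw [hY, ← Real.rpow_natCast, ← Real.rpow_mul (by linarith)]; norm_num
  set L := ‖LSeries (fun n => χ n) s‖ with hL
  have hL0 : 0 ≤ L := norm_nonneg _
  have final : ∀ D : ℝ, 0 ≤ D → D ≤ C → 1 ≤ D * Y ^ 3 * L → 1 ≤ C * X ^ ε * L := by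
    intro D hD hDC h
    rw [hXY]; exact h.trans (by gcongr)
  by_cases hsq : χ ^ 2 = 1
  swap
  · exact final C0 (by linarith) (by linarith) (by rw [← hXY]; exact h0 q χ hsq s hs1 hs2)
  have hY13 : Y ≤ Y ^ 3 := le_self_pow₀ hY1 (by norm_num)
  set d := c / (2 * E * Y ^ 2) with hd
  have hd0 : 0 < d := by positivity
  have hd1 : 2 / d = 4 * E / c * Y ^ 2 := by rw [hd]; field_simp; norm_num
  by_cases hnear : ‖1 - s‖ ≤ d
  · refine final (2 / c) p1 (by linarith) ?_
    have h2 : ‖χ.LFunction 1 - LSeries (fun n => χ n) s‖ ≤ (E * Y) * ‖1 - s‖ := by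
      refine norm_LFunction_one_sub_le hχ hs1 hs2 fun w hw1 hw2 hw3 => ?_
      refine (hD (fun n => χ n) q w hq (fun n => DirichletCharacter.norm_le_one _ _)
        (norm_sum_range_char_le hχ) hw1 hw2).trans ?_
      refine mul_le_mul_of_nonneg_left (Real.rpow_le_rpow (by positivity) ?_ (by positivity)) hE.le
      rw [hX]; gcongr
    have h3 := hS q χ hp hsq hχ
    have h4 : (q : ℝ) ^ (ε / 3) ≤ Y := by
      refine Real.rpow_le_rpow (by linarith) ?_ (by linarith)
      rw [hX]; nlinarith [abs_nonneg s.im]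
    have h5 : (E * Y) * ‖1 - s‖ ≤ c / (2 * Y) := by
      calc (E * Y) * ‖1 - s‖ ≤ (E * Y) * d := by gcongr
        _ = c / (2 * Y) := by rw [hd]; field_simp
    have h6 : ‖χ.LFunction 1‖ ≤ L + c / (2 * Y) := by
      have := norm_add_le (χ.LFunction 1 - LSeries (fun n => χ n) s) (LSeries (fun n => χ n) s)
      rw [sub_add_cancel] at this
      linarith
    have h7 : c ≤ (L + c / (2 * Y)) * Y := h3.trans (by gcongr)
    have h8 : (L + c / (2 * Y)) * Y = L * Y + c / 2 := by field_simp
    have h9 : c / 2 ≤ L * Y ^ 3 := by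
      have : L * Y ≤ L * Y ^ 3 := by gcongr
      linarith
    calc (1 : ℝ) = 2 / c * (c / 2) := by field_simp
      _ ≤ 2 / c * (L * Y ^ 3) := by gcongr
      _ = _ := by ring
  by_cases him : d / 2 ≤ |s.im|
  · refine final _ p2 (by linarith) ?_
    have hi : 0 < |s.im| := by linarith
    refine (h1 q χ hsq hχ s hs1 hs2 (abs_pos.1 hi)).trans ?_
    have h2 : 1 / |s.im| ≤ 2 / d := by
      rw [div_le_div_iff₀ hi hd0]; linarith
    calc C1 * Y * (1 + 1 / |s.im|) * L ≤ C1 * Y * (1 * Y ^ 2 + 4 * E / c * Y ^ 2) * L := by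
          gcongr
          · rw [one_mul]; exact one_le_pow₀ hY1
          · exact h2.trans hd1.le
      _ = _ := by ring
  · refine final _ p3 (by linarith) ?_
    push Not at hnear him
    have h2 : d / 2 ≤ s.re - 1 := by
      have := Complex.norm_le_abs_re_add_abs_im (1 - s)
      simp only [Complex.sub_re, Complex.one_re, Complex.sub_im, Complex.one_im, zero_sub,
        abs_neg] at this
      rw [abs_sub_comm, abs_of_pos (by linarith)] at this
      linarith
    have h3 := DirichletCharacter.LSeries.mul_mu_eq_one χ hs1
    have h4 := hKL ((fun n : ℕ => χ n) * fun n : ℕ => (ArithmeticFunction.moebius n : ℂ)) s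
      (fun n => ?_) hs1 hs2
    · have h5 : (1 : ℝ) ≤ L * (K / (s.re - 1)) := by
        have := congrArg norm h3
        rw [norm_mul, norm_one] at this
        exact this.symm.le.trans (mul_le_mul_of_nonneg_left h4 hL0)
      have h6 : K / (s.re - 1) ≤ K * (4 * E / c * Y ^ 2) := by
        rw [← hd1, div_eq_mul_one_div]
        refine mul_le_mul_of_nonneg_left ?_ (by linarith)
        rw [div_le_div_iff₀ (by linarith) hd0]; linarith
      calc (1 : ℝ) ≤ L * (K * (4 * E / c * Y ^ 2)) := h5.trans (by gcongr)
        _ ≤ L * (K * (4 * E / c * Y ^ 3)) := by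
            have : Y ^ 2 ≤ Y ^ 3 := pow_le_pow_right₀ hY1 (by norm_num)
            gcongr
        _ = _ := by ring
    · simp only [Pi.mul_apply, norm_mul]
      refine mul_le_one₀ (DirichletCharacter.norm_le_one _ _) (norm_nonneg _) ?_
      rw [Complex.norm_intCast]
      exact_mod_cast ArithmeticFunction.abs_moebius_le_one

theorem sum_choose_mul_le {n : ℕ} {a b : ℕ → ℂ} {A B : ℝ}
    (ha : ∀ i ≤ n, ‖a i‖ ≤ A) (hb : ∀ i ≤ n, ‖b i‖ ≤ B) :
    ‖∑ i ∈ range (n + 1), (n.choose i : ℂ) * a i * b (n - i)‖ ≤ 2 ^ n * (A * B) := by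
  have hA : 0 ≤ A := (norm_nonneg _).trans (ha 0 (Nat.zero_le _))
  calc _ ≤ ∑ i ∈ range (n + 1), (n.choose i : ℝ) * (A * B) := by
        refine norm_sum_le_of_le _ fun i hi => ?_
        have hi' : i ≤ n := by simpa [Nat.lt_succ_iff] using hi
        rw [norm_mul, norm_mul, Complex.norm_natCast, mul_assoc]
        have := ha i hi'
        have := hb (n - i) (Nat.sub_le _ _)
        gcongr
    _ = 2 ^ n * (A * B) := by
        rw [← sum_mul]
        congr 1
        exact_mod_cast Nat.sum_range_choose n

/-- Bounds for the derivatives of the reciprocal of an analytic function. -/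
theorem norm_iteratedDeriv_inv_le (k : ℕ) : ∃ c : ℝ, 1 ≤ c ∧ ∀ (f g : ℂ → ℂ) (s : ℂ) (X : ℝ),
    1 ≤ X → AnalyticAt ℂ f s → AnalyticAt ℂ g s → (∀ᶠ w in nhds s, f w * g w = 1) →
    (∀ j ≤ k, ‖iteratedDeriv j f s‖ ≤ X) → ‖g s‖ ≤ X →
    ∀ j ≤ k, ‖iteratedDeriv j g s‖ ≤ c * X ^ (2 * k + 1) := by
  induction k with
  | zero =>
    refine ⟨1, le_rfl, fun f g s X hX _ _ _ _ hg j hj => ?_⟩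
    obtain rfl : j = 0 := by omega
    simpa using hg
  | succ k ih =>
    obtain ⟨c, hc, h⟩ := ih
    refine ⟨2 ^ (k + 1) * c, one_le_mul_of_one_le_of_one_le (one_le_pow₀ (by norm_num)) hc, ?_⟩
    intro f g s X hX hf hg hfg hfX hgX j hj
    have hm := h f g s X hX hf hg hfg (fun j hj => hfX j (by omega)) hgX
    rcases Nat.lt_or_ge k j with hkj | hkj
    swap
    · refine (hm j hkj).trans ?_
      calc c * X ^ (2 * k + 1) = 1 * (c * X ^ (2 * k + 1)) := (one_mul _).symm
        _ ≤ 2 ^ (k + 1) * (c * X ^ (2 * (k + 1) + 1)) := by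
          have := pow_le_pow_right₀ hX (show 2 * k + 1 ≤ 2 * (k + 1) + 1 by omega)
          gcongr
          exact one_le_pow₀ (by norm_num)
        _ = _ := by ring
    obtain rfl : j = k + 1 := by omega
    have hL := iteratedDeriv_fun_mul (n := k + 1) hf.contDiffAt hg.contDiffAt
    have h0 : iteratedDeriv (k + 1) (fun w => f w * g w) s = 0 := by
      have : (fun w => f w * g w) =ᶠ[nhds s] fun _ => (1 : ℂ) := hfg
      rw [this.iteratedDeriv_eq]
      simp [iteratedDeriv_const]
    rw [h0, sum_range_succ'] at hL
    simp only [Nat.choose_zero_right, Nat.cast_one, one_mul, iteratedDeriv_zero, Nat.sub_zero,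
      Nat.reduceSubDiff] at hL
    have h1 : f s * g s = 1 := hfg.self_of_nhds
    have h2 : iteratedDeriv (k + 1) g s = -(g s * ∑ i ∈ range (k + 1),
        ((k + 1).choose (i + 1) : ℂ) * iteratedDeriv (i + 1) f s * iteratedDeriv (k - i) g s) := by
      linear_combination -g s * hL - iteratedDeriv (k + 1) g s * h1
    rw [h2, norm_neg, norm_mul]
    have h3 : ‖∑ i ∈ range (k + 1), ((k + 1).choose (i + 1) : ℂ) * iteratedDeriv (i + 1) f s *
        iteratedDeriv (k - i) g s‖ ≤ 2 ^ (k + 1) * (X * (c * X ^ (2 * k + 1))) := by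
      calc _ ≤ ∑ i ∈ range (k + 1), ((k + 1).choose (i + 1) : ℝ) * (X * (c * X ^ (2 * k + 1))) := by
            refine norm_sum_le_of_le _ fun i hi => ?_
            rw [norm_mul, norm_mul, Complex.norm_natCast, mul_assoc]
            have := hfX (i + 1) (by simp at hi; omega)
            have := hm (k - i) (Nat.sub_le _ _)
            gcongr
        _ ≤ _ := by
          rw [← sum_mul]
          gcongr
          have := Nat.sum_range_choose (k + 1)
          rw [sum_range_succ'] at this
          have h4 : ∑ i ∈ range (k + 1), (k + 1).choose (i + 1) ≤ 2 ^ (k + 1) := by omega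
          exact_mod_cast h4
    calc _ ≤ X * (2 ^ (k + 1) * (X * (c * X ^ (2 * k + 1)))) := by gcongr
      _ = _ := by ring

/-- Bounds for the derivatives of the logarithmic derivative of an analytic function. -/
theorem norm_iteratedDeriv_logDeriv_le (k : ℕ) : ∃ c : ℝ, 1 ≤ c ∧
    ∀ (f g : ℂ → ℂ) (s : ℂ) (X : ℝ),
    1 ≤ X → AnalyticAt ℂ f s → AnalyticAt ℂ g s → (∀ᶠ w in nhds s, f w * g w = 1) →
    (∀ j ≤ k + 1, ‖iteratedDeriv j f s‖ ≤ X) → ‖g s‖ ≤ X →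
    ‖iteratedDeriv k g s‖ ≤ c * X ^ (2 * k + 2) ∧
    ‖iteratedDeriv k (fun w => deriv f w * g w) s‖ ≤ c * X ^ (2 * k + 2) := by
  obtain ⟨c, hc, h⟩ := norm_iteratedDeriv_inv_le k
  refine ⟨2 ^ k * c, one_le_mul_of_one_le_of_one_le (one_le_pow₀ (by norm_num)) hc, ?_⟩
  intro f g s X hX hf hg hfg hfX hgX
  have hm := h f g s X hX hf hg hfg (fun j hj => hfX j (by omega)) hgX
  constructor
  · refine (hm k le_rfl).trans ?_
    calc c * X ^ (2 * k + 1) = 1 * (c * X ^ (2 * k + 1)) := (one_mul _).symm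
      _ ≤ 2 ^ k * (c * X ^ (2 * k + 2)) := by
        have := pow_le_pow_right₀ hX (show 2 * k + 1 ≤ 2 * k + 2 by omega)
        gcongr
        exact one_le_pow₀ (by norm_num)
      _ = _ := by ring
  · rw [iteratedDeriv_fun_mul (n := k) hf.deriv.contDiffAt hg.contDiffAt]
    simp only [← iteratedDeriv_succ']
    refine (sum_choose_mul_le (a := fun i => iteratedDeriv (i + 1) f s)
      (b := fun i => iteratedDeriv i g s) (fun i hi => hfX (i + 1) (by omega)) hm).trans
      (le_of_eq ?_)
    ring

theorem analyticAt_LSeries_of_norm_le_one {f : ℕ → ℂ} (hf : ∀ n, ‖f n‖ ≤ 1) {s : ℂ}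
    (hs : 1 < s.re) : AnalyticAt ℂ (LSeries f) s :=
  LSeries_analyticOnNhd f s (abscissa_lt_of_norm_le_one hf hs)

theorem eventually_one_lt_re {s : ℂ} (hs : 1 < s.re) : ∀ᶠ w : ℂ in nhds s, 1 < w.re :=
  (isOpen_lt continuous_const Complex.continuous_re).mem_nhds hs

theorem norm_moebius_le_one (n : ℕ) : ‖(ArithmeticFunction.moebius n : ℂ)‖ ≤ 1 := by
  rw [Complex.norm_intCast]
  exact_mod_cast ArithmeticFunction.abs_moebius_le_one

theorem norm_char_mul_moebius_le_one {q : ℕ} (χ : DirichletCharacter ℂ q) (n : ℕ) :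
    ‖((fun n : ℕ => χ n) * fun n : ℕ => (ArithmeticFunction.moebius n : ℂ)) n‖ ≤ 1 := by
  simp only [Pi.mul_apply, norm_mul]
  exact mul_le_one₀ (DirichletCharacter.norm_le_one _ _) (norm_nonneg _) (norm_moebius_le_one n)

theorem exists_bound_forall_le {p : ℕ → ℝ → Prop} (hp : ∀ k, ∃ C : ℝ, 0 < C ∧ p k C)
    (hmono : ∀ k C C', C ≤ C' → p k C → p k C') (n : ℕ) : ∃ C : ℝ, 1 ≤ C ∧ ∀ k ≤ n, p k C := by
  choose C hC h using hp
  refine ⟨1 + ∑ k ∈ range (n + 1), C k, ?_, fun k hk => hmono k (C k) _ ?_ (h k)⟩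
  · have := sum_nonneg fun k (_ : k ∈ range (n + 1)) => (hC k).le
    linarith
  · have := single_le_sum (fun k (_ : k ∈ range (n + 1)) => (hC k).le)
      (mem_range.2 (Nat.lt_succ_of_le hk))
    linarith

/-- Bounds for the derivatives of `L'/L(s, χ)` to the right of the line `1`. -/
theorem norm_iteratedDeriv_twist_vonMangoldt_le (k : ℕ) {ε : ℝ} (hε : 0 < ε) (hε1 : ε ≤ 1) :
    ∃ C : ℝ, 1 ≤ C ∧ ∀ (q : ℕ) [NeZero q] (χ : DirichletCharacter ℂ q), χ.IsPrimitive → χ ≠ 1 →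
      ∀ s : ℂ, 1 < s.re → s.re ≤ 2 →
      ‖iteratedDeriv k (LSeries ((fun n : ℕ => χ n) *
        fun n : ℕ => (ArithmeticFunction.vonMangoldt n : ℂ))) s‖ ≤
        C * (q * (|s.im| + 2)) ^ ε := by
  set ε' := ε / (2 * k + 2) with hε'
  have hk : (0 : ℝ) < 2 * k + 2 := by positivity
  have hε'0 : 0 < ε' := by positivity
  have hε'1 : ε' ≤ 1 := (div_le_self hε.le (by linarith)).trans hε1
  obtain ⟨C0, hC0, h0⟩ := one_le_mul_norm_LSeries hε'0 hε'1
  obtain ⟨C1, hC1, h1⟩ := exists_bound_forall_le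
    (fun k => norm_iteratedDeriv_LSeries_le k hε'0) (fun k C C' hCC h f B s h1 h2 h3 h4 h5 =>
      (h f B s h1 h2 h3 h4 h5).trans (by have := abs_nonneg s.im; gcongr)) (k + 1)
  obtain ⟨c, hc, h⟩ := norm_iteratedDeriv_logDeriv_le k
  have hm1 : 1 ≤ max C0 C1 := hC0.trans (le_max_left _ _)
  refine ⟨c * (max C0 C1) ^ (2 * k + 2), one_le_mul_of_one_le_of_one_le hc (one_le_pow₀ hm1), ?_⟩
  intro q _ χ hp hχ s hs1 hs2
  have hX := one_le_tau (q := q) s.im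
  set Y := ((q : ℝ) * (|s.im| + 2)) ^ ε' with hY
  have hY1 : 1 ≤ Y := Real.one_le_rpow hX hε'0.le
  have hq : (1 : ℝ) ≤ q := by exact_mod_cast Nat.pos_of_ne_zero (NeZero.ne q)
  set g : ℂ → ℂ := LSeries ((fun n : ℕ => χ n) * fun n : ℕ => (ArithmeticFunction.moebius n : ℂ))
  have hfg : ∀ w : ℂ, 1 < w.re → LSeries (fun n => χ n) w * g w = 1 := fun w hw =>
    DirichletCharacter.LSeries.mul_mu_eq_one χ hw
  have key := (h (LSeries fun n => χ n) g s (max C0 C1 * Y)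
    (one_le_mul_of_one_le_of_one_le hm1 hY1)
    (analyticAt_LSeries_of_norm_le_one (fun n => DirichletCharacter.norm_le_one _ _) hs1)
    (analyticAt_LSeries_of_norm_le_one (norm_char_mul_moebius_le_one χ) hs1)
    ((eventually_one_lt_re hs1).mono hfg) (fun j hj => ?_) ?_).2
  · have he : (LSeries ((fun n : ℕ => χ n) * fun n : ℕ => (ArithmeticFunction.vonMangoldt n : ℂ)))
        =ᶠ[nhds s] fun w => -(deriv (LSeries fun n => χ n) w * g w) := by
      filter_upwards [eventually_one_lt_re hs1] with w hw
      rw [DirichletCharacter.LSeries_twist_vonMangoldt_eq χ hw,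
        div_eq_iff (DirichletCharacter.LSeries_ne_zero_of_one_lt_re χ hw)]
      linear_combination deriv (LSeries fun n => χ n) w * hfg w hw
    rw [he.iteratedDeriv_eq, iteratedDeriv_fun_neg, norm_neg]
    refine key.trans (le_of_eq ?_)
    have : ((q : ℝ) * (|s.im| + 2)) ^ ε = Y ^ (2 * k + 2) := by
      rw [hY, ← Real.rpow_natCast, ← Real.rpow_mul (by linarith), hε']
      push_cast
      rw [div_mul_cancel₀ _ hk.ne']
    rw [this]; ring
  · refine (h1 j hj (fun n => χ n) q s hq (fun n => DirichletCharacter.norm_le_one _ _)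
        (norm_sum_range_char_le hχ) hs1 hs2).trans ?_
    gcongr
    exact le_max_right _ _
  · have h2 := h0 q χ hp hχ s hs1 hs2
    have h3 := congrArg norm (hfg s hs1)
    rw [norm_mul, norm_one] at h3
    calc ‖g s‖ ≤ (C0 * Y * ‖LSeries (fun n => χ n) s‖) * ‖g s‖ :=
          le_mul_of_one_le_left (norm_nonneg _) h2
      _ = C0 * Y := by rw [mul_assoc, h3, mul_one]
      _ ≤ _ := by gcongr; exact le_max_left _ _

theorem exists_norm_iteratedDeriv_le_of_compact {G : ℂ → ℂ} (hG : ∀ s : ℂ, 1 ≤ s.re → AnalyticAt ℂ G s)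
    (k : ℕ) : ∃ K : ℝ, 0 < K ∧ ∀ s : ℂ, 1 ≤ s.re → s.re ≤ 2 → |s.im| ≤ 1 →
      ‖iteratedDeriv k G s‖ ≤ K := by
  have hc : IsCompact (Set.Icc (1 : ℝ) 2 ×ℂ Set.Icc (-1 : ℝ) 1) :=
    isCompact_Icc.reProdIm isCompact_Icc
  obtain ⟨K, hK⟩ := hc.exists_bound_of_continuousOn (f := iteratedDeriv k G) fun s hs => by
    have hs1 : 1 ≤ s.re := hs.1.1
    rw [iteratedDeriv_eq_iterate]
    exact ((hG s hs1).iterated_deriv k).continuousAt.continuousWithinAt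
  refine ⟨|K| + 1, by positivity, fun s h1 h2 h3 => (hK s ⟨⟨h1, h2⟩, abs_le.1 h3⟩).trans ?_⟩
  linarith [le_abs_self K]

theorem LSeries_one_eq_zetaOne_div {s : ℂ} (hs : 1 < s.re) : LSeries 1 s = zetaOne s / (s - 1) := by
  have h1 : s ≠ 1 := by rintro rfl; simp at hs
  rw [LSeries_one_eq_riemannZeta hs, zetaOne_of_ne_one h1, mul_div_cancel_left₀ _ (sub_ne_zero.2 h1)]

theorem exists_bound_zeta_derivs (n : ℕ) {ε : ℝ} (hε : 0 < ε) (hε1 : ε ≤ 1) : ∃ C : ℝ, 1 ≤ C ∧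
    ∀ s : ℂ, 1 < s.re → s.re ≤ 2 → 1 ≤ |s.im| →
      (∀ j ≤ n, ‖iteratedDeriv j (LSeries 1) s‖ ≤ C * (|s.im| + 2) ^ ε) ∧
      ‖LSeries (fun n : ℕ => (ArithmeticFunction.moebius n : ℂ)) s‖ ≤ C * (|s.im| + 2) ^ ε := by
  obtain ⟨C0, hC0, h0⟩ := one_le_mul_norm_zeta hε hε1
  obtain ⟨C1, hC1, h1⟩ := exists_bound_forall_le
    (fun k => norm_iteratedDeriv_zeta_le k hε) (fun k C C' hCC h s h1 h2 h3 =>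
      (h s h1 h2 h3).trans (by have := abs_nonneg s.im; gcongr)) n
  refine ⟨max C0 C1, hC0.trans (le_max_left _ _), fun s hs1 hs2 hs3 => ⟨fun j hj => ?_, ?_⟩⟩
  · refine (h1 j hj s hs1 hs2 hs3).trans ?_
    gcongr
    exact le_max_right _ _
  · have h2 := h0 s hs1 hs2 hs3
    have h3 := congrArg norm (LSeries_one_mul_Lseries_moebius hs1)
    rw [norm_mul, norm_one] at h3
    set g := LSeries (fun n : ℕ => (ArithmeticFunction.moebius n : ℂ)) s
    calc ‖g‖ ≤ (C0 * (|s.im| + 2) ^ ε * ‖LSeries 1 s‖) * ‖g‖ :=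
          le_mul_of_one_le_left (norm_nonneg _) h2
      _ = C0 * (|s.im| + 2) ^ ε := by rw [mul_assoc, h3, mul_one]
      _ ≤ _ := by gcongr; exact le_max_left _ _

theorem one_le_two_add_abs_rpow (y : ℝ) {ε : ℝ} (hε : 0 ≤ ε) : 1 ≤ (|y| + 2) ^ ε :=
  Real.one_le_rpow (by linarith [abs_nonneg y]) hε

theorem exists_bound_zeta_logDeriv (k : ℕ) {ε : ℝ} (hε : 0 < ε) (hε1 : ε ≤ 1) : ∃ C : ℝ, 1 ≤ C ∧
    ∀ s : ℂ, 1 < s.re → s.re ≤ 2 → 1 ≤ |s.im| →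
      ‖iteratedDeriv k (LSeries (fun n : ℕ => (ArithmeticFunction.moebius n : ℂ))) s‖ ≤
        C * (|s.im| + 2) ^ ε ∧
      ‖iteratedDeriv k (fun w => deriv (LSeries 1) w *
        LSeries (fun n : ℕ => (ArithmeticFunction.moebius n : ℂ)) w) s‖ ≤ C * (|s.im| + 2) ^ ε ∧
      ‖iteratedDeriv k (LSeries 1) s‖ ≤ C * (|s.im| + 2) ^ ε := by
  set ε' := ε / (2 * k + 2) with hε'
  have hk : (0 : ℝ) < 2 * k + 2 := by positivity
  have hε'0 : 0 < ε' := by positivity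
  have hεε : ε' ≤ ε := div_le_self hε.le (by linarith)
  obtain ⟨C1, hC1, h1⟩ := exists_bound_zeta_derivs (k + 1) hε'0 (hεε.trans hε1)
  obtain ⟨c, hc, h⟩ := norm_iteratedDeriv_logDeriv_le k
  refine ⟨c * C1 ^ (2 * k + 2), one_le_mul_of_one_le_of_one_le hc (one_le_pow₀ hC1), ?_⟩
  intro s hs1 hs2 hs3
  obtain ⟨h2, h3⟩ := h1 s hs1 hs2 hs3
  set Y := (|s.im| + 2) ^ ε' with hY
  have hY1 : 1 ≤ Y := one_le_two_add_abs_rpow _ hε'0.le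
  have key := h (LSeries 1) (LSeries (fun n : ℕ => (ArithmeticFunction.moebius n : ℂ))) s (C1 * Y)
    (one_le_mul_of_one_le_of_one_le hC1 hY1)
    (analyticAt_LSeries_of_norm_le_one (fun n => by simp) hs1)
    (analyticAt_LSeries_of_norm_le_one norm_moebius_le_one hs1)
    ((eventually_one_lt_re hs1).mono fun w hw =>
      LSeries_one_mul_Lseries_moebius hw) h2 h3
  have hYε : (|s.im| + 2) ^ ε = Y ^ (2 * k + 2) := by
    rw [hY, ← Real.rpow_natCast, ← Real.rpow_mul (by positivity), hε']
    push_cast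
    rw [div_mul_cancel₀ _ hk.ne']
  have he : c * (C1 * Y) ^ (2 * k + 2) = c * C1 ^ (2 * k + 2) * (|s.im| + 2) ^ ε := by
    rw [hYε]; ring
  rw [he] at key
  refine ⟨key.1, key.2, (h2 k (by omega)).trans ?_⟩
  rw [← he]
  have h4 := one_le_mul_of_one_le_of_one_le hC1 hY1
  calc C1 * Y ≤ (C1 * Y) ^ (2 * k + 2) := le_self_pow₀ h4 (by omega)
    _ ≤ c * (C1 * Y) ^ (2 * k + 2) := le_mul_of_one_le_left (by positivity) hc

/-- Bounds for the derivatives of `1/ζ` to the right of the line `1`. -/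
theorem norm_iteratedDeriv_LSeries_moebius_le (k : ℕ) {ε : ℝ} (hε : 0 < ε) (hε1 : ε ≤ 1) :
    ∃ C : ℝ, 1 ≤ C ∧ ∀ s : ℂ, 1 < s.re → s.re ≤ 2 →
      ‖iteratedDeriv k (LSeries (fun n : ℕ => (ArithmeticFunction.moebius n : ℂ))) s‖ ≤
        C * (|s.im| + 2) ^ ε := by
  obtain ⟨C, hC, h⟩ := exists_bound_zeta_logDeriv k hε hε1
  obtain ⟨K, hK, hG⟩ := exists_norm_iteratedDeriv_le_of_compact (G := fun s => (s - 1) / zetaOne s)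
    (fun s hs => (analyticAt_id.sub analyticAt_const).div
      (differentiable_zetaOne.analyticAt s) (zetaOne_ne_zero hs)) k
  refine ⟨C + K, by linarith, fun s hs1 hs2 => ?_⟩
  have hY1 := one_le_two_add_abs_rpow s.im hε.le
  rcases le_total 1 |s.im| with h3 | h3
  · refine (h s hs1 hs2 h3).1.trans ?_
    gcongr; linarith
  · have he : LSeries (fun n : ℕ => (ArithmeticFunction.moebius n : ℂ)) =ᶠ[nhds s]
        fun s => (s - 1) / zetaOne s := by
      filter_upwards [eventually_one_lt_re hs1] with w hw
      have h5 := LSeries_one_mul_Lseries_moebius hw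
      have h6 := zetaOne_ne_zero hw.le
      rw [LSeries_one_eq_zetaOne_div hw] at h5
      have h7 : w - 1 ≠ 0 := by intro h; rw [h, div_zero, zero_mul] at h5; exact zero_ne_one h5
      field_simp at h5 ⊢
      linear_combination h5
    rw [he.iteratedDeriv_eq]
    refine (hG s hs1.le hs2 h3).trans ?_
    calc K ≤ (C + K) * 1 := by linarith
      _ ≤ _ := by gcongr

/-- Bounds for the derivatives of `-ζ'/ζ - ζ` to the right of the line `1`. -/
theorem norm_iteratedDeriv_LSeries_vonMangoldt_sub_le (k : ℕ) {ε : ℝ} (hε : 0 < ε) (hε1 : ε ≤ 1) :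
    ∃ C : ℝ, 1 ≤ C ∧ ∀ s : ℂ, 1 < s.re → s.re ≤ 2 →
      ‖iteratedDeriv k (LSeries (fun n : ℕ => (ArithmeticFunction.vonMangoldt n : ℂ) - 1)) s‖ ≤
        C * (|s.im| + 2) ^ ε := by
  obtain ⟨C, hC, h⟩ := exists_bound_zeta_logDeriv k hε hε1
  obtain ⟨K, hK, hG⟩ := exists_norm_iteratedDeriv_le_of_compact
    (G := fun s => -(deriv zetaOne s / zetaOne s) - dslope zetaOne 1 s)
    (fun s hs => (((differentiable_zetaOne.analyticAt s).deriv.div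
      (differentiable_zetaOne.analyticAt s) (zetaOne_ne_zero hs)).neg.sub
      (((Complex.differentiableOn_dslope Filter.univ_mem).2
        differentiable_zetaOne.differentiableOn).analyticAt Filter.univ_mem))) k
  refine ⟨2 * C + K, by linarith, fun s hs1 hs2 => ?_⟩
  have hY1 := one_le_two_add_abs_rpow s.im hε.le
  have hsub : ∀ w : ℂ, 1 < w.re →
      LSeries (fun n : ℕ => (ArithmeticFunction.vonMangoldt n : ℂ) - 1) w =
        -(deriv (LSeries 1) w * LSeries (fun n : ℕ => (ArithmeticFunction.moebius n : ℂ)) w) -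
          LSeries 1 w := fun w hw => by
    have h1 := LSeries_sub (ArithmeticFunction.LSeriesSummable_vonMangoldt hw)
      (LSeriesSummable_one_iff.2 hw)
    rw [ArithmeticFunction.LSeries_vonMangoldt_eq hw] at h1
    have h5 := LSeries_one_mul_Lseries_moebius hw
    have h6 := left_ne_zero_of_mul_eq_one h5
    have h7 : -deriv (LSeries 1) w / LSeries 1 w =
        -(deriv (LSeries 1) w * LSeries (fun n : ℕ => (ArithmeticFunction.moebius n : ℂ)) w) := by
      rw [div_eq_iff h6]
      linear_combination deriv (LSeries 1) w * h5
    rw [h7] at h1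
    exact h1
  rcases le_total 1 |s.im| with h3 | h3
  · have he : LSeries (fun n : ℕ => (ArithmeticFunction.vonMangoldt n : ℂ) - 1) =ᶠ[nhds s] fun w =>
        -(deriv (LSeries 1) w * LSeries (fun n : ℕ => (ArithmeticFunction.moebius n : ℂ)) w) -
          LSeries 1 w := by
      filter_upwards [eventually_one_lt_re hs1] with w hw using hsub w hw
    obtain ⟨-, h4, h5⟩ := h s hs1 hs2 h3
    have a1 : AnalyticAt ℂ (LSeries 1) s :=
      analyticAt_LSeries_of_norm_le_one (fun n => by simp) hs1
    have a2 := analyticAt_LSeries_of_norm_le_one norm_moebius_le_one hs1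
    have a3 : AnalyticAt ℂ (fun w => -(deriv (LSeries 1) w *
        LSeries (fun n : ℕ => (ArithmeticFunction.moebius n : ℂ)) w)) s := (a1.deriv.mul a2).neg
    rw [he.iteratedDeriv_eq, iteratedDeriv_fun_sub a3.contDiffAt a1.contDiffAt,
      iteratedDeriv_fun_neg]
    refine (norm_sub_le _ _).trans ?_
    rw [norm_neg]
    have : 0 ≤ K * (|s.im| + 2) ^ ε := by positivity
    linarith
  · have he : LSeries (fun n : ℕ => (ArithmeticFunction.vonMangoldt n : ℂ) - 1) =ᶠ[nhds s]
        fun s => -(deriv zetaOne s / zetaOne s) - dslope zetaOne 1 s := by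
      filter_upwards [eventually_one_lt_re hs1] with w hw
      have hw1 : w ≠ 1 := by rintro rfl; simp at hw
      have hw1' := sub_ne_zero.2 hw1
      have h6 := zetaOne_ne_zero hw.le
      have hd : deriv (LSeries 1) w = (deriv zetaOne w * (w - 1) - zetaOne w) / (w - 1) ^ 2 := by
        have he : LSeries 1 =ᶠ[nhds w] fun w => zetaOne w / (w - 1) := by
          filter_upwards [eventually_one_lt_re hw] with v hv using LSeries_one_eq_zetaOne_div hv
        rw [he.deriv_eq, deriv_fun_div (differentiable_zetaOne w) (by fun_prop) hw1']
        simp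
      have h5 := LSeries_one_mul_Lseries_moebius hw
      have h8 : LSeries (fun n : ℕ => (ArithmeticFunction.moebius n : ℂ)) w =
          (w - 1) / zetaOne w := by
        rw [LSeries_one_eq_zetaOne_div hw] at h5
        field_simp at h5 ⊢
        linear_combination h5
      rw [hsub w hw, hd, h8, LSeries_one_eq_zetaOne_div hw, dslope_of_ne _ hw1, slope_def_field,
        zetaOne_one]
      field_simp
      ring
    rw [he.iteratedDeriv_eq]
    refine (hG s hs1.le hs2 h3).trans ?_
    calc K ≤ (2 * C + K) * 1 := by linarith
      _ ≤ _ := by gcongr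

/-- The function `(1-t)₊` on the positive half-line. -/
noncomputable def rieszKernel (t : ℝ) : ℂ :=
  (Set.Ioc (0 : ℝ) 1).indicator (fun _ => 1) t -
    (Set.Ioc (0 : ℝ) 1).indicator (fun t : ℝ => (t : ℂ) ^ (1 : ℂ)) t

theorem rieszKernel_of_pos {t : ℝ} (ht : 0 < t) : rieszKernel t = ((max (1 - t) 0 : ℝ) : ℂ) := by
  rcases le_total t 1 with h | h
  · have hm : t ∈ Set.Ioc (0 : ℝ) 1 := ⟨ht, h⟩
    rw [rieszKernel, Set.indicator_of_mem hm, Set.indicator_of_mem hm,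
      max_eq_left (by linarith)]
    simp
  · rcases h.eq_or_lt with rfl | h'
    · have hm : (1 : ℝ) ∈ Set.Ioc (0 : ℝ) 1 := ⟨ht, le_rfl⟩
      rw [rieszKernel, Set.indicator_of_mem hm, Set.indicator_of_mem hm]
      simp
    · have : t ∉ Set.Ioc (0 : ℝ) 1 := fun h => absurd h.2 (not_le.2 h')
      rw [rieszKernel, Set.indicator_of_notMem this, Set.indicator_of_notMem this,
        max_eq_right (by linarith)]
      simp

theorem hasMellin_rieszKernel {s : ℂ} (hs : 0 < s.re) :
    HasMellin rieszKernel s (1 / s - 1 / (s + 1)) := by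
  have h1 := hasMellin_one_Ioc hs
  have h2 := hasMellin_cpow_Ioc 1 (s := s) (by simp; linarith)
  have := hasMellin_sub h1.1 h2.1
  rwa [h1.2, h2.2] at this

theorem norm_sq_one_add_le {s : ℂ} (hs : 1 ≤ s.re) :
    ‖1 / s - 1 / (s + 1)‖ ≤ (1 + s.im ^ 2)⁻¹ := by
  have h0 : s ≠ 0 := by rintro rfl; simp at hs; linarith
  have h1 : s + 1 ≠ 0 := by
    intro h
    have := congrArg Complex.re h
    simp at this; linarith
  have e : 1 / s - 1 / (s + 1) = (s * (s + 1))⁻¹ := by field_simp; ring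
  have hsq : ∀ w : ℂ, 1 ≤ w.re → w.im = s.im → Real.sqrt (1 + s.im ^ 2) ≤ ‖w‖ := by
    intro w hw hi
    rw [Complex.norm_eq_sqrt_sq_add_sq, hi]
    apply Real.sqrt_le_sqrt
    nlinarith
  have a1 := hsq s hs rfl
  have a2 := hsq (s + 1) (by simp; linarith) (by simp)
  rw [e, norm_inv, norm_mul]
  apply inv_anti₀ (by positivity)
  calc 1 + s.im ^ 2 = Real.sqrt (1 + s.im ^ 2) * Real.sqrt (1 + s.im ^ 2) :=
        (Real.mul_self_sqrt (by positivity)).symm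
    _ ≤ _ := by gcongr

open MeasureTheory in
theorem integrable_riesz_weight (c σ : ℝ) (hσ : 1 ≤ σ) (x : ℝ) (hx : 0 < x) :
    Integrable fun t : ℝ => (c : ℂ) * ((x : ℂ) ^ (-(σ + t * Complex.I)) *
      (1 / (σ + t * Complex.I) - 1 / (σ + t * Complex.I + 1))) := by
  have hint : Integrable fun t : ℝ => |c| * x ^ (-σ) * (1 + t ^ 2)⁻¹ :=
    integrable_inv_one_add_sq.const_mul _
  refine hint.mono' ?_ (Filter.Eventually.of_forall fun t => ?_)
  · refine Continuous.aestronglyMeasurable ?_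
    have h0 : ∀ t : ℝ, (σ : ℂ) + t * Complex.I ≠ 0 := fun t h => by
      have := congrArg Complex.re h
      simp at this; linarith
    have h1 : ∀ t : ℝ, (σ : ℂ) + t * Complex.I + 1 ≠ 0 := fun t h => by
      have := congrArg Complex.re h
      simp at this; linarith
    refine continuous_const.mul (Continuous.mul ?_ ?_)
    · exact Continuous.const_cpow (by fun_prop) (Or.inl (by exact_mod_cast hx.ne'))
    · exact (continuous_const.div (by fun_prop) h0).sub (continuous_const.div (by fun_prop) h1)
  · rw [norm_mul, norm_mul, Complex.norm_real, Real.norm_eq_abs, Complex.norm_cpow_eq_rpow_re_of_pos hx,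
      mul_assoc]
    have := norm_sq_one_add_le (s := σ + t * Complex.I) (by simpa using hσ)
    simp at this ⊢
    gcongr

open MeasureTheory in
theorem rieszKernel_eq_integral {σ : ℝ} (hσ : 1 ≤ σ) {x : ℝ} (hx : 0 < x) :
    ((max (1 - x) 0 : ℝ) : ℂ) = ((1 / (2 * Real.pi) : ℝ) : ℂ) *
      ∫ t : ℝ, (x : ℂ) ^ (-(σ + t * Complex.I)) *
        (1 / (σ + t * Complex.I) - 1 / (σ + t * Complex.I + 1)) := by
  have hm : ∀ t : ℝ, mellin rieszKernel (σ + t * Complex.I) =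
      1 / (σ + t * Complex.I) - 1 / (σ + t * Complex.I + 1) := fun t =>
    (hasMellin_rieszKernel (s := σ + t * Complex.I) (by simp; linarith)).2
  have := mellinInv_mellin_eq σ rieszKernel hx
    (hasMellin_rieszKernel (s := σ) (by simp; linarith)).1 ?_ ?_
  · rw [rieszKernel_of_pos hx] at this
    rw [← this, mellinInv]
    simp only [hm, smul_eq_mul, Complex.real_smul]
  · rw [Complex.VerticalIntegrable]
    simp only [hm]
    simpa using integrable_riesz_weight 1 σ hσ 1 one_pos
  · have : rieszKernel =ᶠ[nhds x] fun t => ((max (1 - t) 0 : ℝ) : ℂ) := by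
      filter_upwards [lt_mem_nhds hx] with t ht using rieszKernel_of_pos ht
    refine ContinuousAt.congr ?_ this.symm
    exact (by fun_prop : Continuous fun t : ℝ => ((max (1 - t) 0 : ℝ) : ℂ)).continuousAt

theorem sqrt_weight_le (t : ℝ) : (|t| + 2) ^ (1 / 2 : ℝ) * (1 + t ^ 2)⁻¹ ≤
    2 * (1 + ‖t‖ ^ 2) ^ (-(3 / 2) / 2 : ℝ) := by
  have h1 : (|t| + 2) ^ (1 / 2 : ℝ) ≤ 2 * (1 + t ^ 2) ^ (1 / 4 : ℝ) := by
    have : |t| + 2 ≤ (16 * (1 + t ^ 2)) ^ (1 / 2 : ℝ) := by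
      rw [← Real.sqrt_eq_rpow]
      apply Real.le_sqrt_of_sq_le
      nlinarith [sq_abs t, sq_nonneg (|t| - 1)]
    calc (|t| + 2) ^ (1 / 2 : ℝ) ≤ ((16 * (1 + t ^ 2)) ^ (1 / 2 : ℝ)) ^ (1 / 2 : ℝ) := by gcongr
      _ = 16 ^ (1 / 4 : ℝ) * (1 + t ^ 2) ^ (1 / 4 : ℝ) := by
        rw [← Real.rpow_mul (by positivity), Real.mul_rpow (by positivity) (by positivity)]
        norm_num
      _ = _ := by
        rw [show (16 : ℝ) = 2 ^ (4 : ℝ) by norm_num, ← Real.rpow_mul (by norm_num)]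
        norm_num
  calc _ ≤ 2 * (1 + t ^ 2) ^ (1 / 4 : ℝ) * (1 + t ^ 2)⁻¹ := by gcongr
    _ = _ := by
      rw [Real.norm_eq_abs, sq_abs, mul_assoc]
      have : (1 + t ^ 2)⁻¹ = (1 + t ^ 2) ^ (-1 : ℝ) := (Real.rpow_neg_one _).symm
      rw [this, ← Real.rpow_add (by positivity)]
      norm_num

open MeasureTheory in
theorem integrable_weight : Integrable fun t : ℝ => 2 * (1 + ‖t‖ ^ 2) ^ (-(3 / 2) / 2 : ℝ) :=
  (integrable_rpow_neg_one_add_norm_sq (E := ℝ) (μ := volume) (r := 3 / 2)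
    (by simp; norm_num)).const_mul 2

open MeasureTheory in
/-- Riesz means of a Dirichlet series bounded on a vertical line. -/
theorem exists_norm_riesz_le : ∃ I : ℝ, 0 < I ∧ ∀ (b : ℕ → ℂ) (F : ℂ → ℂ) (σ X x : ℝ),
    1 ≤ σ → 0 < x → b 0 = 0 →
    (∀ t : ℝ, HasSum (fun n : ℕ => b n * (n : ℂ) ^ (-(σ + t * Complex.I))) (F (σ + t * Complex.I))) →
    (∀ t : ℝ, ‖F (σ + t * Complex.I)‖ ≤ X * (|t| + 2) ^ (1 / 2 : ℝ)) →
    ‖∑ n ∈ range (⌊x⌋₊ + 1), b n * (1 - n / x)‖ ≤ I * X * x ^ σ := by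
  set J := ∫ t : ℝ, 2 * (1 + ‖t‖ ^ 2) ^ (-(3 / 2) / 2 : ℝ) with hJ
  have hJ0 : 0 ≤ J := integral_nonneg fun t => by positivity
  refine ⟨J + 1, by linarith, fun b F σ X x hσ hx hb hF hX => ?_⟩
  set W : ℝ → ℂ := fun t => 1 / (σ + t * Complex.I) - 1 / (σ + t * Complex.I + 1) with hW
  set G : ℕ → ℝ → ℂ := fun n t => b n * (((n / x : ℝ) : ℂ) ^ (-(σ + t * Complex.I)) * W t) with hG
  have hbt : ∀ (n : ℕ), n ≠ 0 → b n * ((max (1 - n / x) 0 : ℝ) : ℂ) =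
      ((1 / (2 * Real.pi) : ℝ) : ℂ) * ∫ t, G n t := by
    intro n hn
    have hnx : 0 < (n : ℝ) / x := by positivity
    rw [rieszKernel_eq_integral hσ hnx, hG]
    simp only
    rw [integral_const_mul]
    ring
  have hbt' : ∀ n : ℕ, b n * ((max (1 - n / x) 0 : ℝ) : ℂ) =
      ((1 / (2 * Real.pi) : ℝ) : ℂ) * ∫ t, G n t := by
    intro n
    rcases eq_or_ne n 0 with rfl | hn
    · simp [hG, hb]
    · exact hbt n hn
  have hsplit : ∀ (n : ℕ) (t : ℝ), G n t =
      (x : ℂ) ^ (σ + t * Complex.I) * W t * (b n * (n : ℂ) ^ (-(σ + t * Complex.I))) := by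
    intro n t
    rcases eq_or_ne n 0 with rfl | hn
    · simp [hG, hb]
    have hn' : (0 : ℝ) ≤ n := Nat.cast_nonneg n
    simp only [hG, div_eq_mul_inv]
    rw [Complex.ofReal_mul, Complex.mul_cpow_ofReal_nonneg hn' (inv_nonneg.2 hx.le),
      Complex.ofReal_inv, Complex.inv_cpow _ _ (by
        rw [Complex.arg_ofReal_of_nonneg hx.le]; exact Real.pi_pos.ne), Complex.cpow_neg (x : ℂ),
      inv_inv]
    push_cast
    ring
  have hnorm : ∀ (n : ℕ) (t : ℝ), ‖G n t‖ = ‖b n * (n : ℂ) ^ (-(σ : ℂ))‖ * (x ^ σ * ‖W t‖) := by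
    intro n t
    rcases eq_or_ne n 0 with rfl | hn
    · simp [hG, hb]
    have hn' : (0 : ℝ) < n := by positivity
    rw [hsplit, norm_mul, norm_mul, Complex.norm_cpow_eq_rpow_re_of_pos hx, norm_mul, norm_mul,
      ← Complex.ofReal_natCast, Complex.norm_cpow_eq_rpow_re_of_pos hn',
      Complex.norm_cpow_eq_rpow_re_of_pos hn']
    simp
    ring
  have hGint : ∀ n, Integrable (G n) := by
    intro n
    rcases eq_or_ne n 0 with rfl | hn
    · simp [hG, hb]
    have hnx : 0 < (n : ℝ) / x := by positivity
    have := integrable_riesz_weight 1 σ hσ _ hnx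
    simp only [Complex.ofReal_one, one_mul] at this
    exact this.const_mul (b n)
  have hsum : Summable fun n => ∫ t, ‖G n t‖ := by
    simp only [hnorm, integral_const_mul]
    refine Summable.mul_right _ ?_
    have := (hF 0).summable.norm
    simpa using this
  have hs := hasSum_integral_of_summable_integral_norm hGint hsum
  have hts : ∀ t : ℝ, ∑' n, G n t = (x : ℂ) ^ (σ + t * Complex.I) * W t * F (σ + t * Complex.I) := by
    intro t
    simp only [hsplit]
    exact ((hF t).mul_left _).tsum_eq
  simp only [hts] at hs
  have hfin : HasSum (fun n : ℕ => b n * ((max (1 - n / x) 0 : ℝ) : ℂ))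
      (∑ n ∈ range (⌊x⌋₊ + 1), b n * (1 - n / x)) := by
    have h1 : ∑ n ∈ range (⌊x⌋₊ + 1), b n * (1 - (n : ℂ) / x) =
        ∑ n ∈ range (⌊x⌋₊ + 1), b n * ((max (1 - n / x) 0 : ℝ) : ℂ) := by
      refine sum_congr rfl fun n hn => ?_
      have hn' : (n : ℝ) ≤ x := by
        have : n ≤ ⌊x⌋₊ := by simpa [Nat.lt_succ_iff] using hn
        exact (Nat.le_floor_iff hx.le).1 this
      rw [max_eq_left]
      · push_cast; ring
      · rw [sub_nonneg, div_le_one hx]; exact hn'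
    rw [h1]
    refine hasSum_sum_of_ne_finset_zero fun n hn => ?_
    have hn' : x < n := by
      have : ⌊x⌋₊ < n := by simpa [Nat.lt_succ_iff] using hn
      exact (Nat.floor_lt hx.le).1 this
    rw [max_eq_right]
    · simp
    · rw [sub_nonpos, one_le_div hx]; exact hn'.le
  have heq := hfin.unique (by simpa only [hbt'] using hs.mul_left _)
  rw [heq, norm_mul]
  have hX0 : 0 ≤ X := by
    have := (norm_nonneg _).trans (hX 0)
    by_contra h
    have h2 : X * (|0| + 2) ^ (1 / 2 : ℝ) < 0 := mul_neg_of_neg_of_pos (not_le.1 h) (by positivity)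
    linarith
  have hI : ‖∫ t : ℝ, (x : ℂ) ^ (σ + t * Complex.I) * W t * F (σ + t * Complex.I)‖ ≤
      x ^ σ * X * J := by
    rw [hJ, ← integral_const_mul]
    refine norm_integral_le_of_norm_le (integrable_weight.const_mul _)
      (Filter.Eventually.of_forall fun t => ?_)
    have hre : (σ + t * Complex.I : ℂ).re = σ := by simp
    rw [norm_mul, norm_mul, Complex.norm_cpow_eq_rpow_re_of_pos hx, hre]
    have h2 := norm_sq_one_add_le (s := σ + t * Complex.I) (by simpa using hσ)
    have h2im : (σ + t * Complex.I : ℂ).im = t := by simp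
    rw [h2im] at h2
    calc _ ≤ x ^ σ * (1 + t ^ 2)⁻¹ * (X * (|t| + 2) ^ (1 / 2 : ℝ)) := by
          have := hX t
          exact mul_le_mul (mul_le_mul_of_nonneg_left h2 (by positivity)) this
            (norm_nonneg _) (by positivity)
      _ = x ^ σ * X * ((|t| + 2) ^ (1 / 2 : ℝ) * (1 + t ^ 2)⁻¹) := by ring
      _ ≤ _ := mul_le_mul_of_nonneg_left (sqrt_weight_le t) (by positivity)
  have hpi : ‖((1 / (2 * Real.pi) : ℝ) : ℂ)‖ ≤ 1 := by
    rw [Complex.norm_real, Real.norm_of_nonneg (by positivity), div_le_one (by positivity)]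
    linarith [Real.pi_gt_three]
  calc _ ≤ 1 * (x ^ σ * X * J) := by gcongr
    _ ≤ (J + 1) * X * x ^ σ := by
      have : 0 ≤ X * x ^ σ := by positivity
      nlinarith

theorem rpow_one_add_inv_le {x : ℝ} (hx : 1 ≤ x) : x ^ (1 + 1 / (1 + Real.log x)) ≤ 3 * x := by
  have hl := Real.log_nonneg hx
  rw [Real.rpow_add (by linarith), Real.rpow_one, mul_comm]
  gcongr
  rw [Real.rpow_def_of_pos (by linarith)]
  have : Real.log x * (1 / (1 + Real.log x)) ≤ 1 := by
    rw [mul_one_div, div_le_one (by linarith)]; linarith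
  exact (Real.exp_le_exp.2 this).trans Real.exp_one_lt_three.le

/-- Sharp cut-off sums from bounds for the derivatives of a Dirichlet series, log weighted. -/
theorem exists_norm_sum_log_le (m : ℕ) (hm : 1 ≤ m) : ∃ C : ℝ, 1 ≤ C ∧ ∀ (a : ℕ → ℂ) (F : ℂ → ℂ) (X : ℝ),
    1 ≤ X → (∀ n, ‖a n‖ ≤ 1 + Real.log n) →
    (∀ s : ℂ, 1 < s.re → HasSum (fun n : ℕ => a n * logCpow (2 * m - 1) s n) (F s)) →
    (∀ s : ℂ, 1 < s.re → s.re ≤ 2 → ‖F s‖ ≤ X * (|s.im| + 2) ^ (1 / 2 : ℝ)) →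
    ∀ x : ℝ, 1 ≤ x → ‖∑ n ∈ range (⌊x⌋₊ + 1), a n * (Real.log n : ℂ) ^ (2 * m - 1)‖ ≤
      C * X * x * (1 + Real.log x) ^ m := by
  obtain ⟨I, hI, hR⟩ := exists_norm_riesz_le
  obtain ⟨D, hD, hlog⟩ := one_add_log_pow_le (2 * m) (δ := 1) one_pos
  refine ⟨15 * I + 2 ^ (2 * m) * (1 + D), by nlinarith [one_le_pow₀ (M₀ := ℝ) (n := 2 * m) one_le_two],
    fun a F X hX ha hF hFX x hx => ?_⟩
  set b : ℕ → ℂ := fun n => a n * (Real.log n : ℂ) ^ (2 * m - 1) with hb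
  have hb0 : b 0 = 0 := by
    have : 2 * m - 1 ≠ 0 := by omega
    simp [hb, this]
  have hbn : ∀ n, ‖b n‖ ≤ (1 + Real.log n) ^ (2 * m) := by
    intro n
    have hl := Real.log_natCast_nonneg n
    rw [hb, norm_mul, norm_pow, Complex.norm_real, Real.norm_of_nonneg hl]
    calc _ ≤ (1 + Real.log n) * (1 + Real.log n) ^ (2 * m - 1) := by
          gcongr
          · exact ha n
          · linarith
      _ = _ := by rw [← pow_succ']; congr 1; omega
  set T : ℝ → ℂ := fun x => ∑ n ∈ range (⌊x⌋₊ + 1), b n * (x - n) with hT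
  have hTx : ∀ x : ℝ, 1 ≤ x → ‖T x‖ ≤ 3 * I * X * x ^ 2 := by
    intro x hx
    have hl := Real.log_nonneg hx
    have h1 : 1 < 1 + 1 / (1 + Real.log x) := by
      have : 0 < 1 / (1 + Real.log x) := by positivity
      linarith
    have h2 : 1 + 1 / (1 + Real.log x) ≤ 2 := by
      have : 1 / (1 + Real.log x) ≤ 1 := by rw [div_le_one (by linarith)]; linarith
      linarith
    have hσx := rpow_one_add_inv_le hx
    generalize 1 + 1 / (1 + Real.log x) = σ at h1 h2 hσx
    have := hR b F σ X x h1.le (by linarith) hb0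
      (fun t => by
        have := hF (σ + t * Complex.I) (by simpa using h1)
        simpa only [hb, logCpow, mul_assoc, Complex.ofReal_natCast] using this)
      (fun t => by
        have := hFX (σ + t * Complex.I) (by simpa using h1) (by simpa using h2)
        simpa using this)
    have e : T x = x * ∑ n ∈ range (⌊x⌋₊ + 1), b n * (1 - n / x) := by
      have hx0 : (x : ℂ) ≠ 0 := by exact_mod_cast (by linarith : x ≠ 0)
      rw [hT, mul_sum]
      refine sum_congr rfl fun n _ => ?_
      field_simp
    rw [e, norm_mul, Complex.norm_real, Real.norm_of_nonneg (by linarith)]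
    calc _ ≤ x * (I * X * (3 * x)) := by
          gcongr
          exact this.trans (mul_le_mul_of_nonneg_left hσx (by positivity))
      _ = _ := by ring
  have hl := Real.log_nonneg hx
  set L := 1 + Real.log x with hL
  have hL1 : 1 ≤ L := by linarith
  set y := x / L ^ m with hy
  have hy0 : 0 < y := by positivity
  have hyx : y ≤ x := div_le_self (by linarith) (one_le_pow₀ hL1)
  have hdiff : (y : ℂ) * ∑ n ∈ range (⌊x⌋₊ + 1), b n = T (x + y) - T x -
      ∑ n ∈ Ico (⌊x⌋₊ + 1) (⌊x + y⌋₊ + 1), b n * ((x + y : ℝ) - n) := by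
    have hfl : ⌊x⌋₊ + 1 ≤ ⌊x + y⌋₊ + 1 := by
      have := Nat.floor_mono (show x ≤ x + y by linarith)
      omega
    have : T (x + y) = ∑ n ∈ range (⌊x⌋₊ + 1), b n * ((x + y : ℝ) - n) +
        ∑ n ∈ Ico (⌊x⌋₊ + 1) (⌊x + y⌋₊ + 1), b n * ((x + y : ℝ) - n) := by
      rw [sum_range_add_sum_Ico _ hfl]
    rw [this, hT, mul_sum, add_sub_right_comm, add_sub_cancel_right, ← sum_sub_distrib]
    refine sum_congr rfl fun n _ => ?_
    push_cast
    ring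
  have hrem : ‖∑ n ∈ Ico (⌊x⌋₊ + 1) (⌊x + y⌋₊ + 1), b n * ((x + y : ℝ) - n)‖ ≤
      (y + 1) * (2 ^ (2 * m) * L ^ (2 * m) * y) := by
    have hterm : ∀ n ∈ Ico (⌊x⌋₊ + 1) (⌊x + y⌋₊ + 1), ‖b n * ((x + y : ℝ) - n)‖ ≤
        2 ^ (2 * m) * L ^ (2 * m) * y := by
      intro n hn
      rw [mem_Ico] at hn
      have h1 : x < n := (Nat.lt_of_floor_lt hn.1)
      have h2 : (n : ℝ) ≤ x + y := (Nat.le_floor_iff (by linarith)).1 (by omega)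
      have e : ((x + y : ℝ) : ℂ) - n = ((x + y - n : ℝ) : ℂ) := by push_cast; ring
      rw [norm_mul, e, Complex.norm_real, Real.norm_of_nonneg (by linarith), ← mul_pow]
      have h3 : 1 + Real.log n ≤ 2 * L := by
        have : Real.log n ≤ Real.log (2 * x) := Real.log_le_log (by linarith) (by linarith)
        rw [Real.log_mul two_ne_zero (by linarith)] at this
        linarith [Real.log_two_lt_d9]
      refine mul_le_mul ((hbn n).trans (pow_le_pow_left₀ ?_ h3 _)) (by linarith) (by linarith)
        (by positivity)
      linarith [Real.log_natCast_nonneg n]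
    refine (norm_sum_le_of_le _ hterm).trans ?_
    rw [sum_const, nsmul_eq_mul, Nat.card_Ico]
    gcongr
    have h1 := Nat.floor_le (show 0 ≤ x + y by linarith)
    have h2 := Nat.lt_floor_add_one x
    have : ⌊x⌋₊ + 1 ≤ ⌊x + y⌋₊ + 1 := by
      have := Nat.floor_mono (show x ≤ x + y by linarith)
      omega
    rw [Nat.cast_sub this]
    push_cast
    linarith
  have hmain : y * ‖∑ n ∈ range (⌊x⌋₊ + 1), b n‖ ≤
      y * (15 * I * X * x * L ^ m + 2 ^ (2 * m) * (x * L ^ m + D * x)) := by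
    have e : y * ‖∑ n ∈ range (⌊x⌋₊ + 1), b n‖ = ‖(y : ℂ) * ∑ n ∈ range (⌊x⌋₊ + 1), b n‖ := by
      rw [norm_mul, Complex.norm_real, Real.norm_of_nonneg hy0.le]
    have hyL : y * L ^ m = x := by rw [hy]; field_simp
    have hlogx := hlog x hx
    rw [Real.rpow_one] at hlogx
    rw [e, hdiff]
    calc _ ≤ 3 * I * X * (x + y) ^ 2 + 3 * I * X * x ^ 2 + (y + 1) * (2 ^ (2 * m) * L ^ (2 * m) * y) :=
          (norm_sub_le _ _).trans (add_le_add ((norm_sub_le _ _).trans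
            (add_le_add (hTx _ (by linarith)) (hTx _ hx))) hrem)
      _ ≤ 3 * I * X * (2 * x) ^ 2 + 3 * I * X * x ^ 2 + (y + 1) * (2 ^ (2 * m) * L ^ (2 * m) * y) := by
          gcongr; linarith
      _ = 15 * I * X * x * (y * L ^ m) + y * (2 ^ (2 * m) * ((y * L ^ m) * L ^ m + L ^ (2 * m))) := by
          rw [show 3 * I * X * (2 * x) ^ 2 + 3 * I * X * x ^ 2 = 15 * I * X * x * x by ring, hyL,
            show 2 * m = m + m by ring, pow_add L]
          linear_combination 2 ^ (m + m) * y * L ^ m * hyL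
      _ ≤ 15 * I * X * x * (y * L ^ m) + y * (2 ^ (2 * m) * (x * L ^ m + D * x)) := by
          rw [hyL]; gcongr
      _ = _ := by ring
  refine (le_of_mul_le_mul_left hmain hy0).trans ?_
  have hLm : 1 ≤ L ^ m := one_le_pow₀ hL1
  have hx0 : 0 ≤ x := by linarith
  calc _ ≤ 15 * I * X * x * L ^ m + 2 ^ (2 * m) * (X * x * L ^ m + D * (X * x * L ^ m)) := by
        gcongr
        · exact le_mul_of_one_le_left hx0 hX
        · calc x ≤ X * x := le_mul_of_one_le_left hx0 hX
            _ ≤ _ := le_mul_of_one_le_right (by positivity) hLm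
    _ = _ := by ring

/-- Cancellation in the partial sums of the coefficients from bounds for the derivatives of a
Dirichlet series to the right of the line of absolute convergence. -/
theorem exists_norm_sum_le (j : ℕ) : ∃ C : ℝ, 1 ≤ C ∧ ∀ (a : ℕ → ℂ) (F : ℂ → ℂ) (X : ℝ),
    1 ≤ X → (∀ n, ‖a n‖ ≤ 1 + Real.log n) →
    (∀ s : ℂ, 1 < s.re → HasSum (fun n : ℕ => a n * logCpow (2 * j + 1) s n) (F s)) →
    (∀ s : ℂ, 1 < s.re → s.re ≤ 2 → ‖F s‖ ≤ X * (|s.im| + 2) ^ (1 / 2 : ℝ)) →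
    ∀ x : ℝ, 1 ≤ x → ‖∑ n ∈ range (⌊x⌋₊ + 1), a n‖ ≤ C * X * x / (1 + Real.log x) ^ j := by
  obtain ⟨C₀, hC₀, hS⟩ := exists_norm_sum_log_le (j + 1) (by omega)
  obtain ⟨D, hD, hlog⟩ := one_add_log_pow_le (j + 1) (δ := 1 / 2) (by norm_num)
  refine ⟨2 * D + 2 * C₀ * 4 ^ (2 * j + 1) + 8 * 2 ^ j, by
    nlinarith [one_le_pow₀ (M₀ := ℝ) (n := 2 * j + 1) (show (1 : ℝ) ≤ 4 by norm_num),
      one_le_pow₀ (M₀ := ℝ) (n := j) (show (1 : ℝ) ≤ 2 by norm_num)],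
    fun a F X hX ha hF hFX x hx => ?_⟩
  have hl := Real.log_nonneg hx
  set L := 1 + Real.log x with hL
  have hL1 : 1 ≤ L := by linarith
  have htriv : ∀ y : ℝ, 1 ≤ y → y ≤ x → ‖∑ n ∈ range (⌊y⌋₊ + 1), a n‖ ≤ 2 * y * L := by
    intro y hy hyx
    have : ∀ n ∈ range (⌊y⌋₊ + 1), ‖a n‖ ≤ L := by
      intro n hn
      refine (ha n).trans ?_
      rcases Nat.eq_zero_or_pos n with rfl | hn0
      · simp; linarith
      have : (n : ℝ) ≤ y := (Nat.le_floor_iff (by linarith)).1 (by simpa [Nat.lt_succ_iff] using hn)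
      have := Real.log_le_log (by exact_mod_cast hn0) (this.trans hyx)
      linarith
    refine (norm_sum_le_of_le _ this).trans ?_
    rw [sum_const, card_range, nsmul_eq_mul]
    gcongr
    push_cast
    linarith [Nat.floor_le (show 0 ≤ y by linarith)]
  have hx0 : 0 < x := by linarith
  rcases le_or_gt (Real.log x) 1 with hx1 | hx1
  · have hx3 : x ≤ 3 := by
      have := Real.exp_le_exp.2 hx1
      rw [Real.exp_log hx0] at this
      linarith [Real.exp_one_lt_three]
    refine (htriv x hx le_rfl).trans ?_
    rw [le_div_iff₀ (by positivity)]
    have hL2 : L ^ (j + 1) ≤ 2 ^ (j + 1) := pow_le_pow_left₀ (by linarith) (by linarith) _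
    calc 2 * x * L * L ^ j = 2 * x * L ^ (j + 1) := by ring
      _ ≤ 2 * x * 2 ^ (j + 1) := by gcongr
      _ = 4 * 2 ^ j * (1 * x) := by ring
      _ ≤ 4 * 2 ^ j * (X * x) := by gcongr
      _ ≤ _ := by
        rw [mul_assoc _ X x]
        refine mul_le_mul_of_nonneg_right ?_ (by positivity)
        have : 0 ≤ C₀ * 4 ^ (2 * j + 1) := by positivity
        have : (0 : ℝ) ≤ 2 ^ j := by positivity
        linarith
  set z := Real.sqrt x with hz
  have hz0 : 0 < z := Real.sqrt_pos.2 hx0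
  have hz1 : 1 ≤ z := Real.one_le_sqrt.2 hx
  have hzx : z ≤ x := by
    have : z * z = x := Real.mul_self_sqrt hx0.le
    nlinarith
  have hlz : Real.log z = Real.log x / 2 := Real.log_sqrt hx0.le
  set k := 2 * j + 1 with hk
  set f : ℕ → ℂ := fun n => if n < ⌊x⌋₊ + 1 then a n * (Real.log n : ℂ) ^ k else 0 with hf
  have hf' : ∀ N, ‖∑ n ∈ range N, f n‖ ≤ C₀ * X * x * L ^ (j + 1) := by
    intro N
    have e : ∑ n ∈ range N, f n =
        ∑ n ∈ range (min N (⌊x⌋₊ + 1)), a n * (Real.log n : ℂ) ^ k := by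
      rw [hf, ← sum_filter]
      congr 1
      ext n
      simp
    rw [e]
    rcases Nat.lt_or_ge (min N (⌊x⌋₊ + 1)) 2 with h2 | h2
    · have : ∑ n ∈ range (min N (⌊x⌋₊ + 1)), a n * (Real.log n : ℂ) ^ k = 0 := by
        refine sum_eq_zero fun n hn => ?_
        have : n = 0 := by have := mem_range.1 hn; omega
        simp [this, hk]
      rw [this, norm_zero]
      positivity
    · set v := min N (⌊x⌋₊ + 1) - 1 with hv
      have hv1 : 1 ≤ v := by omega
      have hvx : (v : ℝ) ≤ x := (Nat.le_floor_iff hx0.le).1 (by omega)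
      have := hS a F X hX ha (by simpa only [hk, show 2 * (j + 1) - 1 = 2 * j + 1 by omega] using hF)
        hFX v (by exact_mod_cast hv1)
      rw [Nat.floor_natCast, show v + 1 = min N (⌊x⌋₊ + 1) by omega,
        show 2 * (j + 1) - 1 = k by omega] at this
      refine this.trans ?_
      have hv0 : 0 ≤ Real.log v := Real.log_natCast_nonneg v
      have := Real.log_le_log (by positivity) hvx
      gcongr
      linarith
  set g : ℕ → ℝ := fun n => ((Real.log n) ^ k)⁻¹ with hg
  have hfl : ⌊z⌋₊ + 1 ≤ ⌊x⌋₊ + 1 := by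
    have := Nat.floor_mono hzx
    omega
  have hgpos : ∀ n, ⌊z⌋₊ + 1 ≤ n → 0 < Real.log n := fun n hn => by
    refine Real.log_pos (hz1.trans_lt (Nat.lt_of_floor_lt (by omega)))
  have hanti : ∀ n, ⌊z⌋₊ + 1 ≤ n → g (n + 1) ≤ g n := fun n hn => by
    have h0 := hgpos n hn
    have hn0 : (0 : ℝ) < n := by exact_mod_cast (by omega : 0 < n)
    simp only [hg]
    have := Real.log_le_log hn0 (show (n : ℝ) ≤ (n + 1 : ℕ) by push_cast; linarith)
    gcongr
  have hg0 : ∀ n, 0 ≤ g n := fun n => inv_nonneg.2 (pow_nonneg (Real.log_natCast_nonneg n) _)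
  have hparts := norm_sum_Ico_mul_le (f := f) (g := fun n => (g n : ℂ)) hf' hfl
  have hvar : ∑ n ∈ Ico (⌊z⌋₊ + 1) (⌊x⌋₊ + 1), ‖(g (n + 1) : ℂ) - g n‖ =
      g (⌊z⌋₊ + 1) - g (⌊x⌋₊ + 1) := by
    rw [← neg_sub, ← sum_Ico_sub _ hfl, ← sum_neg_distrib]
    refine sum_congr rfl fun n hn => ?_
    rw [← Complex.ofReal_sub, Complex.norm_real, Real.norm_eq_abs, abs_of_nonpos]
    have := hanti n (mem_Ico.1 hn).1
    linarith
  rw [hvar, Complex.norm_real, Complex.norm_real, Real.norm_of_nonneg (hg0 _),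
    Real.norm_of_nonneg (hg0 _)] at hparts
  have hgz : g (⌊z⌋₊ + 1) ≤ 4 ^ k / L ^ k := by
    have h1 : L / 4 ≤ Real.log (⌊z⌋₊ + 1 : ℕ) := by
      have := Real.log_le_log hz0 (show z ≤ (⌊z⌋₊ + 1 : ℕ) by
        push_cast; exact (Nat.lt_floor_add_one z).le)
      linarith
    calc g (⌊z⌋₊ + 1) ≤ ((L / 4) ^ k)⁻¹ := by simp only [hg]; gcongr
      _ = _ := by rw [div_pow, inv_div]
  have hsum : ∑ n ∈ range (⌊x⌋₊ + 1), a n = ∑ n ∈ range (⌊z⌋₊ + 1), a n +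
      ∑ n ∈ Ico (⌊z⌋₊ + 1) (⌊x⌋₊ + 1), f n * (g n : ℂ) := by
    rw [← sum_range_add_sum_Ico _ hfl]
    congr 1
    refine sum_congr rfl fun n hn => ?_
    have h0 : (Real.log n : ℂ) ≠ 0 := by exact_mod_cast (hgpos n (mem_Ico.1 hn).1).ne'
    simp only [hf, hg, if_pos (mem_Ico.1 hn).2]
    rw [Complex.ofReal_inv, Complex.ofReal_pow, mul_assoc, mul_inv_cancel₀ (pow_ne_zero _ h0),
      mul_one]
  have hzL : z * L ^ (j + 1) ≤ D * x := by
    calc z * L ^ (j + 1) ≤ z * (D * x ^ (1 / 2 : ℝ)) := by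
          gcongr
          exact hlog x hx
      _ = D * (z * z) := by rw [hz, Real.sqrt_eq_rpow]; ring
      _ = D * x := by rw [hz, Real.mul_self_sqrt hx0.le]
  rw [hsum, le_div_iff₀ (by positivity)]
  calc _ ≤ (2 * z * L + C₀ * X * x * L ^ (j + 1) * (2 * (4 ^ k / L ^ k))) * L ^ j := by
        refine mul_le_mul_of_nonneg_right ?_ (by positivity)
        refine (norm_add_le _ _).trans (add_le_add (htriv z hz1 hzx) (hparts.trans ?_))
        refine mul_le_mul_of_nonneg_left ?_ (by positivity)
        linarith
    _ = 2 * (z * L ^ (j + 1)) + 2 * C₀ * 4 ^ k * (X * x) * (L ^ k / L ^ k) := by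
      rw [hk, show 2 * j + 1 = (j + 1) + j by ring]; ring
    _ ≤ 2 * (D * x) + 2 * C₀ * 4 ^ k * (X * x) := by
      rw [div_self (by positivity), mul_one]
      linarith
    _ ≤ 2 * D * (X * x) + 2 * C₀ * 4 ^ k * (X * x) + 8 * 2 ^ j * (X * x) := by
      have : x ≤ X * x := le_mul_of_one_le_left hx0.le hX
      have h8 : 0 ≤ 8 * 2 ^ j * (X * x) := by positivity
      nlinarith
    _ = _ := by ring

theorem abscissa_lt_of_norm_le_log {f : ℕ → ℂ} (hf : ∀ n, ‖f n‖ ≤ 1 + Real.log n) {s : ℂ}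
    (hs : 1 < s.re) : LSeries.abscissaOfAbsConv f < s.re := by
  obtain ⟨C, hC, h⟩ := one_add_log_pow_le 1 (δ := (s.re - 1) / 2) (by linarith)
  refine lt_of_le_of_lt (LSeries.abscissaOfAbsConv_le_of_le_const_mul_rpow
    (x := (s.re - 1) / 2) ⟨C, fun n hn => ?_⟩) ?_
  · have := h n (by exact_mod_cast Nat.one_le_iff_ne_zero.2 hn)
    rw [pow_one] at this
    exact (hf n).trans this
  · have : (s.re - 1) / 2 + 1 < s.re := by linarith
    exact_mod_cast this

/-- Cancellation in the partial sums from bounds on the derivatives of the Dirichlet series. -/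
theorem exists_norm_sum_le_of_iteratedDeriv (j : ℕ) : ∃ C : ℝ, 1 ≤ C ∧ ∀ (a : ℕ → ℂ) (X : ℝ),
    1 ≤ X → (∀ n, ‖a n‖ ≤ 1 + Real.log n) →
    (∀ s : ℂ, 1 < s.re → s.re ≤ 2 →
      ‖iteratedDeriv (2 * j + 1) (LSeries a) s‖ ≤ X * (|s.im| + 2) ^ (1 / 2 : ℝ)) →
    ∀ x : ℝ, 1 ≤ x → ‖∑ n ∈ range (⌊x⌋₊ + 1), a n‖ ≤ C * X * x / (1 + Real.log x) ^ j := by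
  obtain ⟨C, hC, h⟩ := exists_norm_sum_le j
  refine ⟨C, hC, fun a X hX ha hF => h a
    (fun s => (-1) ^ (2 * j + 1) * iteratedDeriv (2 * j + 1) (LSeries a) s) X hX ha
    (fun s hs => hasSum_iteratedDeriv_LSeries hs (abscissa_lt_of_norm_le_log ha hs) _)
    (fun s hs hs2 => ?_)⟩
  rw [norm_mul, norm_pow, norm_neg, norm_one, one_pow, one_mul]
  exact hF s hs hs2

theorem norm_vonMangoldt_le (n : ℕ) : ‖(ArithmeticFunction.vonMangoldt n : ℂ)‖ ≤ Real.log n := by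
  rw [Complex.norm_real, Real.norm_of_nonneg ArithmeticFunction.vonMangoldt_nonneg]
  exact ArithmeticFunction.vonMangoldt_le_log

/-- A form of the Siegel–Walfisz theorem. -/
theorem siegel_walfisz (j : ℕ) : ∃ C : ℝ, 1 ≤ C ∧ ∀ (q : ℕ) [NeZero q] (χ : DirichletCharacter ℂ q),
    χ.IsPrimitive → χ ≠ 1 → ∀ x : ℝ, 1 ≤ x →
    ‖∑ n ∈ range (⌊x⌋₊ + 1), χ n * (ArithmeticFunction.vonMangoldt n : ℂ)‖ ≤
      C * q * x / (1 + Real.log x) ^ j := by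
  obtain ⟨C, hC, h⟩ := exists_norm_sum_le_of_iteratedDeriv j
  obtain ⟨D, hD, hd⟩ := norm_iteratedDeriv_twist_vonMangoldt_le (2 * j + 1) (ε := 1 / 2)
    (by norm_num) (by norm_num)
  refine ⟨C * D, by nlinarith, fun q _ χ hχ hχ1 x hx => ?_⟩
  have hq : (1 : ℝ) ≤ q := by exact_mod_cast NeZero.one_le
  have := h ((fun n : ℕ => χ n) * fun n : ℕ => (ArithmeticFunction.vonMangoldt n : ℂ)) (D * q)
    (by nlinarith) (fun n => by
      rw [Pi.mul_apply, norm_mul]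
      have h1 := χ.norm_le_one n
      have h2 := norm_vonMangoldt_le n
      have h3 := Real.log_natCast_nonneg n
      calc _ ≤ 1 * Real.log n := by gcongr
        _ ≤ _ := by linarith) (fun s hs hs2 => (hd q χ hχ hχ1 s hs hs2).trans (by
      rw [Real.mul_rpow (by positivity) (by positivity), mul_assoc]
      have : (q : ℝ) ^ (1 / 2 : ℝ) ≤ q := by
        calc (q : ℝ) ^ (1 / 2 : ℝ) ≤ (q : ℝ) ^ (1 : ℝ) :=
              Real.rpow_le_rpow_of_exponent_le hq (by norm_num)
          _ = q := Real.rpow_one _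
      have h0 : 0 ≤ (|s.im| + 2) ^ (1 / 2 : ℝ) := by positivity
      exact mul_le_mul_of_nonneg_left (mul_le_mul_of_nonneg_right this h0) (by linarith))) x hx
  simp only [Pi.mul_apply] at this
  refine this.trans (le_of_eq ?_)
  ring

/-- The prime number theorem with error term. -/
theorem abs_sum_vonMangoldt_sub_le (j : ℕ) : ∃ C : ℝ, 1 ≤ C ∧ ∀ x : ℝ, 1 ≤ x →
    |∑ n ∈ range (⌊x⌋₊ + 1), (ArithmeticFunction.vonMangoldt n - 1)| ≤
      C * x / (1 + Real.log x) ^ j := by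
  obtain ⟨C, hC, h⟩ := exists_norm_sum_le_of_iteratedDeriv j
  obtain ⟨D, hD, hd⟩ := norm_iteratedDeriv_LSeries_vonMangoldt_sub_le (2 * j + 1) (ε := 1 / 2)
    (by norm_num) (by norm_num)
  refine ⟨C * D, by nlinarith, fun x hx => ?_⟩
  have := h (fun n : ℕ => (ArithmeticFunction.vonMangoldt n : ℂ) - 1) D hD
    (fun n => by
      refine (norm_sub_le _ _).trans ?_
      have := norm_vonMangoldt_le n
      rw [norm_one]
      linarith) hd x hx
  rw [← Real.norm_eq_abs, ← Complex.norm_real]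
  push_cast
  exact this

theorem abs_sum_moebius_le (j : ℕ) : ∃ C : ℝ, 1 ≤ C ∧ ∀ x : ℝ, 1 ≤ x →
    |∑ n ∈ range (⌊x⌋₊ + 1), (ArithmeticFunction.moebius n : ℝ)| ≤
      C * x / (1 + Real.log x) ^ j := by
  obtain ⟨C, hC, h⟩ := exists_norm_sum_le_of_iteratedDeriv j
  obtain ⟨D, hD, hd⟩ := norm_iteratedDeriv_LSeries_moebius_le (2 * j + 1) (ε := 1 / 2)
    (by norm_num) (by norm_num)
  refine ⟨C * D, by nlinarith, fun x hx => ?_⟩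
  have := h (fun n : ℕ => (ArithmeticFunction.moebius n : ℂ)) D hD
    (fun n => (norm_moebius_le_one n).trans
      (le_add_of_nonneg_right (Real.log_natCast_nonneg n))) hd x hx
  rw [← Real.norm_eq_abs, ← Complex.norm_real]
  push_cast
  exact this

/-- The exponential `e(α) = exp(2πiα)`. -/
noncomputable def expTwoPi (α : ℝ) : ℂ := Complex.exp ((2 * Real.pi * α : ℝ) * Complex.I)

theorem expTwoPi_add (α β : ℝ) : expTwoPi (α + β) = expTwoPi α * expTwoPi β := by
  rw [expTwoPi, expTwoPi, expTwoPi, ← Complex.exp_add]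
  congr 1
  push_cast
  ring

theorem norm_expTwoPi (α : ℝ) : ‖expTwoPi α‖ = 1 := Complex.norm_exp_ofReal_mul_I _

theorem conj_expTwoPi (α : ℝ) : (starRingEnd ℂ) (expTwoPi α) = expTwoPi (-α) := by
  rw [expTwoPi, expTwoPi, ← Complex.exp_conj, map_mul, Complex.conj_ofReal, Complex.conj_I]
  congr 1
  push_cast
  ring

theorem expTwoPi_int (z : ℤ) : expTwoPi z = 1 := by
  rw [expTwoPi, Complex.exp_eq_one_iff]
  exact ⟨z, by push_cast; ring⟩

theorem expTwoPi_nat_mul (n : ℕ) (α : ℝ) : expTwoPi (n * α) = expTwoPi α ^ n := by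
  rw [expTwoPi, expTwoPi, ← Complex.exp_nat_mul]
  congr 1
  push_cast
  ring

theorem four_mul_min_le_norm_expTwoPi_sub_one (α : ℝ) :
    4 * min (Int.fract α) (1 - Int.fract α) ≤ ‖expTwoPi α - 1‖ := by
  set β := Int.fract α with hβ
  have h0 : 0 ≤ β := Int.fract_nonneg α
  have h1 : β < 1 := Int.fract_lt_one α
  have e : expTwoPi α = expTwoPi β := by
    conv_lhs => rw [← Int.floor_add_fract α]
    rw [expTwoPi_add, expTwoPi_int, one_mul]
  have hn : ‖expTwoPi β - 1‖ = 2 * Real.sin (Real.pi * β) := by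
    rw [expTwoPi, mul_comm, Complex.norm_exp_I_mul_ofReal_sub_one, Real.norm_of_nonneg]
    · congr 2; ring
    · refine mul_nonneg two_pos.le (Real.sin_nonneg_of_nonneg_of_le_pi (by positivity) ?_)
      nlinarith [Real.pi_pos]
  have hs : ∀ x : ℝ, 0 ≤ x → x ≤ 1 / 2 → 2 * x ≤ Real.sin (Real.pi * x) := by
    intro x hx hx2
    have := Real.mul_le_sin (x := Real.pi * x) (by positivity) (by nlinarith [Real.pi_pos])
    calc 2 * x = 2 / Real.pi * (Real.pi * x) := by field_simp
      _ ≤ _ := this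
  rw [e, hn]
  rcases le_total β (1 / 2) with h | h
  · linarith [hs β h0 h, min_le_left β (1 - β)]
  · have h2 := hs (1 - β) (by linarith) (by linarith)
    rw [show Real.pi * (1 - β) = Real.pi - Real.pi * β by ring, Real.sin_pi_sub] at h2
    linarith [min_le_right β (1 - β)]

theorem norm_sum_expTwoPi_le (K : ℕ) (α : ℝ) : ‖∑ j ∈ range K, expTwoPi (j * α)‖ ≤ K := by
  refine (norm_sum_le_of_le _ (fun j _ => (norm_expTwoPi _).le)).trans ?_
  simp

theorem two_mul_min_mul_norm_sum_le (K : ℕ) (α : ℝ) :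
    2 * min (Int.fract α) (1 - Int.fract α) * ‖∑ j ∈ range K, expTwoPi (j * α)‖ ≤ 1 := by
  have h := four_mul_min_le_norm_expTwoPi_sub_one α
  have h2 : ‖expTwoPi α - 1‖ * ‖∑ j ∈ range K, expTwoPi (j * α)‖ ≤ 2 := by
    simp only [expTwoPi_nat_mul]
    rw [← norm_mul, mul_comm, geom_sum_mul]
    refine (norm_sub_le _ _).trans ?_
    rw [norm_pow, norm_expTwoPi]
    norm_num
  nlinarith [norm_nonneg (∑ j ∈ range K, expTwoPi (j * α))]

theorem sum_one_div_sq_le (H : ℕ) : ∑ k ∈ range H, 1 / ((k : ℝ)) ^ 2 ≤ 2 := by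
  suffices h : ∀ H : ℕ, 1 ≤ H → ∑ k ∈ range (H + 1), 1 / ((k : ℝ)) ^ 2 ≤ 2 - 1 / (H : ℝ) by
    rcases Nat.lt_or_ge H 2 with h2 | h2
    · interval_cases H <;> simp
    · obtain ⟨m, rfl⟩ : ∃ m, H = m + 1 := ⟨H - 1, by omega⟩
      have := h m (by omega)
      have : 0 ≤ 1 / (m : ℝ) := by positivity
      linarith
  intro H hH
  induction H, hH using Nat.le_induction with
  | base => norm_num [sum_range_succ]
  | succ m hm ih =>
    rw [sum_range_succ]
    have hm0 : (0 : ℝ) < m := by exact_mod_cast hm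
    have : 1 / ((m + 1 : ℕ) : ℝ) ^ 2 ≤ 1 / m - 1 / (m + 1 : ℕ) := by
      push_cast
      rw [div_sub_div _ _ (by positivity) (by positivity), div_le_div_iff₀ (by positivity) (by positivity)]
      nlinarith
    linarith

/-- Row sums of the Fejér kernel over well spaced points. -/
theorem sum_norm_sq_kernel_le {ι : Type*} (S : Finset ι) (α : ι → ℝ) (H K : ℕ) (hH : 1 ≤ H)
    (hHK : H ≤ K) (hsp : ∀ r ∈ S, ∀ s ∈ S, r ≠ s → ∀ z : ℤ, 1 / (H : ℝ) ≤ |α r - α s - z|) (β : ℝ) :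
    ∑ s ∈ S, ‖∑ j ∈ range K, expTwoPi (j * (β - α s))‖ ^ 2 ≤ 4 * K ^ 2 := by
  have hH0 : (0 : ℝ) < H := by exact_mod_cast hH
  have hKr : (H : ℝ) ≤ K := by exact_mod_cast hHK
  set k : ι → ℕ := fun s => ⌊H * Int.fract (β - α s)⌋₊ with hk
  set G : ℕ → ℝ := fun k => (if k = 0 then (K : ℝ) ^ 2 else 0) + (if H - 1 - k = 0 then (K : ℝ) ^ 2 else 0)
    + H ^ 2 / 4 * (1 / (k : ℝ) ^ 2) + H ^ 2 / 4 * (1 / ((H - 1 - k : ℕ) : ℝ) ^ 2) with hG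
  have hG1 : ∀ s, ‖∑ j ∈ range K, expTwoPi (j * (β - α s))‖ ^ 2 ≤ G (k s) := by
    intro s
    have hle := norm_sum_expTwoPi_le K (β - α s)
    have hmin := two_mul_min_mul_norm_sum_le K (β - α s)
    have hf0 := Int.fract_nonneg (β - α s)
    have hf1 := Int.fract_lt_one (β - α s)
    have hk1 : (k s : ℝ) ≤ H * Int.fract (β - α s) := Nat.floor_le (by positivity)
    have hk2 : H * Int.fract (β - α s) < k s + 1 := Nat.lt_floor_add_one _
    set f := Int.fract (β - α s)
    set D := ‖∑ j ∈ range K, expTwoPi (j * (β - α s))‖ with hD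
    have hD0 : 0 ≤ D := norm_nonneg _
    have p1 : 0 ≤ (H : ℝ) ^ 2 / 4 * (1 / (k s : ℝ) ^ 2) := by positivity
    have p2 : 0 ≤ (H : ℝ) ^ 2 / 4 * (1 / ((H - 1 - k s : ℕ) : ℝ) ^ 2) := by positivity
    have p3 : (0 : ℝ) ≤ if k s = 0 then (K : ℝ) ^ 2 else 0 := by positivity
    have p4 : (0 : ℝ) ≤ if H - 1 - k s = 0 then (K : ℝ) ^ 2 else 0 := by positivity
    have hDK : D ^ 2 ≤ K ^ 2 := pow_le_pow_left₀ hD0 hle 2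
    simp only [hG]
    have key : ∀ (j : ℕ), 0 < j → (j : ℝ) / H ≤ min f (1 - f) → D ^ 2 ≤ H ^ 2 / 4 * (1 / (j : ℝ) ^ 2) := by
      intro j hj hjm
      have hj0 : (0 : ℝ) < j := by exact_mod_cast hj
      have h2 : 2 * (j / H) * D ≤ 1 := le_trans (by gcongr) hmin
      have h3 : D ≤ H / (2 * j) := by
        rw [le_div_iff₀ (by positivity)]
        calc D * (2 * j) = (2 * (j / H) * D) * H := by field_simp
          _ ≤ 1 * H := by gcongr
          _ = H := one_mul _
      calc D ^ 2 ≤ (H / (2 * j)) ^ 2 := pow_le_pow_left₀ hD0 h3 2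
        _ = _ := by rw [div_pow, mul_pow]; field_simp; norm_num
    by_cases h1 : k s = 0
    · rw [if_pos h1] at p3 ⊢
      linarith
    by_cases h2 : H - 1 - k s = 0
    · rw [if_pos h2] at p4 ⊢
      linarith
    have hsub : ((H - 1 - k s : ℕ) : ℝ) = H - 1 - k s := by
      rw [Nat.cast_sub (by omega), Nat.cast_sub hH]
      norm_num
    rcases le_total f (1 - f) with h | h
    · have := key (k s) (by omega) (by
        rw [min_eq_left h, div_le_iff₀ hH0]; linarith)
      linarith
    · have := key (H - 1 - k s) (by omega) (by
        rw [min_eq_right h, div_le_iff₀ hH0, hsub]; linarith)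
      linarith
  have hinj : Set.InjOn k S := by
    intro s hs t ht hst
    by_contra hne
    have h1 := hsp s hs t ht hne (⌊β - α t⌋ - ⌊β - α s⌋)
    have e : α s - α t - ((⌊β - α t⌋ - ⌊β - α s⌋ : ℤ) : ℝ) =
        Int.fract (β - α t) - Int.fract (β - α s) := by
      rw [Int.fract, Int.fract]; push_cast; ring
    rw [e] at h1
    have a1 : (k s : ℝ) ≤ H * Int.fract (β - α s) :=
      Nat.floor_le (mul_nonneg hH0.le (Int.fract_nonneg _))
    have a2 : H * Int.fract (β - α s) < k s + 1 := Nat.lt_floor_add_one _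
    have b1 : (k t : ℝ) ≤ H * Int.fract (β - α t) :=
      Nat.floor_le (mul_nonneg hH0.le (Int.fract_nonneg _))
    have b2 : H * Int.fract (β - α t) < k t + 1 := Nat.lt_floor_add_one _
    rw [hst] at a1 a2
    rw [div_le_iff₀ hH0] at h1
    have e2 := abs_mul (Int.fract (β - α t) - Int.fract (β - α s)) H
    rw [abs_of_pos hH0] at e2
    rw [← e2] at h1
    have : |(Int.fract (β - α t) - Int.fract (β - α s)) * H| < 1 := by
      rw [abs_lt]
      constructor <;> linarith
    linarith
  have hmaps : ∀ s ∈ S, k s ∈ range H := by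
    intro s _
    rw [mem_range, hk, Nat.floor_lt (mul_nonneg hH0.le (Int.fract_nonneg _))]
    nlinarith [Int.fract_lt_one (β - α s)]
  have hG0 : ∀ k, 0 ≤ G k := fun k => by simp only [hG]; positivity
  have hrefl : ∑ k ∈ range H, 1 / ((H - 1 - k : ℕ) : ℝ) ^ 2 = ∑ k ∈ range H, 1 / (k : ℝ) ^ 2 :=
    sum_range_reflect (fun k : ℕ => 1 / (k : ℝ) ^ 2) H
  have hrefl2 : ∑ k ∈ range H, (if H - 1 - k = 0 then (K : ℝ) ^ 2 else 0) =
      ∑ k ∈ range H, if k = 0 then (K : ℝ) ^ 2 else 0 :=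
    sum_range_reflect (fun k : ℕ => if k = 0 then (K : ℝ) ^ 2 else 0) H
  have hone : ∑ k ∈ range H, (if k = 0 then (K : ℝ) ^ 2 else 0) ≤ K ^ 2 := by
    rw [sum_ite_eq' (range H) 0 (fun _ => (K : ℝ) ^ 2)]
    split_ifs
    · exact le_rfl
    · positivity
  calc _ ≤ ∑ s ∈ S, G (k s) := sum_le_sum fun s _ => hG1 s
    _ = ∑ j ∈ S.image k, G j := (sum_image hinj).symm
    _ ≤ ∑ j ∈ range H, G j := sum_le_sum_of_subset_of_nonneg
        (image_subset_iff.2 hmaps) fun j _ _ => hG0 j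
    _ ≤ K ^ 2 + K ^ 2 + H ^ 2 / 4 * 2 + H ^ 2 / 4 * 2 := by
      simp only [hG, sum_add_distrib, ← mul_sum]
      rw [hrefl, hrefl2]
      have := sum_one_div_sq_le H
      gcongr
    _ ≤ _ := by nlinarith

theorem norm_sq_sum_mul_conj {ι : Type*} (S : Finset ι) (z : ι → ℂ) :
    ((‖∑ r ∈ S, z r‖ ^ 2 : ℝ) : ℂ) = ∑ r ∈ S, ∑ s ∈ S, z r * (starRingEnd ℂ) (z s) := by
  rw [← Complex.normSq_eq_norm_sq, ← Complex.mul_conj, map_sum, sum_mul_sum]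

/-- The dual form of the analytic large sieve. -/
theorem dual_large_sieve {ι : Type*} (S : Finset ι) (α : ι → ℝ) (H K N : ℕ) (hH : 1 ≤ H)
    (hHK : H ≤ K) (hNK : 2 * N ≤ K)
    (hsp : ∀ r ∈ S, ∀ s ∈ S, r ≠ s → ∀ z : ℤ, 1 / (H : ℝ) ≤ |α r - α s - z|) (c : ι → ℂ) :
    ∑ n ∈ range N, ‖∑ r ∈ S, c r * expTwoPi (n * α r)‖ ^ 2 ≤ 8 * K * ∑ r ∈ S, ‖c r‖ ^ 2 := by
  set g : ℝ → ℝ := fun u => ‖∑ r ∈ S, c r * expTwoPi (u * α r)‖ ^ 2 with hg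
  have hK0 : (0 : ℝ) < K := by exact_mod_cast (by omega : 0 < K)
  have hg0 : ∀ u, 0 ≤ g u := fun u => by positivity
  have hlow : (K - N : ℝ) * ∑ n ∈ range N, g n ≤
      ∑ j ∈ range K, ∑ i ∈ range K, g ((i : ℝ) - j) := by
    calc (K - N : ℝ) * ∑ n ∈ range N, g n = ∑ j ∈ range (K - N), ∑ n ∈ range N, g n := by
          rw [sum_const, card_range, nsmul_eq_mul, Nat.cast_sub (by omega)]
      _ ≤ ∑ j ∈ range (K - N), ∑ i ∈ range K, g ((i : ℝ) - j) := by
          refine sum_le_sum fun j hj => ?_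
          rw [mem_range] at hj
          calc ∑ n ∈ range N, g n = ∑ i ∈ Ico j (j + N), g ((i : ℝ) - j) := by
                rw [sum_Ico_eq_sum_range]
                simp
            _ ≤ _ := sum_le_sum_of_subset_of_nonneg (fun i hi => by
                rw [mem_Ico] at hi
                rw [mem_range]; omega) fun i _ _ => hg0 _
      _ ≤ _ := sum_le_sum_of_subset_of_nonneg (fun i hi => by
          rw [mem_range] at hi ⊢; omega) fun i _ _ => sum_nonneg fun _ _ => hg0 _
  set D : ι → ι → ℝ := fun r s => ‖∑ j ∈ range K, expTwoPi (j * (α r - α s))‖ ^ 2 with hD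
  have hup : ((∑ j ∈ range K, ∑ i ∈ range K, g ((i : ℝ) - j) : ℝ) : ℂ) =
      ∑ r ∈ S, ∑ s ∈ S, c r * (starRingEnd ℂ) (c s) * (D r s : ℂ) := by
    have hD' : ∀ r s, (D r s : ℂ) = ∑ j ∈ range K, ∑ i ∈ range K,
        expTwoPi (((i : ℝ) - j) * (α r - α s)) := by
      intro r s
      rw [hD, norm_sq_sum_mul_conj, sum_comm]
      refine sum_congr rfl fun j _ => sum_congr rfl fun i _ => ?_
      rw [conj_expTwoPi, ← expTwoPi_add]
      congr 1; ring
    have hg' : ∀ i j : ℕ, ((g ((i : ℝ) - j) : ℝ) : ℂ) = ∑ r ∈ S, ∑ s ∈ S,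
        c r * (starRingEnd ℂ) (c s) * expTwoPi (((i : ℝ) - j) * (α r - α s)) := by
      intro i j
      simp only [hg]
      rw [norm_sq_sum_mul_conj]
      refine sum_congr rfl fun r _ => sum_congr rfl fun s _ => ?_
      rw [map_mul, conj_expTwoPi, mul_sub, sub_eq_add_neg (_ * α r), expTwoPi_add]
      ring
    rw [Complex.ofReal_sum]
    simp only [Complex.ofReal_sum, hg', hD', mul_sum]
    calc _ = ∑ j ∈ range K, ∑ r ∈ S, ∑ i ∈ range K, ∑ s ∈ S,
          c r * (starRingEnd ℂ) (c s) * expTwoPi (((i : ℝ) - j) * (α r - α s)) :=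
          sum_congr rfl fun j _ => sum_comm
      _ = ∑ r ∈ S, ∑ j ∈ range K, ∑ i ∈ range K, ∑ s ∈ S,
          c r * (starRingEnd ℂ) (c s) * expTwoPi (((i : ℝ) - j) * (α r - α s)) := sum_comm
      _ = ∑ r ∈ S, ∑ j ∈ range K, ∑ s ∈ S, ∑ i ∈ range K,
          c r * (starRingEnd ℂ) (c s) * expTwoPi (((i : ℝ) - j) * (α r - α s)) :=
          sum_congr rfl fun r _ => sum_congr rfl fun j _ => sum_comm
      _ = _ := sum_congr rfl fun r _ => sum_comm
  have hrow : ∀ r, ∑ s ∈ S, D r s ≤ 4 * K ^ 2 := fun r =>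
    sum_norm_sq_kernel_le S α H K hH hHK hsp (α r)
  have hsymm : ∀ r s, D r s = D s r := by
    intro r s
    simp only [hD]
    rw [← Complex.norm_conj, map_sum]
    congr 2
    refine sum_congr rfl fun j _ => ?_
    rw [conj_expTwoPi]
    congr 1; ring
  have hup2 : ∑ j ∈ range K, ∑ i ∈ range K, g ((i : ℝ) - j) ≤ 4 * K ^ 2 * ∑ r ∈ S, ‖c r‖ ^ 2 := by
    have hn : 0 ≤ ∑ j ∈ range K, ∑ i ∈ range K, g ((i : ℝ) - j) :=
      sum_nonneg fun _ _ => sum_nonneg fun _ _ => hg0 _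
    rw [← Real.norm_of_nonneg hn, ← Complex.norm_real, hup]
    calc _ ≤ ∑ r ∈ S, ∑ s ∈ S, (‖c r‖ ^ 2 / 2 * D r s + ‖c s‖ ^ 2 / 2 * D s r) := by
          refine (norm_sum_le _ _).trans (sum_le_sum fun r _ => (norm_sum_le _ _).trans
            (sum_le_sum fun s _ => ?_))
          have hD0 : 0 ≤ D r s := by positivity
          rw [norm_mul, norm_mul, Complex.norm_conj, Complex.norm_real, Real.norm_of_nonneg hD0,
            ← hsymm r s, ← add_mul]
          refine mul_le_mul_of_nonneg_right ?_ hD0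
          nlinarith [sq_nonneg (‖c r‖ - ‖c s‖)]
      _ = ∑ r ∈ S, ‖c r‖ ^ 2 * ∑ s ∈ S, D r s := by
          simp only [sum_add_distrib]
          rw [sum_comm (f := fun r s => ‖c s‖ ^ 2 / 2 * D s r), ← sum_add_distrib]
          refine sum_congr rfl fun r _ => ?_
          rw [← mul_sum]; ring
      _ ≤ ∑ r ∈ S, ‖c r‖ ^ 2 * (4 * K ^ 2) := by gcongr with r _; exact hrow r
      _ = _ := by rw [← sum_mul]; ring
  have hNK' : (2 * N : ℝ) ≤ K := by exact_mod_cast hNK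
  have hs0 : 0 ≤ ∑ n ∈ range N, g n := sum_nonneg fun _ _ => hg0 _
  have : K / 2 * ∑ n ∈ range N, g n ≤ K / 2 * (8 * K * ∑ r ∈ S, ‖c r‖ ^ 2) := by
    calc K / 2 * ∑ n ∈ range N, g n ≤ (K - N : ℝ) * ∑ n ∈ range N, g n := by gcongr; linarith
      _ ≤ _ := hlow.trans hup2
      _ = _ := by ring
  exact le_of_mul_le_mul_left this (by positivity)

theorem norm_gaussSum_sq_of_isPrimitive {q : ℕ} [NeZero q] {χ : DirichletCharacter ℂ q}
    (hχ : χ.IsPrimitive) : ‖gaussSum χ (ZMod.stdAddChar (N := q))‖ ^ 2 = q := by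
  set ψ := ZMod.stdAddChar (N := q)
  have h : ((‖gaussSum χ ψ‖ ^ 2 : ℝ) : ℂ) = (q : ℂ) := by
    rw [← Complex.normSq_eq_norm_sq, ← Complex.mul_conj]
    have hs : (starRingEnd ℂ) (gaussSum χ ψ) = ∑ c, χ⁻¹ c * ψ (-c) := by
      rw [starRingEnd_apply, star_gaussSum_eq, gaussSum]
      rfl
    rw [hs, mul_sum]
    calc _ = ∑ c, ∑ b, χ b * ψ ((b - 1) * c) := by
          refine sum_congr rfl fun c _ => ?_
          rw [← mul_assoc, mul_comm (gaussSum χ ψ), ← gaussSum_mulShift_of_isPrimitive ψ hχ, gaussSum, sum_mul]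
          refine sum_congr rfl fun b _ => ?_
          rw [AddChar.mulShift_apply, mul_assoc, ← AddChar.map_add_eq_mul]
          congr 2; ring
      _ = ∑ b, χ b * ∑ c, ψ (c * (b - 1)) := by
          rw [sum_comm]
          refine sum_congr rfl fun b _ => ?_
          rw [mul_sum]
          refine sum_congr rfl fun c _ => by rw [mul_comm (b - 1)]
      _ = _ := by
          have h1 : ∀ b : ZMod q, ∑ c, ψ (c * (b - 1)) = if b = 1 then (q : ℂ) else 0 := by
            intro b
            rw [AddChar.sum_mulShift _ (ZMod.isPrimitive_stdAddChar q), ZMod.card]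
            simp only [sub_eq_zero, Nat.cast_ite, Nat.cast_zero]
          simp [h1]
  exact_mod_cast h

theorem sum_norm_sum_char_mul_sq (q : ℕ) [NeZero q] (F : ZMod q → ℂ) :
    ∑ χ : DirichletCharacter ℂ q, ‖∑ b, χ b * F b‖ ^ 2 =
      q.totient * ∑ b : (ZMod q)ˣ, ‖F b‖ ^ 2 := by
  have h : ((∑ χ : DirichletCharacter ℂ q, ‖∑ b, χ b * F b‖ ^ 2 : ℝ) : ℂ) =
      ((q.totient * ∑ b : (ZMod q)ˣ, ‖F b‖ ^ 2 : ℝ) : ℂ) := by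
    have hu : ∀ χ : DirichletCharacter ℂ q, ∑ b, χ b * F b = ∑ b : (ZMod q)ˣ, χ b * F b := by
      intro χ
      have := Finset.sum_map univ (⟨_, Units.val_injective⟩ : (ZMod q)ˣ ↪ ZMod q) (fun b => χ b * F b)
      rw [Function.Embedding.coeFn_mk] at this
      rw [← this]
      symm
      refine sum_subset (subset_univ _) fun x _ hx => ?_
      rw [χ.map_nonunit, zero_mul]
      rintro ⟨u, rfl⟩
      exact hx (by simp)
    simp only [hu]
    rw [Complex.ofReal_sum]
    simp only [norm_sq_sum_mul_conj]
    rw [sum_comm]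
    calc _ = ∑ b : (ZMod q)ˣ, ∑ c : (ZMod q)ˣ, F b * (starRingEnd ℂ) (F c) *
          ∑ χ : DirichletCharacter ℂ q, χ ((c : ZMod q)⁻¹) * χ b := by
          refine sum_congr rfl fun b _ => ?_
          rw [sum_comm]
          refine sum_congr rfl fun c _ => ?_
          rw [mul_sum]
          refine sum_congr rfl fun χ _ => ?_
          rw [map_mul, starRingEnd_apply, MulChar.star_apply', MulChar.inv_apply, Ring.inverse_unit,
            ZMod.inv_coe_unit]
          ring
      _ = _ := by
          simp only [DirichletCharacter.sum_char_inv_mul_char_eq ℂ (Units.isUnit _), Units.val_inj]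
          push_cast
          simp only [mul_ite, mul_zero, sum_ite_eq', mem_univ, if_true, mul_sum]
          refine sum_congr rfl fun b _ => ?_
          rw [Complex.mul_conj, Complex.normSq_eq_norm_sq]
          push_cast; ring
  exact_mod_cast h

open scoped Classical in
/-- The primitive Dirichlet characters modulo `q`. -/
noncomputable def primChars (q : ℕ) : Finset (DirichletCharacter ℂ q) :=
  univ.filter fun χ => χ.IsPrimitive

theorem mem_primChars {q : ℕ} {χ : DirichletCharacter ℂ q} : χ ∈ primChars q ↔ χ.IsPrimitive := by
  simp [primChars]

theorem sum_primitive_norm_sq_le (q : ℕ) [NeZero q] (N : ℕ) (a : ℕ → ℂ) :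
    q * ∑ χ ∈ primChars q, ‖∑ n ∈ range N, a n * χ n‖ ^ 2 ≤
      q.totient * ∑ b : (ZMod q)ˣ, ‖∑ n ∈ range N, a n * ZMod.stdAddChar ((n : ZMod q) * (b : ZMod q))‖ ^ 2 := by
  set F : ZMod q → ℂ := fun b => ∑ n ∈ range N, a n * ZMod.stdAddChar ((n : ZMod q) * (b : ZMod q)) with hF
  rw [← sum_norm_sum_char_mul_sq q F]
  have hinv : ∑ χ ∈ primChars q, ‖∑ n ∈ range N, a n * χ n‖ ^ 2 =
      ∑ χ ∈ primChars q, ‖∑ n ∈ range N, a n * χ⁻¹ n‖ ^ 2 := by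
    refine sum_bij' (fun χ _ => χ⁻¹) (fun χ _ => χ⁻¹) ?_ ?_ ?_ ?_ ?_
    all_goals simp [mem_primChars, DirichletCharacter.isPrimitive_def, DirichletCharacter.conductor_inv]
  rw [hinv, mul_sum]
  refine (sum_le_sum fun χ hχ => le_of_eq ?_).trans
    (sum_le_sum_of_subset_of_nonneg (subset_univ _) fun χ _ _ => by positivity)
  rw [mem_primChars] at hχ
  rw [← norm_gaussSum_sq_of_isPrimitive hχ, ← mul_pow, ← norm_mul]
  congr 2
  simp only [hF, mul_sum]
  rw [sum_comm]
  refine sum_congr rfl fun n _ => ?_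
  rw [mul_left_comm, mul_comm (gaussSum _ _), ← gaussSum_mulShift_of_isPrimitive _ hχ, gaussSum, mul_sum]
  refine sum_congr rfl fun b _ => ?_
  rw [AddChar.mulShift_apply]
  ring

/-- The duality principle for bilinear forms. -/
theorem sum_norm_sq_le_of_dual {ι κ : Type*} (S : Finset ι) (T : Finset κ) (φ : ι → κ → ℂ) (B : ℝ)
    (hB0 : 0 ≤ B) (hB : ∀ c : ι → ℂ, ∑ n ∈ T, ‖∑ r ∈ S, c r * φ r n‖ ^ 2 ≤ B * ∑ r ∈ S, ‖c r‖ ^ 2) (a : κ → ℂ) :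
    ∑ r ∈ S, ‖∑ n ∈ T, a n * φ r n‖ ^ 2 ≤ B * ∑ n ∈ T, ‖a n‖ ^ 2 := by
  set A : ι → ℂ := fun r => ∑ n ∈ T, a n * φ r n with hA
  set X := ∑ r ∈ S, ‖A r‖ ^ 2 with hX
  have hX0 : 0 ≤ X := sum_nonneg fun _ _ => by positivity
  have e : (X : ℂ) = ∑ n ∈ T, a n * ∑ r ∈ S, (starRingEnd ℂ) (A r) * φ r n := by
    simp only [hX, mul_sum]
    rw [sum_comm, Complex.ofReal_sum]
    refine sum_congr rfl fun r _ => ?_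
    rw [← Complex.normSq_eq_norm_sq, ← Complex.mul_conj]
    conv_lhs => rw [hA]
    rw [sum_mul]
    refine sum_congr rfl fun n _ => by ring
  have h1 : X ≤ ∑ n ∈ T, ‖a n‖ * ‖∑ r ∈ S, (starRingEnd ℂ) (A r) * φ r n‖ := by
    rw [← Real.norm_of_nonneg hX0, ← Complex.norm_real, e]
    exact (norm_sum_le _ _).trans (sum_le_sum fun n _ => (norm_mul _ _).le)
  have h2 := sum_mul_sq_le_sq_mul_sq T (fun n => ‖a n‖)
    (fun n => ‖∑ r ∈ S, (starRingEnd ℂ) (A r) * φ r n‖)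
  have h3 := hB fun r => (starRingEnd ℂ) (A r)
  simp only [Complex.norm_conj] at h3
  have hs : 0 ≤ ∑ n ∈ T, ‖a n‖ ^ 2 := sum_nonneg fun _ _ => by positivity
  have h4 : X * X ≤ (B * ∑ n ∈ T, ‖a n‖ ^ 2) * X := by
    calc X * X ≤ (∑ n ∈ T, ‖a n‖ * ‖∑ r ∈ S, (starRingEnd ℂ) (A r) * φ r n‖) ^ 2 := by
          rw [sq]; exact mul_self_le_mul_self hX0 h1
      _ ≤ _ := h2
      _ ≤ (∑ n ∈ T, ‖a n‖ ^ 2) * (B * X) := mul_le_mul_of_nonneg_left h3 hs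
      _ = _ := by ring
  rcases hX0.eq_or_lt with h | h
  · rw [← h]
    positivity
  · exact le_of_mul_le_mul_right h4 h

theorem farey_spacing {Q : ℕ} (r s : Σ q : ℕ, (ZMod (q + 1))ˣ) (hr : r.1 < Q) (hs : s.1 < Q)
    (hrs : r ≠ s) (z : ℤ) : 1 / ((Q ^ 2 : ℕ) : ℝ) ≤
      |((r.2 : ZMod (r.1 + 1)).val : ℝ) / (r.1 + 1) - ((s.2 : ZMod (s.1 + 1)).val : ℝ) / (s.1 + 1) - z| := by
  obtain ⟨q, b⟩ := r
  obtain ⟨p, c⟩ := s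
  simp only at hr hs ⊢
  set x := (b : ZMod (q + 1)).val with hx
  set y := (c : ZMod (p + 1)).val with hy
  have hbc : Nat.Coprime x (q + 1) := ZMod.val_coe_unit_coprime b
  have hcc : Nat.Coprime y (p + 1) := ZMod.val_coe_unit_coprime c
  set m : ℤ := x * (p + 1 : ℕ) - y * (q + 1 : ℕ) - z * ((q + 1 : ℕ) * (p + 1 : ℕ)) with hm
  have hm0 : m ≠ 0 := by
    intro h
    have e1 : ((q + 1 : ℕ) : ℤ) ∣ (x : ℤ) * (p + 1 : ℕ) := ⟨y + z * (p + 1 : ℕ), by linarith⟩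
    have e2 : ((p + 1 : ℕ) : ℤ) ∣ (y : ℤ) * (q + 1 : ℕ) :=
      ⟨x - z * (q + 1 : ℕ), by linarith⟩
    have d1 : q + 1 ∣ p + 1 := hbc.symm.dvd_of_dvd_mul_left (by exact_mod_cast e1)
    have d2 : p + 1 ∣ q + 1 := hcc.symm.dvd_of_dvd_mul_left (by exact_mod_cast e2)
    have hqp : q = p := by have := Nat.dvd_antisymm d1 d2; omega
    subst hqp
    apply hrs
    congr 1
    apply Units.ext
    rw [← ZMod.natCast_zmod_val (b : ZMod (q + 1)), ← ZMod.natCast_zmod_val (c : ZMod (q + 1)), ← hx, ← hy]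
    have : ((x : ℤ) : ZMod (q + 1)) = ((y : ℤ) : ZMod (q + 1)) := by
      rw [ZMod.intCast_eq_intCast_iff_dvd_sub]
      refine ⟨-z, ?_⟩
      have h0 : ((q + 1 : ℕ) : ℤ) ≠ 0 := by positivity
      apply mul_left_cancel₀ h0
      linarith
    exact_mod_cast this
  have hm1 : (1 : ℝ) ≤ |(m : ℝ)| := by exact_mod_cast Int.one_le_abs hm0
  have e : (x : ℝ) / (q + 1) - (y : ℝ) / (p + 1) - z = m / (((q : ℝ) + 1) * (p + 1)) := by
    rw [hm]; push_cast; field_simp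
  have hp : (0 : ℝ) < ((q : ℝ) + 1) * (p + 1) := by positivity
  rw [e, abs_div, abs_of_pos hp]
  have hq1 : (q : ℝ) + 1 ≤ Q := by exact_mod_cast hr
  have hp1 : (p : ℝ) + 1 ≤ Q := by exact_mod_cast hs
  refine div_le_div₀ (by positivity) hm1 hp ?_
  push_cast
  rw [sq]
  exact mul_le_mul hq1 hp1 (by positivity) (by positivity)

theorem stdAddChar_natCast_mul (q n : ℕ) [NeZero q] (b : ZMod q) :
    ZMod.stdAddChar ((n : ZMod q) * b) = expTwoPi (n * ((b.val : ℝ) / q)) := by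
  have h : (n : ZMod q) * b = (((n * b.val : ℕ) : ℤ) : ZMod q) := by
    push_cast
    rw [ZMod.natCast_zmod_val]
  rw [h, ZMod.stdAddChar_coe, expTwoPi]
  congr 1
  push_cast
  ring

/-- The multiplicative large sieve inequality. -/
theorem large_sieve_char (Q K N : ℕ) (hQ : 1 ≤ Q) (hQK : Q ^ 2 ≤ K) (hNK : 2 * N ≤ K) (a : ℕ → ℂ) :
    ∑ q ∈ Icc 1 Q, ((q : ℝ) / q.totient) * ∑ χ ∈ primChars q, ‖∑ n ∈ range N, a n * χ n‖ ^ 2 ≤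
      8 * K * ∑ n ∈ range N, ‖a n‖ ^ 2 := by
  have hadd := sum_norm_sq_le_of_dual ((range Q).sigma fun q => (univ : Finset (ZMod (q + 1))ˣ)) (range N)
    (fun r n => expTwoPi (n * (((r.2 : ZMod (r.1 + 1)).val : ℝ) / (r.1 + 1)))) (8 * K) (by positivity)
    (dual_large_sieve _ _ (Q ^ 2) K N (Nat.one_le_pow _ _ hQ) hQK hNK (fun r hr s hs hrs z =>
      farey_spacing r s (by simpa using hr) (by simpa using hs) hrs z)) a
  refine le_trans ?_ hadd
  rw [sum_sigma]
  have hI : Icc 1 Q = (range Q).image (· + 1) := by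
    ext x
    simp only [mem_Icc, mem_image, mem_range]
    exact ⟨fun h => ⟨x - 1, by omega, by omega⟩, by rintro ⟨y, hy, rfl⟩; omega⟩
  rw [hI, sum_image (by intro x _ y _ h; simpa using h)]
  refine sum_le_sum fun q _ => ?_
  have ht : (0 : ℝ) < (q + 1).totient := by exact_mod_cast Nat.totient_pos.2 (Nat.succ_pos q)
  have h := sum_primitive_norm_sq_le (q + 1) N a
  rw [div_mul_eq_mul_div, div_le_iff₀ ht, mul_comm _ ((q + 1).totient : ℝ)]
  refine h.trans (le_of_eq ?_)
  congr 1
  refine sum_congr rfl fun b _ => ?_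
  congr 2
  refine sum_congr rfl fun n _ => ?_
  rw [stdAddChar_natCast_mul]
  push_cast
  rfl

/-- The twist of an arithmetic function by a Dirichlet character. -/
noncomputable def charTwist {q : ℕ} (χ : DirichletCharacter ℂ q) (f : ArithmeticFunction ℝ) :
    ArithmeticFunction ℂ := ⟨fun n => χ n * (f n : ℂ), by simp⟩

theorem charTwist_apply {q : ℕ} (χ : DirichletCharacter ℂ q) (f : ArithmeticFunction ℝ) (n : ℕ) :
    charTwist χ f n = χ n * (f n : ℂ) := rfl

theorem charTwist_mul {q : ℕ} (χ : DirichletCharacter ℂ q) (f g : ArithmeticFunction ℝ) :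
    charTwist χ (f * g) = charTwist χ f * charTwist χ g := by
  ext n
  rw [charTwist_apply, ArithmeticFunction.mul_apply, ArithmeticFunction.mul_apply, Complex.ofReal_sum,
    mul_sum]
  refine sum_congr rfl fun p hp => ?_
  rw [charTwist_apply, charTwist_apply, ← (Nat.mem_divisorsAntidiagonal.1 hp).1]
  push_cast
  rw [map_mul]
  ring

theorem norm_charTwist_le {q : ℕ} (χ : DirichletCharacter ℂ q) (f : ArithmeticFunction ℝ) (n : ℕ) :
    ‖charTwist χ f n‖ ≤ |f n| := by
  rw [charTwist_apply, norm_mul, Complex.norm_real, Real.norm_eq_abs]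
  exact mul_le_of_le_one_left (abs_nonneg _) (χ.norm_le_one _)

/-- The restriction of an arithmetic function to `n ≤ U`. -/
noncomputable def truncLe (U : ℕ) (f : ArithmeticFunction ℝ) : ArithmeticFunction ℝ :=
  ⟨fun n => if n ≤ U then f n else 0, by simp⟩

theorem truncLe_apply (U : ℕ) (f : ArithmeticFunction ℝ) (n : ℕ) :
    truncLe U f n = if n ≤ U then f n else 0 := rfl

/-- The real-valued Möbius function. -/
noncomputable def moebiusReal : ArithmeticFunction ℝ := (ArithmeticFunction.moebius : ArithmeticFunction ℝ)

theorem moebiusReal_mul_zeta : moebiusReal * ((ArithmeticFunction.zeta : ArithmeticFunction ℕ) : ArithmeticFunction ℝ) = 1 :=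
  ArithmeticFunction.coe_moebius_mul_coe_zeta

theorem abs_moebiusReal_le (n : ℕ) : |moebiusReal n| ≤ 1 := by
  have : moebiusReal n = ((ArithmeticFunction.moebius n : ℤ) : ℝ) := rfl
  rw [this]
  exact_mod_cast ArithmeticFunction.abs_moebius_le_one

/-- The bilinear part of Vaughan's identity. -/
noncomputable def vaughanB (U : ℕ) : ArithmeticFunction ℝ :=
  (ArithmeticFunction.vonMangoldt - truncLe U ArithmeticFunction.vonMangoldt) *
    ((ArithmeticFunction.zeta : ArithmeticFunction ℕ) : ArithmeticFunction ℝ)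

/-- Vaughan's identity. -/
theorem vaughan_identity (U : ℕ) : ArithmeticFunction.vonMangoldt =
    truncLe U ArithmeticFunction.vonMangoldt + truncLe U moebiusReal * ArithmeticFunction.log -
      truncLe U moebiusReal * (truncLe U ArithmeticFunction.vonMangoldt *
        ((ArithmeticFunction.zeta : ArithmeticFunction ℕ) : ArithmeticFunction ℝ)) +
      (moebiusReal - truncLe U moebiusReal) * vaughanB U := by
  rw [vaughanB, ← ArithmeticFunction.vonMangoldt_mul_zeta]
  linear_combination (-ArithmeticFunction.vonMangoldt + truncLe U ArithmeticFunction.vonMangoldt) *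
    moebiusReal_mul_zeta

theorem norm_sum_charTwist_mul_le {q : ℕ} (χ : DirichletCharacter ℂ q) (f g : ArithmeticFunction ℝ)
    (x : ℕ) {B : ℝ} (hB : ∀ y ≤ x, ‖∑ n ∈ Ioc 0 y, charTwist χ g n‖ ≤ B) :
    ‖∑ n ∈ Ioc 0 x, charTwist χ (f * g) n‖ ≤ (∑ m ∈ Ioc 0 x, |f m|) * B := by
  rw [charTwist_mul, ArithmeticFunction.sum_Ioc_mul_eq_sum_sum, sum_mul]
  refine norm_sum_le_of_le _ fun m hm => ?_
  rw [norm_mul]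
  exact mul_le_mul (norm_charTwist_le χ f m) (hB _ (Nat.div_le_self _ _)) (norm_nonneg _) (abs_nonneg _)

theorem sum_truncLe_le (U x : ℕ) (f : ArithmeticFunction ℝ) {B : ℝ} (hB0 : 0 ≤ B)
    (hB : ∀ n ≤ U, |f n| ≤ B) : ∑ m ∈ Ioc 0 x, |truncLe U f m| ≤ U * B := by
  calc _ ≤ ∑ m ∈ Ioc 0 x, if m ∈ Ioc 0 U then B else 0 := by
        refine sum_le_sum fun m hm => ?_
        rw [mem_Ioc] at hm
        rw [truncLe_apply]
        split_ifs with h1 h2 h2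
        · exact hB m h1
        · exact absurd (mem_Ioc.2 ⟨hm.1, h1⟩) h2
        · simpa using hB0
        · simp
    _ = ∑ m ∈ Ioc 0 x ∩ Ioc 0 U, B := by rw [sum_ite_mem]
    _ ≤ ∑ m ∈ Ioc 0 U, B := sum_le_sum_of_subset_of_nonneg inter_subset_right fun _ _ _ => hB0
    _ = _ := by simp

theorem sum_Ioc_zero_eq_range {M : Type*} [AddCommMonoid M] (f : ℕ → M) (h0 : f 0 = 0) (x : ℕ) :
    ∑ n ∈ Ioc 0 x, f n = ∑ n ∈ range (x + 1), f n := by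
  rw [sum_range_succ', h0, add_zero, range_eq_Ico, sum_Ico_add' (fun n => f n) 0 x 1]
  rfl

theorem log_add_one_le {x : ℕ} (hx : 1 ≤ x) : Real.log (x + 1 : ℕ) ≤ 1 + Real.log x := by
  have hx0 : (1 : ℝ) ≤ x := by exact_mod_cast hx
  have : Real.log ((x + 1 : ℕ) : ℝ) ≤ Real.log (Real.exp 1 * x) := by
    apply Real.log_le_log (by positivity)
    push_cast
    nlinarith [Real.add_one_le_exp 1]
  rwa [Real.log_mul (Real.exp_pos _).ne' (by positivity), Real.log_exp] at this

theorem norm_sum_charTwist_log_le {q : ℕ} [NeZero q] {χ : DirichletCharacter ℂ q} (hχ : χ ≠ 1) (y : ℕ) :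
    ‖∑ n ∈ Ioc 0 y, charTwist χ ArithmeticFunction.log n‖ ≤ 2 * q * Real.log (y + 1 : ℕ) := by
  have h := norm_sum_Ico_mul_le (f := fun n => χ n) (g := fun n => (Real.log n : ℂ)) (B := q)
    (fun N => norm_sum_range_char_le hχ N) (a := 1) (b := y + 1) (by omega)
  have e : ∑ n ∈ Ico 1 (y + 1), ‖((Real.log ((n + 1 : ℕ) : ℝ) : ℝ) : ℂ) - ((Real.log (n : ℝ) : ℝ) : ℂ)‖ =
      Real.log (y + 1 : ℕ) := by
    have : ∀ n ∈ Ico 1 (y + 1), ‖((Real.log ((n + 1 : ℕ) : ℝ) : ℝ) : ℂ) - ((Real.log (n : ℝ) : ℝ) : ℂ)‖ =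
        Real.log ((n + 1 : ℕ) : ℝ) - Real.log (n : ℝ) := by
      intro n hn
      rw [mem_Ico] at hn
      rw [← Complex.ofReal_sub, Complex.norm_real, Real.norm_of_nonneg]
      rw [sub_nonneg]
      apply Real.log_le_log (by exact_mod_cast hn.1)
      push_cast; linarith
    rw [sum_congr rfl this, sum_Ico_sub (fun n : ℕ => Real.log (n : ℝ)) (by omega)]
    simp
  have h0 : 0 ≤ Real.log (y + 1 : ℕ) := Real.log_natCast_nonneg _
  have e2 : ∑ n ∈ Ioc 0 y, charTwist χ ArithmeticFunction.log n =
      ∑ n ∈ Ico 1 (y + 1), χ n * ((Real.log n : ℝ) : ℂ) := rfl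
  rw [e2]
  refine h.trans (le_of_eq ?_)
  rw [e, Complex.norm_real, Complex.norm_real, Real.norm_of_nonneg h0]
  simp
  ring

theorem norm_sum_charTwist_zeta_le {q : ℕ} [NeZero q] {χ : DirichletCharacter ℂ q} (hq : q ≠ 1) (hχ : χ ≠ 1) (y : ℕ) :
    ‖∑ n ∈ Ioc 0 y, charTwist χ ((ArithmeticFunction.zeta : ArithmeticFunction ℕ) : ArithmeticFunction ℝ) n‖ ≤ q := by
  have e : ∑ n ∈ Ioc 0 y, charTwist χ ((ArithmeticFunction.zeta : ArithmeticFunction ℕ) : ArithmeticFunction ℝ) n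
      = ∑ n ∈ range (y + 1), χ n := by
    rw [sum_Ioc_zero_eq_range _ (by simp)]
    refine sum_congr rfl fun n _ => ?_
    rw [charTwist_apply]
    rcases eq_or_ne n 0 with rfl | h
    · simp [χ.map_zero' hq]
    · simp [h]
  rw [e]
  exact norm_sum_range_char_le hχ _

theorem sum_charTwist_add {q : ℕ} (χ : DirichletCharacter ℂ q) (f g : ArithmeticFunction ℝ) (S : Finset ℕ) :
    ∑ n ∈ S, charTwist χ (f + g) n = ∑ n ∈ S, charTwist χ f n + ∑ n ∈ S, charTwist χ g n := by
  rw [← sum_add_distrib]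
  refine sum_congr rfl fun n _ => ?_
  simp only [charTwist_apply, ArithmeticFunction.add_apply]
  push_cast; ring

theorem arithmeticFunction_sub_apply (f g : ArithmeticFunction ℝ) (n : ℕ) : (f - g) n = f n - g n := by
  rw [sub_eq_add_neg, ArithmeticFunction.add_apply, sub_eq_add_neg]
  rfl

theorem sum_charTwist_sub {q : ℕ} (χ : DirichletCharacter ℂ q) (f g : ArithmeticFunction ℝ) (S : Finset ℕ) :
    ∑ n ∈ S, charTwist χ (f - g) n = ∑ n ∈ S, charTwist χ f n - ∑ n ∈ S, charTwist χ g n := by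
  rw [← sum_sub_distrib]
  refine sum_congr rfl fun n _ => ?_
  simp only [charTwist_apply, arithmeticFunction_sub_apply]
  push_cast; ring

theorem norm_sum_vonMangoldt_le_bilinear {q : ℕ} [NeZero q] {χ : DirichletCharacter ℂ q} (hq : q ≠ 1)
    (hχ : χ ≠ 1) {U x : ℕ} (hU : 1 ≤ U) (hUx : U ≤ x) :
    ‖∑ n ∈ Ioc 0 x, charTwist χ ArithmeticFunction.vonMangoldt n‖ ≤
      ‖∑ n ∈ Ioc 0 x, charTwist χ ((moebiusReal - truncLe U moebiusReal) * vaughanB U) n‖ +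
        4 * q * U ^ 2 * (1 + Real.log x) := by
  have hL := log_add_one_le (hU.trans hUx)
  set L := 1 + Real.log x
  have hx1 : (1 : ℝ) ≤ x := by exact_mod_cast hU.trans hUx
  have hL1 : 1 ≤ L := by have := Real.log_nonneg hx1; linarith
  have hq1 : (1 : ℝ) ≤ q := by exact_mod_cast NeZero.one_le
  have hU1 : (1 : ℝ) ≤ U := by exact_mod_cast hU
  have hΛ : ∀ n ≤ U, |ArithmeticFunction.vonMangoldt n| ≤ L := by
    intro n hn
    rw [abs_of_nonneg ArithmeticFunction.vonMangoldt_nonneg]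
    refine ArithmeticFunction.vonMangoldt_le_log.trans ?_
    rcases Nat.eq_zero_or_pos n with rfl | h0
    · simp; linarith
    · have : Real.log n ≤ Real.log x := Real.log_le_log (by exact_mod_cast h0) (by exact_mod_cast hn.trans hUx)
      linarith
  have h1 : ‖∑ n ∈ Ioc 0 x, charTwist χ (truncLe U ArithmeticFunction.vonMangoldt) n‖ ≤ U * L :=
    (norm_sum_le_of_le _ fun n _ => norm_charTwist_le χ _ n).trans
      (sum_truncLe_le U x _ (by linarith) hΛ)
  have hμ := sum_truncLe_le U x moebiusReal zero_le_one fun n _ => abs_moebiusReal_le n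
  have h2 := norm_sum_charTwist_mul_le χ (truncLe U moebiusReal) ArithmeticFunction.log x (B := 2 * q * L)
    fun y hy => (norm_sum_charTwist_log_le hχ y).trans (mul_le_mul_of_nonneg_left
      ((Real.log_le_log (by positivity) (by exact_mod_cast Nat.add_le_add_right hy 1)).trans hL) (by positivity))
  have h3 := norm_sum_charTwist_mul_le χ (truncLe U moebiusReal) (truncLe U ArithmeticFunction.vonMangoldt *
        ((ArithmeticFunction.zeta : ArithmeticFunction ℕ) : ArithmeticFunction ℝ)) x (B := U * L * q)
    fun y hy => (norm_sum_charTwist_mul_le χ _ _ y fun z _ => norm_sum_charTwist_zeta_le hq hχ z).trans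
      (mul_le_mul_of_nonneg_right (sum_truncLe_le U y _ (by linarith) hΛ) (by positivity))
  conv_lhs => rw [vaughan_identity U]
  rw [sum_charTwist_add, sum_charTwist_sub, sum_charTwist_add]
  set s1 := ∑ n ∈ Ioc 0 x, charTwist χ (truncLe U ArithmeticFunction.vonMangoldt) n
  set s2 := ∑ n ∈ Ioc 0 x, charTwist χ (truncLe U moebiusReal * ArithmeticFunction.log) n
  set s3 := ∑ n ∈ Ioc 0 x, charTwist χ (truncLe U moebiusReal * (truncLe U ArithmeticFunction.vonMangoldt *
        ((ArithmeticFunction.zeta : ArithmeticFunction ℕ) : ArithmeticFunction ℝ))) n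
  set s4 := ∑ n ∈ Ioc 0 x, charTwist χ ((moebiusReal - truncLe U moebiusReal) * vaughanB U) n
  have h2' : ‖s2‖ ≤ U * 1 * (2 * q * L) := h2.trans (mul_le_mul_of_nonneg_right hμ (by positivity))
  have h3' : ‖s3‖ ≤ U * 1 * (U * L * q) := h3.trans (mul_le_mul_of_nonneg_right hμ (by positivity))
  have t1 : ‖s1 + s2 - s3 + s4‖ ≤ ‖s1‖ + ‖s2‖ + ‖s3‖ + ‖s4‖ :=
    (norm_add_le _ _).trans (add_le_add_left ((norm_sub_le _ _).trans (add_le_add_left (norm_add_le _ _) _)) _)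
  have a1 : (U : ℝ) * L ≤ q * U ^ 2 * L := by
    refine mul_le_mul_of_nonneg_right ?_ (by linarith)
    nlinarith [mul_le_mul hq1 hU1 (by linarith) (by linarith)]
  have a2 : (U : ℝ) * 1 * (2 * q * L) ≤ 2 * q * U ^ 2 * L := by
    have : (U : ℝ) ≤ U ^ 2 := by nlinarith
    calc _ = 2 * q * U * L := by ring
      _ ≤ _ := by gcongr
  nlinarith

/-- The large sieve for a product of two character sums over a dyadic range of moduli. -/
theorem sum_block_mul_le (P N₁ N₂ : ℕ) (hP : 1 ≤ P) (a b : ℕ → ℂ) :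
    ∑ q ∈ Ioc P (2 * P), (1 / (q.totient : ℝ)) * ∑ χ ∈ primChars q,
      ‖∑ n ∈ range N₁, a n * χ n‖ * ‖∑ n ∈ range N₂, b n * χ n‖ ≤
    8 / P * (√((4 * P ^ 2 + 2 * N₁) * ∑ n ∈ range N₁, ‖a n‖ ^ 2) *
      √((4 * P ^ 2 + 2 * N₂) * ∑ n ∈ range N₂, ‖b n‖ ^ 2)) := by
  have hP0 : (0 : ℝ) < P := by exact_mod_cast hP
  set w : ℕ → ℝ := fun q => (q : ℝ) / q.totient with hw
  have hw0 : ∀ q, 0 ≤ w q := fun q => by positivity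
  have key : ∀ (N : ℕ) (c : ℕ → ℂ), ∑ q ∈ Ioc P (2 * P), ∑ χ ∈ primChars q,
      (√(w q) * ‖∑ n ∈ range N, c n * χ n‖) ^ 2 ≤ 8 * ((4 * P ^ 2 + 2 * N) * ∑ n ∈ range N, ‖c n‖ ^ 2) := by
    intro N c
    have h := large_sieve_char (2 * P) (4 * P ^ 2 + 2 * N) N (by omega) (by nlinarith) (by omega) c
    push_cast at h
    rw [← mul_assoc]
    refine le_trans ?_ h
    refine le_trans (le_of_eq ?_) (sum_le_sum_of_subset_of_nonneg (s := Ioc P (2 * P)) ?_ ?_)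
    · refine sum_congr rfl fun q _ => ?_
      rw [mul_sum]
      refine sum_congr rfl fun χ _ => ?_
      rw [mul_pow, Real.sq_sqrt (hw0 q)]
    · intro q hq
      rw [mem_Ioc] at hq
      rw [mem_Icc]; omega
    · intro q _ _
      exact mul_nonneg (by positivity) (sum_nonneg fun _ _ => by positivity)
  calc _ ≤ ∑ q ∈ Ioc P (2 * P), (1 / P) * (∑ χ ∈ primChars q,
        (√(w q) * ‖∑ n ∈ range N₁, a n * χ n‖) * (√(w q) * ‖∑ n ∈ range N₂, b n * χ n‖)) := by
        refine sum_le_sum fun q hq => ?_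
        rw [mem_Ioc] at hq
        have hPq : (P : ℝ) ≤ q := by exact_mod_cast hq.1.le
        rw [mul_sum, mul_sum]
        refine sum_le_sum fun χ _ => ?_
        have e : √(w q) * ‖∑ n ∈ range N₁, a n * χ n‖ * (√(w q) * ‖∑ n ∈ range N₂, b n * χ n‖) =
            w q * (‖∑ n ∈ range N₁, a n * χ n‖ * ‖∑ n ∈ range N₂, b n * χ n‖) := by
          rw [mul_mul_mul_comm, Real.mul_self_sqrt (hw0 q)]
        have hle : 1 / (q.totient : ℝ) ≤ 1 / P * w q := by
          rw [hw]
          simp only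
          rw [← mul_div_assoc, one_div_mul_eq_div]
          refine div_le_div_of_nonneg_right ?_ (by positivity)
          rwa [one_le_div hP0]
        rw [e, ← mul_assoc (1 / (P : ℝ))]
        exact mul_le_mul_of_nonneg_right hle (mul_nonneg (norm_nonneg _) (norm_nonneg _))
    _ = 1 / P * ∑ p ∈ (Ioc P (2 * P)).sigma primChars,
        (√(w p.1) * ‖∑ n ∈ range N₁, a n * p.2 n‖) * (√(w p.1) * ‖∑ n ∈ range N₂, b n * p.2 n‖) := by
        rw [← mul_sum, sum_sigma]
    _ ≤ 1 / P * (√(8 * ((4 * P ^ 2 + 2 * N₁) * ∑ n ∈ range N₁, ‖a n‖ ^ 2)) *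
          √(8 * ((4 * P ^ 2 + 2 * N₂) * ∑ n ∈ range N₂, ‖b n‖ ^ 2))) := by
        refine mul_le_mul_of_nonneg_left ((Real.sum_mul_le_sqrt_mul_sqrt _ _ _).trans ?_) (by positivity)
        rw [sum_sigma, sum_sigma]
        exact mul_le_mul (Real.sqrt_le_sqrt (key N₁ a)) (Real.sqrt_le_sqrt (key N₂ b)) (by positivity)
          (by positivity)
    _ = _ := by
        rw [Real.sqrt_mul (by norm_num : (0 : ℝ) ≤ 8), Real.sqrt_mul (by norm_num : (0 : ℝ) ≤ 8),
          mul_mul_mul_comm, Real.mul_self_sqrt (by norm_num)]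
        ring

theorem sum_block_le (P N : ℕ) (hP : 1 ≤ P) (c : ℕ → ℂ) :
    ∑ q ∈ Ioc P (2 * P), (1 / (q.totient : ℝ)) * ∑ χ ∈ primChars q, ‖∑ n ∈ range N, c n * χ n‖ ≤
    24 * √((4 * P ^ 2 + 2 * N) * ∑ n ∈ range N, ‖c n‖ ^ 2) := by
  have hP0 : (1 : ℝ) ≤ P := by exact_mod_cast hP
  have h := sum_block_mul_le P 2 N hP (fun n => if n = 1 then 1 else 0) c
  have e1 : ∀ q : ℕ, ∀ χ : DirichletCharacter ℂ q,
      ‖∑ n ∈ range 2, (if n = 1 then (1 : ℂ) else 0) * χ n‖ = 1 := by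
    intro q χ
    simp
  have e2 : ∑ n ∈ range 2, ‖(if n = 1 then (1 : ℂ) else 0)‖ ^ 2 = 1 := by simp [sum_range_succ]
  simp only [e1, one_mul, e2, mul_one] at h
  refine h.trans ?_
  rw [← mul_assoc]
  refine mul_le_mul_of_nonneg_right ?_ (by positivity)
  have : √(4 * (P : ℝ) ^ 2 + 2 * (2 : ℕ)) ≤ 3 * P := by
    rw [Real.sqrt_le_iff]
    constructor
    · positivity
    · push_cast; nlinarith
  calc _ ≤ 8 / (P : ℝ) * (3 * P) := by gcongr
    _ = 24 := by field_simp; norm_num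

theorem card_divisors_mul_le (m n : ℕ) : (m * n).divisors.card ≤ m.divisors.card * n.divisors.card := by
  rw [Nat.divisors_mul]
  exact Finset.card_mul_le

theorem sum_card_divisors_pow_div_le (j x : ℕ) :
    ∑ n ∈ Ioc 0 x, (n.divisors.card : ℝ) ^ j / n ≤ (1 + Real.log x) ^ 2 ^ j := by
  induction j with
  | zero =>
    have h := harmonic_le_one_add_log x
    rw [harmonic_eq_sum_Icc] at h
    have e : Icc 1 x = Ioc 0 x := rfl
    push_cast at h
    simpa [e] using h
  | succ j ih =>
    have h0 : 0 ≤ ∑ n ∈ Ioc 0 x, (n.divisors.card : ℝ) ^ j / n := sum_nonneg fun _ _ => by positivity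
    have h2 : ∑ n ∈ Ioc 0 x, (n.divisors.card : ℝ) ^ (j + 1) / n ≤
        (∑ n ∈ Ioc 0 x, (n.divisors.card : ℝ) ^ j / n) * ∑ n ∈ Ioc 0 x, (n.divisors.card : ℝ) ^ j / n := by
      calc _ = ∑ n ∈ Ioc 0 x, ∑ p ∈ n.divisorsAntidiagonal, ((p.1 * p.2).divisors.card : ℝ) ^ j / (p.1 * p.2) := by
            refine sum_congr rfl fun n _ => ?_
            have : ∀ p ∈ n.divisorsAntidiagonal, ((p.1 * p.2).divisors.card : ℝ) ^ j / ((p.1 : ℝ) * p.2) =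
                (n.divisors.card : ℝ) ^ j / n := by
              intro p hp
              rw [← (Nat.mem_divisorsAntidiagonal.1 hp).1]
              push_cast; rfl
            rw [sum_congr rfl this, sum_const, nsmul_eq_mul, ← Nat.map_div_right_divisors, card_map]
            ring
        _ ≤ ∑ n ∈ Ioc 0 x, ∑ p ∈ n.divisorsAntidiagonal,
            ((p.1.divisors.card : ℝ) ^ j / p.1) * ((p.2.divisors.card : ℝ) ^ j / p.2) := by
            refine sum_le_sum fun n _ => sum_le_sum fun p _ => ?_
            rw [div_mul_div_comm, ← mul_pow]
            refine div_le_div_of_nonneg_right (pow_le_pow_left₀ (by positivity) ?_ j) (by positivity)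
            exact_mod_cast card_divisors_mul_le _ _
        _ ≤ _ := by
            rw [sum_mul_sum, ← sum_product', ← sum_biUnion]
            · refine sum_le_sum_of_subset_of_nonneg ?_ fun _ _ _ => by positivity
              intro p hp
              simp only [mem_biUnion, mem_Ioc, Nat.mem_divisorsAntidiagonal] at hp
              obtain ⟨n, ⟨h1, h2⟩, h3, -⟩ := hp
              have ha : 0 < p.1 := Nat.pos_of_ne_zero (by rintro h; rw [h] at h3; omega)
              have hb : 0 < p.2 := Nat.pos_of_ne_zero (by rintro h; rw [h] at h3; omega)
              simp only [mem_product, mem_Ioc]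
              refine ⟨⟨ha, ?_⟩, hb, ?_⟩ <;> nlinarith
            · intro m _ n _ hmn
              rw [Function.onFun, disjoint_left]
              intro p hp hp'
              exact hmn ((Nat.mem_divisorsAntidiagonal.1 hp).1.symm.trans (Nat.mem_divisorsAntidiagonal.1 hp').1)
    refine h2.trans ((mul_le_mul ih ih h0 (h0.trans ih)).trans (le_of_eq ?_))
    rw [← sq, ← pow_mul, pow_succ]

theorem moebiusReal_sub_trunc_apply (U n : ℕ) :
    (moebiusReal - truncLe U moebiusReal) n = if n ≤ U then 0 else moebiusReal n := by
  rw [arithmeticFunction_sub_apply, truncLe_apply]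
  split_ifs <;> simp

theorem vaughanB_eq (U n : ℕ) : vaughanB U n = ∑ d ∈ n.divisors,
    if d ≤ U then 0 else ArithmeticFunction.vonMangoldt d := by
  rw [vaughanB, ArithmeticFunction.coe_mul_zeta_apply]
  refine sum_congr rfl fun d _ => ?_
  rw [arithmeticFunction_sub_apply, truncLe_apply]
  split_ifs <;> simp

theorem vaughanB_eq_zero {U n : ℕ} (h : n ≤ U) : vaughanB U n = 0 := by
  rw [vaughanB_eq]
  refine sum_eq_zero fun d hd => ?_
  rw [if_pos ((Nat.divisor_le hd).trans h)]

theorem abs_vaughanB_le (U n : ℕ) : |vaughanB U n| ≤ Real.log n := by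
  rw [vaughanB_eq, ← ArithmeticFunction.vonMangoldt_sum, abs_of_nonneg]
  · refine sum_le_sum fun d _ => ?_
    split_ifs
    · exact ArithmeticFunction.vonMangoldt_nonneg
    · exact le_rfl
  · refine sum_nonneg fun d _ => ?_
    split_ifs
    · exact le_rfl
    · exact ArithmeticFunction.vonMangoldt_nonneg

theorem sum_primChars_le (q : ℕ) [NeZero q] {B : ℝ} (hB : 0 ≤ B) (F : DirichletCharacter ℂ q → ℝ)
    (h : ∀ χ ∈ primChars q, F χ ≤ B) : (1 / (q.totient : ℝ)) * ∑ χ ∈ primChars q, F χ ≤ B := by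
  have ht : (0 : ℝ) < q.totient := by exact_mod_cast Nat.totient_pos.2 (NeZero.pos q)
  have hc : ((primChars q).card : ℝ) ≤ q.totient := by
    rw [← DirichletCharacter.card_eq_totient_of_hasEnoughRootsOfUnity ℂ q, Nat.card_eq_fintype_card]
    exact_mod_cast card_le_univ _
  calc _ ≤ (1 / (q.totient : ℝ)) * ∑ χ ∈ primChars q, B :=
        mul_le_mul_of_nonneg_left (sum_le_sum h) (by positivity)
    _ = (primChars q).card * B / q.totient := by rw [sum_const, nsmul_eq_mul]; ring
    _ ≤ _ := by
      rw [div_le_iff₀ ht, mul_comm B]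
      exact mul_le_mul_of_nonneg_right hc hB

/-- The average over primitive characters of conductor in `(P, 2P]`. -/
noncomputable def blockSum (P : ℕ) (F : (q : ℕ) → DirichletCharacter ℂ q → ℝ) : ℝ :=
  ∑ q ∈ Ioc P (2 * P), (1 / (q.totient : ℝ)) * ∑ χ ∈ primChars q, F q χ

theorem blockSum_mono (P : ℕ) {F G : (q : ℕ) → DirichletCharacter ℂ q → ℝ}
    (h : ∀ q ∈ Ioc P (2 * P), ∀ χ ∈ primChars q, F q χ ≤ G q χ) : blockSum P F ≤ blockSum P G :=
  sum_le_sum fun q hq => mul_le_mul_of_nonneg_left (sum_le_sum (h q hq)) (by positivity)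

theorem blockSum_add (P : ℕ) (F G : (q : ℕ) → DirichletCharacter ℂ q → ℝ) :
    blockSum P (fun q χ => F q χ + G q χ) = blockSum P F + blockSum P G := by
  simp only [blockSum, sum_add_distrib, mul_add]

theorem blockSum_sum (P : ℕ) {ι : Type*} (s : Finset ι) (F : ι → (q : ℕ) → DirichletCharacter ℂ q → ℝ) :
    blockSum P (fun q χ => ∑ i ∈ s, F i q χ) = ∑ i ∈ s, blockSum P (F i) := by
  simp only [blockSum]
  rw [sum_comm]
  refine sum_congr rfl fun q _ => ?_
  rw [sum_comm, mul_sum]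

theorem blockSum_le (P : ℕ) {F : (q : ℕ) → DirichletCharacter ℂ q → ℝ} {B : ℝ} (hB : 0 ≤ B)
    (h : ∀ q ∈ Ioc P (2 * P), ∀ χ ∈ primChars q, F q χ ≤ B) : blockSum P F ≤ P * B := by
  have : ∀ q ∈ Ioc P (2 * P), (1 / (q.totient : ℝ)) * ∑ χ ∈ primChars q, F q χ ≤ B := by
    intro q hq
    have : NeZero q := ⟨by have := (mem_Ioc.1 hq).1; omega⟩
    exact sum_primChars_le q hB _ (h q hq)
  refine (sum_le_sum this).trans ?_
  rw [sum_const, Nat.card_Ioc, nsmul_eq_mul]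
  exact mul_le_mul_of_nonneg_right (by exact_mod_cast (by omega)) hB

/-- Splitting a bilinear sum over `m n ≤ x` into boxes and an edge. -/
theorem sum_mul_eq_box_add_edge {q : ℕ} (χ : DirichletCharacter ℂ q) (f g : ArithmeticFunction ℝ) (x J : ℕ)
    (j : ℕ → ℕ) (v : ℕ → ℝ) (hj : ∀ m ∈ Ioc 0 x, j m < J) (hv : ∀ m ∈ Ioc 0 x, (m : ℝ) ≤ v (j m)) :
    ∑ n ∈ Ioc 0 x, charTwist χ (f * g) n =
      ∑ i ∈ range J, (∑ m ∈ (Ioc 0 x).filter (fun m => j m = i), charTwist χ f m) *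
        (∑ n ∈ (Ioc 0 x).filter (fun n : ℕ => (n : ℝ) * v i ≤ x), charTwist χ g n) +
      ∑ k ∈ Ioc 0 x, (∑ p ∈ k.divisorsAntidiagonal.filter (fun p => (x : ℝ) < p.2 * v (j p.1)),
        ((f p.1 * g p.2 : ℝ) : ℂ)) * χ k := by
  have h1 : ∑ n ∈ Ioc 0 x, charTwist χ (f * g) n =
      ∑ k ∈ Ioc 0 x, ∑ p ∈ k.divisorsAntidiagonal, charTwist χ f p.1 * charTwist χ g p.2 := by
    refine sum_congr rfl fun n _ => ?_
    rw [charTwist_mul, ArithmeticFunction.mul_apply]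
  have h2 : ∀ k ∈ Ioc 0 x, ∑ p ∈ k.divisorsAntidiagonal, charTwist χ f p.1 * charTwist χ g p.2 =
      ∑ p ∈ k.divisorsAntidiagonal.filter (fun p => ¬ (x : ℝ) < p.2 * v (j p.1)),
        charTwist χ f p.1 * charTwist χ g p.2 +
      (∑ p ∈ k.divisorsAntidiagonal.filter (fun p => (x : ℝ) < p.2 * v (j p.1)),
        ((f p.1 * g p.2 : ℝ) : ℂ)) * χ k := by
    intro k _
    rw [← sum_filter_add_sum_filter_not _ (fun p => (x : ℝ) < p.2 * v (j p.1)), add_comm, sum_mul]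
    congr 1
    refine sum_congr rfl fun p hp => ?_
    rw [← (Nat.mem_divisorsAntidiagonal.1 (mem_filter.1 hp).1).1, charTwist_apply, charTwist_apply]
    push_cast
    rw [map_mul]
    ring
  rw [h1, sum_congr rfl h2, sum_add_distrib]
  congr 1
  have h3 : ∀ i ∈ range J, (∑ m ∈ (Ioc 0 x).filter (fun m => j m = i), charTwist χ f m) *
        (∑ n ∈ (Ioc 0 x).filter (fun n : ℕ => (n : ℝ) * v i ≤ x), charTwist χ g n) =
      ∑ m ∈ (Ioc 0 x).filter (fun m => j m = i), ∑ n ∈ (Ioc 0 x).filter (fun n : ℕ => (n : ℝ) * v (j m) ≤ x),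
        charTwist χ f m * charTwist χ g n := by
    intro i _
    rw [sum_mul]
    refine sum_congr rfl fun m hm => ?_
    rw [mul_sum, (mem_filter.1 hm).2]
  rw [sum_congr rfl h3, sum_fiberwise_of_maps_to (fun m hm => mem_range.2 (hj m hm))]
  rw [sum_sigma', sum_sigma']
  refine sum_bij' (fun a _ => ⟨a.2.1, a.2.2⟩) (fun b _ => ⟨b.1 * b.2, (b.1, b.2)⟩) ?_ ?_ ?_ ?_ ?_
  · rintro ⟨k, m, n⟩ h
    simp only [mem_sigma, mem_Ioc, mem_filter, Nat.mem_divisorsAntidiagonal, not_lt] at h ⊢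
    obtain ⟨⟨hk, hkx⟩, ⟨rfl, -⟩, h⟩ := h
    have hm := Nat.pos_of_mul_pos_right hk
    have hn := Nat.pos_of_mul_pos_left hk
    exact ⟨⟨by nlinarith, by nlinarith⟩, ⟨by nlinarith, by nlinarith⟩, h⟩
  · rintro ⟨m, n⟩ h
    simp only [mem_sigma, mem_Ioc, mem_filter, Nat.mem_divisorsAntidiagonal, not_lt] at h ⊢
    obtain ⟨⟨hm, hmx⟩, ⟨hn, hnx⟩, h⟩ := h
    refine ⟨⟨Nat.mul_pos hm hn, ?_⟩, ⟨trivial, (Nat.mul_pos hm hn).ne'⟩, h⟩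
    have := hv m (mem_Ioc.2 ⟨hm, hmx⟩)
    have : ((m * n : ℕ) : ℝ) ≤ x := by
      push_cast
      rw [mul_comm]
      exact (mul_le_mul_of_nonneg_left this (by positivity)).trans h
    exact_mod_cast this
  · rintro ⟨k, m, n⟩ h
    simp only [mem_sigma, mem_filter, Nat.mem_divisorsAntidiagonal] at h
    obtain ⟨-, ⟨rfl, -⟩, -⟩ := h
    rfl
  · rintro ⟨m, n⟩ _
    rfl
  · rintro ⟨k, m, n⟩ _
    rfl

theorem blockSum_const_of_eq_zero (P : ℕ) {F : (q : ℕ) → DirichletCharacter ℂ q → ℝ} (h : ∀ q χ, F q χ = 0) :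
    blockSum P F = 0 := by
  simp [blockSum, h]

theorem sum_charTwist_eq_range {q : ℕ} (χ : DirichletCharacter ℂ q) (f : ArithmeticFunction ℝ) (S : Finset ℕ)
    {N : ℕ} (hS : ∀ m ∈ S, m < N) :
    ∑ m ∈ S, charTwist χ f m = ∑ n ∈ range N, (if n ∈ S then (f n : ℂ) else 0) * χ n := by
  simp only [ite_mul, zero_mul]
  rw [← sum_filter, filter_mem_eq_inter, inter_eq_right.2 fun m hm => mem_range.2 (hS m hm)]
  exact sum_congr rfl fun m _ => by rw [charTwist_apply, mul_comm]

theorem sum_norm_sq_indicator_le (f : ℕ → ℝ) (S : Finset ℕ) (N : ℕ) {L : ℝ} (h : ∀ n ∈ S, |f n| ≤ L) :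
    ∑ n ∈ range N, ‖(if n ∈ S then (f n : ℂ) else 0)‖ ^ 2 ≤ N * L ^ 2 := by
  calc _ ≤ ∑ n ∈ range N, L ^ 2 := by
        refine sum_le_sum fun n _ => ?_
        split_ifs with hn
        · rw [Complex.norm_real, Real.norm_eq_abs]
          exact pow_le_pow_left₀ (abs_nonneg _) (h n hn) 2
        · simpa using sq_nonneg L
    _ = _ := by rw [sum_const, card_range, nsmul_eq_mul]

theorem sqrt_block_le {P s N L S : ℝ} (hP : 0 ≤ P) (hs : 0 ≤ s) (hL : 0 ≤ L) (hN0 : 0 ≤ N) (hN : N ≤ 2 * s ^ 2)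
    (hS : S ≤ N * L ^ 2) : √((4 * P ^ 2 + 2 * N) * S) ≤ 4 * L * (P * s + s ^ 2) := by
  rw [Real.sqrt_le_iff]
  refine ⟨by positivity, ?_⟩
  calc (4 * P ^ 2 + 2 * N) * S ≤ (4 * P ^ 2 + 2 * N) * (N * L ^ 2) := by gcongr
    _ ≤ (4 * P ^ 2 + 2 * (2 * s ^ 2)) * (2 * s ^ 2 * L ^ 2) := by gcongr
    _ ≤ (4 * L * (P * s + s ^ 2)) ^ 2 := by
      have e : (4 * L * (P * s + s ^ 2)) ^ 2 - (4 * P ^ 2 + 2 * (2 * s ^ 2)) * (2 * s ^ 2 * L ^ 2) =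
        L ^ 2 * s ^ 2 * (8 * P ^ 2 + 32 * P * s + 8 * s ^ 2) := by ring
      have : 0 ≤ L ^ 2 * s ^ 2 * (8 * P ^ 2 + 32 * P * s + 8 * s ^ 2) := by positivity
      linarith

theorem blockSum_box_le {P x T : ℕ} (hP : 1 ≤ P) (hT : 1 ≤ T) {f g : ArithmeticFunction ℝ} {L : ℝ} (hL : 0 ≤ L)
    (hf : ∀ n, |f n| ≤ 1) (hf0 : ∀ n ≤ T ^ 2, f n = 0) (hg : ∀ n ≤ x, |g n| ≤ L) (hg0 : ∀ n ≤ T ^ 2, g n = 0)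
    (v : ℝ) (S : Finset ℕ) (hS : ∀ m ∈ S, (m : ℝ) ≤ v) :
    blockSum P (fun q χ => ‖(∑ m ∈ S, charTwist χ f m) *
      ∑ n ∈ (Ioc 0 x).filter (fun n : ℕ => (n : ℝ) * v ≤ x), charTwist χ g n‖) ≤
      128 * L * (P * √x + 2 * x / T + x / P) := by
  have hP1 : (1 : ℝ) ≤ P := by exact_mod_cast hP
  have hT1 : (1 : ℝ) ≤ T := by exact_mod_cast hT
  have hrhs : 0 ≤ 128 * L * (P * √x + 2 * x / T + x / P) := by positivity
  rcases le_or_gt v (T ^ 2 : ℕ) with hv | hv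
  · rw [blockSum_const_of_eq_zero]
    · exact hrhs
    · intro q χ
      rw [sum_eq_zero, zero_mul, norm_zero]
      intro m hm
      rw [charTwist_apply, hf0 m (by exact_mod_cast (hS m hm).trans hv)]
      simp
  have hT2 : (1 : ℝ) ≤ (T ^ 2 : ℕ) := by exact_mod_cast Nat.one_le_pow 2 T hT
  have hv0 : 0 < v := by linarith
  rcases le_or_gt (x : ℝ) ((T ^ 2 : ℕ) * v) with hxv | hxv
  · rw [blockSum_const_of_eq_zero]
    · exact hrhs
    · intro q χ
      rw [mul_comm, sum_eq_zero, zero_mul, norm_zero]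
      intro n hn
      have : (n : ℝ) ≤ (T ^ 2 : ℕ) := le_of_mul_le_mul_right ((mem_filter.1 hn).2.trans hxv) hv0
      rw [charTwist_apply, hg0 n (by exact_mod_cast this)]
      simp
  set S' := (Ioc 0 x).filter (fun n : ℕ => (n : ℝ) * v ≤ x) with hS'
  set N₁ := ⌊v⌋₊ + 1 with hN₁
  set N₂ := ⌊x / v⌋₊ + 1 with hN₂
  have hv1 : 1 ≤ v := by linarith
  have hxv1 : 1 ≤ x / v := by rw [le_div_iff₀ hv0]; nlinarith
  have hb1 : (N₁ : ℝ) ≤ 2 * (√v) ^ 2 := by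
    rw [Real.sq_sqrt hv0.le, hN₁]
    push_cast
    linarith [Nat.floor_le hv0.le]
  have hb2 : (N₂ : ℝ) ≤ 2 * (√(x / v)) ^ 2 := by
    rw [Real.sq_sqrt (by positivity), hN₂]
    push_cast
    linarith [Nat.floor_le (show 0 ≤ x / v by positivity)]
  have h := sum_block_mul_le P N₁ N₂ hP (fun n => if n ∈ S then (f n : ℂ) else 0)
    (fun n => if n ∈ S' then (g n : ℂ) else 0)
  have e : blockSum P (fun q χ => ‖(∑ m ∈ S, charTwist χ f m) * ∑ n ∈ S', charTwist χ g n‖) =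
      ∑ q ∈ Ioc P (2 * P), (1 / (q.totient : ℝ)) * ∑ χ ∈ primChars q,
        ‖∑ n ∈ range N₁, (if n ∈ S then (f n : ℂ) else 0) * χ n‖ *
        ‖∑ n ∈ range N₂, (if n ∈ S' then (g n : ℂ) else 0) * χ n‖ := by
    unfold blockSum
    refine sum_congr rfl fun q _ => ?_
    congr 1
    refine sum_congr rfl fun χ _ => ?_
    beta_reduce
    rw [norm_mul, sum_charTwist_eq_range χ f S (N := N₁), sum_charTwist_eq_range χ g S' (N := N₂)]
    · intro n hn
      rw [hN₂, Nat.lt_add_one_iff, Nat.le_floor_iff (by positivity), le_div_iff₀ hv0]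
      exact (mem_filter.1 hn).2
    · intro n hn
      rw [hN₁, Nat.lt_add_one_iff, Nat.le_floor_iff (by positivity)]
      exact hS n hn
  rw [e]
  refine h.trans ?_
  have q1 := sqrt_block_le (P := P) (s := √v) (N := N₁) (L := 1) (by positivity) (by positivity) (by positivity)
    (by positivity) hb1 (sum_norm_sq_indicator_le f S N₁ fun n _ => hf n)
  have q2 := sqrt_block_le (P := P) (s := √(x / v)) (N := N₂) (L := L) (by positivity) (by positivity) hL
    (by positivity) hb2 (sum_norm_sq_indicator_le g S' N₂ fun n hn => hg n (mem_Ioc.1 (mem_filter.1 hn).1).2)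
  have est : √v * √(x / v) = √x := by
    rw [← Real.sqrt_mul hv0.le, mul_div_cancel₀ _ hv0.ne']
  have hxx : √(x : ℝ) ^ 2 = x := Real.sq_sqrt (by positivity)
  have hTv : (T : ℝ) ≤ √v := Real.le_sqrt_of_sq_le (by push_cast at hv; exact hv.le)
  have hTx : (T : ℝ) ≤ √(x / v) := Real.le_sqrt_of_sq_le (by
    rw [le_div_iff₀ hv0]; push_cast at hxv; exact hxv.le)
  set s := √v
  set t := √(x / v)
  have hs : s ≤ √x / T := by
    rw [le_div_iff₀ (by positivity), ← est]
    exact mul_le_mul_of_nonneg_left hTx (by positivity)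
  have ht : t ≤ √x / T := by
    rw [le_div_iff₀ (by positivity), ← est, mul_comm]
    exact mul_le_mul_of_nonneg_right hTv (by positivity)
  calc _ ≤ 8 / (P : ℝ) * ((4 * 1 * (P * s + s ^ 2)) * (4 * L * (P * t + t ^ 2))) := by
        refine mul_le_mul_of_nonneg_left ?_ (by positivity)
        exact mul_le_mul q1 q2 (by positivity) (by positivity)
    _ = 128 * L * (P * (s * t) + (s * t) * (s + t) + (s * t) ^ 2 / P) := by
        field_simp
        ring
    _ ≤ 128 * L * (P * √x + √x * (√x / T + √x / T) + √x ^ 2 / P) := by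
        rw [est]
        gcongr
    _ = _ := by
        have : √(x : ℝ) * (√x / T + √x / T) = 2 * √x ^ 2 / T := by ring
        rw [this, hxx]

theorem sum_card_divisors_sq_edge_le {x : ℕ} (hx : 1 ≤ x) {η : ℝ} (hη : 0 < η) (hηx : 1 ≤ η ^ 4 * x) :
    ∑ k ∈ (Ioc 0 x).filter (fun k : ℕ => (x : ℝ) < (1 + η ^ 4) * k), (k.divisors.card : ℝ) ^ 2 ≤
      2 * η ^ 2 * x * (1 + Real.log x) ^ 8 := by
  have hL : 0 ≤ Real.log x := Real.log_natCast_nonneg x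
  set E := (Ioc 0 x).filter (fun k : ℕ => (x : ℝ) < (1 + η ^ 4) * k) with hE
  have h4 : ∑ k ∈ E, ((k.divisors.card : ℝ) ^ 2) ^ 2 ≤ x * (1 + Real.log x) ^ 16 := by
    calc _ ≤ ∑ k ∈ Ioc 0 x, ((k.divisors.card : ℝ) ^ 2) ^ 2 :=
          sum_le_sum_of_subset_of_nonneg (filter_subset _ _) fun _ _ _ => by positivity
      _ ≤ ∑ k ∈ Ioc 0 x, x * ((k.divisors.card : ℝ) ^ 4 / k) := by
          refine sum_le_sum fun k hk => ?_
          have hk0 : (0 : ℝ) < k := by exact_mod_cast (mem_Ioc.1 hk).1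
          have hkx : (k : ℝ) ≤ x := by exact_mod_cast (mem_Ioc.1 hk).2
          rw [← pow_mul, mul_div_assoc', le_div_iff₀ hk0, mul_comm]
          exact mul_le_mul_of_nonneg_right hkx (by positivity)
      _ ≤ _ := by
          rw [← mul_sum]
          exact mul_le_mul_of_nonneg_left (sum_card_divisors_pow_div_le 4 x) (by positivity)
  have hc : (E.card : ℝ) ≤ 2 * (η ^ 4 * x) := by
    have hsub : E ⊆ Ioc ⌊(x : ℝ) / (1 + η ^ 4)⌋₊ x := by
      intro k hk
      have := mem_filter.1 hk
      refine mem_Ioc.2 ⟨?_, (mem_Ioc.1 this.1).2⟩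
      rw [Nat.floor_lt (by positivity), div_lt_iff₀ (by positivity), mul_comm]
      exact this.2
    have h1 : (E.card : ℝ) ≤ ((x - ⌊(x : ℝ) / (1 + η ^ 4)⌋₊ : ℕ) : ℝ) := by
      have := card_le_card hsub
      rw [Nat.card_Ioc] at this
      exact_mod_cast this
    have h2 : ⌊(x : ℝ) / (1 + η ^ 4)⌋₊ ≤ x := by
      exact Nat.floor_le_of_le (div_le_self (by positivity) (by linarith [pow_pos hη 4]))
    rw [Nat.cast_sub h2] at h1
    have h3 := Nat.lt_floor_add_one ((x : ℝ) / (1 + η ^ 4))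
    have h4 : (1 - η ^ 4) * x ≤ (x : ℝ) / (1 + η ^ 4) := by
      rw [le_div_iff₀ (by positivity)]
      have : 0 ≤ (η ^ 4) ^ 2 * x := by positivity
      nlinarith
    linarith
  have hcs := sq_sum_le_card_mul_sum_sq (s := E) (f := fun k => (k.divisors.card : ℝ) ^ 2)
  refine abs_le_of_sq_le_sq' ?_ (by positivity) |>.2
  calc _ ≤ _ := hcs
    _ ≤ 2 * (η ^ 4 * x) * (x * (1 + Real.log x) ^ 16) := mul_le_mul hc h4 (sum_nonneg fun _ _ => by positivity) (by positivity)
    _ ≤ _ := by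
      have : 0 ≤ 2 * (η ^ 4 * x) * (x * (1 + Real.log x) ^ 16) := by positivity
      calc _ ≤ 2 * (2 * (η ^ 4 * x) * (x * (1 + Real.log x) ^ 16)) := by linarith
        _ = _ := by ring

theorem blockSum_edge_le {P x : ℕ} (hP : 1 ≤ P) (hPx : P ^ 2 ≤ x) {η : ℝ} (hη : 0 < η) (hηx : 1 ≤ η ^ 4 * x)
    (c : ℕ → ℂ) (hc : ∀ k ∈ Ioc 0 x, ‖c k‖ ≤ k.divisors.card * (1 + Real.log x))
    (hc0 : ∀ k ∈ Ioc 0 x, (1 + η ^ 4) * k ≤ x → c k = 0) :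
    blockSum P (fun q χ => ‖∑ k ∈ Ioc 0 x, c k * χ k‖) ≤ 96 * η * x * (1 + Real.log x) ^ 5 := by
  have hx : 1 ≤ x := le_trans (Nat.one_le_pow 2 P hP) hPx
  have hx1 : (1 : ℝ) ≤ x := by exact_mod_cast hx
  have hL : 0 ≤ Real.log x := Real.log_natCast_nonneg x
  set c' : ℕ → ℂ := fun k => if k ∈ Ioc 0 x then c k else 0 with hc'
  have e : blockSum P (fun q χ => ‖∑ k ∈ Ioc 0 x, c k * χ k‖) =
      ∑ q ∈ Ioc P (2 * P), (1 / (q.totient : ℝ)) * ∑ χ ∈ primChars q, ‖∑ n ∈ range (x + 1), c' n * χ n‖ := by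
    unfold blockSum
    refine sum_congr rfl fun q _ => ?_
    congr 1
    refine sum_congr rfl fun χ _ => ?_
    rw [← sum_Ioc_zero_eq_range (fun n => c' n * χ n) (by simp [hc'])]
    refine congrArg _ (sum_congr rfl fun k hk => ?_)
    simp only [hc', if_pos hk]
  rw [e]
  refine (sum_block_le P (x + 1) hP c').trans ?_
  have hs : ∑ n ∈ range (x + 1), ‖c' n‖ ^ 2 ≤ (1 + Real.log x) ^ 2 * (2 * η ^ 2 * x * (1 + Real.log x) ^ 8) := by
    refine le_trans ?_ (mul_le_mul_of_nonneg_left (sum_card_divisors_sq_edge_le hx hη hηx) (by positivity))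
    rw [← sum_Ioc_zero_eq_range (fun n => ‖c' n‖ ^ 2) (by simp [hc']), mul_sum, sum_filter]
    refine sum_le_sum fun k hk => ?_
    simp only [hc', if_pos hk]
    split_ifs with h
    · rw [← mul_pow, mul_comm]
      exact pow_le_pow_left₀ (norm_nonneg _) (hc k hk) 2
    · rw [hc0 k hk (not_lt.1 h)]
      simp
  have hPx' : (P : ℝ) ^ 2 ≤ x := by exact_mod_cast hPx
  have : √((4 * (P : ℝ) ^ 2 + 2 * (x + 1 : ℕ)) * ∑ n ∈ range (x + 1), ‖c' n‖ ^ 2) ≤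
      4 * η * x * (1 + Real.log x) ^ 5 := by
    rw [Real.sqrt_le_iff]
    refine ⟨by positivity, ?_⟩
    calc _ ≤ (8 * (x : ℝ)) * ((1 + Real.log x) ^ 2 * (2 * η ^ 2 * x * (1 + Real.log x) ^ 8)) := by
          refine mul_le_mul ?_ hs (by positivity) (by positivity)
          push_cast
          linarith
      _ = _ := by ring
  linarith

theorem ne_one_of_mem_primChars {q : ℕ} [NeZero q] (hq : q ≠ 1) {χ : DirichletCharacter ℂ q} (h : χ ∈ primChars q) :
    χ ≠ 1 := by
  rintro rfl
  have h1 := mem_primChars.1 h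
  rw [DirichletCharacter.isPrimitive_def, DirichletCharacter.conductor_one] at h1
  exact hq h1.symm

theorem blockSum_vonMangoldt_le {P x T : ℕ} (hP : 1 ≤ P) (hPx : P ^ 2 ≤ x) (hT : 1 ≤ T) (hTx : T ^ 2 ≤ x)
    {η : ℝ} (hη : 0 < η) (hη1 : η ≤ 1) (hηx : 1 ≤ η ^ 4 * x) :
    blockSum P (fun q χ => ‖∑ n ∈ Ioc 0 x, charTwist χ ArithmeticFunction.vonMangoldt n‖) ≤
      8 * P ^ 2 * T ^ 4 * (1 + Real.log x) +
      3 * (1 + Real.log x) / η ^ 4 * (128 * (1 + Real.log x) * (P * √x + 2 * x / T + x / P)) +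
      96 * η * x * (1 + Real.log x) ^ 5 := by
  have hx : 1 ≤ x := le_trans (Nat.one_le_pow 2 P hP) hPx
  have hL : 0 ≤ Real.log x := Real.log_natCast_nonneg x
  set L := Real.log x with hLdef
  have hδ : 0 < η ^ 4 := by positivity
  have hδ1 : η ^ 4 ≤ 1 := pow_le_one₀ hη.le hη1
  set δ := η ^ 4 with hδdef
  set f : ArithmeticFunction ℝ := moebiusReal - truncLe (T ^ 2) moebiusReal with hf
  set g := vaughanB (T ^ 2) with hg
  have hlog : δ / 2 ≤ Real.log (1 + δ) := by
    have := Real.one_sub_inv_le_log_of_pos (show 0 < 1 + δ by linarith)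
    refine le_trans ?_ this
    rw [div_le_iff₀ two_pos, sub_mul, inv_mul_eq_div, le_sub_iff_add_le, ← le_sub_iff_add_le', div_le_iff₀ (by linarith)]
    nlinarith
  have hlog0 : 0 < Real.log (1 + δ) := by linarith
  set j : ℕ → ℕ := fun m => ⌊Real.log m / Real.log (1 + δ)⌋₊ with hj
  set v : ℕ → ℝ := fun i => (1 + δ) ^ (i + 1) with hv
  have hjv : ∀ m ∈ Ioc 0 x, (m : ℝ) ≤ v (j m) := by
    intro m hm
    have hm0 : (0 : ℝ) < m := by exact_mod_cast (mem_Ioc.1 hm).1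
    have h1 := Nat.lt_floor_add_one (Real.log m / Real.log (1 + δ))
    rw [div_lt_iff₀ hlog0] at h1
    rw [← Real.log_le_log_iff hm0 (by positivity), Real.log_pow]
    push_cast
    exact h1.le
  have hvj : ∀ m ∈ Ioc 0 x, v (j m) ≤ (1 + δ) * m := by
    intro m hm
    have hm0 : (0 : ℝ) < m := by exact_mod_cast (mem_Ioc.1 hm).1
    have h1 := Nat.floor_le (show 0 ≤ Real.log m / Real.log (1 + δ) from
      div_nonneg (Real.log_natCast_nonneg m) hlog0.le)
    rw [le_div_iff₀ hlog0] at h1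
    rw [hv]
    simp only
    rw [pow_succ, mul_comm]
    refine mul_le_mul_of_nonneg_left ?_ (by positivity)
    rw [← Real.log_le_log_iff (by positivity) hm0, Real.log_pow]
    exact h1
  set J := ⌊2 * L / δ⌋₊ + 1 with hJ
  have hjJ : ∀ m ∈ Ioc 0 x, j m < J := by
    intro m hm
    have hm0 : (0 : ℝ) < m := by exact_mod_cast (mem_Ioc.1 hm).1
    rw [hJ, Nat.lt_add_one_iff]
    refine Nat.floor_le_floor ?_
    rw [div_le_div_iff₀ hlog0 hδ]
    have h1 : Real.log m ≤ L := Real.log_le_log hm0 (by exact_mod_cast (mem_Ioc.1 hm).2)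
    nlinarith [Real.log_natCast_nonneg m]
  have hJle : (J : ℝ) ≤ 3 * (1 + L) / δ := by
    rw [hJ]
    push_cast
    have h1 := Nat.floor_le (show 0 ≤ 2 * L / δ by positivity)
    have h2 : 1 ≤ 1 / δ := by rw [le_div_iff₀ hδ]; linarith
    have h3 : 0 ≤ L / δ := by positivity
    have e1 : 3 * (1 + L) / δ = 2 * L / δ + L / δ + 3 * (1 / δ) := by ring
    linarith
  have hf1 : ∀ n, |f n| ≤ 1 := by
    intro n
    rw [hf, moebiusReal_sub_trunc_apply]
    split_ifs
    · simp
    · exact abs_moebiusReal_le n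
  have hgL : ∀ n ≤ x, |g n| ≤ 1 + L := by
    intro n hn
    rcases Nat.eq_zero_or_pos n with rfl | hn0
    · simp; linarith
    refine (abs_vaughanB_le _ n).trans ?_
    have : Real.log n ≤ L := Real.log_le_log (by exact_mod_cast hn0) (by exact_mod_cast hn)
    linarith
  set c : ℕ → ℂ := fun k => ∑ p ∈ k.divisorsAntidiagonal.filter (fun p => (x : ℝ) < p.2 * v (j p.1)),
        ((f p.1 * g p.2 : ℝ) : ℂ) with hc
  have hbox : ∀ i, blockSum P (fun q χ => ‖(∑ m ∈ (Ioc 0 x).filter (fun m => j m = i), charTwist χ f m) *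
      ∑ n ∈ (Ioc 0 x).filter (fun n : ℕ => (n : ℝ) * v i ≤ x), charTwist χ g n‖) ≤
      128 * (1 + L) * (P * √x + 2 * x / T + x / P) := by
    intro i
    refine blockSum_box_le hP hT (by linarith) hf1 (fun n hn => ?_) hgL (fun n hn => vaughanB_eq_zero hn) _ _ ?_
    · rw [hf, moebiusReal_sub_trunc_apply, if_pos hn]
    · intro m hm
      have := mem_filter.1 hm
      rw [← this.2]
      exact hjv m this.1
  have hedge : blockSum P (fun q χ => ‖∑ k ∈ Ioc 0 x, c k * χ k‖) ≤ 96 * η * x * (1 + L) ^ 5 := by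
    refine blockSum_edge_le hP hPx hη hηx c (fun k hk => ?_) (fun k hk hkx => ?_)
    · have hb : ∀ p ∈ k.divisorsAntidiagonal.filter (fun p => (x : ℝ) < p.2 * v (j p.1)),
          ‖((f p.1 * g p.2 : ℝ) : ℂ)‖ ≤ 1 + L := by
        intro p hp
        have hp1 := (Nat.mem_divisorsAntidiagonal.1 (mem_filter.1 hp).1).1
        have hp2 : p.2 ≤ x := (Nat.le_of_dvd (mem_Ioc.1 hk).1 ⟨p.1, by rw [← hp1, mul_comm]⟩).trans (mem_Ioc.1 hk).2
        rw [Complex.norm_real, Real.norm_eq_abs, abs_mul]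
        calc _ ≤ 1 * (1 + L) := mul_le_mul (hf1 _) (hgL _ hp2) (abs_nonneg _) zero_le_one
          _ = _ := one_mul _
      refine (norm_sum_le_of_le _ hb).trans ?_
      rw [sum_const, nsmul_eq_mul]
      refine mul_le_mul_of_nonneg_right ?_ (by linarith)
      rw [← Nat.map_div_right_divisors, ← card_map (α := ℕ)]
      exact_mod_cast card_filter_le _ _
    · rw [hc]
      simp only
      refine sum_eq_zero fun p hp => ?_
      have hp' := mem_filter.1 hp
      have hp1 := (Nat.mem_divisorsAntidiagonal.1 hp'.1).1
      have hm : p.1 ∈ Ioc 0 x := by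
        refine mem_Ioc.2 ⟨Nat.pos_of_ne_zero fun h => ?_, (Nat.le_of_dvd (mem_Ioc.1 hk).1 ⟨p.2, hp1.symm⟩).trans (mem_Ioc.1 hk).2⟩
        rw [h, zero_mul] at hp1
        exact (mem_Ioc.1 hk).1.ne hp1
      have h1 := mul_le_mul_of_nonneg_left (hvj p.1 hm) (show (0 : ℝ) ≤ p.2 by positivity)
      have h2 : (p.2 : ℝ) * ((1 + δ) * p.1) = (1 + δ) * k := by
        rw [← hp1]; push_cast; ring
      linarith [hp'.2]
  calc _ ≤ blockSum P (fun q χ => (∑ i ∈ range J, ‖(∑ m ∈ (Ioc 0 x).filter (fun m => j m = i), charTwist χ f m) *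
      ∑ n ∈ (Ioc 0 x).filter (fun n : ℕ => (n : ℝ) * v i ≤ x), charTwist χ g n‖ + ‖∑ k ∈ Ioc 0 x, c k * χ k‖) +
      8 * P * T ^ 4 * (1 + L)) := by
        refine blockSum_mono P fun q hq χ hχ => ?_
        obtain ⟨hq1, hq2⟩ := mem_Ioc.1 hq
        have : NeZero q := ⟨by omega⟩
        refine (norm_sum_vonMangoldt_le_bilinear (by omega) (ne_one_of_mem_primChars (by omega) hχ)
          (Nat.one_le_pow 2 T hT) hTx).trans (add_le_add ?_ ?_)
        · rw [sum_mul_eq_box_add_edge χ f g x J j v hjJ hjv]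
          exact (norm_add_le _ _).trans (add_le_add_left (norm_sum_le _ _) _)
        · have : (q : ℝ) ≤ 2 * P := by exact_mod_cast hq2
          push_cast
          calc 4 * (q : ℝ) * (T ^ 2) ^ 2 * (1 + L) ≤ 4 * (2 * P) * (T ^ 2) ^ 2 * (1 + L) := by gcongr
            _ = _ := by ring
    _ ≤ (∑ i ∈ range J, 128 * (1 + L) * (P * √x + 2 * x / T + x / P) + 96 * η * x * (1 + L) ^ 5) +
        P * (8 * P * T ^ 4 * (1 + L)) := by
        rw [blockSum_add, blockSum_add, blockSum_sum]
        exact add_le_add (add_le_add (sum_le_sum fun i _ => hbox i) hedge)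
          (blockSum_le P (by positivity) fun _ _ _ _ => le_rfl)
    _ ≤ _ := by
        rw [sum_const, card_range, nsmul_eq_mul]
        have := mul_le_mul_of_nonneg_right hJle (show 0 ≤ 128 * (1 + L) * (P * √x + 2 * x / T + x / P) by positivity)
        linarith

theorem exists_blockSum_vonMangoldt_le (A : ℕ) : ∃ B : ℕ, ∃ C : ℝ, 0 ≤ C ∧ ∀ x P : ℕ, 1 ≤ P →
    (P : ℝ) ^ 2 * (1 + Real.log x) ^ (2 * B) ≤ x →
    blockSum P (fun q χ => ‖∑ n ∈ Ioc 0 x, charTwist χ ArithmeticFunction.vonMangoldt n‖) ≤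
      C * x / (1 + Real.log x) ^ A := by
  set s := A + 2 + 4 * (A + 5) with hs
  obtain ⟨C₀, hC₀, hSW⟩ := siegel_walfisz (2 * s + A)
  refine ⟨2 * s + 1 + A, 2 * C₀ + 2600, by linarith, fun x P hP hPx => ?_⟩
  have hlog : 0 ≤ Real.log x := Real.log_natCast_nonneg x
  set L := 1 + Real.log x with hL
  have hL1 : 1 ≤ L := by linarith
  have hL0 : 0 < L := by linarith
  have hP1 : (1 : ℝ) ≤ P := by exact_mod_cast hP
  have hLx : ∀ k ≤ 2 * (2 * s + 1 + A), (P : ℝ) ^ 2 * L ^ k ≤ x := fun k hk =>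
    (mul_le_mul_of_nonneg_left (pow_le_pow_right₀ hL1 hk) (by positivity)).trans hPx
  have hLx' : ∀ k ≤ 2 * (2 * s + 1 + A), L ^ k ≤ x := fun k hk => by
    have h1 := hLx k hk
    have h2 : 1 * L ^ k ≤ (P : ℝ) ^ 2 * L ^ k := mul_le_mul_of_nonneg_right (one_le_pow₀ hP1) (by positivity)
    linarith
  have hx1 : (1 : ℝ) ≤ x := by simpa using hLx' 0 (by omega)
  have hx1' : 1 ≤ x := by exact_mod_cast hx1
  rcases le_or_gt (L ^ s) P with hcase | hcase
  · set T := ⌊L ^ s⌋₊ with hT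
    have hT1 : 1 ≤ T := Nat.le_floor (by simpa using one_le_pow₀ hL1)
    have hT1' : (1 : ℝ) ≤ T := by exact_mod_cast hT1
    have hTL : (T : ℝ) ≤ L ^ s := Nat.floor_le (by positivity)
    have hTL2 : L ^ s ≤ 2 * T := by
      have := Nat.lt_floor_add_one (L ^ s)
      linarith
    have hTx : T ^ 2 ≤ x := by
      have : (T : ℝ) ^ 2 ≤ x := by
        refine (pow_le_pow_left₀ (by positivity) hTL 2).trans ?_
        rw [← pow_mul]
        exact hLx' _ (by omega)
      exact_mod_cast this
    have hPx2 : P ^ 2 ≤ x := by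
      have := hLx 0 (by omega)
      rw [pow_zero, mul_one] at this
      exact_mod_cast this
    have h := blockSum_vonMangoldt_le hP hPx2 hT1 hTx (η := 1 / L ^ (A + 5)) (by positivity)
      (by rw [div_le_one (by positivity)]; exact one_le_pow₀ hL1)
      (by
        rw [div_pow, one_pow, ← pow_mul, one_div, inv_mul_eq_div, le_div_iff₀ (by positivity), one_mul]
        exact hLx' _ (by omega))
    rw [← hL] at h
    refine h.trans ?_
    have hA : 0 < L ^ A := by positivity
    have t1 : 8 * (P : ℝ) ^ 2 * T ^ 4 * L ≤ 8 * (x / L ^ A) := by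
      have : (P : ℝ) ^ 2 * T ^ 4 * L ≤ x / L ^ A := by
        rw [le_div_iff₀ hA]
        calc (P : ℝ) ^ 2 * T ^ 4 * L * L ^ A ≤ (P : ℝ) ^ 2 * (L ^ s) ^ 4 * L * L ^ A := by gcongr
          _ = (P : ℝ) ^ 2 * L ^ (s * 4 + 1 + A) := by ring
          _ ≤ x := hLx _ (by omega)
      linarith
    have t2 : (P * √x + 2 * x / T + x / P) ≤ 6 * (x / L ^ s) := by
      have a1 : (P : ℝ) * √x ≤ x / L ^ s := by
        have h1 : (P : ℝ) * L ^ s ≤ √x := Real.le_sqrt_of_sq_le (by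
          rw [mul_pow, ← pow_mul]; exact hLx _ (by omega))
        rw [le_div_iff₀ (by positivity)]
        calc (P : ℝ) * √x * L ^ s = (P * L ^ s) * √x := by ring
          _ ≤ √x * √x := mul_le_mul_of_nonneg_right h1 (Real.sqrt_nonneg _)
          _ = x := Real.mul_self_sqrt (by positivity)
      have a2 : 2 * (x : ℝ) / T ≤ 4 * (x / L ^ s) := by
        rw [mul_div_assoc', div_le_div_iff₀ (by positivity) (by positivity)]
        nlinarith
      have a3 : (x : ℝ) / P ≤ x / L ^ s := div_le_div_of_nonneg_left (by positivity) (by positivity) hcase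
      linarith
    have t3 : 3 * L / (1 / L ^ (A + 5)) ^ 4 * (128 * L * (P * √x + 2 * x / T + x / P)) ≤ 2304 * (x / L ^ A) := by
      calc _ ≤ 3 * L / (1 / L ^ (A + 5)) ^ 4 * (128 * L * (6 * (x / L ^ s))) := by gcongr
        _ = 2304 * (x / L ^ A) := by
          have : L ^ s = L ^ A * L ^ 2 * (L ^ (A + 5)) ^ 4 := by rw [hs]; ring
          rw [this]
          field_simp
          norm_num
    have t4 : 96 * (1 / L ^ (A + 5)) * x * L ^ 5 = 96 * (x / L ^ A) := by
      rw [pow_add]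
      field_simp
    have e : (2 * C₀ + 2600) * (x : ℝ) / L ^ A = (2 * C₀ + 2600) * (x / L ^ A) := mul_div_assoc _ _ _
    rw [e]
    have : 0 ≤ (x : ℝ) / L ^ A := by positivity
    nlinarith
  · have hb : ∀ q ∈ Ioc P (2 * P), ∀ χ ∈ primChars q,
        ‖∑ n ∈ Ioc 0 x, charTwist χ ArithmeticFunction.vonMangoldt n‖ ≤ C₀ * (2 * P) * x / L ^ (2 * s + A) := by
      intro q hq χ hχ
      obtain ⟨hq1, hq2⟩ := mem_Ioc.1 hq
      have : NeZero q := ⟨by omega⟩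
      have h := hSW q χ (mem_primChars.1 hχ) (ne_one_of_mem_primChars (by omega) hχ) x hx1
      rw [Nat.floor_natCast] at h
      rw [sum_Ioc_zero_eq_range (fun n => charTwist χ ArithmeticFunction.vonMangoldt n) (by simp)]
      simp only [charTwist_apply]
      refine h.trans ?_
      have : (q : ℝ) ≤ 2 * P := by exact_mod_cast hq2
      gcongr
    refine (blockSum_le P (by positivity) hb).trans ?_
    rw [mul_div_assoc', div_le_div_iff₀ (by positivity) (by positivity)]
    have hPP : (P : ℝ) ^ 2 ≤ L ^ (2 * s) := by
      rw [mul_comm, pow_mul]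
      exact pow_le_pow_left₀ (by positivity) hcase.le 2
    calc (P : ℝ) * (C₀ * (2 * P) * x) * L ^ A = 2 * C₀ * x * L ^ A * P ^ 2 := by ring
      _ ≤ 2 * C₀ * x * L ^ A * L ^ (2 * s) := by gcongr
      _ ≤ (2 * C₀ + 2600) * x * L ^ A * L ^ (2 * s) := by gcongr; linarith
      _ = _ := by ring

theorem sum_Ioc_le_sum_dyadic {F : ℕ → ℝ} (hF : ∀ n, 0 ≤ F n) (I Q : ℕ) (hQ : Q ≤ 2 ^ I) :
    ∑ q ∈ Ioc 1 Q, F q ≤ ∑ i ∈ range I, ∑ q ∈ Ioc (2 ^ i) (2 * 2 ^ i), F q := by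
  refine (sum_le_sum_of_subset_of_nonneg (Ioc_subset_Ioc_right hQ) fun _ _ _ => hF _).trans (le_of_eq ?_)
  clear hQ
  induction I with
  | zero => simp
  | succ I ih =>
    rw [sum_range_succ, ← ih, pow_succ']
    exact (sum_Ioc_consecutive _ Nat.one_le_two_pow (by omega)).symm

theorem exists_sum_primChars_vonMangoldt_le (A : ℕ) : ∃ B : ℕ, ∃ C : ℝ, 0 ≤ C ∧ ∀ x Q : ℕ, 1 ≤ x →
    (Q : ℝ) ^ 2 * (1 + Real.log x) ^ (2 * B) ≤ x →
    ∑ q ∈ Ioc 1 Q, (1 / (q.totient : ℝ)) *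
      ∑ χ ∈ primChars q, ‖∑ n ∈ Ioc 0 x, charTwist χ ArithmeticFunction.vonMangoldt n‖ ≤
      C * x / (1 + Real.log x) ^ A := by
  obtain ⟨B, C, hC, h⟩ := exists_blockSum_vonMangoldt_le (A + 1)
  refine ⟨B, 2 * C, by positivity, fun x Q hx hQ => ?_⟩
  have hlog : 0 ≤ Real.log x := Real.log_natCast_nonneg x
  set L := 1 + Real.log x with hL
  have hL1 : 1 ≤ L := by linarith
  have hx0 : (0 : ℝ) < x := by exact_mod_cast hx
  refine (sum_Ioc_le_sum_dyadic (fun n => mul_nonneg (by positivity) (sum_nonneg fun _ _ => norm_nonneg _))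
    (Nat.clog 2 Q) Q (Nat.le_pow_clog (by norm_num) Q)).trans ?_
  have hlt : ∀ i < Nat.clog 2 Q, 2 ^ i ≤ Q := fun i hi => ((Nat.lt_clog_iff_pow_lt (by norm_num)).1 hi).le
  have hb : ∀ i ∈ range (Nat.clog 2 Q), blockSum (2 ^ i)
      (fun q χ => ‖∑ n ∈ Ioc 0 x, charTwist χ ArithmeticFunction.vonMangoldt n‖) ≤ C * x / L ^ (A + 1) := by
    intro i hi
    refine h x _ Nat.one_le_two_pow ((mul_le_mul_of_nonneg_right ?_ (by positivity)).trans hQ)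
    exact pow_le_pow_left₀ (by positivity) (by exact_mod_cast hlt i (mem_range.1 hi)) 2
  refine (sum_le_sum hb).trans ?_
  rw [sum_const, card_range, nsmul_eq_mul]
  have hI : (Nat.clog 2 Q : ℝ) ≤ 2 * L := by
    rcases Nat.eq_zero_or_pos (Nat.clog 2 Q) with h0 | h0
    · rw [h0]; push_cast; linarith
    have h1 := hlt (Nat.clog 2 Q - 1) (by omega)
    have hQx : (Q : ℝ) ≤ x := by
      rcases Nat.eq_zero_or_pos Q with hz | hz
      · rw [hz]; push_cast; linarith
      have hq1 : (1 : ℝ) ≤ Q := by exact_mod_cast hz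
      have : 1 ≤ L ^ (2 * B) := one_le_pow₀ hL1
      nlinarith
    have h2 : ((2 : ℝ) ^ (Nat.clog 2 Q - 1)) ≤ x := le_trans (by exact_mod_cast h1) hQx
    have h3 := Real.log_le_log (by positivity) h2
    rw [Real.log_pow, Nat.cast_sub h0] at h3
    have := Real.log_two_gt_d9
    push_cast at h3
    nlinarith
  calc (Nat.clog 2 Q : ℝ) * (C * x / L ^ (A + 1)) ≤ 2 * L * (C * x / L ^ (A + 1)) :=
        mul_le_mul_of_nonneg_right hI (by positivity)
    _ = _ := by
      rw [pow_succ]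
      field_simp

theorem sum_vonMangoldt_not_coprime_le (q x : ℕ) (hq : q ≠ 0) (hx : 1 ≤ x) :
    ∑ n ∈ (Ioc 0 x).filter (fun n => ¬ n.Coprime q), ArithmeticFunction.vonMangoldt n ≤
      Real.log q + 2 * √x * Real.log x := by
  rw [← sum_filter_add_sum_filter_not _ Nat.Prime]
  refine add_le_add ?_ ?_
  · have hsub : ((Ioc 0 x).filter (fun n => ¬ n.Coprime q)).filter Nat.Prime ⊆ q.primeFactors := by
      intro p hp
      rw [mem_filter, mem_filter] at hp
      rw [Nat.mem_primeFactors]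
      exact ⟨hp.2, by_contra fun h => hp.1.2 ((Nat.Prime.coprime_iff_not_dvd hp.2).2 h), hq⟩
    calc _ ≤ ∑ p ∈ q.primeFactors, ArithmeticFunction.vonMangoldt p :=
          sum_le_sum_of_subset_of_nonneg hsub fun _ _ _ => ArithmeticFunction.vonMangoldt_nonneg
      _ ≤ ∑ p ∈ q.divisors, ArithmeticFunction.vonMangoldt p :=
          sum_le_sum_of_subset_of_nonneg (fun p hp => Nat.mem_divisors.2 ⟨Nat.dvd_of_mem_primeFactors hp, hq⟩)
            fun _ _ _ => ArithmeticFunction.vonMangoldt_nonneg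
      _ = _ := ArithmeticFunction.vonMangoldt_sum
  · have h := Chebyshev.psi_sub_theta_le (x := (x : ℝ)) (by exact_mod_cast hx)
    rw [Chebyshev.psi_sub_theta_eq_sum_not_prime, Nat.floor_natCast] at h
    refine le_trans (sum_le_sum_of_subset_of_nonneg ?_ fun _ _ _ => ArithmeticFunction.vonMangoldt_nonneg) h
    exact filter_subset_filter _ (filter_subset _ _)

theorem norm_sum_charTwist_sub_le {q : ℕ} [NeZero q] (χ : DirichletCharacter ℂ q) (ρ : ℕ → ℂ) (hρ : ∀ n, ‖ρ n‖ ≤ 1)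
    (h : ∀ n : ℕ, n.Coprime q → ρ n = χ n) {x : ℕ} (hx : 1 ≤ x) :
    ‖∑ n ∈ Ioc 0 x, charTwist χ ArithmeticFunction.vonMangoldt n -
      ∑ n ∈ Ioc 0 x, ρ n * (ArithmeticFunction.vonMangoldt n : ℂ)‖ ≤ Real.log q + 2 * √x * Real.log x := by
  rw [← sum_sub_distrib]
  refine le_trans ?_ (sum_vonMangoldt_not_coprime_le q x (NeZero.ne q) hx)
  rw [sum_filter]
  refine norm_sum_le_of_le _ fun n _ => ?_
  rw [charTwist_apply, ← sub_mul, norm_mul, Complex.norm_real, Real.norm_of_nonneg ArithmeticFunction.vonMangoldt_nonneg]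
  split_ifs with hc
  · rw [h n hc, sub_self, norm_zero, zero_mul]
  · have : χ (n : ZMod q) = 0 := χ.map_nonunit fun hu => hc ((ZMod.isUnit_iff_coprime n q).1 hu)
    rw [this, zero_sub, norm_neg]
    exact mul_le_of_le_one_left ArithmeticFunction.vonMangoldt_nonneg (hρ n)

theorem primitiveCharacter_natCast {q : ℕ} (χ : DirichletCharacter ℂ q) {n : ℕ} (h : n.Coprime q) :
    χ.primitiveCharacter n = χ n := by
  have := χ.primitiveCharacter_apply_of_isCoprime (a := (n : ℤ)) (Nat.isCoprime_iff_coprime.2 h)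
  simpa using this

theorem sum_ne_one_primitive_le {q : ℕ} [NeZero q] (F : (d : ℕ) → DirichletCharacter ℂ d → ℝ)
    (hF : ∀ d χ, 0 ≤ F d χ) :
    ∑ χ ∈ (univ : Finset (DirichletCharacter ℂ q)).erase 1, F χ.conductor χ.primitiveCharacter ≤
      ∑ d ∈ q.divisors.erase 1, ∑ χ ∈ primChars d, F d χ := by
  rw [sum_sigma']
  let e : DirichletCharacter ℂ q → (Σ d, DirichletCharacter ℂ d) := fun χ => ⟨χ.conductor, χ.primitiveCharacter⟩
  have hinj : Function.Injective e := by
    have key : ∀ s : (Σ d, DirichletCharacter ℂ d), ∀ χ, e χ = s → ∀ hd : s.1 ∣ q,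
        χ = DirichletCharacter.changeLevel hd s.2 := by
      rintro s χ rfl hd
      exact χ.changeLevel_primitiveCharacter.symm
    intro χ χ' h
    rw [key _ χ h χ'.conductor_dvd_level, ← key _ χ' rfl χ'.conductor_dvd_level]
  calc _ = ∑ s ∈ ((univ : Finset (DirichletCharacter ℂ q)).erase 1).map ⟨e, hinj⟩, F s.1 s.2 := by
        rw [sum_map]; rfl
    _ ≤ _ := by
        refine sum_le_sum_of_subset_of_nonneg ?_ fun _ _ _ => hF _ _
        intro s hs
        obtain ⟨χ, hχ, rfl⟩ := mem_map.1 hs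
        simp only [Function.Embedding.coeFn_mk, e, mem_sigma, mem_erase, Nat.mem_divisors]
        refine ⟨⟨fun h => (mem_erase.1 hχ).1 (χ.eq_one_iff_conductor_eq_one.2 h), χ.conductor_dvd_level, NeZero.ne q⟩, ?_⟩
        exact mem_primChars.2 χ.primitiveCharacter_isPrimitive

/-- The error term for primes in residue classes in terms of primitive characters. -/
theorem abs_sum_vonMangoldt_residue_sub_le {q : ℕ} [NeZero q] {a : ZMod q} (ha : IsUnit a) {x : ℕ} (hx : 1 ≤ x) :
    |∑ n ∈ (Ioc 0 x).filter (fun n : ℕ => (n : ZMod q) = a), ArithmeticFunction.vonMangoldt n - x / q.totient| ≤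
      Real.log q + 2 * √x * Real.log x + (1 / (q.totient : ℝ)) *
        (|∑ n ∈ Ioc 0 x, ArithmeticFunction.vonMangoldt n - x| + ∑ d ∈ q.divisors.erase 1, ∑ χ ∈ primChars d,
          ‖∑ n ∈ Ioc 0 x, charTwist χ ArithmeticFunction.vonMangoldt n‖) := by
  have ht : (0 : ℝ) < q.totient := by exact_mod_cast Nat.totient_pos.2 (NeZero.pos q)
  set Y := Real.log q + 2 * √x * Real.log x with hY
  set S : DirichletCharacter ℂ q → ℂ := fun χ => ∑ n ∈ Ioc 0 x, charTwist χ ArithmeticFunction.vonMangoldt n with hS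
  have horth : ((q.totient * ∑ n ∈ (Ioc 0 x).filter (fun n : ℕ => (n : ZMod q) = a),
      ArithmeticFunction.vonMangoldt n : ℝ) : ℂ) = ∑ χ : DirichletCharacter ℂ q, χ a⁻¹ * S χ := by
    simp only [hS, mul_sum]
    rw [sum_comm, sum_filter]
    push_cast
    refine sum_congr rfl fun n _ => ?_
    have h := DirichletCharacter.sum_char_inv_mul_char_eq ℂ ha (n : ZMod q)
    simp only [charTwist_apply, ← mul_assoc]
    rw [← sum_mul, h]
    by_cases hn : (n : ZMod q) = a
    · rw [if_pos hn, if_pos hn.symm]; push_cast; rfl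
    · rw [if_neg hn, if_neg (Ne.symm hn)]; simp
  have h1 : ‖S 1 - x‖ ≤ Y + |∑ n ∈ Ioc 0 x, ArithmeticFunction.vonMangoldt n - x| := by
    have := norm_sum_charTwist_sub_le (1 : DirichletCharacter ℂ q) (fun _ => 1) (by simp)
      (fun n hn => by rw [MulChar.one_apply ((ZMod.isUnit_iff_coprime n q).2 hn)]) hx
    have h2 : S 1 - x = (S 1 - ∑ n ∈ Ioc 0 x, 1 * (ArithmeticFunction.vonMangoldt n : ℂ)) +
        ((∑ n ∈ Ioc 0 x, ArithmeticFunction.vonMangoldt n - x : ℝ) : ℂ) := by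
      push_cast
      simp only [one_mul]
      ring
    rw [h2]
    refine (norm_add_le _ _).trans (add_le_add this ?_)
    rw [Complex.norm_real, Real.norm_eq_abs]
  have h2 : ∀ χ : DirichletCharacter ℂ q, ‖S χ‖ ≤ Y + ‖∑ n ∈ Ioc 0 x, charTwist χ.primitiveCharacter
      ArithmeticFunction.vonMangoldt n‖ := by
    intro χ
    have := norm_sum_charTwist_sub_le χ (fun n => χ.primitiveCharacter n) (fun n => DirichletCharacter.norm_le_one _ _)
      (fun n hn => primitiveCharacter_natCast χ hn) hx
    simp only [← charTwist_apply] at this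
    have h3 := norm_le_norm_sub_add (S χ) (∑ n ∈ Ioc 0 x, charTwist χ.primitiveCharacter ArithmeticFunction.vonMangoldt n)
    linarith
  have ha1 : (1 : DirichletCharacter ℂ q) a⁻¹ = 1 := by
    rw [MulChar.one_apply (IsUnit.of_mul_eq_one a (ZMod.inv_mul_of_unit a ha))]
  have hmain : q.totient * |∑ n ∈ (Ioc 0 x).filter (fun n : ℕ => (n : ZMod q) = a), ArithmeticFunction.vonMangoldt n -
      x / q.totient| ≤ q.totient * Y + (|∑ n ∈ Ioc 0 x, ArithmeticFunction.vonMangoldt n - x| +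
        ∑ d ∈ q.divisors.erase 1, ∑ χ ∈ primChars d, ‖∑ n ∈ Ioc 0 x, charTwist χ ArithmeticFunction.vonMangoldt n‖) := by
    rw [← abs_of_pos ht, ← abs_mul, mul_sub, abs_of_pos ht, mul_div_cancel₀ _ ht.ne', ← Real.norm_eq_abs,
      ← Complex.norm_real, Complex.ofReal_sub, horth, ← add_sum_erase _ _ (mem_univ (1 : DirichletCharacter ℂ q)), ha1, one_mul,
      Complex.ofReal_natCast, add_sub_right_comm]
    have h3 : ‖∑ χ ∈ (univ : Finset (DirichletCharacter ℂ q)).erase 1, χ a⁻¹ * S χ‖ ≤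
        ∑ χ ∈ (univ : Finset (DirichletCharacter ℂ q)).erase 1, (Y + ‖∑ n ∈ Ioc 0 x, charTwist χ.primitiveCharacter
      ArithmeticFunction.vonMangoldt n‖) := by
      refine norm_sum_le_of_le _ fun χ _ => ?_
      rw [norm_mul]
      exact (mul_le_of_le_one_left (norm_nonneg _) (DirichletCharacter.norm_le_one _ _)).trans (h2 χ)
    rw [sum_add_distrib, sum_const, card_erase_of_mem (mem_univ _), nsmul_eq_mul, card_univ, ← Nat.card_eq_fintype_card,
      DirichletCharacter.card_eq_totient_of_hasEnoughRootsOfUnity ℂ q,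
      Nat.cast_sub (Nat.totient_pos.2 (NeZero.pos q)), Nat.cast_one] at h3
    have h4 := sum_ne_one_primitive_le (q := q)
      (fun d χ => ‖∑ n ∈ Ioc 0 x, charTwist χ ArithmeticFunction.vonMangoldt n‖) (fun _ _ => norm_nonneg _)
    refine (norm_add_le _ _).trans ?_
    linarith
  rw [← mul_le_mul_iff_right₀ ht, mul_add, ← mul_assoc, mul_one_div_cancel ht.ne', one_mul]
  exact hmain

theorem theta_nonneg (n : ℕ) : 0 ≤ theta n := by
  rw [theta]
  split_ifs
  · exact Real.log_natCast_nonneg n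
  · exact le_rfl

theorem theta_le_log (n : ℕ) : theta n ≤ Real.log n := by
  rw [theta]
  split_ifs
  · exact le_rfl
  · exact Real.log_natCast_nonneg n

theorem abs_sum_theta_sub_vonMangoldt_le {x : ℕ} (hx : 1 ≤ x) (S : Finset ℕ) (hS : S ⊆ Ioc 0 x) :
    |∑ n ∈ S, theta n - ∑ n ∈ S, ArithmeticFunction.vonMangoldt n| ≤ 2 * √x * Real.log x := by
  have h := Chebyshev.psi_sub_theta_le (x := (x : ℝ)) (by exact_mod_cast hx)
  rw [Chebyshev.psi_sub_theta_eq_sum_not_prime, Nat.floor_natCast] at h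
  refine le_trans ?_ ((sum_le_sum_of_subset_of_nonneg (filter_subset_filter (fun n => ¬ n.Prime) hS)
    fun _ _ _ => ArithmeticFunction.vonMangoldt_nonneg).trans h)
  rw [← sum_sub_distrib, sum_filter]
  refine abs_sum_le_sum_abs _ _ |>.trans (sum_le_sum fun n _ => ?_)
  rw [theta]
  by_cases hp : n.Prime
  · simp [hp, ArithmeticFunction.vonMangoldt_apply_prime hp]
  · simp [hp, abs_of_nonneg ArithmeticFunction.vonMangoldt_nonneg]

theorem card_residue_le {q : ℕ} (hq : 0 < q) (a : ZMod q) (x : ℕ) :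
    ((Ioc 0 x).filter (fun n : ℕ => (n : ZMod q) = a)).card ≤ x / q + 1 := by
  rw [← card_range (x / q + 1)]
  refine card_le_card_of_injOn (fun n => n / q) ?_ ?_
  · intro n hn
    have := (mem_Ioc.1 (mem_filter.1 hn).1).2
    exact mem_coe.2 (mem_range.2 (Nat.lt_succ_of_le (Nat.div_le_div_right this)))
  · intro n hn m hm h
    have h1 := (mem_filter.1 hn).2.trans (mem_filter.1 hm).2.symm
    rw [ZMod.natCast_eq_natCast_iff'] at h1
    rw [← Nat.div_add_mod n q, ← Nat.div_add_mod m q, h1, show n / q = m / q from h]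

theorem le_card_divisors_mul_totient (n : ℕ) : n ≤ n.divisors.card * n.totient := by
  rcases Nat.eq_zero_or_pos n with rfl | hn
  · simp
  calc n = ∑ d ∈ n.divisors, d.totient := (Nat.sum_totient n).symm
    _ ≤ ∑ d ∈ n.divisors, n.totient := sum_le_sum fun d hd =>
        Nat.le_of_dvd (Nat.totient_pos.2 hn) (Nat.totient_dvd_of_dvd (Nat.dvd_of_mem_divisors hd))
    _ = _ := by rw [sum_const, smul_eq_mul]

theorem one_div_totient_le {n : ℕ} (hn : 0 < n) : 1 / (n.totient : ℝ) ≤ n.divisors.card / n := by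
  have ht : (0 : ℝ) < n.totient := by exact_mod_cast Nat.totient_pos.2 hn
  rw [div_le_div_iff₀ ht (by exact_mod_cast hn), one_mul]
  exact_mod_cast le_card_divisors_mul_totient n

theorem sum_one_div_totient_le (x : ℕ) : ∑ n ∈ Ioc 0 x, 1 / (n.totient : ℝ) ≤ (1 + Real.log x) ^ 2 := by
  refine (sum_le_sum fun n hn => one_div_totient_le (mem_Ioc.1 hn).1).trans ?_
  simpa using sum_card_divisors_pow_div_le 1 x

theorem abs_sum_theta_residue_sub_le {q x : ℕ} (hq : 0 < q) (hqx : q ≤ x) (a : ZMod q) :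
    |∑ n ∈ (Ioc 0 x).filter (fun n : ℕ => (n : ZMod q) = a), theta n - x / q.totient| ≤
      3 * x * (1 + Real.log x) * q.divisors.card / q := by
  have hL : 0 ≤ Real.log x := Real.log_natCast_nonneg x
  have hq0 : (0 : ℝ) < q := by exact_mod_cast hq
  have hqx' : (q : ℝ) ≤ x := by exact_mod_cast hqx
  have hd : (1 : ℝ) ≤ q.divisors.card := by
    exact_mod_cast card_pos.2 (Nat.nonempty_divisors.2 hq.ne')
  have h1 : ∑ n ∈ (Ioc 0 x).filter (fun n : ℕ => (n : ZMod q) = a), theta n ≤ 2 * x * Real.log x / q := by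
    have h2 : ∀ n ∈ (Ioc 0 x).filter (fun n : ℕ => (n : ZMod q) = a), theta n ≤ Real.log x := by
      intro n hn
      have := mem_Ioc.1 (mem_filter.1 hn).1
      exact (theta_le_log n).trans (Real.log_le_log (by exact_mod_cast this.1) (by exact_mod_cast this.2))
    refine (sum_le_card_nsmul _ _ _ h2).trans ?_
    rw [nsmul_eq_mul, mul_div_right_comm]
    refine mul_le_mul_of_nonneg_right ?_ hL
    have h3 : (((Ioc 0 x).filter (fun n : ℕ => (n : ZMod q) = a)).card : ℝ) ≤ (x / q : ℕ) + 1 := by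
      exact_mod_cast card_residue_le hq a x
    have h4 : ((x / q : ℕ) : ℝ) ≤ x / q := Nat.cast_div_le
    have h5 : (1 : ℝ) ≤ x / q := by rwa [le_div_iff₀ hq0, one_mul]
    rw [mul_div_assoc]
    linarith
  have h0 : 0 ≤ ∑ n ∈ (Ioc 0 x).filter (fun n : ℕ => (n : ZMod q) = a), theta n := sum_nonneg fun n _ => theta_nonneg n
  have h6 : (x : ℝ) / q.totient ≤ x * q.divisors.card / q := by
    have := mul_le_mul_of_nonneg_left (one_div_totient_le hq) (show (0 : ℝ) ≤ x by positivity)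
    rwa [mul_one_div, ← mul_div_assoc] at this
  have h7 : 2 * x * Real.log x / q ≤ 2 * x * Real.log x * q.divisors.card / q := by
    refine div_le_div_of_nonneg_right ?_ hq0.le
    exact le_mul_of_one_le_right (by positivity) hd
  have h8 : 3 * x * (1 + Real.log x) * q.divisors.card / q = x * q.divisors.card / q +
      2 * x * Real.log x * q.divisors.card / q + (2 * x * q.divisors.card / q + x * Real.log x * q.divisors.card / q) := by
    ring
  have h9 : 0 ≤ (2 * x * q.divisors.card / q + x * Real.log x * q.divisors.card / q : ℝ) := by positivity
  have h10 : 0 ≤ (x : ℝ) / q.totient := by positivity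
  rw [abs_le]
  constructor <;> linarith

theorem sum_divisors_div_totient_le (G : ℕ → ℝ) (hG : ∀ d, 0 ≤ G d) (Q : ℕ) :
    ∑ q ∈ Ioc 0 Q, (1 / (q.totient : ℝ)) * ∑ d ∈ q.divisors.erase 1, G d ≤
      (∑ d ∈ Ioc 1 Q, (1 / (d.totient : ℝ)) * G d) * ∑ m ∈ Ioc 0 Q, 1 / (m.totient : ℝ) := by
  calc _ ≤ ∑ q ∈ Ioc 0 Q, ∑ d ∈ Ioc 1 Q, if d ∣ q then G d * (1 / (q.totient : ℝ)) else 0 := by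
        refine sum_le_sum fun q hq => ?_
        rw [mul_comm, sum_mul, ← sum_filter]
        refine sum_le_sum_of_subset_of_nonneg ?_ fun d _ _ => mul_nonneg (hG d) (by positivity)
        intro d hd
        simp only [mem_erase, Nat.mem_divisors, mem_filter, mem_Ioc] at hd hq ⊢
        have := Nat.pos_of_dvd_of_pos hd.2.1 hq.1
        have := Nat.le_of_dvd hq.1 hd.2.1
        exact ⟨⟨by omega, by omega⟩, hd.2.1⟩
    _ = ∑ d ∈ Ioc 1 Q, G d * ∑ q ∈ (Ioc 0 Q).filter (fun q => d ∣ q), 1 / (q.totient : ℝ) := by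
        rw [sum_comm]
        refine sum_congr rfl fun d _ => ?_
        rw [mul_sum, sum_filter]
    _ ≤ _ := by
        rw [sum_mul]
        refine sum_le_sum fun d hd => ?_
        have hd1 := (mem_Ioc.1 hd).1
        rw [mul_comm (1 / _) (G d), mul_assoc]
        refine mul_le_mul_of_nonneg_left ?_ (hG d)
        have hsub : (Ioc 0 Q).filter (fun q => d ∣ q) ⊆ (Ioc 0 Q).image (fun m => d * m) := by
          intro q hq
          obtain ⟨h1, m, rfl⟩ := mem_filter.1 hq
          have := mem_Ioc.1 h1
          refine mem_image.2 ⟨m, mem_Ioc.2 ⟨Nat.pos_of_mul_pos_left this.1, ?_⟩, rfl⟩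
          nlinarith [this.2]
        refine (sum_le_sum_of_subset_of_nonneg hsub fun _ _ _ => by positivity).trans ?_
        rw [sum_image fun m _ n _ h => Nat.eq_of_mul_eq_mul_left (by omega) h, mul_sum]
        refine sum_le_sum fun m hm => ?_
        have h1 : (0 : ℝ) < d.totient := by exact_mod_cast Nat.totient_pos.2 (by omega)
        have h2 : (0 : ℝ) < m.totient := by exact_mod_cast Nat.totient_pos.2 (mem_Ioc.1 hm).1
        rw [one_div_mul_one_div]
        refine one_div_le_one_div_of_le (by positivity) ?_
        exact_mod_cast Nat.totient_super_multiplicative d m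

theorem exists_bombieriVinogradov_psi (A : ℕ) : ∃ B : ℕ, ∃ C : ℝ, 0 ≤ C ∧ ∀ x Q : ℕ, 1 ≤ x →
    (Q : ℝ) ^ 2 * (1 + Real.log x) ^ (2 * B) ≤ x → ∃ E : ℕ → ℝ, (∀ q, 0 ≤ E q) ∧
    (∀ q ∈ Ioc 0 Q, ∀ a : ZMod q, IsUnit a →
      |∑ n ∈ (Ioc 0 x).filter (fun n : ℕ => (n : ZMod q) = a), theta n - x / q.totient| ≤ E q) ∧
    ∑ q ∈ Ioc 0 Q, E q ≤ C * x / (1 + Real.log x) ^ A := by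
  obtain ⟨B₀, C₁, hC₁, h₁⟩ := exists_sum_primChars_vonMangoldt_le (A + 2)
  obtain ⟨C₂, hC₂, h₂⟩ := abs_sum_vonMangoldt_sub_le (A + 2)
  obtain ⟨C₃, hC₃, h₃⟩ := one_add_log_pow_le (A + 2) one_pos
  refine ⟨B₀ + A + 1, C₁ + (C₂ + C₃) + 5, by linarith, fun x Q hx hQ => ?_⟩
  have hlog : 0 ≤ Real.log x := Real.log_natCast_nonneg x
  set L := 1 + Real.log x with hL
  have hL1 : 1 ≤ L := by linarith
  have hx0 : (1 : ℝ) ≤ x := by exact_mod_cast hx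
  set G : ℕ → ℝ := fun d => ∑ χ ∈ primChars d, ‖∑ n ∈ Ioc 0 x, charTwist χ ArithmeticFunction.vonMangoldt n‖ with hG
  have hG0 : ∀ d, 0 ≤ G d := fun d => sum_nonneg fun _ _ => norm_nonneg _
  set D := |∑ n ∈ Ioc 0 x, ArithmeticFunction.vonMangoldt n - x| with hD
  have hQL : (Q : ℝ) * L ^ (A + 1) ≤ √x := by
    refine Real.le_sqrt_of_sq_le (le_trans ?_ hQ)
    rw [mul_pow, ← pow_mul]
    exact mul_le_mul_of_nonneg_left (pow_le_pow_right₀ hL1 (by omega)) (by positivity)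
  have hQx : Q ≤ x := by
    have h1 : (Q : ℝ) ≤ √x := le_trans (le_mul_of_one_le_right (by positivity) (one_le_pow₀ hL1)) hQL
    have h2 : √(x : ℝ) ≤ x := Real.sqrt_le_iff.2 ⟨by linarith, by nlinarith⟩
    exact_mod_cast h1.trans h2
  refine ⟨fun q => Real.log q + 4 * √x * Real.log x + (1 / (q.totient : ℝ)) * (D + ∑ d ∈ q.divisors.erase 1, G d),
    fun q => ?_, fun q hq a ha => ?_, ?_⟩
  · have := Real.log_natCast_nonneg q
    have h3 : 0 ≤ ∑ d ∈ q.divisors.erase 1, G d := sum_nonneg fun d _ => hG0 d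
    positivity
  · have : NeZero q := ⟨(mem_Ioc.1 hq).1.ne'⟩
    have h3 := abs_sum_vonMangoldt_residue_sub_le ha hx
    have h4 := abs_sum_theta_sub_vonMangoldt_le hx _ (filter_subset (fun n : ℕ => (n : ZMod q) = a) (Ioc 0 x))
    have h5 := abs_sub_le (∑ n ∈ (Ioc 0 x).filter (fun n : ℕ => (n : ZMod q) = a), theta n)
      (∑ n ∈ (Ioc 0 x).filter (fun n : ℕ => (n : ZMod q) = a), ArithmeticFunction.vonMangoldt n) (x / q.totient)
    simp only [hG, hD]
    linarith
  · have hDle : D ≤ (C₂ + C₃) * x / L ^ (A + 2) := by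
      have := h₂ x hx0
      have h6 := h₃ x hx0
      rw [Nat.floor_natCast, sum_sub_distrib, ← sum_Ioc_zero_eq_range _ (by simp)] at this
      rw [sum_const, card_range, nsmul_one, Nat.cast_add, Nat.cast_one] at this
      rw [Real.rpow_one, ← hL] at h6
      have h7 := abs_sub_le (∑ n ∈ Ioc 0 x, ArithmeticFunction.vonMangoldt n) (x + 1) (x : ℝ)
      rw [add_sub_cancel_left, abs_one] at h7
      have h8 : 1 ≤ C₃ * x / L ^ (A + 2) := by rwa [le_div_iff₀ (by positivity), one_mul]
      rw [add_mul, add_div]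
      linarith
    have hφ : ∑ m ∈ Ioc 0 Q, 1 / (m.totient : ℝ) ≤ L ^ 2 :=
      (sum_le_sum_of_subset_of_nonneg (Ioc_subset_Ioc_right hQx) fun _ _ _ => by positivity).trans
        (sum_one_div_totient_le x)
    have hφ0 : 0 ≤ ∑ m ∈ Ioc 0 Q, 1 / (m.totient : ℝ) := sum_nonneg fun _ _ => by positivity
    have hB := h₁ x Q hx (le_trans (mul_le_mul_of_nonneg_left
      (pow_le_pow_right₀ hL1 (by omega)) (by positivity)) hQ)
    have hB0 : 0 ≤ ∑ d ∈ Ioc 1 Q, (1 / (d.totient : ℝ)) * G d :=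
      sum_nonneg fun d _ => mul_nonneg (by positivity) (hG0 d)
    have e1 : ∑ q ∈ Ioc 0 Q, (Real.log q + 4 * √x * Real.log x) ≤ 5 * (x / L ^ A) := by
      have : ∀ q ∈ Ioc 0 Q, Real.log q + 4 * √x * Real.log x ≤ 5 * √x * L := by
        intro q hq
        have h1 : Real.log q ≤ Real.log x := Real.log_le_log (by exact_mod_cast (mem_Ioc.1 hq).1)
          (by exact_mod_cast (mem_Ioc.1 hq).2.trans hQx)
        have h2 : 1 ≤ √(x : ℝ) := Real.one_le_sqrt.2 hx0
        nlinarith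
      refine (sum_le_sum this).trans ?_
      rw [sum_const, Nat.card_Ioc, nsmul_eq_mul, Nat.sub_zero, mul_div_assoc', le_div_iff₀ (by positivity)]
      calc Q * (5 * √x * L) * L ^ A = 5 * √x * (Q * L ^ (A + 1)) := by ring
        _ ≤ 5 * √x * √x := mul_le_mul_of_nonneg_left hQL (by positivity)
        _ = 5 * x := by rw [mul_assoc, Real.mul_self_sqrt (by positivity)]
    have e2 : ∑ q ∈ Ioc 0 Q, (1 / (q.totient : ℝ)) * D ≤ (C₂ + C₃) * (x / L ^ A) := by
      rw [← sum_mul]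
      calc _ ≤ L ^ 2 * ((C₂ + C₃) * x / L ^ (A + 2)) := mul_le_mul hφ hDle (abs_nonneg _) (by positivity)
        _ = _ := by rw [pow_add]; field_simp
    have e3 : ∑ q ∈ Ioc 0 Q, (1 / (q.totient : ℝ)) * ∑ d ∈ q.divisors.erase 1, G d ≤ C₁ * (x / L ^ A) := by
      refine (sum_divisors_div_totient_le G hG0 Q).trans ?_
      calc _ ≤ (C₁ * x / L ^ (A + 2)) * L ^ 2 := mul_le_mul hB hφ hφ0 (hB0.trans hB)
        _ = _ := by rw [pow_add]; field_simp
    simp only [mul_add, sum_add_distrib] at e1 e2 e3 ⊢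
    rw [mul_div_assoc]
    linarith

/-- The Bombieri-Vinogradov theorem for primes, with divisor function weights. -/
theorem exists_bombieriVinogradov (A j : ℕ) : ∃ B : ℕ, ∃ C : ℝ, 0 ≤ C ∧ ∀ x Q : ℕ, 1 ≤ x →
    (Q : ℝ) ^ 2 * (1 + Real.log x) ^ (2 * B) ≤ x → ∃ E : ℕ → ℝ, (∀ q, 0 ≤ E q) ∧
    (∀ q ∈ Ioc 0 Q, ∀ a : ZMod q, IsUnit a →
      |∑ n ∈ (Ioc 0 x).filter (fun n : ℕ => (n : ZMod q) = a), theta n - x / q.totient| ≤ E q) ∧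
    ∑ q ∈ Ioc 0 Q, (q.divisors.card : ℝ) ^ j * E q ≤ C * x / (1 + Real.log x) ^ A := by
  obtain ⟨B, C, hC, h⟩ := exists_bombieriVinogradov_psi (2 * A + 1 + 2 ^ (2 * j + 1))
  refine ⟨B, 3 * C + 1, by positivity, fun x Q hx hQ => ?_⟩
  obtain ⟨E, hE0, hE1, hE2⟩ := h x Q hx hQ
  have hlog : 0 ≤ Real.log x := Real.log_natCast_nonneg x
  set L := 1 + Real.log x with hL
  have hL1 : 1 ≤ L := by linarith
  have hx0 : (1 : ℝ) ≤ x := by exact_mod_cast hx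
  have hQx : Q ≤ x := by
    have h1 : (Q : ℝ) ^ 2 ≤ x := le_trans (le_mul_of_one_le_right (by positivity) (one_le_pow₀ hL1)) hQ
    have h2 : Q ^ 2 ≤ x := by exact_mod_cast h1
    exact (Nat.le_self_pow two_ne_zero Q).trans h2
  set E' : ℕ → ℝ := fun q => min (E q) (3 * x * L * q.divisors.card / q) with hE'
  have hE'0 : ∀ q, 0 ≤ E' q := fun q => le_min (hE0 q) (by positivity)
  refine ⟨E', hE'0, fun q hq a ha => le_min (hE1 q hq a ha)
    (abs_sum_theta_residue_sub_le (mem_Ioc.1 hq).1 ((mem_Ioc.1 hq).2.trans hQx) a), ?_⟩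
  have hcs := sum_mul_sq_le_sq_mul_sq (Ioc 0 Q) (fun q => (q.divisors.card : ℝ) ^ j * √(E' q)) (fun q => √(E' q))
  have e0 : ∀ q : ℕ, (q.divisors.card : ℝ) ^ j * √(E' q) * √(E' q) = (q.divisors.card : ℝ) ^ j * E' q := fun q => by
    rw [mul_assoc, Real.mul_self_sqrt (hE'0 q)]
  have e1 : ∀ q : ℕ, ((q.divisors.card : ℝ) ^ j * √(E' q)) ^ 2 = (q.divisors.card : ℝ) ^ (2 * j) * E' q := fun q => by
    rw [mul_pow, Real.sq_sqrt (hE'0 q), ← pow_mul, mul_comm j]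
  have e2 : ∀ q : ℕ, √(E' q) ^ 2 = E' q := fun q => Real.sq_sqrt (hE'0 q)
  simp only [e0, e1, e2] at hcs
  have s1 : ∑ q ∈ Ioc 0 Q, (q.divisors.card : ℝ) ^ (2 * j) * E' q ≤ 3 * x * L * L ^ 2 ^ (2 * j + 1) := by
    refine le_trans ?_ (mul_le_mul_of_nonneg_left (sum_card_divisors_pow_div_le (2 * j + 1) x) (by positivity))
    rw [mul_sum]
    refine le_trans (sum_le_sum fun q _ => ?_)
      (sum_le_sum_of_subset_of_nonneg (Ioc_subset_Ioc_right hQx) fun _ _ _ => by positivity)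
    calc (q.divisors.card : ℝ) ^ (2 * j) * E' q ≤ (q.divisors.card : ℝ) ^ (2 * j) * (3 * x * L * q.divisors.card / q) :=
          mul_le_mul_of_nonneg_left (min_le_right _ _) (by positivity)
      _ = _ := by rw [pow_succ]; ring
  have s2 : ∑ q ∈ Ioc 0 Q, E' q ≤ C * x / L ^ (2 * A + 1 + 2 ^ (2 * j + 1)) :=
    (sum_le_sum fun q _ => min_le_left _ _).trans hE2
  refine (abs_le_of_sq_le_sq' (hcs.trans ?_) (by positivity)).2
  calc _ ≤ (3 * x * L * L ^ 2 ^ (2 * j + 1)) * (C * x / L ^ (2 * A + 1 + 2 ^ (2 * j + 1))) :=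
        mul_le_mul s1 s2 (sum_nonneg fun q _ => hE'0 q) (by positivity)
    _ = 3 * C * (x / L ^ A) ^ 2 := by
      rw [pow_add, pow_add, mul_comm 2 A, pow_mul]
      field_simp
      ring
    _ ≤ (3 * C + 1) ^ 2 * (x / L ^ A) ^ 2 := by
      refine mul_le_mul_of_nonneg_right ?_ (by positivity)
      nlinarith
    _ = _ := by ring

/-- The truncated power `x ^ a / a!` on `x ≥ 0`, extended by zero. -/
noncomputable def truncPow (a : ℕ) (x : ℝ) : ℝ := if 0 ≤ x then x ^ a / a.factorial else 0

theorem truncPow_of_neg (a : ℕ) {x : ℝ} (hx : x < 0) : truncPow a x = 0 := if_neg hx.not_ge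

theorem truncPow_of_nonneg (a : ℕ) {x : ℝ} (hx : 0 ≤ x) : truncPow a x = x ^ a / a.factorial := if_pos hx

/-- The weighted sum of logarithmic shifts of `g`. -/
noncomputable def shiftSum (c : ℕ → ℝ) (K : ℕ) (g : ℝ → ℝ) (x : ℝ) : ℝ :=
  ∑ n ∈ Ioc 0 K, c n / n * g (x - Real.log n)

/-- The operator attached to the reciprocal of zeta. -/
noncomputable def moebiusShift (K : ℕ) (g : ℝ → ℝ) (x : ℝ) : ℝ :=
  shiftSum (fun n => (ArithmeticFunction.moebius n : ℝ)) K g x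

theorem shiftSum_of_neg {c : ℕ → ℝ} {K : ℕ} {g : ℝ → ℝ} (hg : ∀ x < 0, g x = 0) {x : ℝ} (hx : x < 0) :
    shiftSum c K g x = 0 :=
  sum_eq_zero fun n _ => by
    rw [hg _ (by linarith [Real.log_natCast_nonneg n]), mul_zero]

theorem shiftSum_eq_sum_floor {c : ℕ → ℝ} {K : ℕ} {g : ℝ → ℝ} (hg : ∀ x < 0, g x = 0) {x : ℝ}
    (hx : Real.exp x < K + 1) :
    shiftSum c K g x = ∑ n ∈ Ioc 0 ⌊Real.exp x⌋₊, c n / n * g (x - Real.log n) := by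
  have hK : ⌊Real.exp x⌋₊ ≤ K := by
    rw [← Nat.lt_succ_iff, Nat.floor_lt (Real.exp_pos x).le]; exact_mod_cast hx
  refine (sum_subset (Ioc_subset_Ioc_right hK) fun n hn h => ?_).symm
  have hn0 := (mem_Ioc.1 hn).1
  have h1 : ⌊Real.exp x⌋₊ < n := by by_contra h2; exact h (mem_Ioc.2 ⟨hn0, by omega⟩)
  rw [hg, mul_zero]
  rw [sub_neg, Real.lt_log_iff_exp_lt (by exact_mod_cast hn0)]
  exact (Nat.floor_lt (Real.exp_pos x).le).1 h1

theorem log_succ_sub_log {n : ℕ} (hn : 0 < n) :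
    1 / ((n : ℝ) + 1) ≤ Real.log ((n + 1 : ℕ) : ℝ) - Real.log n ∧
      Real.log ((n + 1 : ℕ) : ℝ) - Real.log n ≤ 1 / n := by
  have h0 : (0 : ℝ) < n := by exact_mod_cast hn
  rw [← Real.log_div (by positivity) h0.ne']
  push_cast
  constructor
  · have := Real.one_sub_inv_le_log_of_pos (x := ((n : ℝ) + 1) / n) (by positivity)
    convert this using 1
    field_simp
    ring
  · have := Real.log_le_sub_one_of_pos (x := ((n : ℝ) + 1) / n) (by positivity)
    convert this using 1
    field_simp
    ring

theorem abs_sum_moebius_div_le : ∃ C : ℝ, 0 ≤ C ∧ ∀ a b : ℕ, 0 < a → a ≤ b →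
    |∑ n ∈ Ioc a b, (ArithmeticFunction.moebius n : ℝ) / n| ≤ C / (1 + Real.log a) ^ 3 := by
  obtain ⟨C, hC, h⟩ := abs_sum_moebius_le 5
  refine ⟨4 * C, by linarith, fun a b ha hab => ?_⟩
  set S : ℕ → ℝ := fun n => ∑ j ∈ range (n + 1), (ArithmeticFunction.moebius j : ℝ) with hS
  have hla : 0 ≤ Real.log a := Real.log_natCast_nonneg a
  have hlog : ∀ n, a ≤ n → Real.log a ≤ Real.log n := fun n hn =>
    Real.log_le_log (by exact_mod_cast ha) (by exact_mod_cast hn)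
  have hSb : ∀ n : ℕ, 0 < n → |S n| ≤ C * n / (1 + Real.log n) ^ 5 := fun n hn => by
    have := h n (by exact_mod_cast hn)
    rwa [Nat.floor_natCast] at this
  have hSa : ∀ n : ℕ, a ≤ n → |S n / (n + 1)| ≤ C / (1 + Real.log a) ^ 3 := fun n hn => by
    have hn0 : (0 : ℝ) < n := by exact_mod_cast ha.trans_le hn
    have h2 := hlog n hn
    rw [abs_div, abs_of_pos (by positivity : (0 : ℝ) < n + 1), div_le_iff₀ (by positivity), div_mul_eq_mul_div]
    refine (hSb n (ha.trans_le hn)).trans (div_le_div₀ (by positivity) ?_ (by positivity) ?_)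
    · exact mul_le_mul_of_nonneg_left (by linarith) (by linarith)
    · exact (pow_le_pow_left₀ (by linarith) (by linarith) 3).trans (pow_le_pow_right₀ (by linarith) (by norm_num))
  have key : ∀ b, a ≤ b → ∑ n ∈ Ioc a b, (ArithmeticFunction.moebius n : ℝ) / n =
      S b / (b + 1) - S a / (a + 1) + ∑ n ∈ Ioc a b, S n / (n * (n + 1)) := by
    intro b hb
    induction b, hb using Nat.le_induction with
    | base => simp
    | succ b hb ih =>
      have h1 : S (b + 1) = S b + ArithmeticFunction.moebius (b + 1) := sum_range_succ _ (b + 1)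
      rw [sum_Ioc_succ_top hb, sum_Ioc_succ_top hb, ih, h1]
      push_cast
      field_simp
      ring
  have tele : ∀ b, a ≤ b → ∑ n ∈ Ioc a b, 1 / (((n : ℝ) + 1) * (1 + Real.log n) ^ 2) ≤
      2 - 2 / (1 + Real.log ((b + 1 : ℕ) : ℝ)) := by
    intro b hb
    induction b, hb using Nat.le_induction with
    | base =>
      have : 0 ≤ Real.log ((a + 1 : ℕ) : ℝ) := Real.log_natCast_nonneg _
      rw [Ioc_self, sum_empty, sub_nonneg, div_le_iff₀ (by positivity)]
      linarith
    | succ b hb ih =>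
      rw [sum_Ioc_succ_top hb]
      refine (add_le_add_left ih _).trans ?_
      obtain ⟨h1, h2⟩ := log_succ_sub_log (Nat.succ_pos b)
      have h3 : 0 ≤ Real.log ((b + 1 : ℕ) : ℝ) := Real.log_natCast_nonneg _
      have h4 : (1 : ℝ) / ((b + 1 : ℕ) : ℝ) ≤ 1 := by
        rw [div_le_one (by positivity)]; exact_mod_cast Nat.succ_pos b
      simp only [Nat.succ_eq_add_one] at h1 h2
      set u := Real.log ((b + 1 : ℕ) : ℝ)
      set v := Real.log ((b + 1 + 1 : ℕ) : ℝ)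
      have h5 : 1 / ((((b + 1 : ℕ) : ℝ) + 1) * (1 + u) ^ 2) ≤ (v - u) / (1 + u) ^ 2 := by
        rw [← div_div]
        exact div_le_div_of_nonneg_right h1 (by positivity)
      have h6 : (v - u) / (1 + u) ^ 2 ≤ 2 / (1 + u) - 2 / (1 + v) := by
        have h8 : 0 ≤ v - u := le_trans (by positivity) h1
        rw [div_sub_div _ _ (by positivity) (by linarith), div_le_div_iff₀ (by positivity)
          (mul_pos (by positivity) (by linarith))]
        nlinarith [mul_nonneg (mul_nonneg h8 (by positivity : 0 ≤ 1 + u)) (by linarith : 0 ≤ 2 * (1 + u) - (1 + v))]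
      linarith
  have hsum : |∑ n ∈ Ioc a b, S n / (n * (n + 1))| ≤ 2 * (C / (1 + Real.log a) ^ 3) := by
    refine (abs_sum_le_sum_abs _ _).trans ?_
    calc _ ≤ ∑ n ∈ Ioc a b, C / (1 + Real.log a) ^ 3 * (1 / (((n : ℝ) + 1) * (1 + Real.log n) ^ 2)) := by
          refine sum_le_sum fun n hn => ?_
          have hn1 := mem_Ioc.1 hn
          have hn0 : (0 : ℝ) < n := by exact_mod_cast ha.trans hn1.1
          have h2 := hlog n hn1.1.le
          have h9 : 0 ≤ Real.log n := Real.log_natCast_nonneg n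
          rw [abs_div, abs_of_pos (by positivity : (0 : ℝ) < n * (n + 1)), div_le_iff₀ (by positivity)]
          refine (hSb n (ha.trans hn1.1)).trans ?_
          rw [div_le_iff₀ (by positivity)]
          have h10 : (1 + Real.log a) ^ 3 ≤ (1 + Real.log n) ^ 3 := pow_le_pow_left₀ (by positivity) (by linarith) 3
          calc C * n = C / (1 + Real.log a) ^ 3 * (1 / ((n + 1) * (1 + Real.log n) ^ 2)) * (n * (n + 1)) *
                ((1 + Real.log n) ^ 2 * (1 + Real.log a) ^ 3) := by field_simp
            _ ≤ _ := by
              rw [show (5 : ℕ) = 2 + 3 from rfl, pow_add (1 + Real.log n)]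
              exact mul_le_mul_of_nonneg_left (mul_le_mul_of_nonneg_left h10 (by positivity)) (by positivity)
      _ ≤ _ := by
          rw [← mul_sum, mul_comm 2]
          have : 0 ≤ 2 / (1 + Real.log ((b + 1 : ℕ) : ℝ)) := by
            have := Real.log_natCast_nonneg (b + 1)
            positivity
          exact mul_le_mul_of_nonneg_left ((tele b hab).trans (by linarith)) (by positivity)
  rw [key b hab]
  have h1 := hSa b hab
  have h2 := hSa a le_rfl
  rw [mul_div_assoc]
  have h3 := abs_add_le (S b / (b + 1) - S a / (a + 1)) (∑ n ∈ Ioc a b, S n / (n * (n + 1)))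
  have h4 := abs_sub (S b / (b + 1)) (S a / (a + 1))
  linarith

theorem exists_abs_sub_le_of_cauchy {f w : ℕ → ℝ} (hw : Filter.Tendsto w Filter.atTop (nhds 0))
    (h : ∀ a b, 0 < a → a ≤ b → |f b - f a| ≤ w a) : ∃ κ : ℝ, ∀ a, 0 < a → |f a - κ| ≤ w a := by
  have hc : CauchySeq f := by
    refine Metric.cauchySeq_iff'.2 fun ε hε => ?_
    obtain ⟨N, hN⟩ := ((hw.eventually (gt_mem_nhds hε)).and (Filter.eventually_gt_atTop 0)).exists
    exact ⟨N, fun n hn => (h N n hN.2 hn).trans_lt hN.1⟩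
  obtain ⟨κ, hκ⟩ := cauchySeq_tendsto_of_complete hc
  refine ⟨κ, fun a ha => ?_⟩
  rw [abs_sub_comm]
  exact le_of_tendsto (hκ.sub_const (f a)).abs ((Filter.eventually_ge_atTop a).mono fun b hb => h a b ha hb)

theorem tendsto_div_one_add_log_pow (C : ℝ) {k : ℕ} (hk : k ≠ 0) :
    Filter.Tendsto (fun n : ℕ => C / (1 + Real.log n) ^ k) Filter.atTop (nhds 0) :=
  Filter.Tendsto.const_div_atTop ((Filter.tendsto_pow_atTop hk).comp (Filter.tendsto_atTop_add_const_left _ _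
    (Real.tendsto_log_atTop.comp tendsto_natCast_atTop_atTop))) _

theorem one_add_le_four_mul_log_floor {x : ℝ} (hx : 0 ≤ x) :
    0 < ⌊Real.exp x⌋₊ ∧ 1 + x ≤ 4 * (1 + Real.log ⌊Real.exp x⌋₊) := by
  have h1 : 1 ≤ Real.exp x := Real.one_le_exp hx
  have h2 : 0 < ⌊Real.exp x⌋₊ := Nat.floor_pos.2 h1
  have h3 : Real.exp x ≤ 2 * (⌊Real.exp x⌋₊ : ℝ) := by
    have h4 : (1 : ℝ) ≤ ⌊Real.exp x⌋₊ := by exact_mod_cast h2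
    linarith [Nat.lt_floor_add_one (Real.exp x)]
  have h5 := (Real.le_log_iff_exp_le (by positivity)).2 h3
  rw [Real.log_mul two_ne_zero (by positivity)] at h5
  have := Real.log_two_lt_d9
  have := Real.log_natCast_nonneg ⌊Real.exp x⌋₊
  exact ⟨h2, by linarith⟩

theorem exists_moebiusShift_truncPow_zero : ∃ κ C : ℝ, 0 ≤ C ∧ ∀ (K : ℕ) (x : ℝ), 0 ≤ x → Real.exp x < K + 1 →
    |moebiusShift K (truncPow 0) x - κ| ≤ C / (1 + x) ^ 3 := by
  obtain ⟨C, hC, h⟩ := abs_sum_moebius_div_le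
  obtain ⟨κ, hκ⟩ := exists_abs_sub_le_of_cauchy (f := fun b => ∑ n ∈ Ioc 0 b, (ArithmeticFunction.moebius n : ℝ) / n)
    (tendsto_div_one_add_log_pow C three_ne_zero) fun a b ha hab => by
      refine le_trans (le_of_eq ?_) (h a b ha hab)
      rw [← sum_Ioc_consecutive _ (Nat.zero_le a) hab, add_sub_cancel_left]
  refine ⟨κ, 64 * C, by positivity, fun K x hx hK => ?_⟩
  obtain ⟨h1, h2⟩ := one_add_le_four_mul_log_floor hx
  rw [moebiusShift, shiftSum_eq_sum_floor (fun x => truncPow_of_neg 0) hK]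
  have h3 : ∀ n ∈ Ioc 0 ⌊Real.exp x⌋₊, (ArithmeticFunction.moebius n : ℝ) / n * truncPow 0 (x - Real.log n) =
      (ArithmeticFunction.moebius n : ℝ) / n := fun n hn => by
    have h4 := mem_Ioc.1 hn
    rw [truncPow_of_nonneg, pow_zero, Nat.factorial_zero, Nat.cast_one, div_one, mul_one]
    rw [sub_nonneg, Real.log_le_iff_le_exp (by exact_mod_cast h4.1)]
    exact (Nat.le_floor_iff (Real.exp_pos x).le).1 h4.2
  rw [sum_congr rfl h3]
  refine (hκ _ h1).trans ?_
  have := Real.log_natCast_nonneg ⌊Real.exp x⌋₊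
  rw [div_le_div_iff₀ (by positivity) (by positivity), mul_comm 64 C, mul_assoc]
  refine mul_le_mul_of_nonneg_left ((pow_le_pow_left₀ (by positivity) h2 3).trans_eq (by ring)) hC

theorem pow_succ_sub_pow_succ_bounds (l : ℕ) {a b : ℝ} (hb : 0 ≤ b) (hab : b ≤ a) :
    (l + 1) * b ^ l * (a - b) ≤ a ^ (l + 1) - b ^ (l + 1) ∧
      a ^ (l + 1) - b ^ (l + 1) ≤ (l + 1) * a ^ l * (a - b) := by
  induction l with
  | zero => simp
  | succ l ih =>
    have h1 : b ^ (l + 1) ≤ a ^ (l + 1) := pow_le_pow_left₀ hb hab _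
    have e : a ^ (l + 1 + 1) - b ^ (l + 1 + 1) = a * (a ^ (l + 1) - b ^ (l + 1)) + b ^ (l + 1) * (a - b) := by ring
    rw [e]
    push_cast
    constructor
    · have h2 : b * ((l + 1) * b ^ l * (a - b)) ≤ a * (a ^ (l + 1) - b ^ (l + 1)) :=
        mul_le_mul hab ih.1 (mul_nonneg (by positivity) (by linarith)) (by linarith)
      linarith [show (l + 1 + 1) * b ^ (l + 1) * (a - b) =
        b * ((l + 1) * b ^ l * (a - b)) + b ^ (l + 1) * (a - b) by ring]
    · have h2 := mul_le_mul_of_nonneg_left ih.2 (hb.trans hab)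
      have h3 := mul_le_mul_of_nonneg_right h1 (by linarith : 0 ≤ a - b)
      linarith [show (l + 1 + 1) * a ^ (l + 1) * (a - b) =
        a * ((l + 1) * a ^ l * (a - b)) + a ^ (l + 1) * (a - b) by ring]

/-- `F` vanishes when an argument is negative and is close to `c X ^ l / l!` near the diagonal. -/
def DiagApprox (F : ℝ → ℝ → ℝ) (T c : ℝ) (l : ℕ) (B : ℝ) : Prop :=
  (∀ x y, x < 0 ∨ y < 0 → F x y = 0) ∧ ∀ X s t, 0 ≤ X → X ≤ T → 0 ≤ s → 0 ≤ t →
    |F (X - s) (X - t) - c * (X ^ l / l.factorial)| ≤ B * ((1 + s) * (1 + t)) * ((1 + X) ^ l / √(1 + X))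

theorem pow_div_factorial_le (l : ℕ) {X : ℝ} (hX : 0 ≤ X) : X ^ l / l.factorial ≤ (1 + X) ^ l :=
  (div_le_self (by positivity) (by exact_mod_cast l.factorial_pos)).trans
    (pow_le_pow_left₀ hX (by linarith) l)

theorem abs_shift_sub_le {g : ℝ → ℝ} {T c C : ℝ} {l : ℕ} (hC : 0 ≤ C) (hg : ∀ x < 0, g x = 0)
    (h : ∀ x, 0 ≤ x → x ≤ T → |g x - c * (x ^ l / l.factorial)| ≤ C * ((1 + x) ^ l / (1 + x)))
    {X s : ℝ} (hX : 0 ≤ X) (hXT : X ≤ T) (hs : 0 ≤ s) :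
    |g (X - s) - c * (X ^ l / l.factorial)| ≤ (C + |c| * (l + 1)) * (1 + s) * ((1 + X) ^ l / (1 + X)) := by
  have hf : (1 : ℝ) ≤ l.factorial := by exact_mod_cast l.factorial_pos
  rcases lt_or_ge X s with hlt | hle
  · rw [hg _ (by linarith), zero_sub, abs_neg, abs_mul, abs_of_nonneg (by positivity : 0 ≤ X ^ l / (l.factorial : ℝ))]
    have h1 : (1 : ℝ) ≤ (1 + s) / (1 + X) := by rw [one_le_div (by positivity)]; linarith
    calc |c| * (X ^ l / l.factorial) ≤ |c| * (1 + X) ^ l := mul_le_mul_of_nonneg_left (pow_div_factorial_le l hX) (abs_nonneg c)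
      _ ≤ (|c| * (1 + X) ^ l) * ((1 + s) / (1 + X)) := le_mul_of_one_le_right (by positivity) h1
      _ = |c| * 1 * (1 + s) * ((1 + X) ^ l / (1 + X)) := by ring
      _ ≤ _ := by
        refine mul_le_mul_of_nonneg_right (mul_le_mul_of_nonneg_right ?_ (by positivity)) (by positivity)
        nlinarith [mul_nonneg (abs_nonneg c) (Nat.cast_nonneg (α := ℝ) l)]
  · have hx : 0 ≤ X - s := by linarith
    have h1 := h (X - s) hx (by linarith)
    have h2 : (1 + (X - s)) ^ l / (1 + (X - s)) ≤ (1 + s) * ((1 + X) ^ l / (1 + X)) := by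
      rw [← mul_div_assoc, div_le_div_iff₀ (by positivity) (by positivity)]
      have h3 : (1 + (X - s)) ^ l ≤ (1 + X) ^ l := pow_le_pow_left₀ (by linarith) (by linarith) l
      have h4 : 1 + X ≤ (1 + s) * (1 + (X - s)) := by nlinarith
      calc _ ≤ (1 + X) ^ l * ((1 + s) * (1 + (X - s))) := mul_le_mul h3 h4 (by positivity) (by positivity)
        _ = _ := by ring
    have h5 : X ^ l / l.factorial - (X - s) ^ l / l.factorial ≤ l * (1 + s) * ((1 + X) ^ l / (1 + X)) := by
      rw [← sub_div]
      have h50 : (X - s) ^ l ≤ X ^ l := pow_le_pow_left₀ hx (by linarith) l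
      refine (div_le_self (by linarith) hf).trans ?_
      cases l with
      | zero => simp
      | succ l =>
        rw [pow_succ (1 + X), mul_div_assoc, div_self (by positivity), mul_one]
        refine (pow_succ_sub_pow_succ_bounds l hx (by linarith)).2.trans ?_
        rw [sub_sub_cancel, mul_right_comm]
        push_cast
        have : X ^ l ≤ (1 + X) ^ l := pow_le_pow_left₀ hX (by linarith) l
        exact mul_le_mul (mul_le_mul_of_nonneg_left (by linarith) (by positivity)) this (by positivity) (by positivity)
    have h6 : (X - s) ^ l / l.factorial ≤ X ^ l / (l.factorial : ℝ) :=
      div_le_div_of_nonneg_right (pow_le_pow_left₀ hx (by linarith) l) (by positivity)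
    have h7 := abs_sub_le (g (X - s)) (c * ((X - s) ^ l / l.factorial)) (c * (X ^ l / l.factorial))
    have h70 : |c * ((X - s) ^ l / l.factorial) - c * (X ^ l / l.factorial)| =
        |c| * (X ^ l / l.factorial - (X - s) ^ l / l.factorial) := by
      rw [← mul_sub, abs_mul, abs_sub_comm, abs_of_nonneg (sub_nonneg.2 h6)]
    have h8 := mul_le_mul_of_nonneg_left h5 (abs_nonneg c)
    have h9 := mul_le_mul_of_nonneg_left h2 hC
    have h10 : 0 ≤ |c| * ((1 + s) * ((1 + X) ^ l / (1 + X))) := by positivity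
    linarith

theorem DiagApprox.mul {g₁ g₂ : ℝ → ℝ} {T c₁ c₂ C₁ C₂ : ℝ} {l₁ l₂ : ℕ} (hC₁ : 0 ≤ C₁) (hC₂ : 0 ≤ C₂)
    (hg₁ : ∀ x < 0, g₁ x = 0) (hg₂ : ∀ x < 0, g₂ x = 0)
    (h₁ : ∀ x, 0 ≤ x → x ≤ T → |g₁ x - c₁ * (x ^ l₁ / l₁.factorial)| ≤ C₁ * ((1 + x) ^ l₁ / (1 + x)))
    (h₂ : ∀ x, 0 ≤ x → x ≤ T → |g₂ x - c₂ * (x ^ l₂ / l₂.factorial)| ≤ C₂ * ((1 + x) ^ l₂ / (1 + x))) :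
    DiagApprox (fun x y => g₁ x * g₂ y) T (c₁ * c₂ * (l₁ + l₂).choose l₁) (l₁ + l₂)
      ((C₁ + |c₁| * (l₁ + 1)) * (C₂ + |c₂| * (l₂ + 1)) + |c₁| * (C₂ + |c₂| * (l₂ + 1)) + |c₂| * (C₁ + |c₁| * (l₁ + 1))) := by
  refine ⟨fun x y h => ?_, fun X s t hX hXT hs ht => ?_⟩
  · rcases h with h | h
    · simp [hg₁ x h]
    · simp [hg₂ y h]
  have k₁ := abs_shift_sub_le hC₁ hg₁ h₁ hX hXT hs
  have k₂ := abs_shift_sub_le hC₂ hg₂ h₂ hX hXT ht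
  have p₁ := pow_div_factorial_le l₁ hX
  have p₂ := pow_div_factorial_le l₂ hX
  have e : c₁ * c₂ * (l₁ + l₂).choose l₁ * (X ^ (l₁ + l₂) / (l₁ + l₂).factorial) =
      (c₁ * (X ^ l₁ / l₁.factorial)) * (c₂ * (X ^ l₂ / l₂.factorial)) := by
    have := Nat.add_choose_mul_factorial_mul_factorial l₁ l₂
    have h3 : ((l₁ + l₂).choose l₁ : ℝ) * l₁.factorial * l₂.factorial = (l₁ + l₂).factorial := by
      rw [← this, Nat.choose_symm_add]; push_cast; rfl
    rw [← h3, pow_add]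
    have : ((l₁ + l₂).choose l₁ : ℝ) ≠ 0 := by exact_mod_cast (Nat.choose_pos (by omega)).ne'
    field_simp
  rw [e]
  have hA₁ : 0 ≤ C₁ + |c₁| * (l₁ + 1) := by positivity
  have hA₂ : 0 ≤ C₂ + |c₂| * (l₂ + 1) := by positivity
  generalize C₁ + |c₁| * (l₁ + 1) = A₁ at *
  generalize C₂ + |c₂| * (l₂ + 1) = A₂ at *
  clear h₁ h₂ e hg₁ hg₂
  have hsq : 1 ≤ √(1 + X) := Real.one_le_sqrt.2 (by linarith)
  have hw : ∀ l : ℕ, (1 + X) ^ l / (1 + X) ≤ (1 + X) ^ l / √(1 + X) := fun l =>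
    div_le_div_of_nonneg_left (by positivity) (by positivity) (by
      nlinarith [Real.sq_sqrt (by linarith : 0 ≤ 1 + X)])
  have hw1 : (1 + X) ^ l₁ / (1 + X) ≤ (1 + X) ^ l₁ := div_le_self (by positivity) (by linarith)
  have hw2 : (1 + X) ^ l₂ / (1 + X) ≤ (1 + X) ^ l₂ := div_le_self (by positivity) (by linarith)
  have m₁ : |c₁ * (X ^ l₁ / l₁.factorial)| ≤ |c₁| * (1 + X) ^ l₁ := by
    rw [abs_mul, abs_of_nonneg (by positivity : 0 ≤ X ^ l₁ / (l₁.factorial : ℝ))]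
    exact mul_le_mul_of_nonneg_left p₁ (abs_nonneg _)
  have m₂ : |c₂ * (X ^ l₂ / l₂.factorial)| ≤ |c₂| * (1 + X) ^ l₂ := by
    rw [abs_mul, abs_of_nonneg (by positivity : 0 ≤ X ^ l₂ / (l₂.factorial : ℝ))]
    exact mul_le_mul_of_nonneg_left p₂ (abs_nonneg _)
  generalize c₁ * (X ^ l₁ / (l₁.factorial : ℝ)) = u₁ at *
  generalize c₂ * (X ^ l₂ / (l₂.factorial : ℝ)) = u₂ at *
  have j₁ := k₁.trans (mul_le_mul_of_nonneg_left (hw l₁) (by positivity))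
  have j₂ := k₂.trans (mul_le_mul_of_nonneg_left (hw l₂) (by positivity))
  have j₃ := k₁.trans (mul_le_mul_of_nonneg_left hw1 (by positivity))
  have e2 : g₁ (X - s) * g₂ (X - t) - u₁ * u₂ = (g₁ (X - s) - u₁) * (g₂ (X - t) - u₂) + u₁ * (g₂ (X - t) - u₂) +
      u₂ * (g₁ (X - s) - u₁) := by ring
  rw [e2]
  refine (abs_add_three _ _ _).trans ?_
  rw [abs_mul, abs_mul, abs_mul]
  have i₁ := mul_le_mul j₃ j₂ (abs_nonneg _) (by positivity)
  have i₂ := mul_le_mul m₁ j₂ (abs_nonneg _) (by positivity)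
  have i₃ := mul_le_mul m₂ j₁ (abs_nonneg _) (by positivity)
  set W := (1 + X) ^ (l₁ + l₂) / √(1 + X) with hW
  have w0 : 0 ≤ W := by positivity
  calc _ ≤ _ := add_le_add (add_le_add i₁ i₂) i₃
    _ = A₁ * A₂ * ((1 + s) * (1 + t)) * W + |c₁| * A₂ * (1 + t) * W + |c₂| * A₁ * (1 + s) * W := by
      rw [hW, pow_add]; ring
    _ ≤ A₁ * A₂ * ((1 + s) * (1 + t)) * W + |c₁| * A₂ * ((1 + s) * (1 + t)) * W + |c₂| * A₁ * ((1 + s) * (1 + t)) * W := by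
      have a1 : |c₁| * A₂ * (1 + t) * W ≤ |c₁| * A₂ * ((1 + s) * (1 + t)) * W :=
        mul_le_mul_of_nonneg_right (mul_le_mul_of_nonneg_left (by nlinarith) (by positivity)) w0
      have a2 : |c₂| * A₁ * (1 + s) * W ≤ |c₂| * A₁ * ((1 + s) * (1 + t)) * W :=
        mul_le_mul_of_nonneg_right (mul_le_mul_of_nonneg_left (by nlinarith) (by positivity)) w0
      linarith
    _ = _ := by ring

/-- The operator attached to the zeta function, shifting both variables. -/
noncomputable def zetaShift (K : ℕ) (F : ℝ → ℝ → ℝ) (x y : ℝ) : ℝ :=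
  ∑ n ∈ Ioc 0 K, 1 / (n : ℝ) * F (x - Real.log n) (y - Real.log n)

theorem sum_one_div_mul_sqrt_le {X : ℝ} {m : ℕ} (hm : 0 < m) (hmX : Real.log m ≤ X) :
    ∑ n ∈ Ioc 0 m, 1 / (n : ℝ) * (1 / √(1 + (X - Real.log n))) ≤
      1 + 4 * (√(1 + X) - √(1 + (X - Real.log m))) := by
  induction m, hm using Nat.le_induction with
  | base =>
    have : 1 ≤ √(1 + X) := Real.one_le_sqrt.2 (by simpa using hmX)
    simpa using inv_le_one_of_one_le₀ this
  | succ m hm ih =>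
    obtain ⟨h1, h2⟩ := log_succ_sub_log hm
    have hm1 : (1 : ℝ) ≤ m := by exact_mod_cast hm
    have h3 : (1 : ℝ) / m ≤ 1 := by rw [div_le_one (by positivity)]; exact hm1
    have h30 : (0 : ℝ) < 1 / (m + 1) := by positivity
    have ih' := ih (by linarith)
    rw [sum_Ioc_succ_top (Nat.zero_le m)]
    set a := 1 + (X - Real.log m)
    set b := 1 + (X - Real.log ((m + 1 : ℕ) : ℝ))
    have hab : a - b = Real.log ((m + 1 : ℕ) : ℝ) - Real.log m := by ring
    have hb : 1 ≤ b := by linarith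
    have hsb : 1 ≤ √b := Real.one_le_sqrt.2 hb
    have hab2 : √a ≤ 2 * √b := by
      rw [Real.sqrt_le_left (by positivity), mul_pow, Real.sq_sqrt (by linarith)]
      linarith
    have h4 : 1 / (((m + 1 : ℕ) : ℝ)) * (1 / √b) ≤ 4 * (√a - √b) := by
      have h5 : (√a - √b) * (√a + √b) = a - b := by
        nlinarith [Real.sq_sqrt (by linarith : 0 ≤ a), Real.sq_sqrt (by linarith : 0 ≤ b)]
      have h6 : √b ≤ √a := Real.sqrt_le_sqrt (by linarith)
      rw [mul_one_div, div_le_iff₀ (by positivity)]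
      push_cast at h1 hab ⊢
      nlinarith [mul_nonneg (sub_nonneg.2 h6) (by linarith : 0 ≤ 4 * √b - (√a + √b))]
    linarith

theorem sum_one_div_mul_pow_bounds (l : ℕ) {X : ℝ} {m : ℕ} (hm : 0 < m) (hmX : Real.log m ≤ X) :
    (X ^ (l + 1) - (X - Real.log m) ^ (l + 1)) / (l + 1) + 1 / m * (X - Real.log m) ^ l ≤
        ∑ n ∈ Ioc 0 m, 1 / (n : ℝ) * (X - Real.log n) ^ l ∧
      ∑ n ∈ Ioc 0 m, 1 / (n : ℝ) * (X - Real.log n) ^ l ≤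
        X ^ l + (X ^ (l + 1) - (X - Real.log m) ^ (l + 1)) / (l + 1) := by
  induction m, hm using Nat.le_induction with
  | base => simp
  | succ m hm ih =>
    obtain ⟨h1, h2⟩ := log_succ_sub_log hm
    have hm1 : (1 : ℝ) ≤ m := by exact_mod_cast hm
    have h30 : (0 : ℝ) < 1 / (m + 1) := by positivity
    obtain ⟨i1, i2⟩ := ih (by linarith)
    rw [sum_Ioc_succ_top (Nat.zero_le m)]
    set a := X - Real.log m
    set b := X - Real.log ((m + 1 : ℕ) : ℝ)
    have hb : 0 ≤ b := sub_nonneg.2 hmX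
    have hab : a - b = Real.log ((m + 1 : ℕ) : ℝ) - Real.log m := by ring
    obtain ⟨j1, j2⟩ := pow_succ_sub_pow_succ_bounds l hb (by linarith : b ≤ a)
    have hl : (0 : ℝ) < l + 1 := by positivity
    have k1 : (a ^ (l + 1) - b ^ (l + 1)) / (l + 1) ≤ 1 / m * a ^ l := by
      rw [div_le_iff₀ hl]
      have : a ^ l * (a - b) ≤ a ^ l * (1 / m) := mul_le_mul_of_nonneg_left (hab ▸ h2) (pow_nonneg (by linarith) l)
      nlinarith
    have k2 : 1 / ((m + 1 : ℕ) : ℝ) * b ^ l ≤ (a ^ (l + 1) - b ^ (l + 1)) / (l + 1) := by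
      rw [le_div_iff₀ hl]
      have : b ^ l * (1 / ((m + 1 : ℕ) : ℝ)) ≤ b ^ l * (a - b) :=
        mul_le_mul_of_nonneg_left (by rw [hab]; push_cast at h1 ⊢; exact h1) (pow_nonneg hb l)
      nlinarith
    rw [sub_div] at i1 i2 k1 k2 ⊢
    constructor <;> linarith

theorem log_natFloor_exp {X : ℝ} (hX : 0 ≤ X) :
    0 < ⌊Real.exp X⌋₊ ∧ Real.log ⌊Real.exp X⌋₊ ≤ X ∧ X < Real.log ((⌊Real.exp X⌋₊ + 1 : ℕ) : ℝ) := by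
  have h1 : 0 < ⌊Real.exp X⌋₊ := Nat.floor_pos.2 (Real.one_le_exp hX)
  refine ⟨h1, ?_, ?_⟩
  · rw [Real.log_le_iff_le_exp (by exact_mod_cast h1)]
    exact Nat.floor_le (Real.exp_pos X).le
  · rw [Real.lt_log_iff_exp_lt (by positivity)]
    push_cast
    exact Nat.lt_floor_add_one _

theorem abs_sum_one_div_mul_pow_sub_le (l : ℕ) {X : ℝ} (hX : 0 ≤ X) :
    |∑ n ∈ Ioc 0 ⌊Real.exp X⌋₊, 1 / (n : ℝ) * ((X - Real.log n) ^ l / l.factorial) -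
      X ^ (l + 1) / (l + 1).factorial| ≤ (1 + X) ^ l := by
  obtain ⟨h1, h2, h3⟩ := log_natFloor_exp hX
  obtain ⟨i1, i2⟩ := sum_one_div_mul_pow_bounds l h1 h2
  have k := (log_succ_sub_log h1).2
  set m := ⌊Real.exp X⌋₊
  set v := X - Real.log m with hv
  have hv0 : 0 ≤ v := sub_nonneg.2 h2
  have k1 : v ^ (l + 1) / (l + 1) ≤ 1 / m * v ^ l := by
    refine (div_le_self (by positivity) (by linarith [Nat.cast_nonneg (α := ℝ) l])).trans ?_
    rw [pow_succ, mul_comm]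
    exact mul_le_mul_of_nonneg_right (by linarith) (by positivity)
  have k2 : 0 ≤ v ^ (l + 1) / (l + 1) := by positivity
  have hf : (0 : ℝ) < l.factorial := by positivity
  have e : ∑ n ∈ Ioc 0 m, 1 / (n : ℝ) * ((X - Real.log n) ^ l / l.factorial) - X ^ (l + 1) / (l + 1).factorial =
      (∑ n ∈ Ioc 0 m, 1 / (n : ℝ) * (X - Real.log n) ^ l - X ^ (l + 1) / (l + 1)) / l.factorial := by
    rw [sub_div, sum_div, div_div, Nat.factorial_succ]
    push_cast
    congr 1
    exact sum_congr rfl fun n _ => by ring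
  rw [e, abs_div, abs_of_pos hf]
  refine (div_le_self (abs_nonneg _) (by exact_mod_cast l.factorial_pos)).trans ?_
  have h5 : X ^ l ≤ (1 + X) ^ l := pow_le_pow_left₀ hX (by linarith) l
  have h6 : 0 ≤ X ^ l := by positivity
  rw [sub_div] at i1 i2
  rw [abs_le]
  constructor <;> linarith

theorem DiagApprox.zetaShift {F : ℝ → ℝ → ℝ} {T c B : ℝ} {l K : ℕ} (hB : 0 ≤ B) (hF : DiagApprox F T c l B)
    (hK : Real.exp T < K + 1) : DiagApprox (zetaShift K F) T c (l + 1) (5 * B + |c|) := by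
  refine ⟨fun x y h => sum_eq_zero fun n _ => ?_, fun X s t hX hXT hs ht => ?_⟩
  · rw [hF.1, mul_zero]
    have := Real.log_natCast_nonneg n
    exact h.imp (fun h => by linarith) fun h => by linarith
  obtain ⟨h1, h2, h3⟩ := log_natFloor_exp hX
  have hsub : Ioc 0 ⌊Real.exp X⌋₊ ⊆ Ioc 0 K := by
    refine Ioc_subset_Ioc_right ?_
    rw [← Nat.lt_succ_iff, Nat.floor_lt (Real.exp_pos X).le]
    exact lt_of_le_of_lt (Real.exp_le_exp.2 hXT) (by exact_mod_cast hK)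
  have hres : _root_.zetaShift K F (X - s) (X - t) =
      ∑ n ∈ Ioc 0 ⌊Real.exp X⌋₊, 1 / (n : ℝ) * F (X - Real.log n - s) (X - Real.log n - t) := by
    simp only [sub_right_comm X _ s, sub_right_comm X _ t]
    refine (sum_subset hsub fun n hn h => ?_).symm
    have hn0 := (mem_Ioc.1 hn).1
    have h4 : ⌊Real.exp X⌋₊ + 1 ≤ n := by by_contra h2; exact h (mem_Ioc.2 ⟨hn0, by omega⟩)
    have h5 := Real.log_le_log (by positivity) (by exact_mod_cast h4 : ((⌊Real.exp X⌋₊ + 1 : ℕ) : ℝ) ≤ n)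
    rw [hF.1 _ _ (Or.inl (by linarith)), mul_zero]
  rw [hres]
  have hlog : ∀ n ∈ Ioc 0 ⌊Real.exp X⌋₊, 0 ≤ X - Real.log n := fun n hn => by
    have h4 := mem_Ioc.1 hn
    have h5 := Real.log_le_log (by exact_mod_cast h4.1) (by exact_mod_cast h4.2 : (n : ℝ) ≤ ⌊Real.exp X⌋₊)
    linarith
  have q1 := abs_sum_one_div_mul_pow_sub_le l hX
  have q2 := sum_one_div_mul_sqrt_le h1 h2
  have hS1 : 1 ≤ √(1 + X) := Real.one_le_sqrt.2 (by linarith)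
  have hW : (1 + X) ^ (l + 1) / √(1 + X) = (1 + X) ^ l * √(1 + X) := by
    rw [pow_succ, mul_div_assoc, Real.div_sqrt]
  set m := ⌊Real.exp X⌋₊
  have q3 : |∑ n ∈ Ioc 0 m, 1 / (n : ℝ) * F (X - Real.log n - s) (X - Real.log n - t) -
      ∑ n ∈ Ioc 0 m, 1 / (n : ℝ) * (c * ((X - Real.log n) ^ l / l.factorial))| ≤
      B * ((1 + s) * (1 + t)) * (1 + X) ^ l * (5 * √(1 + X)) := by
    rw [← sum_sub_distrib]
    refine (abs_sum_le_sum_abs _ _).trans ?_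
    have q4 : 1 + 4 * (√(1 + X) - √(1 + (X - Real.log m))) ≤ 5 * √(1 + X) := by
      linarith [Real.sqrt_nonneg (1 + (X - Real.log m))]
    refine le_trans ?_ (mul_le_mul_of_nonneg_left (q2.trans q4) (by positivity))
    rw [mul_sum]
    refine sum_le_sum fun n hn => ?_
    have hn1 := hlog n hn
    have hn2 : X - Real.log n ≤ X := by linarith [Real.log_natCast_nonneg n]
    rw [← mul_sub, abs_mul, abs_of_nonneg (by positivity : 0 ≤ 1 / (n : ℝ))]
    have q5 := hF.2 (X - Real.log n) s t hn1 (hn2.trans hXT) hs ht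
    have q6 : (1 + (X - Real.log n)) ^ l / √(1 + (X - Real.log n)) ≤ (1 + X) ^ l * (1 / √(1 + (X - Real.log n))) := by
      rw [mul_one_div]
      exact div_le_div_of_nonneg_right (pow_le_pow_left₀ (by linarith) (by linarith) l) (Real.sqrt_nonneg _)
    calc _ ≤ 1 / (n : ℝ) * (B * ((1 + s) * (1 + t)) * ((1 + X) ^ l * (1 / √(1 + (X - Real.log n))))) :=
          mul_le_mul_of_nonneg_left (q5.trans (mul_le_mul_of_nonneg_left q6 (by positivity))) (by positivity)
      _ = _ := by ring
  have q7 : |∑ n ∈ Ioc 0 m, 1 / (n : ℝ) * (c * ((X - Real.log n) ^ l / l.factorial)) -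
      c * (X ^ (l + 1) / (l + 1).factorial)| ≤ |c| * (1 + X) ^ l := by
    have : ∑ n ∈ Ioc 0 m, 1 / (n : ℝ) * (c * ((X - Real.log n) ^ l / l.factorial)) =
        c * ∑ n ∈ Ioc 0 m, 1 / (n : ℝ) * ((X - Real.log n) ^ l / l.factorial) := by
      rw [mul_sum]; exact sum_congr rfl fun n _ => by ring
    rw [this, ← mul_sub, abs_mul]
    exact mul_le_mul_of_nonneg_left q1 (abs_nonneg c)
  refine (abs_sub_le _ _ _).trans ((add_le_add q3 q7).trans ?_)
  rw [hW]
  have q8 : |c| * (1 + X) ^ l ≤ |c| * ((1 + s) * (1 + t)) * ((1 + X) ^ l * √(1 + X)) := by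
    have : 1 ≤ (1 + s) * (1 + t) := by nlinarith
    calc |c| * (1 + X) ^ l = |c| * 1 * ((1 + X) ^ l * 1) := by ring
      _ ≤ _ := mul_le_mul (mul_le_mul_of_nonneg_left this (abs_nonneg c))
        (mul_le_mul_of_nonneg_left hS1 (by positivity)) (by positivity) (by positivity)
  calc _ ≤ _ := add_le_add_right q8 _
    _ = _ := by ring

theorem sum_sum_moebius_div_smul {V : Type*} [AddCommGroup V] [Module ℝ V] {K : ℕ} (hK : 0 < K) (G : ℕ → V)
    (hG : ∀ n, K < n → G n = 0) :
    ∑ n ∈ Ioc 0 K, ∑ m ∈ Ioc 0 K, (1 / (n : ℝ) * ((ArithmeticFunction.moebius m : ℝ) / m)) • G (n * m) = G 1 := by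
  rw [← sum_product', ← sum_filter_add_sum_filter_not _ (fun x : ℕ × ℕ => x.1 * x.2 ≤ K),
    sum_eq_zero (s := filter (fun x : ℕ × ℕ => ¬ x.1 * x.2 ≤ K) _) (fun x hx => by
      rw [hG _ (not_le.1 (mem_filter.1 hx).2), smul_zero]), add_zero]
  rw [← sum_fiberwise_of_maps_to (t := Ioc 0 K) (g := fun x : ℕ × ℕ => x.1 * x.2) (fun x hx => by
    simp only [mem_filter, mem_product, mem_Ioc] at hx ⊢
    exact ⟨Nat.mul_pos hx.1.1.1 hx.1.2.1, hx.2⟩)]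
  have h : ∀ k ∈ Ioc 0 K, ∑ x ∈ ((Ioc 0 K ×ˢ Ioc 0 K).filter (fun x : ℕ × ℕ => x.1 * x.2 ≤ K)).filter
      (fun x => x.1 * x.2 = k), (1 / (x.1 : ℝ) * ((ArithmeticFunction.moebius x.2 : ℝ) / x.2)) • G (x.1 * x.2) =
      if k = 1 then G 1 else 0 := by
    intro k hk
    have e : ((Ioc 0 K ×ˢ Ioc 0 K).filter (fun x : ℕ × ℕ => x.1 * x.2 ≤ K)).filter (fun x => x.1 * x.2 = k) =
        k.divisorsAntidiagonal := by
      ext x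
      have hk' := mem_Ioc.1 hk
      simp only [mem_filter, mem_product, mem_Ioc, Nat.mem_divisorsAntidiagonal]
      constructor
      · rintro ⟨_, h⟩; exact ⟨h, by omega⟩
      · rintro ⟨rfl, h⟩
        have h1 := Nat.pos_of_mul_pos_right hk'.1
        have h2 := Nat.pos_of_mul_pos_left hk'.1
        exact ⟨⟨⟨⟨h1, (Nat.le_mul_of_pos_right _ h2).trans hk'.2⟩, h2, (Nat.le_mul_of_pos_left _ h1).trans hk'.2⟩,
          hk'.2⟩, rfl⟩
    rw [e]
    have e2 : ∀ x ∈ k.divisorsAntidiagonal, (1 / (x.1 : ℝ) * ((ArithmeticFunction.moebius x.2 : ℝ) / x.2)) • G (x.1 * x.2) =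
        ((ArithmeticFunction.zeta : ArithmeticFunction ℝ) x.1 * (ArithmeticFunction.moebius : ArithmeticFunction ℝ) x.2) •
          ((1 / (k : ℝ)) • G k) := by
      intro x hx
      obtain ⟨rfl, h⟩ := Nat.mem_divisorsAntidiagonal.1 hx
      have h1 := (Nat.mul_ne_zero_iff.1 h).1
      rw [smul_smul, ArithmeticFunction.natCoe_apply, ArithmeticFunction.zeta_apply_ne h1,
        ArithmeticFunction.intCoe_apply]
      push_cast
      congr 1
      ring
    rw [sum_congr rfl e2, ← sum_smul, ← ArithmeticFunction.mul_apply, ArithmeticFunction.coe_zeta_mul_coe_moebius,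
      ArithmeticFunction.one_apply]
    split_ifs with h1
    · simp [h1]
    · simp
  rw [sum_congr rfl h, sum_ite_eq' (Ioc 0 K) 1, if_pos (mem_Ioc.2 ⟨one_pos, hK⟩)]

theorem eq_zero_of_mul_le_sqrt {d B : ℝ} (h : ∀ T, 0 ≤ T → |d * T| ≤ B * √(1 + T)) : d = 0 := by
  by_contra hd
  have hd' := abs_pos.2 hd
  have hB : 0 ≤ B := by simpa using h 0 le_rfl
  set s := 2 * B / |d| + 1
  have hs : 1 ≤ s := le_add_of_nonneg_left (by positivity)
  have h1 := h (s ^ 2) (by positivity)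
  have h2 : √(1 + s ^ 2) ≤ 2 * s := by
    rw [Real.sqrt_le_left (by positivity)]; nlinarith
  have h3 := h1.trans (mul_le_mul_of_nonneg_left h2 hB)
  rw [abs_mul, abs_of_nonneg (by positivity : 0 ≤ s ^ 2)] at h3
  have h4 : |d| * s = 2 * B + |d| := by simp only [s]; field_simp
  nlinarith

theorem eq_of_moebiusShift_truncPow {a : ℕ} {κ d C : ℝ} (hC : 0 ≤ C) (hd : ∀ T, 0 ≤ T → |truncPow a T - d * T| ≤ 1)
    (h : ∀ (K : ℕ) x, 0 ≤ x → Real.exp x < K + 1 → |moebiusShift K (truncPow a) x - κ| ≤ C / (1 + x)) : κ = d := by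
  have hφ : ∀ a, ∀ x < 0, truncPow a x = 0 := fun a x hx => truncPow_of_neg a hx
  suffices ∃ B, ∀ T, 0 ≤ T → |(κ - d) * T| ≤ B * √(1 + T) from
    sub_eq_zero.1 (eq_zero_of_mul_le_sqrt this.choose_spec)
  obtain ⟨b, hb, hbe⟩ : ∃ b, 0 ≤ b ∧ b = (C + |κ| * ((0 : ℕ) + 1)) * (0 + |(1 : ℝ)| * ((0 : ℕ) + 1)) +
      |κ| * (0 + |(1 : ℝ)| * ((0 : ℕ) + 1)) + |(1 : ℝ)| * (C + |κ| * ((0 : ℕ) + 1)) := ⟨_, by positivity, rfl⟩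
  refine ⟨5 * b + |κ * 1 * ((0 + 0).choose 0 : ℕ)| + 1, fun T hT => ?_⟩
  obtain ⟨k1, k2, k3⟩ := log_natFloor_exp hT
  have hK := Nat.lt_floor_add_one (Real.exp T)
  set K := ⌊Real.exp T⌋₊
  have q := (DiagApprox.zetaShift hb (hbe ▸ DiagApprox.mul (T := T) (g₁ := moebiusShift K (truncPow a)) (g₂ := truncPow 0) (c₁ := κ) (c₂ := 1)
    (l₁ := 0) (l₂ := 0) hC le_rfl (fun x hx => shiftSum_of_neg (hφ a) hx) (hφ 0) (fun x hx hxT => by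
      simpa [div_eq_mul_inv] using h K x hx ((Real.exp_le_exp.2 hxT).trans_lt hK)) (fun x hx _ => by
      simp [truncPow_of_nonneg 0 hx])) hK).2 T 0 0 hT le_rfl le_rfl le_rfl
  have e : zetaShift K (fun x y => moebiusShift K (truncPow a) x * truncPow 0 y) (T - 0) (T - 0) = truncPow a T := by
    rw [sub_zero]
    have := sum_sum_moebius_div_smul k1 (fun n : ℕ => truncPow a (T - Real.log n)) fun n hn =>
      hφ a _ (by linarith [Real.log_le_log (by positivity) (by exact_mod_cast hn : ((K + 1 : ℕ) : ℝ) ≤ n)])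
    rw [Nat.cast_one, Real.log_one, sub_zero] at this
    rw [← this]
    refine sum_congr rfl fun n hn => ?_
    have hn := mem_Ioc.1 hn
    have hn1 : Real.log n ≤ Real.log K := Real.log_le_log (by exact_mod_cast hn.1) (by exact_mod_cast hn.2)
    beta_reduce
    rw [truncPow_of_nonneg 0 (by linarith : 0 ≤ T - Real.log n), moebiusShift, shiftSum]
    simp only [pow_zero, Nat.factorial_zero, Nat.cast_one, div_one, mul_one, mul_sum, smul_eq_mul]
    refine sum_congr rfl fun m hm => ?_
    have hm := mem_Ioc.1 hm
    rw [Nat.cast_mul, Real.log_mul (by exact_mod_cast hn.1.ne') (by exact_mod_cast hm.1.ne'), sub_sub, mul_assoc]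
  rw [e] at q
  have hs : 1 ≤ √(1 + T) := Real.one_le_sqrt.2 (by linarith)
  simp only [zero_add, pow_one, Nat.factorial_one, Nat.cast_one, div_one, add_zero, mul_one, Real.div_sqrt,
    Nat.choose_self] at q ⊢
  have h2 := abs_sub_le (κ * T) (truncPow a T) (d * T)
  rw [abs_sub_comm (κ * T) (truncPow a T), ← sub_mul] at h2
  linarith [hd T hT]

theorem integral_one_div_sq_one_add {a b : ℝ} (ha : 0 ≤ a) (hab : a ≤ b) :
    IntervalIntegrable (fun u : ℝ => 1 / (1 + u) ^ 2) MeasureTheory.volume a b ∧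
      ∫ u in a..b, 1 / (1 + u) ^ 2 = 1 / (1 + a) - 1 / (1 + b) := by
  have h0 : ∀ x ∈ Set.uIcc a b, 1 + x ≠ 0 := fun x hx => by
    rw [Set.uIcc_of_le hab] at hx; linarith [hx.1]
  have hi : IntervalIntegrable (fun u : ℝ => 1 / (1 + u) ^ 2) MeasureTheory.volume a b :=
    ContinuousOn.intervalIntegrable (continuousOn_const.div (by fun_prop) fun x hx => pow_ne_zero _ (h0 x hx))
  refine ⟨hi, ?_⟩
  rw [intervalIntegral.integral_eq_sub_of_hasDerivAt (f := fun u => -(1 / (1 + u))) (fun x hx => ?_) hi]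
  · ring
  · have := (((hasDerivAt_id x).const_add 1).inv (h0 x hx)).neg
    simp only [one_div]
    refine this.congr_deriv ?_
    simp [neg_div]

/-- `G` is the primitive of `g` vanishing on the negative half line. -/
def IsPrimitive (G g : ℝ → ℝ) : Prop :=
  (∀ a b, IntervalIntegrable g MeasureTheory.volume a b) ∧ ∀ z, z ≤ 0 → ∀ y, G y = ∫ u in z..y, g u

theorem isPrimitive_truncPow (a : ℕ) : IsPrimitive (truncPow (a + 1)) (truncPow a) := by
  have hm : Monotone (truncPow a) := fun x y hxy => by
    unfold truncPow
    split_ifs with h1 h2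
    · gcongr
    · linarith
    · positivity
    · rfl
  refine ⟨fun _ _ => hm.intervalIntegrable, fun z hz y => ?_⟩
  have hz0 : truncPow (a + 1) z = 0 := by
    rcases hz.lt_or_eq with h | rfl
    · exact truncPow_of_neg _ h
    · simp [truncPow]
  have he : truncPow (a + 1) = fun x => (max x 0) ^ (a + 1) / ((a + 1).factorial : ℝ) := by
    ext x
    rcases lt_or_ge x 0 with h | h
    · rw [truncPow_of_neg _ h, max_eq_right h.le, zero_pow (by omega), zero_div]
    · rw [truncPow_of_nonneg _ h, max_eq_left h]
  rw [intervalIntegral.integral_eq_sub_of_hasDeriv_right (f := truncPow (a + 1)) _ (fun x _ => ?_)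
    hm.intervalIntegrable, hz0, sub_zero]
  · rw [he]; fun_prop
  rcases lt_or_ge x 0 with h | h
  · rw [truncPow_of_neg _ h]
    refine ((hasDerivAt_const x (0 : ℝ)).congr_of_eventuallyEq ?_).hasDerivWithinAt
    filter_upwards [Iio_mem_nhds h] with y hy using truncPow_of_neg _ hy
  · rw [truncPow_of_nonneg _ h]
    have : HasDerivAt (fun x : ℝ => x ^ (a + 1) / ((a + 1).factorial : ℝ)) (x ^ a / a.factorial) x := by
      refine ((hasDerivAt_pow (a + 1) x).div_const _).congr_deriv ?_
      rw [Nat.factorial_succ]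
      push_cast
      field_simp
    exact this.hasDerivWithinAt.congr (fun y hy => truncPow_of_nonneg _ (h.trans (le_of_lt hy)))
      (truncPow_of_nonneg _ h)

theorem IsPrimitive.moebiusShift {G g : ℝ → ℝ} (h : IsPrimitive G g) (K : ℕ) :
    IsPrimitive (moebiusShift K G) (moebiusShift K g) := by
  have hi : ∀ n : ℕ, ∀ a b, IntervalIntegrable (fun u => (ArithmeticFunction.moebius n : ℝ) / n * g (u - Real.log n))
      MeasureTheory.volume a b := fun n a b => by
    simpa using ((h.1 (a - Real.log n) (b - Real.log n)).comp_sub_right (Real.log n)).const_mul _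
  refine ⟨fun a b => ?_, fun z hz y => ?_⟩
  · have e : _root_.moebiusShift K g =
        ∑ n ∈ Ioc 0 K, fun u => (ArithmeticFunction.moebius n : ℝ) / n * g (u - Real.log n) := by
      ext u; simp [_root_.moebiusShift, shiftSum]
    exact e ▸ IntervalIntegrable.sum _ fun n _ => hi n a b
  · simp only [_root_.moebiusShift, shiftSum]
    rw [intervalIntegral.integral_finsetSum fun n _ => hi n z y]
    refine sum_congr rfl fun n _ => ?_
    rw [intervalIntegral.integral_const_mul, intervalIntegral.integral_comp_sub_right,
      h.2 (z - Real.log n) (by linarith [Real.log_natCast_nonneg n])]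

theorem IsPrimitive.moebiusShift_eq {G g : ℝ → ℝ} (h : IsPrimitive G g) (K : ℕ) {x : ℝ} (hx : 0 ≤ x) :
    IntervalIntegrable (fun u => _root_.moebiusShift K (truncPow 0) u * g (x - u)) MeasureTheory.volume 0 x ∧
      _root_.moebiusShift K G x = ∫ u in 0..x, _root_.moebiusShift K (truncPow 0) u * g (x - u) := by
  have hg : IntervalIntegrable (fun u => g (x - u)) MeasureTheory.volume 0 x := by
    simpa using ((h.1 x 0).comp_sub_left x)
  have hi : ∀ n : ℕ, IntervalIntegrable (fun u => (ArithmeticFunction.moebius n : ℝ) / n *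
      (truncPow 0 (u - Real.log n) * g (x - u))) MeasureTheory.volume 0 x := fun n => by
    refine IntervalIntegrable.const_mul ?_ _
    have e : (fun u => truncPow 0 (u - Real.log n) * g (x - u)) =
        Set.indicator (Set.Ici (Real.log n)) (fun u => g (x - u)) := by
      ext u
      simp [truncPow, Set.indicator_apply]
    rw [e]
    exact ⟨hg.1.indicator measurableSet_Ici, hg.2.indicator measurableSet_Ici⟩
  have e0 : (fun u => _root_.moebiusShift K (truncPow 0) u * g (x - u)) = ∑ n ∈ Ioc 0 K, fun u =>
      (ArithmeticFunction.moebius n : ℝ) / n * (truncPow 0 (u - Real.log n) * g (x - u)) := by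
    ext u
    simp only [_root_.moebiusShift, shiftSum, sum_mul, mul_assoc, Finset.sum_apply]
  rw [e0]
  refine ⟨IntervalIntegrable.sum _ fun n _ => hi n, ?_⟩
  rw [Finset.sum_fn]
  rw [intervalIntegral.integral_finsetSum fun n _ => hi n, _root_.moebiusShift, shiftSum]
  refine sum_congr rfl fun n _ => ?_
  rw [intervalIntegral.integral_const_mul]
  congr 1
  have hn := Real.log_natCast_nonneg n
  generalize Real.log n = c at *
  have e1 : ∫ u in 0..x, truncPow 0 (u - c) * g (x - u) = ∫ v in 0..x, truncPow 0 (x - c - v) * g v := by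
    have := intervalIntegral.integral_comp_sub_left (fun v => truncPow 0 (x - c - v) * g v) (a := 0) (b := x) x
    simp only [sub_self, sub_zero] at this
    rw [← this]
    congr 1; ext u; congr 2; ring
  rw [e1, h.2 0 le_rfl]
  rcases lt_or_ge x c with hc | hc
  · rw [← h.2 0 le_rfl, h.2 (x - c) (by linarith), intervalIntegral.integral_same]
    refine (intervalIntegral.integral_zero_ae (Filter.Eventually.of_forall fun v hv => ?_)).symm
    rw [Set.uIoc_of_le hx] at hv
    rw [truncPow_of_neg 0 (by linarith [hv.1]), zero_mul]
  · rw [← intervalIntegral.integral_indicator (a₂ := x - c) (a₃ := x) ⟨by linarith, by linarith⟩]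
    congr 1; ext v
    simp [truncPow, Set.indicator_apply]

theorem exists_abs_moebiusShift_truncPow_zero_le : ∃ C : ℝ, 0 ≤ C ∧ ∀ (K : ℕ) (x : ℝ), 0 ≤ x → Real.exp x < K + 1 →
    |moebiusShift K (truncPow 0) x| ≤ C / (1 + x) ^ 3 := by
  obtain ⟨κ, C, hC, h⟩ := exists_moebiusShift_truncPow_zero
  have : κ = 0 := eq_of_moebiusShift_truncPow (a := 0) hC (fun T hT => by simp [truncPow_of_nonneg 0 hT])
    fun K x hx hK => (h K x hx hK).trans (div_le_div_of_nonneg_left hC (by linarith) (le_self_pow₀ (by linarith) (by norm_num)))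
  exact ⟨C, hC, fun K x hx hK => by simpa [this] using h K x hx hK⟩

theorem exists_abs_moebiusShift_truncPow_one_sub_le : ∃ C : ℝ, 0 ≤ C ∧ ∀ (K : ℕ) (x : ℝ), 0 ≤ x → Real.exp x < K + 1 →
    |moebiusShift K (truncPow 1) x - 1| ≤ C / (1 + x) := by
  obtain ⟨C, hC, h⟩ := exists_abs_moebiusShift_truncPow_zero_le
  have hφ : ∀ x < 0, truncPow 1 x = 0 := fun x hx => truncPow_of_neg 1 hx
  have hfl : ∀ x, Real.exp x < ⌊Real.exp x⌋₊ + 1 := fun x => Nat.lt_floor_add_one _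
  have hind : ∀ (K : ℕ) x, Real.exp x < K + 1 → moebiusShift K (truncPow 1) x =
      moebiusShift ⌊Real.exp x⌋₊ (truncPow 1) x := fun K x hK =>
    (shiftSum_eq_sum_floor hφ hK).trans (shiftSum_eq_sum_floor hφ (hfl x)).symm
  have hcauchy : ∀ x y, 0 ≤ x → x ≤ y → |moebiusShift ⌊Real.exp y⌋₊ (truncPow 1) y -
      moebiusShift ⌊Real.exp x⌋₊ (truncPow 1) x| ≤ C / (1 + x) := fun x y hx hxy => by
    have hK := hfl y
    rw [← hind _ x ((Real.exp_le_exp.2 hxy).trans_lt hK)]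
    have hP := (isPrimitive_truncPow 0).moebiusShift ⌊Real.exp y⌋₊
    rw [hP.2 0 le_rfl y, hP.2 0 le_rfl x, intervalIntegral.integral_interval_sub_left (hP.1 _ _) (hP.1 _ _)]
    obtain ⟨i1, i2⟩ := integral_one_div_sq_one_add hx hxy
    rw [← Real.norm_eq_abs]
    refine (intervalIntegral.norm_integral_le_of_norm_le hxy (.of_forall fun u hu => ?_) (i1.const_mul C)).trans ?_
    · have hu0 : 0 ≤ u := hx.trans hu.1.le
      refine (h _ u hu0 ((Real.exp_le_exp.2 hu.2).trans_lt hK)).trans ?_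
      rw [mul_one_div]
      exact div_le_div_of_nonneg_left hC (by positivity) (pow_le_pow_right₀ (by linarith) (by norm_num))
    · rw [intervalIntegral.integral_const_mul, i2]
      have h0 : 0 ≤ C * (1 / (1 + y)) := by have := hx.trans hxy; positivity
      linarith [mul_one_div C (1 + x)]
  obtain ⟨κ, hκ⟩ := exists_abs_sub_le_of_cauchy (f := fun n : ℕ => moebiusShift ⌊Real.exp n⌋₊ (truncPow 1) n)
    (w := fun n => C / (1 + n)) (Filter.Tendsto.const_div_atTop
      (Filter.tendsto_atTop_add_const_left _ 1 tendsto_natCast_atTop_atTop) C)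
    fun a b _ hab => hcauchy a b a.cast_nonneg (by exact_mod_cast hab)
  have key : ∀ (K : ℕ) (x : ℝ), 0 ≤ x → Real.exp x < K + 1 → |moebiusShift K (truncPow 1) x - κ| ≤ 2 * C / (1 + x) := by
    intro K x hx hK
    rw [hind K x hK]
    have hx1 := Nat.le_ceil x
    have h1 := hκ (⌈x⌉₊ + 1) (by omega)
    have h2 := hcauchy x (⌈x⌉₊ + 1 : ℕ) hx (by push_cast; linarith)
    have h3 : C / (1 + ((⌈x⌉₊ + 1 : ℕ) : ℝ)) ≤ C / (1 + x) :=
      div_le_div_of_nonneg_left hC (by positivity) (by push_cast; linarith)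
    rw [abs_sub_comm] at h2
    refine (abs_sub_le _ _ _).trans ((add_le_add h2 (h1.trans h3)).trans (le_of_eq (by ring)))
  have : κ = 1 := eq_of_moebiusShift_truncPow (a := 1) (by positivity) (fun T hT => by simp [truncPow_of_nonneg 1 hT]) key
  exact ⟨2 * C, by positivity, this ▸ key⟩

theorem isPrimitive_iterate_moebiusShift (K k a : ℕ) :
    IsPrimitive ((moebiusShift K)^[k] (truncPow (a + 1))) ((moebiusShift K)^[k] (truncPow a)) := by
  induction k with
  | zero => exact isPrimitive_truncPow a
  | succ k ih => simpa only [Function.iterate_succ_apply'] using ih.moebiusShift K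

theorem iterate_moebiusShift_of_neg (K k a : ℕ) : ∀ x < 0, (moebiusShift K)^[k] (truncPow a) x = 0 := by
  induction k with
  | zero => exact fun x hx => truncPow_of_neg a hx
  | succ k ih => rw [Function.iterate_succ_apply']; exact fun x hx => shiftSum_of_neg ih hx

theorem exists_abs_iterate_moebiusShift_sub_le (k l : ℕ) : ∃ C : ℝ, 0 ≤ C ∧ ∀ (K : ℕ) (x : ℝ), 0 ≤ x →
    Real.exp x < K + 1 → |(moebiusShift K)^[k] (truncPow (k + l)) x - 1 * (x ^ l / l.factorial)| ≤
      C * ((1 + x) ^ l / (1 + x)) := by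
  induction k with
  | zero => exact ⟨0, le_rfl, fun K x hx _ => by simp [truncPow_of_nonneg l hx]⟩
  | succ k ih =>
    obtain ⟨C, hC, ih⟩ := ih
    obtain ⟨C₀, hC₀, h₀⟩ := exists_abs_moebiusShift_truncPow_zero_le
    obtain ⟨C₁, hC₁, h₁⟩ := exists_abs_moebiusShift_truncPow_one_sub_le
    have hA : 0 ≤ C + |(1 : ℝ)| * (l + 1) := by positivity
    refine ⟨C₀ * (C + |1| * (l + 1)) + C₁, by positivity, fun K x hx hK => ?_⟩
    have hsh : ∀ u : ℝ, 0 ≤ u → _ := fun u hu => abs_shift_sub_le hC (iterate_moebiusShift_of_neg K k (k + l)) (T := x)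
      (fun v hv hvx => ih K v hv ((Real.exp_le_exp.2 hvx).trans_lt hK)) hx le_rfl hu
    have hbd : ∀ u : ℝ, 0 ≤ u → u ≤ x → _ := fun u hu hux => h₀ K u hu ((Real.exp_le_exp.2 hux).trans_lt hK)
    obtain ⟨i1, i2⟩ := (isPrimitive_iterate_moebiusShift K k (k + l)).moebiusShift_eq K hx
    obtain ⟨j1, j2⟩ := (isPrimitive_truncPow 0).moebiusShift_eq K hx
    have j3 : ∫ u in 0..x, moebiusShift K (truncPow 0) u * truncPow 0 (x - u) =
        ∫ u in 0..x, moebiusShift K (truncPow 0) u :=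
      intervalIntegral.integral_congr fun u hu => by
        rw [Set.uIcc_of_le hx] at hu
        simp [truncPow_of_nonneg 0 (sub_nonneg.2 hu.2)]
    have h₁' := h₁ K x hx hK
    have hm := ((isPrimitive_truncPow 0).moebiusShift K).1 0 x
    rw [zero_add] at j2
    rw [j2, j3] at h₁'
    rw [Function.iterate_succ_apply', show k + 1 + l = k + l + 1 by ring, i2]
    simp only [one_mul] at hsh ⊢
    have hp := pow_div_factorial_le l hx
    have hp0 : 0 ≤ x ^ l / (l.factorial : ℝ) := by positivity
    have hW0 : 0 ≤ (1 + x) ^ l / (1 + x) := by positivity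
    have hWe : (1 + x) ^ l / (1 + x) = (1 + x) ^ l * (1 / (1 + x)) := by ring
    generalize x ^ l / (l.factorial : ℝ) = p at *
    generalize C + |(1 : ℝ)| * (l + 1) = A at *
    set g := (moebiusShift K)^[k] (truncPow (k + l))
    obtain ⟨q1, q2⟩ := integral_one_div_sq_one_add le_rfl hx
    have e : (∫ u in 0..x, moebiusShift K (truncPow 0) u * g (x - u)) - p =
        (∫ u in 0..x, (moebiusShift K (truncPow 0) u * g (x - u) - moebiusShift K (truncPow 0) u * p)) +
          ((∫ u in 0..x, moebiusShift K (truncPow 0) u) - 1) * p := by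
      rw [intervalIntegral.integral_sub i1 (hm.mul_const p), intervalIntegral.integral_mul_const]
      ring
    rw [e]
    refine (abs_add_le _ _).trans ?_
    have b1 : |∫ u in 0..x, (moebiusShift K (truncPow 0) u * g (x - u) - moebiusShift K (truncPow 0) u * p)| ≤
        C₀ * A * ((1 + x) ^ l / (1 + x)) * (1 / (1 + 0) - 1 / (1 + x)) := by
      rw [← q2, ← intervalIntegral.integral_const_mul, ← Real.norm_eq_abs]
      refine intervalIntegral.norm_integral_le_of_norm_le hx (.of_forall fun u hu => ?_) (q1.const_mul _)
      have hu0 : 0 < 1 + u := by linarith [hu.1]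
      rw [← mul_sub, Real.norm_eq_abs, abs_mul]
      refine (mul_le_mul (hbd u hu.1.le hu.2) (hsh u hu.1.le) (abs_nonneg _) (by positivity)).trans (le_of_eq ?_)
      field_simp
    have b2 : |((∫ u in 0..x, moebiusShift K (truncPow 0) u) - 1) * p| ≤ C₁ / (1 + x) * (1 + x) ^ l := by
      rw [abs_mul, abs_of_nonneg hp0]
      exact mul_le_mul h₁' hp hp0 (by positivity)
    have b3 : 1 / (1 + 0) - 1 / (1 + x) ≤ 1 := by
      have : 0 ≤ 1 / (1 + x) := by positivity
      linarith
    calc _ ≤ C₀ * A * ((1 + x) ^ l / (1 + x)) * 1 + C₁ / (1 + x) * (1 + x) ^ l :=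
          add_le_add (b1.trans (mul_le_mul_of_nonneg_left b3 (by positivity))) b2
      _ = _ := by ring

theorem exists_diagApprox (k₁ k₂ l₁ l₂ r : ℕ) : ∃ B : ℝ, 0 ≤ B ∧ ∀ (K : ℕ) (T : ℝ), Real.exp T < K + 1 →
    DiagApprox ((zetaShift K)^[r] fun x y => (moebiusShift K)^[k₁] (truncPow (k₁ + l₁)) x *
      (moebiusShift K)^[k₂] (truncPow (k₂ + l₂)) y) T ((l₁ + l₂).choose l₁) (l₁ + l₂ + r) B := by
  obtain ⟨C₁, hC₁, h₁⟩ := exists_abs_iterate_moebiusShift_sub_le k₁ l₁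
  obtain ⟨C₂, hC₂, h₂⟩ := exists_abs_iterate_moebiusShift_sub_le k₂ l₂
  induction r with
  | zero =>
    refine ⟨_, ?_, fun K T hK => by
      simpa using DiagApprox.mul hC₁ hC₂ (iterate_moebiusShift_of_neg K _ _) (iterate_moebiusShift_of_neg K _ _)
        (fun x hx hxT => h₁ K x hx ((Real.exp_le_exp.2 hxT).trans_lt hK))
        (fun x hx hxT => h₂ K x hx ((Real.exp_le_exp.2 hxT).trans_lt hK))⟩
    positivity
  | succ r ih =>
    obtain ⟨B, hB, ih⟩ := ih
    refine ⟨5 * B + |((l₁ + l₂).choose l₁ : ℝ)|, by positivity, fun K T hK => ?_⟩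
    rw [Function.iterate_succ_apply']
    exact (ih K T hK).zetaShift hB hK

/-- The linear functional on the algebra of double Dirichlet polynomials that sends the monomial
`(d, e)` to `F (L - log d) (L - log e)`. -/
noncomputable def shiftFunctional (L : ℝ) (F : ℝ → ℝ → ℝ) : MonoidAlgebra ℝ (ℕ × ℕ) →ₗ[ℝ] ℝ :=
  Finsupp.linearCombination ℝ (fun d : ℕ × ℕ => if d.1 * d.2 = 0 then 0 else F (L - Real.log d.1) (L - Real.log d.2)) ∘ₗ
    (MonoidAlgebra.coeffLinearEquiv ℝ).toLinearMap

theorem shiftFunctional_single (L : ℝ) (F : ℝ → ℝ → ℝ) (d : ℕ × ℕ) (c : ℝ) :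
    shiftFunctional L F (MonoidAlgebra.single d c) =
      c * if d.1 * d.2 = 0 then 0 else F (L - Real.log d.1) (L - Real.log d.2) := by
  simp [shiftFunctional, Finsupp.linearCombination_single]

/-- The multiplicative map `n ↦ (n ^ i, n ^ j)` into double Dirichlet polynomials. -/
noncomputable def monoPow (i j : ℕ) : ℕ →* MonoidAlgebra ℝ (ℕ × ℕ) :=
  (MonoidAlgebra.of ℝ (ℕ × ℕ)).comp ((powMonoidHom i).prod (powMonoidHom j))

theorem monoPow_apply (i j n : ℕ) : monoPow i j n = MonoidAlgebra.single (n ^ i, n ^ j) 1 := rfl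

theorem shiftFunctional_mul_sum (L : ℝ) (F : ℝ → ℝ → ℝ) (c : ℕ → ℝ) (i j K : ℕ) (a : MonoidAlgebra ℝ (ℕ × ℕ)) :
    shiftFunctional L F (a * ∑ n ∈ Ioc 0 K, c n • monoPow i j n) =
      shiftFunctional L (fun x y => ∑ n ∈ Ioc 0 K, c n * F (x - i * Real.log n) (y - j * Real.log n)) a := by
  refine MonoidAlgebra.induction_linear a (by simp) (fun a b ha hb => by rw [add_mul, map_add, map_add, ha, hb]) ?_
  intro d b
  rw [mul_sum, map_sum, shiftFunctional_single]
  by_cases hd : d.1 * d.2 = 0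
  · rw [if_pos hd, mul_zero]
    refine sum_eq_zero fun n _ => ?_
    rw [mul_smul_comm, monoPow_apply, MonoidAlgebra.single_mul_single, map_smul, shiftFunctional_single, if_pos]
    · simp
    · rcases mul_eq_zero.1 hd with h | h <;> simp [h]
  · rw [if_neg hd, mul_sum]
    have hd' := mul_ne_zero_iff.1 hd
    refine sum_congr rfl fun n hn => ?_
    have hn0 : n ≠ 0 := (mem_Ioc.1 hn).1.ne'
    rw [mul_smul_comm, monoPow_apply, MonoidAlgebra.single_mul_single, map_smul, shiftFunctional_single, if_neg]
    · simp only [Prod.fst_mul, Prod.snd_mul, Nat.cast_mul, Nat.cast_pow]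
      rw [Real.log_mul (by exact_mod_cast hd'.1) (by positivity), Real.log_mul (by exact_mod_cast hd'.2) (by positivity),
        Real.log_pow, Real.log_pow, smul_eq_mul, mul_one, sub_sub, sub_sub]
      ring
    · simp [hd'.1, hd'.2, hn0]

/-- The ideal of double Dirichlet polynomials with no monomial inside `[1, K]²`. -/
noncomputable def tailIdeal (K : ℕ) : Ideal (MonoidAlgebra ℝ (ℕ × ℕ)) :=
  Ideal.span {a | ∃ d : ℕ × ℕ, (d.1 * d.2 = 0 ∨ K < d.1 ∨ K < d.2) ∧ a = MonoidAlgebra.single d 1}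

theorem shiftFunctional_eq_zero {L : ℝ} {K : ℕ} (hL : Real.exp L < K + 1) {F : ℝ → ℝ → ℝ}
    (hF : ∀ x y, x < 0 ∨ y < 0 → F x y = 0) {a : MonoidAlgebra ℝ (ℕ × ℕ)} (ha : a ∈ tailIdeal K) :
    shiftFunctional L F a = 0 := by
  have hlog (d : ℕ) (hd : K < d) : L - Real.log d < 0 := by
    have : Real.exp L < d := hL.trans_le (by exact_mod_cast hd)
    have := (Real.lt_log_iff_exp_lt ((Real.exp_pos L).trans this)).2 this
    linarith
  refine Submodule.span_induction (p := fun a _ => ∀ b, shiftFunctional L F (b * a) = 0) ?_ (by simp)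
    (fun x y _ _ hx hy b => by rw [mul_add, map_add, hx, hy, add_zero])
    (fun b x _ hx c => by rw [smul_eq_mul, ← mul_assoc, hx]) ha 1 |>.symm.trans (by rw [one_mul]) |>.symm
  rintro _ ⟨d, hd, rfl⟩ b
  refine MonoidAlgebra.induction_linear b (by simp) (fun a b ha hb => by rw [add_mul, map_add, ha, hb, add_zero]) ?_
  intro e c
  rw [MonoidAlgebra.single_mul_single, shiftFunctional_single]
  split_ifs with h
  · simp
  · simp only [Prod.fst_mul, Prod.snd_mul, mul_eq_zero, not_or] at h
    rw [hF, mul_zero]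
    rcases hd with hd | hd
    · simp_all
    · exact hd.imp (fun hd => hlog _ (hd.trans_le (Nat.le_mul_of_pos_left _ (Nat.pos_of_ne_zero h.1.1))))
        fun hd => hlog _ (hd.trans_le (Nat.le_mul_of_pos_left _ (Nat.pos_of_ne_zero h.2.1)))

theorem prod_one_sub_smul_eq_sum_moebius {Q : Type*} [CommRing Q] [Algebra ℝ Q] {K : ℕ} (x : ℕ →* Q)
    (hx : ∀ n, n = 0 ∨ K < n → x n = 0) :
    ∏ p ∈ K.primesLE, (1 - (1 / (p : ℝ)) • x p) = ∑ n ∈ Ioc 0 K, ((ArithmeticFunction.moebius n : ℝ) / n) • x n := by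
  let f : ArithmeticFunction Q := ⟨fun n => (1 / (n : ℝ)) • x n, by simp⟩
  have hf : f.IsMultiplicative := ⟨by simp [f], fun {m n} _ => by
    simp only [f, ArithmeticFunction.coe_mk, map_mul, Nat.cast_mul, smul_mul_smul_comm]
    rw [one_div_mul_one_div]⟩
  have h := ArithmeticFunction.IsMultiplicative.prodPrimeFactors_one_sub_of_squarefree f hf (squarefree_primorial K)
  rw [primeFactors_primorial] at h
  refine h.trans ?_
  have e (n : ℕ) : (ArithmeticFunction.moebius n : Q) * f n = ((ArithmeticFunction.moebius n : ℝ) / n) • x n := by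
    rw [div_eq_mul_one_div, mul_smul, Int.cast_smul_eq_zsmul, zsmul_eq_mul]
    rfl
  simp_rw [e]
  rw [← sum_filter_of_ne (s := (primorial K).divisors) (p := (· ∈ Ioc 0 K)),
    ← sum_filter_of_ne (s := Ioc 0 K) (p := (· ∈ (primorial K).divisors)), filter_mem_eq_inter, filter_mem_eq_inter,
    inter_comm]
  · intro n _ hn
    refine Nat.mem_divisors.2 ⟨?_, primorial_ne_zero K⟩
    have : Squarefree n := ArithmeticFunction.moebius_ne_zero_iff_squarefree.1 fun h => hn (by simp [h])
    exact this.dvd_primorial.trans (primorial_dvd_primorial (by simp_all))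
  · intro n _ hn
    by_contra h
    exact hn (by rw [hx n (by simp at h; omega), smul_zero])

theorem monoPow_mem_tailIdeal {i j : ℕ} (hij : i ≠ 0 ∨ j ≠ 0) {K n : ℕ} (hn : n = 0 ∨ K < n) : monoPow i j n ∈ tailIdeal K := by
  refine Ideal.subset_span ⟨_, ?_, rfl⟩
  rcases hn with rfl | hn
  · rcases hij with h | h <;> simp [h]
  · rcases hij with h | h
    · exact Or.inr (Or.inl (hn.trans_le (Nat.le_self_pow h n)))
    · exact Or.inr (Or.inr (hn.trans_le (Nat.le_self_pow h n)))

/-- The monomial `n ^ (-s - i u - j v)` in double Dirichlet notation, at `s = 1`. -/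
noncomputable def eulerTerm (i j n : ℕ) : MonoidAlgebra ℝ (ℕ × ℕ) := (1 / (n : ℝ)) • monoPow i j n

theorem mk_prod_one_sub_eulerTerm {i j : ℕ} (hij : i ≠ 0 ∨ j ≠ 0) (K : ℕ) :
    Ideal.Quotient.mk (tailIdeal K) (∏ p ∈ K.primesLE, (1 - eulerTerm i j p)) =
      Ideal.Quotient.mk (tailIdeal K) (∑ n ∈ Ioc 0 K, ((ArithmeticFunction.moebius n : ℝ) / n) • monoPow i j n) := by
  have h := prod_one_sub_smul_eq_sum_moebius (K := K)
    (((Ideal.Quotient.mkₐ ℝ (tailIdeal K)).toRingHom.toMonoidHom).comp (monoPow i j)) fun n hn => by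
      exact Ideal.Quotient.eq_zero_iff_mem.2 (monoPow_mem_tailIdeal hij hn)
  rw [← Ideal.Quotient.mkₐ_eq_mk ℝ, map_prod, map_sum]
  simp only [map_sub, map_one, eulerTerm, map_smul]
  exact h

theorem mk_prod_geom_sum_mul {i j : ℕ} (hij : i ≠ 0 ∨ j ≠ 0) {K J : ℕ} (hJ : K < 2 ^ J) :
    Ideal.Quotient.mk (tailIdeal K) ((∏ p ∈ K.primesLE, ∑ n ∈ range J, eulerTerm i j p ^ n) *
      ∑ n ∈ Ioc 0 K, ((ArithmeticFunction.moebius n : ℝ) / n) • monoPow i j n) = 1 := by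
  rw [map_mul, ← mk_prod_one_sub_eulerTerm hij, ← map_mul, ← prod_mul_distrib, map_prod]
  refine prod_eq_one fun p hp => ?_
  rw [geom_sum_mul_neg, map_sub, map_one, sub_eq_self, eulerTerm, smul_pow, ← map_pow]
  refine Ideal.Quotient.eq_zero_iff_mem.2 (Submodule.smul_of_tower_mem _ _ (monoPow_mem_tailIdeal hij (Or.inr ?_)))
  exact hJ.trans_le (Nat.pow_le_pow_left (Nat.prime_of_mem_primesLE hp).two_le J)

theorem mk_prod_one_sub_mul_sum {i j : ℕ} (hij : i ≠ 0 ∨ j ≠ 0) {K : ℕ} (hK : 0 < K) :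
    Ideal.Quotient.mk (tailIdeal K) ((∏ p ∈ K.primesLE, (1 - eulerTerm i j p)) *
      ∑ n ∈ Ioc 0 K, (1 / (n : ℝ)) • monoPow i j n) = 1 := by
  have h := sum_sum_moebius_div_smul hK (fun n => Ideal.Quotient.mkₐ ℝ (tailIdeal K) (monoPow i j n)) fun n hn =>
    (Ideal.Quotient.eq_zero_iff_mem (I := tailIdeal K)).2 (monoPow_mem_tailIdeal hij (Or.inr hn))
  rw [map_mul, mk_prod_one_sub_eulerTerm hij, ← map_mul, mul_comm, sum_mul_sum, ← Ideal.Quotient.mkₐ_eq_mk ℝ,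
    map_sum]
  refine Eq.trans (sum_congr rfl fun n _ => ?_) (h.trans (by simp))
  rw [map_sum]
  exact sum_congr rfl fun m _ => by rw [smul_mul_smul_comm, ← map_mul, map_smul]

theorem shiftFunctional_prod {L : ℝ} {K J : ℕ} (hK : 0 < K) (hJ : K < 2 ^ J) (hL : Real.exp L < K + 1) {f g : ℝ → ℝ}
    (hf : ∀ x < 0, f x = 0) (hg : ∀ x < 0, g x = 0) (A : ℕ → MonoidAlgebra ℝ (ℕ × ℕ)) (k₁ k₂ r : ℕ) :
    shiftFunctional L (fun x y => f x * g y) (∏ p ∈ K.primesLE, A p) =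
      shiftFunctional L ((zetaShift K)^[r] fun x y => (moebiusShift K)^[k₁] f x * (moebiusShift K)^[k₂] g y)
        (∏ p ∈ K.primesLE, (A p * (∑ n ∈ range J, eulerTerm 1 0 p ^ n) ^ k₁ * (∑ n ∈ range J, eulerTerm 0 1 p ^ n) ^ k₂ *
          (1 - eulerTerm 1 1 p) ^ r)) := by
  set D := fun i j => ∑ n ∈ Ioc 0 K, ((ArithmeticFunction.moebius n : ℝ) / n) • monoPow i j n
  set Z := ∑ n ∈ Ioc 0 K, (1 / (n : ℝ)) • monoPow 1 1 n
  have hZ (k : ℕ) (F) (a) : shiftFunctional L F (a * Z ^ k) = shiftFunctional L ((zetaShift K)^[k] F) a := by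
    induction k generalizing F with
    | zero => simp
    | succ k ih => rw [pow_succ, ← mul_assoc, shiftFunctional_mul_sum, ih, Function.iterate_succ_apply,
      ← funext₂ (fun x y => by simp [zetaShift] : ∀ x y, (∑ n ∈ Ioc 0 K, 1 / (n : ℝ) * F (x - (1 : ℕ) * Real.log n)
        (y - (1 : ℕ) * Real.log n)) = zetaShift K F x y)]
  have hX (k : ℕ) (f g : ℝ → ℝ) (a) : shiftFunctional L (fun x y => f x * g y) (a * D 1 0 ^ k) =
      shiftFunctional L (fun x y => (moebiusShift K)^[k] f x * g y) a := by
    induction k generalizing f with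
    | zero => simp
    | succ k ih =>
      rw [pow_succ, ← mul_assoc, shiftFunctional_mul_sum, Function.iterate_succ_apply, ← ih]
      simp [moebiusShift, shiftSum, sum_mul, mul_assoc]
  have hY (k : ℕ) (f g : ℝ → ℝ) (a) : shiftFunctional L (fun x y => f x * g y) (a * D 0 1 ^ k) =
      shiftFunctional L (fun x y => f x * (moebiusShift K)^[k] g y) a := by
    induction k generalizing g with
    | zero => simp
    | succ k ih =>
      rw [pow_succ, ← mul_assoc, shiftFunctional_mul_sum, Function.iterate_succ_apply, ← ih]
      simp [moebiusShift, shiftSum, mul_sum, mul_left_comm]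
  rw [← hZ, ← hY, ← hX, ← sub_eq_zero, ← map_sub]
  refine shiftFunctional_eq_zero hL (fun x y h => ?_) (Ideal.Quotient.eq.1 ?_)
  · rcases h with h | h
    · rw [hf x h, zero_mul]
    · rw [hg y h, mul_zero]
  · have e1 := mk_prod_geom_sum_mul (i := 1) (j := 0) (by simp) hJ
    have e2 := mk_prod_geom_sum_mul (i := 0) (j := 1) (by simp) hJ
    have e3 := mk_prod_one_sub_mul_sum (i := 1) (j := 1) (by simp) hK
    simp only [prod_mul_distrib, prod_pow]
    generalize (∏ p ∈ K.primesLE, ∑ n ∈ range J, eulerTerm 1 0 p ^ n) = U at e1 ⊢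
    generalize (∏ p ∈ K.primesLE, ∑ n ∈ range J, eulerTerm 0 1 p ^ n) = V at e2 ⊢
    generalize (∏ p ∈ K.primesLE, (1 - eulerTerm 1 1 p)) = W at e3 ⊢
    rw [show ∀ a : MonoidAlgebra ℝ (ℕ × ℕ), a * U ^ k₁ * V ^ k₂ * W ^ r * Z ^ r * D 0 1 ^ k₂ * D 1 0 ^ k₁ =
      a * (U * D 1 0) ^ k₁ * (V * D 0 1) ^ k₂ * (W * Z) ^ r from fun a => by ring]
    rw [map_mul, map_mul, map_mul, map_pow, map_pow, map_pow, e1, e2, e3]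
    simp

/-- The weighted `ℓ¹` norm of a double Dirichlet polynomial, with the monomial `(d, e)` of weight `(d e) ^ σ`. -/
noncomputable def weightNorm (σ : ℝ) (a : MonoidAlgebra ℝ (ℕ × ℕ)) : ℝ :=
  a.coeff.sum fun d c => |c| * ((d.1 * d.2 : ℕ) : ℝ) ^ σ

theorem weightNorm_nonneg (σ : ℝ) (a : MonoidAlgebra ℝ (ℕ × ℕ)) : 0 ≤ weightNorm σ a :=
  sum_nonneg fun _ _ => by positivity

theorem weightNorm_single (σ : ℝ) (d : ℕ × ℕ) (c : ℝ) :
    weightNorm σ (MonoidAlgebra.single d c) = |c| * ((d.1 * d.2 : ℕ) : ℝ) ^ σ := by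
  simp [weightNorm, MonoidAlgebra.coeff_single, Finsupp.sum_single_index]

theorem weightNorm_one (σ : ℝ) : weightNorm σ 1 = 1 := by
  simp [MonoidAlgebra.one_def, weightNorm_single]

theorem weightNorm_add_le (σ : ℝ) (a b : MonoidAlgebra ℝ (ℕ × ℕ)) :
    weightNorm σ (a + b) ≤ weightNorm σ a + weightNorm σ b := by
  classical
  simp only [weightNorm, MonoidAlgebra.coeff_add]
  rw [Finsupp.sum_of_support_subset (s := a.coeff.support ∪ b.coeff.support) _ Finsupp.support_add _ (by simp),
    Finsupp.sum_of_support_subset (s := a.coeff.support ∪ b.coeff.support) _ subset_union_left _ (by simp),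
    Finsupp.sum_of_support_subset (s := a.coeff.support ∪ b.coeff.support) _ subset_union_right _ (by simp), ← sum_add_distrib]
  refine sum_le_sum fun d _ => ?_
  rw [← add_mul]
  exact mul_le_mul_of_nonneg_right (abs_add_le _ _) (by positivity)

theorem weightNorm_smul (σ c : ℝ) (a : MonoidAlgebra ℝ (ℕ × ℕ)) : weightNorm σ (c • a) = |c| * weightNorm σ a := by
  simp only [weightNorm, MonoidAlgebra.coeff_smul]
  rw [Finsupp.sum_of_support_subset (s := a.coeff.support) _ Finsupp.support_smul _ (by simp), Finsupp.sum, mul_sum]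
  exact sum_congr rfl fun d _ => by simp [abs_mul, mul_assoc]

theorem weightNorm_sum_le (σ : ℝ) {ι : Type*} (s : Finset ι) (f : ι → MonoidAlgebra ℝ (ℕ × ℕ)) :
    weightNorm σ (∑ i ∈ s, f i) ≤ ∑ i ∈ s, weightNorm σ (f i) :=
  le_sum_of_subadditive _ (by simp [weightNorm]) (weightNorm_add_le σ) _ _

theorem weightNorm_mul_le (σ : ℝ) (a b : MonoidAlgebra ℝ (ℕ × ℕ)) :
    weightNorm σ (a * b) ≤ weightNorm σ a * weightNorm σ b := by
  rw [MonoidAlgebra.mul_def]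
  refine (weightNorm_sum_le σ _ _).trans ?_
  rw [weightNorm, Finsupp.sum, sum_mul]
  refine sum_le_sum fun d _ => (weightNorm_sum_le σ _ _).trans ?_
  rw [weightNorm, Finsupp.sum, mul_sum]
  refine sum_le_sum fun e _ => (weightNorm_single _ _ _).le.trans (le_of_eq ?_)
  simp only [Prod.fst_mul, Prod.snd_mul]
  rw [mul_mul_mul_comm d.1, Nat.cast_mul, Real.mul_rpow (by positivity) (by positivity), abs_mul]
  ring

theorem weightNorm_prod_le (σ : ℝ) {ι : Type*} (s : Finset ι) (f : ι → MonoidAlgebra ℝ (ℕ × ℕ)) :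
    weightNorm σ (∏ i ∈ s, f i) ≤ ∏ i ∈ s, weightNorm σ (f i) := by
  induction s using Finset.cons_induction with
  | empty => simp [weightNorm_one]
  | cons i s hi ih =>
    rw [prod_cons, prod_cons]
    exact (weightNorm_mul_le _ _ _).trans (mul_le_mul_of_nonneg_left ih (weightNorm_nonneg _ _))

/-- The sum of the coefficients of the monomials `(d, e)` with `d e ≠ 0`, as an algebra homomorphism. -/
noncomputable def augment : MonoidAlgebra ℝ (ℕ × ℕ) →ₐ[ℝ] ℝ :=
  MonoidAlgebra.lift ℝ ℝ (ℕ × ℕ)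
    { toFun := fun d => if d.1 * d.2 = 0 then 0 else 1
      map_one' := by simp
      map_mul' := fun d e => by
        by_cases h1 : d.1 = 0 <;> by_cases h2 : d.2 = 0 <;> by_cases h3 : e.1 = 0 <;> by_cases h4 : e.2 = 0 <;>
          simp [*] }

theorem abs_augment_le {σ : ℝ} (hσ : 0 ≤ σ) (a : MonoidAlgebra ℝ (ℕ × ℕ)) : |augment a| ≤ weightNorm σ a := by
  rw [augment, MonoidAlgebra.lift_apply]
  refine (abs_sum_le_sum_abs _ _).trans (sum_le_sum fun d _ => ?_)
  simp only [MonoidHom.coe_mk, OneHom.coe_mk, smul_eq_mul, abs_mul]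
  refine mul_le_mul_of_nonneg_left ?_ (abs_nonneg _)
  split_ifs with h
  · rw [abs_zero]; positivity
  · rw [abs_one]; exact Real.one_le_rpow (by exact_mod_cast Nat.one_le_iff_ne_zero.2 h) hσ

theorem one_add_log_le_rpow_div {σ : ℝ} (hσ : 0 < σ) (hσ1 : σ ≤ 1) {n : ℕ} (hn : n ≠ 0) :
    1 + Real.log n ≤ (n : ℝ) ^ σ / σ := by
  rw [le_div_iff₀ hσ, Real.rpow_def_of_pos (by positivity)]
  nlinarith [Real.add_one_le_exp (Real.log n * σ)]

theorem DiagApprox.abs_shiftFunctional_sub_le {F : ℝ → ℝ → ℝ} {L c B σ : ℝ} {l : ℕ} (hF : DiagApprox F L c l B)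
    (hL : 0 ≤ L) (hB : 0 ≤ B) (hσ : 0 < σ) (hσ1 : σ ≤ 1) (a : MonoidAlgebra ℝ (ℕ × ℕ)) :
    |shiftFunctional L F a - c * (L ^ l / l.factorial) * augment a| ≤
      B / σ ^ 2 * ((1 + L) ^ l / √(1 + L)) * weightNorm σ a := by
  rw [augment, MonoidAlgebra.lift_apply, shiftFunctional, LinearMap.comp_apply, Finsupp.linearCombination_apply,
    weightNorm, Finsupp.sum, Finsupp.sum, Finsupp.sum, mul_sum, mul_sum]
  erw [← sum_sub_distrib]
  refine (abs_sum_le_sum_abs _ _).trans (sum_le_sum fun d _ => ?_)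
  simp only [MonoidHom.coe_mk, OneHom.coe_mk, smul_eq_mul, LinearEquiv.coe_coe, MonoidAlgebra.coeffLinearEquiv_apply]
  split_ifs with h
  · simp only [mul_zero, sub_self, abs_zero]; positivity
  have h' := mul_ne_zero_iff.1 h
  rw [mul_one, mul_comm, ← sub_mul, abs_mul, mul_comm |_|]
  rw [mul_left_comm]
  refine mul_le_mul_of_nonneg_left ((hF.2 L _ _ hL le_rfl (Real.log_natCast_nonneg _) (Real.log_natCast_nonneg _)).trans ?_) (abs_nonneg _)
  have h1 := mul_le_mul (one_add_log_le_rpow_div hσ hσ1 h'.1) (one_add_log_le_rpow_div hσ hσ1 h'.2)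
    (by linarith [Real.log_natCast_nonneg d.2]) (by positivity)
  rw [div_mul_div_comm, ← Real.mul_rpow (by positivity) (by positivity)] at h1
  refine (mul_le_mul_of_nonneg_right (mul_le_mul_of_nonneg_left h1 hB) (by positivity)).trans (le_of_eq ?_)
  push_cast
  field_simp

/-- An Euler factor `a` with its expected zeros and poles divided out, to order `J`. -/
noncomputable def localFactor (k₁ k₂ r J p : ℕ) (a : MonoidAlgebra ℝ (ℕ × ℕ)) : MonoidAlgebra ℝ (ℕ × ℕ) :=
  a * (∑ n ∈ range J, eulerTerm 1 0 p ^ n) ^ k₁ * (∑ n ∈ range J, eulerTerm 0 1 p ^ n) ^ k₂ * (1 - eulerTerm 1 1 p) ^ r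

theorem exists_abs_shiftFunctional_prod_sub_le (k₁ k₂ l₁ l₂ r : ℕ) : ∃ B : ℝ, 0 ≤ B ∧ ∀ (K J : ℕ) (L σ : ℝ)
    (A : ℕ → MonoidAlgebra ℝ (ℕ × ℕ)), 0 < K → K < 2 ^ J → 0 ≤ L → Real.exp L < K + 1 → 0 < σ → σ ≤ 1 →
    |shiftFunctional L (fun x y => truncPow (k₁ + l₁) x * truncPow (k₂ + l₂) y) (∏ p ∈ K.primesLE, A p) -
      (l₁ + l₂).choose l₁ * (L ^ (l₁ + l₂ + r) / (l₁ + l₂ + r).factorial) *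
        ∏ p ∈ K.primesLE, augment (localFactor k₁ k₂ r J p (A p))| ≤
      B / σ ^ 2 * ((1 + L) ^ (l₁ + l₂ + r) / √(1 + L)) * ∏ p ∈ K.primesLE, weightNorm σ (localFactor k₁ k₂ r J p (A p)) := by
  obtain ⟨B, hB, h⟩ := exists_diagApprox k₁ k₂ l₁ l₂ r
  refine ⟨B, hB, fun K J L σ A hK hJ hL hLK hσ hσ1 => ?_⟩
  rw [shiftFunctional_prod hK hJ hLK (fun x => truncPow_of_neg _) (fun x => truncPow_of_neg _) A k₁ k₂ r, ← map_prod]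
  exact ((h K L hLK).abs_shiftFunctional_sub_le hL hB hσ hσ1 _).trans
    (mul_le_mul_of_nonneg_left (weightNorm_prod_le _ _ _) (by positivity))

/-- `a` is `1 + t` to first order in `η`. -/
def NearOne (σ η C : ℝ) (a t : MonoidAlgebra ℝ (ℕ × ℕ)) : Prop :=
  weightNorm σ t ≤ C * η ∧ weightNorm σ (a - 1 - t) ≤ C * η ^ 2

theorem NearOne.mul {σ η C C' : ℝ} {a b t u : MonoidAlgebra ℝ (ℕ × ℕ)} (hη : 0 ≤ η) (hη1 : η ≤ 1) (hC : 0 ≤ C)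
    (hC' : 0 ≤ C') (ha : NearOne σ η C a t) (hb : NearOne σ η C' b u) :
    NearOne σ η (C + C' + 4 * C * C') (a * b) (t + u) := by
  obtain ⟨h1, h2⟩ := ha
  obtain ⟨h3, h4⟩ := hb
  refine ⟨(weightNorm_add_le _ _ _).trans (by nlinarith [mul_nonneg (mul_nonneg hC hC') hη]), ?_⟩
  generalize e1 : a - 1 - t = α at *
  generalize e2 : b - 1 - u = β at *
  obtain rfl : a = α + 1 + t := by rw [← e1]; ring
  obtain rfl : b = β + 1 + u := by rw [← e2]; ring
  rw [show (α + 1 + t) * (β + 1 + u) - 1 - (t + u) = α + β + (t * u + (t * β + (α * u + α * β))) by ring]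
  have hη2 : η ^ 2 ≤ η := by nlinarith
  have n := weightNorm_nonneg σ
  have hCC : 0 ≤ C * C' := mul_nonneg hC hC'
  have h2' : weightNorm σ α ≤ C * η := h2.trans (mul_le_mul_of_nonneg_left hη2 hC)
  have h4' : weightNorm σ β ≤ C' * η := h4.trans (mul_le_mul_of_nonneg_left hη2 hC')
  have key {x y} (hx : weightNorm σ x ≤ C * η) (hy : weightNorm σ y ≤ C' * η) : weightNorm σ (x * y) ≤ C * C' * η ^ 2 :=
    (weightNorm_mul_le _ _ _).trans ((mul_le_mul hx hy (n _) (by positivity)).trans (le_of_eq (by ring)))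
  calc _ ≤ C * η ^ 2 + C' * η ^ 2 + (C * C' * η ^ 2 + (C * C' * η ^ 2 + (C * C' * η ^ 2 + C * C' * η ^ 2))) :=
        (weightNorm_add_le _ _ _).trans (add_le_add ((weightNorm_add_le _ _ _).trans (add_le_add h2 h4))
          ((weightNorm_add_le _ _ _).trans (add_le_add (key h1 h3) ((weightNorm_add_le _ _ _).trans
            (add_le_add (key h1 h4') ((weightNorm_add_le _ _ _).trans (add_le_add (key h2' h3) (key h2' h4'))))))))
    _ = _ := by ring

theorem NearOne.exists_pow {C : ℝ} (hC : 0 ≤ C) (k : ℕ) : ∃ C', 0 ≤ C' ∧ ∀ {σ η : ℝ} {a t : MonoidAlgebra ℝ (ℕ × ℕ)},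
    0 ≤ η → η ≤ 1 → NearOne σ η C a t → NearOne σ η C' (a ^ k) ((k : ℝ) • t) := by
  induction k with
  | zero => exact ⟨0, le_rfl, fun _ _ _ => by simp [NearOne, weightNorm]⟩
  | succ k ih =>
    obtain ⟨C', hC', h⟩ := ih
    refine ⟨C' + C + 4 * C' * C, by positivity, fun hη hη1 ha => ?_⟩
    rw [pow_succ, Nat.cast_succ, add_smul, one_smul]
    exact (h hη hη1 ha).mul hη hη1 hC' hC ha

theorem weightNorm_eulerTerm (σ : ℝ) (i j p : ℕ) :
    weightNorm σ (eulerTerm i j p) = 1 / p * ((p ^ i * p ^ j : ℕ) : ℝ) ^ σ := by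
  rw [eulerTerm, monoPow_apply, weightNorm_smul, weightNorm_single, abs_one, one_mul, abs_of_nonneg (by positivity)]

theorem weightNorm_pow_le (σ : ℝ) (a : MonoidAlgebra ℝ (ℕ × ℕ)) (n : ℕ) : weightNorm σ (a ^ n) ≤ weightNorm σ a ^ n := by
  simpa using weightNorm_prod_le σ (range n) fun _ => a

theorem nearOne_geom_sum {σ η : ℝ} {e : MonoidAlgebra ℝ (ℕ × ℕ)} (he : weightNorm σ e ≤ η) (he' : weightNorm σ e ≤ 3 / 4)
    (J : ℕ) : NearOne σ η 4 (∑ n ∈ range (J + 2), e ^ n) e := by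
  have h0 := weightNorm_nonneg σ e
  refine ⟨by linarith, ?_⟩
  rw [sum_range_succ', sum_range_succ']
  rw [show ∀ a : MonoidAlgebra ℝ (ℕ × ℕ), a + e ^ (0 + 1) + e ^ 0 - 1 - e = a from fun a => by ring]
  refine (weightNorm_sum_le _ _ _).trans ((sum_le_sum fun n _ =>
    (weightNorm_pow_le _ _ _).trans (pow_add _ n 2).le).trans ?_)
  rw [← sum_mul]
  have h := geom_sum_mul_neg (weightNorm σ e) J
  have : 0 ≤ ∑ i ∈ range J, weightNorm σ e ^ i := by positivity
  exact mul_le_mul (by nlinarith [pow_nonneg h0 J]) (pow_le_pow_left₀ h0 he 2) (by positivity) (by norm_num)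

theorem nearOne_add_self {σ η C : ℝ} {t : MonoidAlgebra ℝ (ℕ × ℕ)} (hC : 0 ≤ C) (h : weightNorm σ t ≤ C * η) :
    NearOne σ η C (1 + t) t := ⟨h, by rw [add_sub_cancel_left, sub_self]; simp [weightNorm]; positivity⟩

theorem weightNorm_eulerTerm_le {σ : ℝ} (hσ : 0 ≤ σ) {p : ℕ} (hp : p.Prime) {i j : ℕ} (hij : i + j ≤ 2) :
    weightNorm σ (eulerTerm i j p) ≤ (p : ℝ) ^ (2 * σ - 1) := by
  have h1 : (1 : ℝ) ≤ p := by exact_mod_cast hp.one_le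
  rw [weightNorm_eulerTerm, ← pow_add, Nat.cast_pow, ← Real.rpow_natCast, ← Real.rpow_mul (by positivity),
    Real.rpow_sub_one (by positivity), one_div_mul_eq_div]
  refine div_le_div_of_nonneg_right (Real.rpow_le_rpow_of_exponent_le h1 (mul_le_mul_of_nonneg_right ?_ hσ)) (by positivity)
  exact_mod_cast hij

theorem weightNorm_eulerTerm_le_three_fourths {σ : ℝ} (hσ : σ ≤ 1 / 4) {p : ℕ} (hp : p.Prime) {i j : ℕ} (hij : i + j = 1) :
    weightNorm σ (eulerTerm i j p) ≤ 3 / 4 := by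
  have h1 : (2 : ℝ) ≤ p := by exact_mod_cast hp.two_le
  rw [weightNorm_eulerTerm, ← pow_add, hij, pow_one, one_div_mul_eq_div, ← Real.rpow_sub_one (by positivity)]
  calc (p : ℝ) ^ (σ - 1) ≤ p ^ (-(1 / 2) : ℝ) := Real.rpow_le_rpow_of_exponent_le (by linarith) (by linarith)
    _ = 1 / √p := by rw [Real.rpow_neg (by positivity), Real.sqrt_eq_rpow, one_div, one_div]
    _ ≤ 3 / 4 := by
      rw [div_le_iff₀ (by positivity)]
      nlinarith [Real.sq_sqrt (show (0 : ℝ) ≤ p by positivity), Real.sqrt_nonneg p]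

theorem exists_weightNorm_localFactor_le (k₁ k₂ r : ℕ) {M : ℝ} (hM : 0 ≤ M) : ∃ C : ℝ, 0 ≤ C ∧ ∀ (σ α β γ : ℝ) (J p : ℕ),
    0 ≤ σ → σ ≤ 1 / 4 → p.Prime → |α| ≤ M → |β| ≤ M → |γ| ≤ M →
    weightNorm σ (localFactor k₁ k₂ r (J + 2) p (1 + (-α • eulerTerm 1 0 p - β • eulerTerm 0 1 p + γ • eulerTerm 1 1 p))) ≤
      1 + (|k₁ - α| + |k₂ - β| + |r - γ|) * (p : ℝ) ^ (2 * σ - 1) + C * ((p : ℝ) ^ (2 * σ - 1)) ^ 2 := by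
  obtain ⟨C₁, hC₁, h₁⟩ := NearOne.exists_pow zero_le_four k₁
  obtain ⟨C₂, hC₂, h₂⟩ := NearOne.exists_pow zero_le_four k₂
  obtain ⟨C₃, hC₃, h₃⟩ := NearOne.exists_pow zero_le_one r
  have : ∃ C : ℝ, 0 ≤ C ∧ ∀ {η σ : ℝ} {a b c d t u v w : MonoidAlgebra ℝ (ℕ × ℕ)}, 0 ≤ η → η ≤ 1 →
      NearOne σ η (3 * M) a t → NearOne σ η C₁ b u → NearOne σ η C₂ c v → NearOne σ η C₃ d w →
      NearOne σ η C (a * b * c * d) (t + u + v + w) :=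
    ⟨_, by positivity, fun h0 h1 ha hb hc hd => (((ha.mul h0 h1 (by positivity) hC₁ hb).mul h0 h1 (by positivity) hC₂ hc).mul
      h0 h1 (by positivity) hC₃ hd)⟩
  obtain ⟨C, hC, h⟩ := this
  refine ⟨C, hC, fun σ α β γ J p hσ hσ1 hp hα hβ hγ => ?_⟩
  have e {i j} := weightNorm_eulerTerm_le hσ hp (i := i) (j := j)
  have e' {i j} := weightNorm_eulerTerm_le_three_fourths hσ1 hp (i := i) (j := j)
  have hη : 0 ≤ (p : ℝ) ^ (2 * σ - 1) := by positivity
  have hη1 : (p : ℝ) ^ (2 * σ - 1) ≤ 1 := Real.rpow_le_one_of_one_le_of_nonpos (by exact_mod_cast hp.one_le) (by linarith)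
  generalize (p : ℝ) ^ (2 * σ - 1) = η at *
  have comb (α β γ : ℝ) : weightNorm σ (-α • eulerTerm 1 0 p - β • eulerTerm 0 1 p + γ • eulerTerm 1 1 p) ≤
      (|α| + |β| + |γ|) * η := by
    rw [sub_eq_add_neg, ← neg_smul]
    refine (weightNorm_add_le _ _ _).trans ((add_le_add_left (weightNorm_add_le _ _ _) _).trans ?_)
    simp only [weightNorm_smul, abs_neg, add_mul]
    exact add_le_add (add_le_add (mul_le_mul_of_nonneg_left (e (by simp)) (abs_nonneg _))
      (mul_le_mul_of_nonneg_left (e (by simp)) (abs_nonneg _))) (mul_le_mul_of_nonneg_left (e (by simp)) (abs_nonneg _))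
  have := h hη hη1 (nearOne_add_self (by positivity) ((comb α β γ).trans (mul_le_mul_of_nonneg_right (by linarith) hη)))
    (h₁ hη hη1 (nearOne_geom_sum (e (i := 1) (j := 0) (by simp)) (e' (by simp)) J))
    (h₂ hη hη1 (nearOne_geom_sum (e (i := 0) (j := 1) (by simp)) (e' (by simp)) J))
    (h₃ hη hη1 (nearOne_add_self (t := -eulerTerm 1 1 p) zero_le_one (by
      rw [← neg_one_smul ℝ, weightNorm_smul]; simpa using e (by simp))))
  rw [← sub_eq_add_neg] at this
  have h4 := comb (-(k₁ - α)) (-(k₂ - β)) (-(r - γ))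
  simp only [abs_neg] at h4
  refine le_trans ?_ (add_le_add (add_le_add (weightNorm_one σ).le h4) this.2)
  refine le_trans (le_of_eq (congrArg _ ?_)) ((weightNorm_add_le _ _ _).trans (add_le_add_left (weightNorm_add_le _ _ _) _))
  rw [localFactor]
  module

theorem sq_sum_primesLE_one_div_le (z : ℕ) : (∑ p ∈ z.primesLE, 1 / (p : ℝ)) ^ 2 ≤ 2 * (1 + 2 * Real.log z) := by
  rw [sq, sum_mul_sum, ← sum_product', ← sum_fiberwise_of_maps_to (t := Ioc 0 (z ^ 2)) (g := fun x : ℕ × ℕ => x.1 * x.2)]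
  · have h := sum_card_divisors_pow_div_le 0 (z ^ 2)
    simp only [pow_zero, pow_one] at h
    rw [Nat.cast_pow, Real.log_pow, Nat.cast_ofNat] at h
    refine le_trans ?_ (mul_le_mul_of_nonneg_left h zero_le_two)
    rw [mul_sum]
    refine sum_le_sum fun n _ => ?_
    refine (sum_le_card_nsmul _ _ (1 / (n : ℝ)) fun x hx => ?_).trans ?_
    · rw [one_div_mul_one_div, ← (mem_filter.1 hx).2, Nat.cast_mul]
    · rw [nsmul_eq_mul]
      refine mul_le_mul_of_nonneg_right ?_ (by positivity)
      rcases Finset.eq_empty_or_nonempty ({x ∈ z.primesLE ×ˢ z.primesLE | x.1 * x.2 = n}) with h | ⟨y, hy⟩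
      · simp [h]
      · have : {x ∈ z.primesLE ×ˢ z.primesLE | x.1 * x.2 = n} ⊆ {y, (y.2, y.1)} := fun x hx => by
          simp only [mem_filter, mem_product, Nat.mem_primesLE] at hx hy
          have hd : x.1 ∣ y.1 * y.2 := ⟨x.2, by rw [hx.2, hy.2]⟩
          have e := hx.2.trans hy.2.symm
          have h0 := hx.1.1.2.pos
          rcases (Nat.Prime.dvd_mul hx.1.1.2).1 hd with h | h
          · rw [Nat.prime_dvd_prime_iff_eq hx.1.1.2 hy.1.1.2] at h
            rw [← h] at e
            simp [Prod.ext_iff, h, Nat.eq_of_mul_eq_mul_left h0 e]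
          · rw [Nat.prime_dvd_prime_iff_eq hx.1.1.2 hy.1.2.2] at h
            rw [← h, mul_comm y.1] at e
            simp [Prod.ext_iff, h, Nat.eq_of_mul_eq_mul_left h0 e]
        exact_mod_cast (card_le_card this).trans card_le_two
  · intro x hx
    simp only [mem_product, Nat.mem_primesLE, mem_Ioc] at hx ⊢
    exact ⟨Nat.mul_pos hx.1.2.pos hx.2.2.pos, by nlinarith⟩

/-- A product of Euler factors that are `1 + O(p⁻²)` off a small set of primes is bounded by a small power of `log L`. -/
theorem exists_prod_primesLE_le {M C : ℝ} (hM : 0 ≤ M) (hC : 0 ≤ C) : ∃ C' : ℝ, 0 ≤ C' ∧ ∀ (K : ℕ) (L : ℝ) (S N : ℕ → ℝ)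
    (D : Finset ℕ), 0 < L → 8 ≤ Real.log L → (∀ p, S p ≤ M) → (∀ p ∈ K.primesLE, p ∉ D → S p ≤ M / p) →
    (D.card : ℝ) ≤ M * L → (∀ p, 0 ≤ N p) →
    (∀ p ∈ K.primesLE, N p ≤ 1 + S p * (p : ℝ) ^ (2 * (1 / Real.log L) - 1) + C * ((p : ℝ) ^ (2 * (1 / Real.log L) - 1)) ^ 2) →
    ∏ p ∈ K.primesLE, N p ≤ Real.exp (C' * √(Real.log L)) := by
  have hs : Summable fun n : ℕ => 1 / (n : ℝ) ^ (3 / 2 : ℝ) := Real.summable_one_div_nat_rpow.2 (by norm_num)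
  set T := ∑' n : ℕ, 1 / (n : ℝ) ^ (3 / 2 : ℝ)
  have hT : 0 ≤ T := tsum_nonneg fun n => by positivity
  set E := Real.exp 2
  have hE : 0 ≤ E := (Real.exp_pos _).le
  refine ⟨(M + C) * (3 * E + T + E * M), by positivity, fun K L S N D hL0 hL hSM hSD hD hN0 hN => ?_⟩
  set σ := 1 / Real.log L with hσ
  have hσ0 : 0 < σ := by positivity
  have hσ8 : σ ≤ 1 / 8 := one_div_le_one_div_of_le (by norm_num) hL
  have hLσ : L ^ (2 * σ) = E := by
    rw [Real.rpow_def_of_pos hL0, mul_left_comm, hσ, mul_one_div_cancel (by linarith), mul_one]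
  clear_value σ
  have key : ∀ p ∈ K.primesLE, N p ≤ Real.exp ((M + C) * (E * (if (p : ℝ) ≤ L then 1 / (p : ℝ) else 0) +
      1 / (p : ℝ) ^ (3 / 2 : ℝ) + E / L * if p ∈ D then 1 else 0)) := by
    intro p hp
    have h1 : (1 : ℝ) ≤ p := by exact_mod_cast (Nat.prime_of_mem_primesLE hp).one_le
    have hη1 : (p : ℝ) ^ (2 * σ - 1) ≤ 1 := Real.rpow_le_one_of_one_le_of_nonpos h1 (by linarith)
    have hηp : 1 / (p : ℝ) ≤ p ^ (2 * σ - 1) := by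
      rw [one_div, ← Real.rpow_neg_one]; exact Real.rpow_le_rpow_of_exponent_le h1 (by linarith)
    have hη2 : ((p : ℝ) ^ (2 * σ - 1)) ^ 2 ≤ 1 / (p : ℝ) ^ (3 / 2 : ℝ) := by
      rw [← Real.rpow_natCast, ← Real.rpow_mul (by positivity), one_div, ← Real.rpow_neg (by positivity)]
      exact Real.rpow_le_rpow_of_exponent_le h1 (by push_cast; linarith)
    have hη : (p : ℝ) ^ (2 * σ - 1) = p ^ (2 * σ) / p := Real.rpow_sub_one (by positivity) _
    refine (hN p hp).trans ?_
    rw [add_assoc, add_comm]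
    refine (Real.add_one_le_exp _).trans (Real.exp_le_exp.2 ?_)
    have hη0 : 0 ≤ (p : ℝ) ^ (2 * σ - 1) := by positivity
    have h3 : 0 ≤ 1 / (p : ℝ) ^ (3 / 2 : ℝ) := by positivity
    have hEL : 0 ≤ E / L := by positivity
    have gen : S p * (p : ℝ) ^ (2 * σ - 1) + C * ((p : ℝ) ^ (2 * σ - 1)) ^ 2 ≤ (M + C) * (p : ℝ) ^ (2 * σ - 1) := by
      rw [add_mul]
      exact add_le_add (mul_le_mul_of_nonneg_right (hSM p) hη0)
        (mul_le_mul_of_nonneg_left (pow_le_of_le_one hη0 hη1 two_ne_zero) hC)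
    by_cases hpL : (p : ℝ) ≤ L
    · refine gen.trans (mul_le_mul_of_nonneg_left ?_ (by positivity))
      rw [if_pos hpL, hη]
      have := div_le_div_of_nonneg_right (Real.rpow_le_rpow (by positivity) hpL (by positivity : 0 ≤ 2 * σ)) (by positivity : 0 ≤ (p : ℝ))
      rw [hLσ, div_eq_mul_one_div E] at this
      split_ifs <;> linarith
    · rw [if_neg hpL, mul_zero, zero_add]
      push Not at hpL
      by_cases hpD : p ∈ D
      · refine gen.trans (mul_le_mul_of_nonneg_left ?_ (by positivity))
        rw [if_pos hpD, mul_one, ← hLσ, ← Real.rpow_sub_one hL0.ne']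
        have := Real.rpow_le_rpow_of_nonpos hL0 hpL.le (by linarith : 2 * σ - 1 ≤ 0)
        linarith
      · rw [if_neg hpD, mul_zero, add_zero]
        have h4 : S p ≤ M * p ^ (2 * σ - 1) := (hSD p hp hpD).trans
          ((div_eq_mul_one_div M (p : ℝ)).le.trans (mul_le_mul_of_nonneg_left hηp hM))
        refine le_trans ?_ (mul_le_mul_of_nonneg_left hη2 (by positivity))
        nlinarith [mul_le_mul_of_nonneg_right h4 hη0]
  refine (prod_le_prod (fun p _ => hN0 p) key).trans ?_
  rw [← Real.exp_sum, ← mul_sum, mul_assoc]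
  refine Real.exp_le_exp.2 (mul_le_mul_of_nonneg_left ?_ (by positivity))
  rw [sum_add_distrib, sum_add_distrib, ← mul_sum, ← mul_sum, add_mul, add_mul]
  have h1 : 1 ≤ √(Real.log L) := Real.one_le_sqrt.2 (by linarith)
  refine add_le_add (add_le_add ?_ ?_) ?_
  · rw [mul_assoc, mul_left_comm]
    refine mul_le_mul_of_nonneg_left ?_ hE
    refine abs_le_of_sq_le_sq' ?_ (by positivity) |>.2
    rw [← sum_filter, mul_pow, Real.sq_sqrt (by linarith)]
    have hfl : Real.log (⌊L⌋₊ : ℕ) ≤ Real.log L := by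
      rcases Nat.eq_zero_or_pos ⌊L⌋₊ with h | h
      · rw [h]; simp; linarith
      · exact Real.log_le_log (by exact_mod_cast h) (Nat.floor_le hL0.le)
    refine (pow_le_pow_left₀ (by positivity) (sum_le_sum_of_subset_of_nonneg (t := ⌊L⌋₊.primesLE) (fun p hp => ?_)
      fun _ _ _ => by positivity) 2).trans ((sq_sum_primesLE_one_div_le _).trans (by linarith))
    simp only [mem_filter, Nat.mem_primesLE] at hp ⊢
    exact ⟨Nat.le_floor hp.2, hp.1.2⟩
  · exact (hs.sum_le_tsum _ fun _ _ => by positivity).trans (le_mul_of_one_le_right hT h1)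
  · rw [← sum_filter, sum_const, nsmul_eq_mul, mul_one]
    have : (((K.primesLE.filter (· ∈ D)).card : ℕ) : ℝ) ≤ M * L :=
      (Nat.cast_le.2 (card_le_card fun p hp => (mem_filter.1 hp).2)).trans hD
    calc _ ≤ E / L * (M * L) := mul_le_mul_of_nonneg_left this (by positivity)
      _ = E * M := by field_simp
      _ ≤ _ := le_mul_of_one_le_right (by positivity) h1

/-- The local factor of the singular series. -/
noncomputable def singFactor (H : Finset ℕ) (p : ℕ) : ℝ :=
  (1 - (residCard H p : ℝ) / p) * ((1 - 1 / (p : ℝ)) ^ H.card)⁻¹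

theorem abs_singFactor_sub_one_le {H : Finset ℕ} {p : ℕ} (hp : 2 ≤ p) (h : residCard H p = H.card) :
    |singFactor H p - 1| ≤ 2 ^ H.card * H.card ^ 2 * ((p : ℝ) ^ 2)⁻¹ := by
  rw [singFactor, h]
  generalize H.card = m
  have hp' : (2 : ℝ) ≤ p := by exact_mod_cast hp
  have hx : 1 / (p : ℝ) ≤ 1 / 2 := one_div_le_one_div_of_le two_pos hp'
  rw [div_eq_mul_one_div, ← inv_pow (p : ℝ), ← one_div (p : ℝ)]
  have hx0 : 0 ≤ 1 / (p : ℝ) := by positivity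
  generalize 1 / (p : ℝ) = x at *
  have h1 : 1 - m * x ≤ (1 - x) ^ m := by
    have := one_add_mul_le_pow (a := -x) (by linarith) m
    rw [← sub_eq_add_neg] at this; linarith
  have h2 : (1 - x) ^ m ≤ 1 - m * x + m ^ 2 * x ^ 2 := by
    clear h1
    induction m with
    | zero => simp
    | succ m ih =>
      rw [pow_succ]
      push_cast
      nlinarith [mul_le_mul_of_nonneg_right ih (by linarith : 0 ≤ 1 - x), mul_nonneg (Nat.cast_nonneg (α := ℝ) m) (sq_nonneg x),
        mul_nonneg (mul_nonneg (sq_nonneg (m : ℝ)) (sq_nonneg x)) hx0, sq_nonneg x]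
  have h3 : (1 / 2) ^ m ≤ (1 - x) ^ m := pow_le_pow_left₀ (by norm_num) (by linarith) m
  have h4 : (0 : ℝ) < (1 / 2) ^ m := by positivity
  have h5 : (1 - m * x) * ((1 - x) ^ m)⁻¹ - 1 = -(((1 - x) ^ m - (1 - m * x)) / (1 - x) ^ m) := by
    field_simp [(h4.trans_le h3).ne']; ring
  rw [h5, abs_neg, abs_of_nonneg (div_nonneg (by linarith) (h4.le.trans h3)), div_le_iff₀ (h4.trans_le h3)]
  have h6 : (2 : ℝ) ^ m * (1 / 2) ^ m = 1 := by rw [← mul_pow]; norm_num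
  have h7 : (m : ℝ) ^ 2 * x ^ 2 = 2 ^ m * m ^ 2 * x ^ 2 * (1 / 2) ^ m := by
    linear_combination (-(m : ℝ) ^ 2 * x ^ 2) * h6
  exact (by linarith : _ ≤ (m : ℝ) ^ 2 * x ^ 2).trans (h7.le.trans (mul_le_mul_of_nonneg_left h3 (by positivity)))

theorem abs_singSeries_sub_prod_le {H : Finset ℕ} {K : ℕ} (hK : 0 < K) (h : ∀ p, p.Prime → K < p → residCard H p = H.card) :
    |singSeries H - ∏ p ∈ K.primesLE, singFactor H p| ≤
      |∏ p ∈ K.primesLE, singFactor H p| * (Real.exp (2 ^ H.card * H.card ^ 2 * (2 / (K + 1))) - 1) := by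
  set C : ℝ := 2 ^ H.card * H.card ^ 2
  set g : ℕ → ℝ := {p : ℕ | p.Prime}.mulIndicator (singFactor H) with hg
  have hs : singSeries H = ∏' n, g n := tprod_subtype {p : ℕ | p.Prime} (singFactor H)
  have hb (n : ℕ) (hn : K < n) : ‖g n - 1‖ ≤ C * ((n : ℝ) ^ 2)⁻¹ := by
    by_cases hp : n.Prime
    · rw [hg, Set.mulIndicator_of_mem (show n ∈ {p : ℕ | p.Prime} from hp)]; exact abs_singFactor_sub_one_le hp.two_le (h n hp hn)
    · rw [hg, Set.mulIndicator_of_notMem (show n ∉ {p : ℕ | p.Prime} from hp)]; simp; positivity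
  have hm : Multipliable g := by
    have : Summable fun n => g n - 1 := .of_norm_bounded_eventually_nat (g := fun n : ℕ => C * ((n : ℝ) ^ 2)⁻¹)
      ((Real.summable_nat_pow_inv.2 one_lt_two).mul_left _) (Filter.eventually_atTop.2 ⟨K + 1, fun n hn => hb n hn⟩)
    simpa using Real.multipliable_one_add_of_summable this
  have hP : ∏ p ∈ K.primesLE, singFactor H p = ∏ n ∈ range (K + 1), g n := by
    rw [Nat.primesLE_eq_filter_range, prod_filter]; simp [hg, Set.mulIndicator_apply]
  rw [hs, hP]
  refine le_of_tendsto ((hm.tendsto_prod_tprod_nat.sub_const _).abs) (Filter.eventually_atTop.2 ⟨K + 1, fun n hn => ?_⟩)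
  rw [← prod_range_mul_prod_Ico _ hn, ← mul_sub_one, abs_mul]
  refine mul_le_mul_of_nonneg_left ?_ (abs_nonneg _)
  have h1 := norm_prod_one_add_sub_one_le (Ico (K + 1) n) fun i => g i - 1
  simp only [add_sub_cancel, Real.norm_eq_abs] at h1
  refine h1.trans (sub_le_sub_right (Real.exp_le_exp.2 ?_) _)
  refine (sum_le_sum fun i hi => hb i (mem_Ico.1 hi).1).trans ?_
  rw [← mul_sum]
  exact mul_le_mul_of_nonneg_left (sum_Ioo_inv_sq_le K n) (by positivity)

/-- The nonzero residues `m` mod `p` with `p ∣ m - h₀ + h` for some `h ∈ H`. -/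
def shiftResidues (p h₀ : ℕ) (H : Finset ℕ) : Finset (ZMod p) := (H.image fun h : ℕ => (h₀ : ZMod p) - h).erase 0

theorem card_shiftResidues_add_one {p : ℕ} (hp : 0 < p) (h₀ : ℕ) (H : Finset ℕ) :
    (shiftResidues p h₀ H).card + 1 = residCard (H ∪ {h₀}) p := by
  have : NeZero p := ⟨hp.ne'⟩
  have h1 : residCard (H ∪ {h₀}) p = ((H ∪ {h₀}).image fun h : ℕ => (h₀ : ZMod p) - h).card := by
    rw [residCard, ← card_image_of_injective (image (fun h : ℕ => (h₀ : ZMod p) - h) _)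
      ((ZMod.val_injective p).comp (sub_right_injective (b := (h₀ : ZMod p)))), image_image]
    congr 2
    ext h
    simp [ZMod.val_natCast]
  rw [h1, image_union, image_singleton, sub_self, union_comm, ← insert_eq, shiftResidues, ← card_insert_of_notMem (notMem_erase 0 _)]
  congr 1
  ext x
  by_cases hx : x = 0 <;> simp [hx]

theorem shiftResidues_union (p h₀ : ℕ) (H₁ H₂ : Finset ℕ) :
    shiftResidues p h₀ (H₁ ∪ H₂) = shiftResidues p h₀ H₁ ∪ shiftResidues p h₀ H₂ := by
  rw [shiftResidues, image_union, erase_union_distrib]; rfl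

theorem card_shiftResidues_le (p h₀ : ℕ) (H : Finset ℕ) : (shiftResidues p h₀ H).card ≤ H.card :=
  (card_erase_le).trans card_image_le

theorem card_shiftResidues_eq {p h₀ : ℕ} (hp : 0 < p) {H H' : Finset ℕ} (hH : H ⊆ H') (h₀H : h₀ ∉ H')
    (h : residCard (H' ∪ {h₀}) p = (H' ∪ {h₀}).card) : (shiftResidues p h₀ H).card = H.card := by
  have h1 := card_shiftResidues_add_one hp h₀ H
  rw [residCard, card_image_of_injOn ((card_image_iff.1 h).mono (coe_subset.2 (union_subset_union_left hH))),
    card_union_of_disjoint (disjoint_singleton_right.2 fun h => h₀H (hH h)), card_singleton] at h1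
  exact Nat.succ_injective h1

/-- The Euler factor at `p` of the correlation of the two sieve weights along shifted primes. -/
noncomputable def correlationFactor (p h₀ : ℕ) (H₁ H₂ : Finset ℕ) : MonoidAlgebra ℝ (ℕ × ℕ) :=
  1 + (-((p : ℝ) / (p - 1) * (shiftResidues p h₀ H₁).card) • eulerTerm 1 0 p -
    ((p : ℝ) / (p - 1) * (shiftResidues p h₀ H₂).card) • eulerTerm 0 1 p +
    ((p : ℝ) / (p - 1) * (shiftResidues p h₀ H₁ ∩ shiftResidues p h₀ H₂).card) • eulerTerm 1 1 p)

theorem augment_eulerTerm {p : ℕ} (hp : 0 < p) (i j : ℕ) : augment (eulerTerm i j p) = 1 / (p : ℝ) := by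
  rw [eulerTerm, map_smul, monoPow_apply, augment, MonoidAlgebra.lift_single]
  simp [hp.ne']

open Filter Topology in
theorem tendsto_augment_localFactor {p h₀ : ℕ} (hp : p.Prime) {H₁ H₂ : Finset ℕ} (h₀H : h₀ ∉ H₁ ∪ H₂) :
    Tendsto (fun J => augment (localFactor H₁.card H₂.card (H₁ ∩ H₂).card (J + 2) p (correlationFactor p h₀ H₁ H₂)))
      atTop (𝓝 (singFactor (H₁ ∪ H₂ ∪ {h₀}) p)) := by
  have hp1 : (1 : ℝ) < p := by exact_mod_cast hp.one_lt
  have hx : 1 / (p : ℝ) < 1 := by rw [div_lt_one (by positivity)]; exact hp1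
  have hg : Tendsto (fun J => ∑ n ∈ range (J + 2), (1 / (p : ℝ)) ^ n) atTop (𝓝 (1 - 1 / (p : ℝ))⁻¹) :=
    ((hasSum_geometric_of_lt_one (by positivity) hx).tendsto_sum_nat).comp (tendsto_add_atTop_nat 2)
  simp only [localFactor, correlationFactor, map_mul, map_pow, map_sum, map_sub, map_one, map_add, map_smul,
    augment_eulerTerm hp.pos, smul_eq_mul]
  refine ((tendsto_const_nhds.mul (hg.pow _)).mul (hg.pow _)).mul_const _ |>.trans_eq ?_
  have h1 := card_shiftResidues_add_one hp.pos h₀ (H₁ ∪ H₂)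
  have h2 := card_union_add_card_inter (shiftResidues p h₀ H₁) (shiftResidues p h₀ H₂)
  have h3 := card_union_add_card_inter H₁ H₂
  rw [singFactor, card_union_of_disjoint (disjoint_singleton_right.2 h₀H), card_singleton, ← h1, shiftResidues_union]
  rw [← @Nat.cast_inj ℝ, Nat.cast_add, Nat.cast_add] at h2
  generalize ((shiftResidues p h₀ H₁).card : ℝ) = a at *
  generalize ((shiftResidues p h₀ H₂).card : ℝ) = b at *
  obtain rfl := eq_sub_of_add_eq h2.symm
  congr 1
  have hy : 1 - 1 / (p : ℝ) ≠ 0 := by linarith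
  have hy' : (p : ℝ) - 1 ≠ 0 := by linarith
  rw [mul_assoc (_ + _), ← pow_add, ← h3, pow_add, pow_succ, mul_inv, mul_assoc (_ + _), mul_assoc (_ ^ _), ← mul_pow, inv_mul_cancel₀ hy, one_pow]
  rw [mul_one, inv_pow, mul_left_comm, mul_comm]
  congr 1
  push_cast
  field_simp
  ring

theorem card_primeFactors_le (n : ℕ) : (n.primeFactors.card : ℝ) ≤ 2 * Real.log n := by
  rcases Nat.eq_zero_or_pos n with rfl | hn
  · simp
  have h : 2 ^ n.primeFactors.card ≤ n := (pow_card_le_prod _ id _ fun p hp => (Nat.prime_of_mem_primeFactors hp).two_le).trans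
    (Nat.le_of_dvd hn (Nat.prod_primeFactors_dvd n))
  have h2 := Real.log_le_log (by positivity) (Nat.cast_le (α := ℝ).2 h)
  rw [Nat.cast_pow, Real.log_pow, Nat.cast_ofNat] at h2
  nlinarith [Real.log_two_gt_d9, Nat.cast_nonneg (α := ℝ) n.primeFactors.card]

theorem residCard_eq_card_of_le {H : Finset ℕ} {h p : ℕ} (hH : H ⊆ Icc 1 h) (hp : h < p) : residCard H p = H.card :=
  card_image_of_injOn fun a ha b hb e => by
    have ha := mem_Icc.1 (hH ha)
    have hb := mem_Icc.1 (hH hb)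
    simpa [Nat.mod_eq_of_lt (ha.2.trans_lt hp), Nat.mod_eq_of_lt (hb.2.trans_lt hp)] using e

/-- Elements of `H ⊆ [1, h]` are distinct modulo all but few primes. -/
theorem exists_residCard_eq_card {H : Finset ℕ} {h : ℕ} {L : ℝ} (hH : H ⊆ Icc 1 h) (hL0 : 0 ≤ L) (hL : Real.log h ≤ L) :
    ∃ D : Finset ℕ, (D.card : ℝ) ≤ H.card ^ 2 * (2 * L) ∧ ∀ p ∉ D, p.Prime → residCard H p = H.card := by
  refine ⟨H.offDiag.biUnion fun x => (x.1 - x.2).primeFactors, ?_, fun p hpD hp => card_image_of_injOn fun a ha b hb e => ?_⟩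
  · refine (Nat.cast_le.2 card_biUnion_le).trans ?_
    rw [Nat.cast_sum]
    refine (sum_le_card_nsmul _ _ (2 * L) fun x hx => ?_).trans ?_
    · refine (card_primeFactors_le _).trans (mul_le_mul_of_nonneg_left ?_ zero_le_two)
      rcases Nat.eq_zero_or_pos (x.1 - x.2) with h0 | h0
      · rw [h0]; simpa
      · refine (Real.log_le_log (by exact_mod_cast h0) (Nat.cast_le.2 ?_)).trans hL
        have := mem_Icc.1 (hH (mem_offDiag.1 hx).1)
        lia
    · rw [nsmul_eq_mul]
      refine mul_le_mul_of_nonneg_right ?_ (by positivity)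
      rw [offDiag_card, sq]
      exact_mod_cast Nat.sub_le _ _
  · by_contra hab
    refine hpD (mem_biUnion.2 ?_)
    rcases lt_or_gt_of_ne hab with h | h
    · exact ⟨(b, a), mem_offDiag.2 ⟨hb, ha, Ne.symm hab⟩, Nat.mem_primeFactors.2
        ⟨hp, (Nat.modEq_iff_dvd' h.le).1 e, by dsimp only; lia⟩⟩
    · exact ⟨(a, b), mem_offDiag.2 ⟨ha, hb, hab⟩, Nat.mem_primeFactors.2
        ⟨hp, (Nat.modEq_iff_dvd' h.le).1 (Eq.symm e), by dsimp only; lia⟩⟩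

open Filter Topology in
theorem tendsto_sq_mul_exp_sqrt_sub {C : ℝ} (hC : 0 ≤ C) : Tendsto (fun u : ℝ => u ^ 2 * Real.exp (C * √u - u / 2)) atTop (𝓝 0) := by
  have h := ((Real.tendsto_pow_mul_exp_neg_atTop_nhds_zero 2).comp (tendsto_id.atTop_div_const zero_lt_four)).const_mul 16
  rw [mul_zero] at h
  refine squeeze_zero' (.of_forall fun u => by positivity) ?_ h
  filter_upwards [eventually_ge_atTop ((4 * C) ^ 2), eventually_ge_atTop 0] with u hu h0
  have h1 : 4 * C ≤ √u := Real.le_sqrt_of_sq_le hu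
  simp only [Function.comp, id, div_pow]
  rw [show (16 : ℝ) * (u ^ 2 / 4 ^ 2 * Real.exp (-(u / 4))) = u ^ 2 * Real.exp (-(u / 4)) by ring]
  refine mul_le_mul_of_nonneg_left (Real.exp_le_exp.2 ?_) (sq_nonneg u)
  nlinarith [Real.sq_sqrt h0, Real.sqrt_nonneg u]

theorem exists_prod_weightNorm_localFactor_le (k₁ k₂ r : ℕ) : ∃ C : ℝ, 0 ≤ C ∧ ∀ (J h h₀ K : ℕ) (L : ℝ) (H₁ H₂ : Finset ℕ),
    8 ≤ Real.log L → 0 < L → Real.log h ≤ L → H₁ ⊆ Icc 1 h → H₂ ⊆ Icc 1 h → h₀ ∈ Icc 1 h → h₀ ∉ H₁ ∪ H₂ →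
    H₁.card = k₁ → H₂.card = k₂ → (H₁ ∩ H₂).card = r →
    ∏ p ∈ K.primesLE, weightNorm (1 / Real.log L) (localFactor k₁ k₂ r (J + 2) p (correlationFactor p h₀ H₁ H₂)) ≤
      Real.exp (C * √(Real.log L)) := by
  set M : ℝ := 5 * (k₁ + k₂ + r) + 2 * (k₁ + k₂ + 1) ^ 2
  have hM : 0 ≤ M := by positivity
  obtain ⟨C, hC, hloc⟩ := exists_weightNorm_localFactor_le k₁ k₂ r hM
  obtain ⟨C', hC', hprod⟩ := exists_prod_primesLE_le hM hC
  refine ⟨C', hC', fun J h h₀ K L H₁ H₂ hL hL0 hhL hH₁ hH₂ hh₀ hh₀' c₁ c₂ c₃ => ?_⟩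
  have hH : H₁ ∪ H₂ ∪ {h₀} ⊆ Icc 1 h := union_subset (union_subset hH₁ hH₂) (singleton_subset_iff.2 hh₀)
  obtain ⟨D, hD, hD'⟩ := exists_residCard_eq_card hH hL0.le hhL
  have key (p a k : ℕ) (hak : a ≤ k) : |(p : ℝ) / (p - 1) * a| ≤ 2 * k := by
    have ha : (a : ℝ) ≤ k := Nat.cast_le.2 hak
    rcases lt_or_ge p 2 with hp | hp
    · have : (p : ℝ) / (p - 1) = 0 := by interval_cases p <;> simp
      rw [this]; simp
    · have hp : (2 : ℝ) ≤ p := by exact_mod_cast hp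
      rw [abs_mul, Nat.abs_cast, abs_of_nonneg (div_nonneg (by linarith) (by linarith))]
      refine mul_le_mul ?_ ha (by positivity) zero_le_two
      rw [div_le_iff₀ (by linarith)]; linarith
  have s₁ (p) : (shiftResidues p h₀ H₁).card ≤ k₁ := (card_shiftResidues_le _ _ _).trans c₁.le
  have s₂ (p) : (shiftResidues p h₀ H₂).card ≤ k₂ := (card_shiftResidues_le _ _ _).trans c₂.le
  have s₃ (p) : (shiftResidues p h₀ H₁ ∩ shiftResidues p h₀ H₂).card ≤ k₁ := (card_le_card inter_subset_left).trans (s₁ p)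
  have b₁ (p) := key p _ _ (s₁ p)
  have b₂ (p) := key p _ _ (s₂ p)
  have b₃ (p) := key p _ _ (s₃ p)
  have hk₁ : (0 : ℝ) ≤ k₁ := by positivity
  have hk₂ : (0 : ℝ) ≤ k₂ := by positivity
  have hr : (0 : ℝ) ≤ r := by positivity
  have hM2 : (k₁ : ℝ) + k₂ + r ≥ 0 ∧ 2 * ((k₁ : ℝ) + k₂ + 1) ^ 2 ≥ 0 := ⟨by positivity, by positivity⟩
  have hσ : 1 / Real.log L ≤ 1 / 4 := one_div_le_one_div_of_le (by norm_num) (by linarith)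
  refine hprod K L (fun p => |k₁ - (p : ℝ) / (p - 1) * (shiftResidues p h₀ H₁).card| +
    |k₂ - (p : ℝ) / (p - 1) * (shiftResidues p h₀ H₂).card| +
    |r - (p : ℝ) / (p - 1) * (shiftResidues p h₀ H₁ ∩ shiftResidues p h₀ H₂).card|) _ D hL0 hL (fun p => ?_) (fun p hp hpD => ?_) ?_
    (fun p => weightNorm_nonneg _ _) fun p hp => hloc _ _ _ _ J p (by positivity) hσ (Nat.prime_of_mem_primesLE hp)
      ((b₁ p).trans (by linarith)) ((b₂ p).trans (by linarith)) ((b₃ p).trans (by linarith))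
  · have t₁ := abs_sub (k₁ : ℝ) ((p : ℝ) / (p - 1) * (shiftResidues p h₀ H₁).card)
    have t₂ := abs_sub (k₂ : ℝ) ((p : ℝ) / (p - 1) * (shiftResidues p h₀ H₂).card)
    have t₃ := abs_sub (r : ℝ) ((p : ℝ) / (p - 1) * (shiftResidues p h₀ H₁ ∩ shiftResidues p h₀ H₂).card)
    rw [Nat.abs_cast] at t₁ t₂ t₃
    linarith [b₁ p, b₂ p, b₃ p]
  · have hp := Nat.prime_of_mem_primesLE hp
    have g {H} (hH : H ⊆ H₁ ∪ H₂) := card_shiftResidues_eq hp.pos hH hh₀' (hD' p hpD hp)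
    have g₃ := card_union_add_card_inter (shiftResidues p h₀ H₁) (shiftResidues p h₀ H₂)
    rw [← shiftResidues_union, g subset_rfl, g subset_union_left, g subset_union_right, ← card_union_add_card_inter H₁ H₂] at g₃
    rw [g subset_union_left, g subset_union_right, add_left_cancel g₃, c₁, c₂, c₃]
    have h2 : (2 : ℝ) ≤ p := by exact_mod_cast hp.two_le
    have e (k : ℕ) : |k - (p : ℝ) / (p - 1) * k| ≤ 2 * k / p := by
      have h1 : (p : ℝ) - 1 > 0 := by linarith
      rw [show (k : ℝ) - p / (p - 1) * k = -(k / (p - 1)) by field_simp; ring, abs_neg, abs_of_nonneg (by positivity),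
        div_le_div_iff₀ h1 (by positivity)]
      nlinarith [Nat.cast_nonneg (α := ℝ) k]
    refine (add_le_add (add_le_add (e _) (e _)) (e _)).trans ?_
    rw [← add_div, ← add_div]
    exact div_le_div_of_nonneg_right (by linarith) (by positivity)
  · refine hD.trans ?_
    have : ((H₁ ∪ H₂ ∪ {h₀}).card : ℝ) ≤ k₁ + k₂ + 1 := by
      exact_mod_cast (card_union_le _ _).trans (add_le_add ((card_union_le _ _).trans (by rw [c₁, c₂])) le_rfl)
    rw [← mul_assoc]
    refine mul_le_mul_of_nonneg_right ?_ hL0.le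
    linarith [pow_le_pow_left₀ (by positivity) this 2]

/-- The main term of the correlation sum. -/
theorem exists_abs_shiftFunctional_correlation_sub_le (k₁ k₂ l₁ l₂ r : ℕ) {ε : ℝ} (hε : 0 < ε) : ∃ R₀ : ℝ, ∀ (R : ℝ) (h h₀ : ℕ)
    (H₁ H₂ : Finset ℕ), R₀ ≤ R → (h : ℝ) ≤ R → H₁ ⊆ Icc 1 h → H₂ ⊆ Icc 1 h → h₀ ∈ Icc 1 h → h₀ ∉ H₁ ∪ H₂ →
    H₁.card = k₁ → H₂.card = k₂ → (H₁ ∩ H₂).card = r →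
    |shiftFunctional (Real.log R) (fun x y => truncPow (k₁ + l₁) x * truncPow (k₂ + l₂) y)
        (∏ p ∈ ⌊R⌋₊.primesLE, correlationFactor p h₀ H₁ H₂) -
      (l₁ + l₂).choose l₁ * (Real.log R ^ (l₁ + l₂ + r) / (l₁ + l₂ + r).factorial) * singSeries (H₁ ∪ H₂ ∪ {h₀})| ≤
      ε * Real.log R ^ (l₁ + l₂ + r) := by
  obtain ⟨B, hB, hmain⟩ := exists_abs_shiftFunctional_prod_sub_le k₁ k₂ l₁ l₂ r
  obtain ⟨C, hC, hprod⟩ := exists_prod_weightNorm_localFactor_le k₁ k₂ r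
  set m := l₁ + l₂ + r
  set c : ℝ := ((Nat.choose (l₁ + l₂) l₁ : ℕ) : ℝ)
  set C' : ℝ := 2 ^ (k₁ + k₂ + 1) * (k₁ + k₂ + 1) ^ 2
  have hC' : 0 ≤ C' := by positivity
  have ht := (tendsto_sq_mul_exp_sqrt_sub hC).const_mul (B * 2 ^ m + c * (4 * C'))
  rw [mul_zero] at ht
  have hll := Real.tendsto_log_atTop.comp Real.tendsto_log_atTop
  obtain ⟨R₀, hR₀⟩ := Filter.eventually_atTop.1 (((ht.comp hll).eventually_le_const hε).and ((hll.eventually_ge_atTop 8).and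
    ((Real.tendsto_log_atTop.eventually_ge_atTop 1).and (Filter.eventually_ge_atTop (2 * C' + 1)))))
  refine ⟨R₀, fun R h h₀ H₁ H₂ hR hhR hH₁ hH₂ hh₀ hh₀' c₁ c₂ c₃ => ?_⟩
  obtain ⟨e₁, e₂, e₃, e₄⟩ := hR₀ R hR
  simp only [Function.comp] at e₁ e₂
  have hR0 : 0 < R := by linarith
  have hh0 : 0 < h := by have := mem_Icc.1 hh₀; lia
  have hhL := Real.log_le_log (by positivity) hhR
  have hfl := Nat.lt_floor_add_one R
  have hK : 0 < ⌊R⌋₊ := Nat.floor_pos.2 (by linarith)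
  have hhK : h ≤ ⌊R⌋₊ := Nat.le_floor hhR
  have hLR := Real.log_le_sub_one_of_pos hR0
  have hexp := Real.exp_log hR0
  generalize ⌊R⌋₊ = K at *
  set L := Real.log R
  have hH : H₁ ∪ H₂ ∪ {h₀} ⊆ Icc 1 h := union_subset (union_subset hH₁ hH₂) (singleton_subset_iff.2 hh₀)
  set P := Real.exp (C * √(Real.log L))
  have hσ : 1 / Real.log L ≤ 1 := by rw [div_le_one (by linarith)]; linarith
  have hσ0 : 0 < 1 / Real.log L := by positivity
  have hp (J : ℕ) := hprod J h h₀ K L H₁ H₂ e₂ (by linarith) hhL hH₁ hH₂ hh₀ hh₀' c₁ c₂ c₃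
  have hlim := tendsto_finsetProd K.primesLE fun p hp => tendsto_augment_localFactor (h₀ := h₀) (Nat.prime_of_mem_primesLE hp) hh₀'
  rw [c₁, c₂, c₃] at hlim
  set S := ∏ p ∈ K.primesLE, singFactor (H₁ ∪ H₂ ∪ {h₀}) p
  have hS : |S| ≤ P := le_of_tendsto hlim.abs (.of_forall fun J => by
    rw [abs_prod]
    exact (prod_le_prod (fun _ _ => abs_nonneg _) fun p _ => abs_augment_le hσ0.le _).trans (hp J))
  have h1 : |shiftFunctional L (fun x y => truncPow (k₁ + l₁) x * truncPow (k₂ + l₂) y)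
      (∏ p ∈ K.primesLE, correlationFactor p h₀ H₁ H₂) - c * (L ^ m / m.factorial) * S| ≤
      B / (1 / Real.log L) ^ 2 * ((1 + L) ^ m / √(1 + L)) * P := by
    refine le_of_tendsto ((hlim.const_mul _).const_sub _).abs (Filter.eventually_atTop.2 ⟨K, fun J hJ => ?_⟩)
    refine (hmain K (J + 2) L _ _ hK ?_ (by linarith) (by linarith) hσ0 hσ).trans (mul_le_mul_of_nonneg_left (hp J) (by positivity))
    exact Nat.lt_two_pow_self.trans_le (Nat.pow_le_pow_right two_pos (by lia))
  have h2 := abs_singSeries_sub_prod_le (H := H₁ ∪ H₂ ∪ {h₀}) hK fun p _ hp => residCard_eq_card_of_le hH (hhK.trans_lt hp)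
  have hm0 : ((H₁ ∪ H₂ ∪ {h₀}).card : ℕ) ≤ k₁ + k₂ + 1 :=
    (card_union_le _ _).trans (add_le_add ((card_union_le _ _).trans (by rw [c₁, c₂])) le_rfl)
  have hx : (2 : ℝ) ^ (H₁ ∪ H₂ ∪ {h₀}).card * (H₁ ∪ H₂ ∪ {h₀}).card ^ 2 * (2 / (K + 1)) ≤ 2 * C' / (K + 1) := by
    rw [mul_comm 2 C', ← mul_div_assoc]
    refine div_le_div_of_nonneg_right (mul_le_mul_of_nonneg_right (mul_le_mul (pow_le_pow_right₀ one_le_two hm0)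
      (pow_le_pow_left₀ (by positivity) ?_ 2) (by positivity) (by positivity)) zero_le_two) (by positivity)
    exact_mod_cast hm0
  have hx1 : 2 * C' / (K + 1) ≤ 1 := by rw [div_le_one (by positivity)]; linarith
  have hx2 : 2 * C' / (K + 1) ≤ 2 * C' / L := div_le_div_of_nonneg_left (by positivity) (by linarith) (by linarith)
  generalize (2 : ℝ) ^ (H₁ ∪ H₂ ∪ {h₀}).card * (H₁ ∪ H₂ ∪ {h₀}).card ^ 2 * (2 / (K + 1)) = x at hx h2
  have hx3 : Real.exp x - 1 ≤ 2 * (2 * C' / L) := by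
    have h3 := le_of_abs_le (Real.abs_exp_sub_one_le (x := 2 * C' / (K + 1)) (by rwa [abs_of_nonneg (by positivity)]))
    rw [abs_of_nonneg (by positivity)] at h3
    linarith [Real.exp_le_exp.2 hx]
  have hP : 0 < P := Real.exp_pos _
  have hL0 : 0 < L := by linarith
  have hs := Real.sq_sqrt hL0.le
  have hs1 := Real.one_le_sqrt.2 e₃
  have h3 : |singSeries (H₁ ∪ H₂ ∪ {h₀}) - S| ≤ P * (2 * (2 * C' / L)) :=
    h2.trans ((mul_le_mul_of_nonneg_left hx3 (abs_nonneg _)).trans (mul_le_mul_of_nonneg_right hS (by positivity)))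
  rw [Real.exp_sub, ← Real.log_sqrt hL0.le, Real.exp_log (by positivity)] at e₁
  change _ * (_ * (P / √L)) ≤ ε at e₁
  clear_value P
  clear ht hll hlim hp hmain hprod hR₀
  generalize Real.log L = u at *
  have h4 : (1 + L) ^ m / √(1 + L) ≤ 2 ^ m * L ^ m / √L := by
    rw [← mul_pow]
    exact div_le_div₀ (by positivity) (pow_le_pow_left₀ (by positivity) (by linarith) m) (by positivity) (Real.sqrt_le_sqrt (by linarith))
  have h5 : L ^ m / m.factorial ≤ L ^ m := div_le_self (by positivity) (by exact_mod_cast m.factorial_pos)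
  have h6 : 1 / L ≤ u ^ 2 / √L := by
    rw [div_le_div_iff₀ hL0 (by positivity), one_mul]
    nlinarith [mul_le_mul_of_nonneg_right (by nlinarith : 1 ≤ u ^ 2) hL0.le]
  calc _ = |shiftFunctional L (fun x y => truncPow (k₁ + l₁) x * truncPow (k₂ + l₂) y)
        (∏ p ∈ K.primesLE, correlationFactor p h₀ H₁ H₂) - c * (L ^ m / m.factorial) * S -
        c * (L ^ m / m.factorial) * (singSeries (H₁ ∪ H₂ ∪ {h₀}) - S)| := by congr 1; ring
    _ ≤ B * u ^ 2 * (2 ^ m * L ^ m / √L) * P + c * L ^ m * (P * (4 * C' * (u ^ 2 / √L))) := by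
      refine (abs_sub _ _).trans (add_le_add (h1.trans ?_) ?_)
      · refine mul_le_mul_of_nonneg_right (mul_le_mul (le_of_eq ?_) h4 (by positivity) (by positivity)) hP.le
        rw [one_div, inv_pow, div_inv_eq_mul]
      · rw [abs_mul, abs_of_nonneg (by positivity)]
        refine mul_le_mul (mul_le_mul_of_nonneg_left h5 (by positivity)) (h3.trans (mul_le_mul_of_nonneg_left ?_ hP.le))
          (abs_nonneg _) (by positivity)
        calc _ = 4 * C' * (1 / L) := by ring
          _ ≤ _ := mul_le_mul_of_nonneg_left h6 (by positivity)
    _ = (B * 2 ^ m + c * (4 * C')) * (u ^ 2 * (P / √L)) * L ^ m := by ring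
    _ ≤ _ := mul_le_mul_of_nonneg_right e₁ (by positivity)

/-- The functional pairing a double Dirichlet polynomial with two truncated powers of logarithms. -/
noncomputable abbrev sieveFunctional (L : ℝ) (a b : ℕ) : MonoidAlgebra ℝ (ℕ × ℕ) →ₗ[ℝ] ℝ :=
  shiftFunctional L fun x y => truncPow a x * truncPow b y

theorem abs_truncPow_le {L x : ℝ} (hL : 0 ≤ L) (hx : x ≤ L) (a : ℕ) : |truncPow a x| ≤ (1 + L) ^ a := by
  rcases lt_or_ge x 0 with h | h
  · rw [truncPow_of_neg a h, abs_zero]; positivity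
  · rw [truncPow_of_nonneg a h, abs_of_nonneg (by positivity)]
    exact (div_le_self (by positivity) (by exact_mod_cast a.factorial_pos)).trans (pow_le_pow_left₀ h (by linarith) a)

theorem abs_sieveFunctional_le {L τ : ℝ} {K : ℕ} (hL : 0 ≤ L) (hK : Real.exp L < K + 1) (hτ : 0 ≤ τ) (a b : ℕ)
    (z : MonoidAlgebra ℝ (ℕ × ℕ)) :
    |sieveFunctional L a b z| ≤ (1 + L) ^ (a + b) * ((K ^ 2 : ℕ) : ℝ) ^ τ * weightNorm (-τ) z := by
  rw [sieveFunctional, shiftFunctional, LinearMap.comp_apply, Finsupp.linearCombination_apply, weightNorm, Finsupp.sum, Finsupp.sum, mul_sum]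
  refine (abs_sum_le_sum_abs _ _).trans (sum_le_sum fun d _ => ?_)
  rw [smul_eq_mul, abs_mul, mul_left_comm]
  refine mul_le_mul_of_nonneg_left ?_ (abs_nonneg _)
  have neg (n : ℕ) (h : K < n) (a) : truncPow a (L - Real.log n) = 0 := by
    have h : Real.exp L < n := hK.trans_le (by exact_mod_cast h)
    exact truncPow_of_neg _ (by linarith [(Real.lt_log_iff_exp_lt ((Real.exp_pos L).trans h)).2 h])
  by_cases hd : d.1 * d.2 = 0
  · rw [if_pos hd, abs_zero]; positivity
  rw [if_neg hd]
  rcases lt_or_ge K d.1 with h1 | h1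
  · rw [neg _ h1, zero_mul, abs_zero]; positivity
  rcases lt_or_ge K d.2 with h2 | h2
  · rw [neg _ h2, mul_zero, abs_zero]; positivity
  have le (n : ℕ) (a) := abs_truncPow_le hL (x := L - Real.log n) (by linarith [Real.log_natCast_nonneg n]) a
  rw [abs_mul, mul_assoc]
  refine (mul_le_mul (le d.1 a) (le d.2 b) (abs_nonneg _) (by positivity)).trans ?_
  rw [← pow_add]
  refine le_mul_of_one_le_right (by positivity) ?_
  have hd0 : 0 < ((d.1 * d.2 : ℕ) : ℝ) := by exact_mod_cast Nat.pos_of_ne_zero hd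
  rw [Real.rpow_neg hd0.le, ← div_eq_mul_inv, one_le_div (by positivity)]
  exact Real.rpow_le_rpow hd0.le (by rw [sq]; exact_mod_cast Nat.mul_le_mul h1 h2) hτ

/-- The contribution of `p` to the product of the two sieve weights, as a function of the residue mod `p`. -/
noncomputable def localWeight (p h₀ : ℕ) (H₁ H₂ : Finset ℕ) (a : ZMod p) : MonoidAlgebra ℝ (ℕ × ℕ) :=
  (-(if a ∈ shiftResidues p h₀ H₁ then (1 : ℝ) else 0)) • monoPow 1 0 p -
    (if a ∈ shiftResidues p h₀ H₂ then (1 : ℝ) else 0) • monoPow 0 1 p +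
    (if a ∈ shiftResidues p h₀ H₁ ∩ shiftResidues p h₀ H₂ then (1 : ℝ) else 0) • monoPow 1 1 p

theorem localWeight_zero (p h₀ : ℕ) (H₁ H₂ : Finset ℕ) : localWeight p h₀ H₁ H₂ 0 = 0 := by
  simp [localWeight, shiftResidues]

theorem sum_localWeight {p : ℕ} [NeZero p] (hp : p.Prime) (h₀ : ℕ) (H₁ H₂ : Finset ℕ) :
    ∑ a : ZMod p, localWeight p h₀ H₁ H₂ a = ((p : ℝ) - 1) • (correlationFactor p h₀ H₁ H₂ - 1) := by
  have h1 : (p : ℝ) - 1 ≠ 0 := by have := hp.one_lt; rify at this; linarith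
  have h2 : (p : ℝ) ≠ 0 := NeZero.ne _
  simp only [localWeight, correlationFactor, sum_add_distrib, sum_sub_distrib, ← sum_smul, sum_neg_distrib, sum_boole, eulerTerm,
    filter_univ_mem, add_sub_cancel_left, smul_add, smul_sub, smul_smul]
  congr 2 <;> [congr 1; congr 1; skip] <;> field_simp

/-- The size of `localWeight`. -/
noncomputable def localSize (p h₀ : ℕ) (H₁ H₂ : Finset ℕ) (a : ZMod p) : ℝ :=
  (if a ∈ shiftResidues p h₀ H₁ then (1 : ℝ) else 0) + (if a ∈ shiftResidues p h₀ H₂ then (1 : ℝ) else 0) +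
    (if a ∈ shiftResidues p h₀ H₁ ∩ shiftResidues p h₀ H₂ then (1 : ℝ) else 0)

theorem localSize_nonneg (p h₀ : ℕ) (H₁ H₂ : Finset ℕ) (a : ZMod p) : 0 ≤ localSize p h₀ H₁ H₂ a := by
  unfold localSize; positivity

theorem sum_localSize_le {p : ℕ} [NeZero p] (h₀ : ℕ) (H₁ H₂ : Finset ℕ) :
    ∑ a : ZMod p, localSize p h₀ H₁ H₂ a ≤ 2 * H₁.card + H₂.card := by
  simp only [localSize, sum_add_distrib, sum_boole, filter_univ_mem]
  have h1 := card_shiftResidues_le p h₀ H₁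
  have h2 := card_shiftResidues_le p h₀ H₂
  have h3 := card_le_card (inter_subset_left (s₁ := shiftResidues p h₀ H₁) (s₂ := shiftResidues p h₀ H₂))
  rify at h1 h2 h3
  linarith

theorem weightNorm_localWeight_le {p : ℕ} (hp : 0 < p) {τ : ℝ} (hτ : 0 ≤ τ) (h₀ : ℕ) (H₁ H₂ : Finset ℕ) (a : ZMod p) :
    weightNorm (-τ) (localWeight p h₀ H₁ H₂ a) ≤ localSize p h₀ H₁ H₂ a * (p : ℝ) ^ (-τ) := by
  have h1 : (1 : ℝ) ≤ p := by exact_mod_cast hp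
  have h2 : ((p * p : ℕ) : ℝ) ^ (-τ) ≤ (p : ℝ) ^ (-τ) := Real.rpow_le_rpow_of_nonpos (by positivity)
    (by push_cast; nlinarith) (by linarith)
  rw [localWeight, sub_eq_add_neg, ← neg_smul]
  refine (weightNorm_add_le _ _ _).trans ((add_le_add_left (weightNorm_add_le _ _ _) _).trans ?_)
  simp only [weightNorm_smul, abs_neg, monoPow_apply, weightNorm_single, pow_one, pow_zero, mul_one, one_mul, abs_one, localSize, add_mul]
  refine add_le_add (add_le_add ?_ ?_) ?_ <;> split_ifs <;> simp
  simpa using h2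

theorem sum_zmod_prod_eq {A ι : Type*} [CommSemiring A] [Fintype ι] [DecidableEq ι] (m : ι → ℕ) [∀ i, NeZero (m i)] [NeZero (∏ i, m i)]
    (hm : Pairwise (Function.onFun Nat.Coprime m)) (F : ∀ i, ZMod (m i) → A) :
    ∑ x : ZMod (∏ i, m i), ∏ i, F i (x.cast : ZMod (m i)) = ∏ i, ∑ b : ZMod (m i), F i b := by
  rw [prod_univ_sum, Fintype.piFinset_univ]
  refine Fintype.sum_equiv (ZMod.prodEquivPi m hm).toEquiv _ _ fun x => prod_congr rfl fun i _ => congrArg _ ?_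
  conv_rhs => rw [← ZMod.natCast_zmod_val x]
  rw [RingEquiv.toEquiv_eq_coe, RingEquiv.coe_toEquiv, map_natCast, Pi.natCast_apply, ZMod.natCast_val]

theorem abs_sum_mul_sub_le_of_residues {D : ℕ} [NeZero D] {T : Finset ℕ} {g : ℕ → ℝ} {E X : ℝ} {f : ZMod D → ℝ} (hf : ∀ a, ¬IsUnit a → f a = 0)
    (hE : ∀ a : ZMod D, IsUnit a → |∑ m ∈ T.filter (fun m : ℕ => (m : ZMod D) = a), g m - X| ≤ E) :
    |∑ m ∈ T, g m * f m - X * ∑ a, f a| ≤ E * ∑ a, |f a| := by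
  rw [← sum_fiberwise (s := T) (g := fun m : ℕ => (m : ZMod D)), mul_sum, ← sum_sub_distrib, mul_sum]
  refine (abs_sum_le_sum_abs _ _).trans (sum_le_sum fun a _ => ?_)
  by_cases ha : IsUnit a
  · rw [show (∑ m ∈ T with ((m : ℕ) : ZMod D) = a, g m * f m) = (∑ m ∈ T with ((m : ℕ) : ZMod D) = a, g m) * f a by
      rw [sum_mul]; exact sum_congr rfl fun m hm => by rw [(mem_filter.1 hm).2], ← sub_mul, abs_mul]
    exact mul_le_mul_of_nonneg_right (hE a ha) (abs_nonneg _)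
  · rw [hf a ha, sum_eq_zero fun m hm => by rw [(mem_filter.1 hm).2, hf a ha, mul_zero]]
    simp

/-- Equidistribution in residue classes evaluates the average of a product of local weights. -/
theorem abs_sum_sieveFunctional_sub_le {L E X : ℝ} {K : ℕ} (hL : 0 ≤ L) (hK : Real.exp L < K + 1) {u : Finset ℕ} (hu : ∀ p ∈ u, p.Prime) (a b h₀ : ℕ)
    (H₁ H₂ : Finset ℕ) {T : Finset ℕ} {g : ℕ → ℝ} (hE0 : 0 ≤ E)
    (hE : ∏ p ∈ u, p ≤ K ^ 2 → ∀ c : ZMod (∏ p ∈ u, p), IsUnit c →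
      |∑ m ∈ T.filter (fun m : ℕ => (m : ZMod (∏ p ∈ u, p)) = c), g m - X / (∏ p ∈ u, p).totient| ≤ E) :
    |∑ m ∈ T, g m * sieveFunctional L a b (∏ p ∈ u, localWeight p h₀ H₁ H₂ m) -
      X * sieveFunctional L a b (∏ p ∈ u, (correlationFactor p h₀ H₁ H₂ - 1))| ≤
      if ∏ p ∈ u, p ≤ K ^ 2 then (1 + L) ^ (a + b) * (2 * H₁.card + H₂.card) ^ u.card * E else 0 := by
  have hne (i : u) : NeZero (i : ℕ) := ⟨(hu i i.2).ne_zero⟩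
  have hD0 : 0 < ∏ p ∈ u, p := prod_pos fun p hp => (hu p hp).pos
  have hco : Pairwise (Function.onFun Nat.Coprime fun i : u => (i : ℕ)) := fun i j hij =>
    (Nat.coprime_primes (hu i i.2) (hu j j.2)).2 fun h => hij (Subtype.ext h)
  have hphi : ((∏ p ∈ u, p).totient : ℝ) = ∏ p ∈ u, ((p : ℝ) - 1) := by
    have h := Nat.totient_mul_prod_primeFactors (∏ p ∈ u, p)
    rw [Nat.primeFactors_prod hu, mul_comm] at h
    rw [Nat.eq_of_mul_eq_mul_left hD0 h, Nat.cast_prod]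
    exact prod_congr rfl fun p hp => by rw [Nat.cast_sub (hu p hp).one_le, Nat.cast_one]
  rw [← prod_coe_sort u fun p => p] at *
  have : NeZero (∏ i : u, (i : ℕ)) := ⟨hD0.ne'⟩
  set f : ZMod (∏ i : u, (i : ℕ)) → ℝ := fun c => sieveFunctional L a b (∏ i : u, localWeight i h₀ H₁ H₂ c.cast) with hf
  have hsum : sieveFunctional L a b (∏ p ∈ u, (correlationFactor p h₀ H₁ H₂ - 1)) = 1 / (∏ i : u, (i : ℕ)).totient * ∑ c, f c := by
    rw [hf, ← map_sum, sum_zmod_prod_eq (fun i : u => (i : ℕ)) hco fun i => localWeight i h₀ H₁ H₂]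
    rw [prod_congr rfl fun (i : u) _ => sum_localWeight (hu i i.2) h₀ H₁ H₂, prod_smul, map_smul, smul_eq_mul, hphi,
      prod_coe_sort u fun p : ℕ => (p : ℝ) - 1, prod_coe_sort u fun p => correlationFactor p h₀ H₁ H₂ - 1, ← mul_assoc,
      one_div_mul_cancel, one_mul]
    refine prod_ne_zero_iff.2 fun p hp => ?_
    have := (hu p hp).one_lt
    rify at this
    linarith
  have hfm (m : ℕ) : sieveFunctional L a b (∏ p ∈ u, localWeight p h₀ H₁ H₂ m) = f m := by
    rw [hf, ← prod_coe_sort u]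
    refine congrArg _ (prod_congr rfl fun i _ => ?_)
    rw [ZMod.cast_natCast (dvd_prod_of_mem (fun i : u => (i : ℕ)) (mem_univ i))]
  have hbd (c) {τ : ℝ} (hτ : 0 ≤ τ) : |f c| ≤ (1 + L) ^ (a + b) * (∏ i : u, localSize i h₀ H₁ H₂ c.cast) *
      (((K ^ 2 : ℕ) : ℝ) / (∏ i : u, (i : ℕ) : ℕ)) ^ τ := by
    refine (abs_sieveFunctional_le hL hK hτ a b _).trans ?_
    rw [Real.div_rpow (by positivity) (by positivity), mul_assoc, mul_assoc, mul_div, mul_comm (∏ i : u, _) (_ ^ τ), mul_div_assoc]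
    refine mul_le_mul_of_nonneg_left (mul_le_mul_of_nonneg_left ?_ (by positivity)) (by positivity)
    rw [div_eq_mul_inv, ← Real.rpow_neg (by positivity), Nat.cast_prod, ← Real.finsetProd_rpow _ _ fun _ _ => by positivity, ← prod_mul_distrib]
    exact (weightNorm_prod_le _ _ _).trans (prod_le_prod (fun _ _ => weightNorm_nonneg _ _) fun i _ =>
      weightNorm_localWeight_le (hu i i.2).pos hτ h₀ H₁ H₂ _)
  simp only [hfm, hsum]
  rw [← mul_assoc, mul_one_div]
  split_ifs with h
  · refine (abs_sum_mul_sub_le_of_residues ?_ (hE h)).trans ?_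
    · intro c hc
      rw [← ZMod.natCast_zmod_val c, ZMod.isUnit_iff_coprime, Nat.Prime.not_coprime_iff_dvd] at hc
      obtain ⟨p, hp, h1, h2⟩ := hc
      obtain ⟨i, -, hi⟩ := hp.prime.exists_mem_finset_dvd h2
      rw [Nat.prime_dvd_prime_iff_eq hp (hu i i.2)] at hi
      rw [hf]
      dsimp only
      rw [prod_eq_zero (mem_univ i), map_zero]
      rw [← ZMod.natCast_val, (ZMod.natCast_eq_zero_iff _ _).2 (hi ▸ h1), localWeight_zero]
    · rw [mul_comm _ E]
      refine mul_le_mul_of_nonneg_left ?_ hE0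
      refine (sum_le_sum fun c _ => hbd c le_rfl).trans ?_
      simp only [Real.rpow_zero, mul_one]
      rw [← mul_sum, sum_zmod_prod_eq (fun i : u => (i : ℕ)) hco fun i => localSize i h₀ H₁ H₂]
      refine mul_le_mul_of_nonneg_left ?_ (by positivity)
      refine (prod_le_prod (fun i _ => sum_nonneg fun _ _ => localSize_nonneg _ _ _ _ _) fun i _ => sum_localSize_le h₀ H₁ H₂).trans ?_
      simp
  · have hf0 (c) : f c = 0 := by
      push Not at h
      have h1 : ((K ^ 2 : ℕ) : ℝ) / (∏ i : u, (i : ℕ) : ℕ) < 1 := by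
        rw [div_lt_one (by exact_mod_cast hD0)]; exact_mod_cast h
      have h2 := (tendsto_pow_atTop_nhds_zero_of_lt_one (by positivity) h1).const_mul
        ((1 + L) ^ (a + b) * ∏ i : u, localSize i h₀ H₁ H₂ c.cast)
      rw [mul_zero] at h2
      refine abs_nonpos_iff.1 (ge_of_tendsto' h2 fun n => ?_)
      simpa only [Real.rpow_natCast] using hbd c n.cast_nonneg
    simp only [hf0, mul_zero, sum_const_zero, sub_zero, abs_zero, le_refl]

theorem lamR_eq_sum_primesLE {R : ℝ} (hR : 0 < R) {n : ℕ} (hn : 0 < n) (H : Finset ℕ) (a : ℕ) :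
    lamR R n H a = ∑ s ∈ ⌊R⌋₊.primesLE.powerset, (∏ p ∈ s, -(if p ∣ ∏ h ∈ H, (n + h) then (1 : ℝ) else 0)) *
      truncPow a (Real.log R - Real.log (∏ p ∈ s, p : ℕ)) := by
  have hP : ∏ h ∈ H, (n + h) ≠ 0 := prod_ne_zero_iff.2 fun h _ => by lia
  have hlog {d : ℕ} (hd : 0 < d) : 0 ≤ Real.log R - Real.log d ↔ (d : ℝ) ≤ R := by
    rw [sub_nonneg, Real.log_le_log_iff (by exact_mod_cast hd) hR]
  rw [lamR]
  generalize ∏ h ∈ H, (n + h) = P at *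
  have hs {s} (h : s ∈ ⌊R⌋₊.primesLE.powerset) p (hp : p ∈ s) : p.Prime := Nat.prime_of_mem_primesLE (mem_powerset.1 h hp)
  rw [← sum_filter_of_ne (p := fun s => (∏ p ∈ s, p) ∣ P ∧ ((∏ p ∈ s, p : ℕ) : ℝ) ≤ R), mul_sum,
    ← sum_filter_of_ne (p := Squarefree)]
  · refine sum_nbij' Nat.primeFactors (fun s => ∏ p ∈ s, p) (fun d hd => ?_) (fun s h => ?_)
      (fun d hd => Nat.prod_primeFactors_of_squarefree (mem_filter.1 hd).2)
      (fun s h => Nat.primeFactors_prod (hs (mem_filter.1 h).1)) fun d hd => ?_ <;>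
      simp only [mem_filter, Nat.mem_divisors, mem_powerset] at *
    · rw [Nat.prod_primeFactors_of_squarefree hd.2]
      refine ⟨fun p hp => Nat.mem_primesLE.2 ⟨?_, Nat.prime_of_mem_primeFactors hp⟩, hd.1.1.1, hd.1.2⟩
      exact (Nat.le_of_mem_primeFactors hp).trans (Nat.le_floor hd.1.2)
    · exact ⟨⟨⟨h.2.1, hP⟩, h.2.2⟩, squarefree_prod_of_pairwise_isCoprime (fun p hp q hq hpq => Nat.coprime_iff_isRelPrime.1
        ((Nat.coprime_primes (hs h.1 p hp) (hs h.1 q hq)).2 hpq)) fun p hp => (hs h.1 p hp).squarefree⟩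
    · have hd0 := Nat.pos_of_dvd_of_pos hd.1.1.1 (Nat.pos_of_ne_zero hP)
      nth_rw 1 [← Nat.prod_primeFactors_of_squarefree hd.2]
      rw [ArithmeticFunction.isMultiplicative_moebius.map_prod_of_prime _ fun p hp => Nat.prime_of_mem_primeFactors hp,
        Nat.prod_primeFactors_of_squarefree hd.2, truncPow_of_nonneg _ ((hlog hd0).2 hd.1.2),
        ← Real.log_div hR.ne' (by positivity), Int.cast_prod, prod_congr rfl fun p hp => ?_]
      · rw [one_div_mul_eq_div, mul_div_assoc]
      · rw [if_pos ((Nat.dvd_of_mem_primeFactors hp).trans hd.1.1.1),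
          ArithmeticFunction.moebius_apply_prime (Nat.prime_of_mem_primeFactors hp)]
        simp
  · intro d _ h
    by_contra hd
    rw [ArithmeticFunction.moebius_eq_zero_of_not_squarefree hd] at h
    simp at h
  · intro s h h0
    rw [mul_ne_zero_iff, prod_ne_zero_iff] at h0
    refine ⟨prod_primes_dvd _ (fun p hp => (hs h p hp).prime) fun p hp => ?_, ?_⟩
    · by_contra hd
      exact h0.1 p hp (by rw [if_neg hd, neg_zero])
    · rw [← hlog (prod_pos fun p hp => (hs h p hp).pos)]
      by_contra hd
      exact h0.2 (truncPow_of_neg _ (not_le.1 hd))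

theorem natCast_mem_shiftResidues {p n h₀ : ℕ} (h : ¬p ∣ n + h₀) (hp : p.Prime) (H : Finset ℕ) :
    ((n + h₀ : ℕ) : ZMod p) ∈ shiftResidues p h₀ H ↔ p ∣ ∏ h ∈ H, (n + h) := by
  rw [shiftResidues, mem_erase, Ne, ZMod.natCast_eq_zero_iff, and_iff_right h, mem_image, hp.prime.dvd_finsetProd_iff]
  refine exists_congr fun x => and_congr_right fun _ => ?_
  rw [← ZMod.natCast_eq_zero_iff, Nat.cast_add, Nat.cast_add, eq_comm, ← sub_eq_zero]
  ring_nf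

theorem lamR_mul_lamR {R : ℝ} (hR : 0 < R) {n h₀ : ℕ} (hn : 0 < n) (h : ∀ p ∈ ⌊R⌋₊.primesLE, ¬p ∣ n + h₀) (H₁ H₂ : Finset ℕ) (a b : ℕ) :
    lamR R n H₁ a * lamR R n H₂ b =
      sieveFunctional (Real.log R) a b (∏ p ∈ ⌊R⌋₊.primesLE, (1 + localWeight p h₀ H₁ H₂ (n + h₀ : ℕ))) := by
  rw [prod_congr rfl (g := fun p => (1 + (-(if p ∣ ∏ h ∈ H₁, (n + h) then (1 : ℝ) else 0)) • monoPow 1 0 p) *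
    (1 + (-(if p ∣ ∏ h ∈ H₂, (n + h) then (1 : ℝ) else 0)) • monoPow 0 1 p)) fun p hp => ?_, prod_mul_distrib, prod_one_add, prod_one_add,
    sum_mul_sum, map_sum, lamR_eq_sum_primesLE hR hn, lamR_eq_sum_primesLE hR hn, sum_mul_sum]
  · refine sum_congr rfl fun s hs => ?_
    rw [map_sum]
    refine sum_congr rfl fun t ht => ?_
    have hne {s} (h : s ∈ ⌊R⌋₊.primesLE.powerset) : ∏ p ∈ s, p ≠ 0 :=
      prod_ne_zero_iff.2 fun p hp => (Nat.prime_of_mem_primesLE (mem_powerset.1 h hp)).ne_zero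
    rw [prod_smul, prod_smul, ← map_prod, ← map_prod, smul_mul_smul_comm, map_smul, monoPow_apply, monoPow_apply,
      MonoidAlgebra.single_mul_single, sieveFunctional, shiftFunctional_single]
    simp only [pow_one, pow_zero, Prod.mk_mul_mk, one_mul, mul_one, smul_eq_mul]
    rw [if_neg (mul_ne_zero (hne hs) (hne ht))]
    ring
  · have hpp := Nat.prime_of_mem_primesLE hp
    rw [localWeight]
    simp only [mem_inter, natCast_mem_shiftResidues (h p hp) hpp]
    have : monoPow 1 1 p = monoPow 1 0 p * monoPow 0 1 p := by
      simp [monoPow_apply, MonoidAlgebra.single_mul_single]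
    rw [this, mul_add, add_mul, add_mul, smul_mul_smul_comm]
    split_ifs <;> simp_all <;> abel

theorem card_divisors_prod {u : Finset ℕ} (hu : ∀ p ∈ u, p.Prime) : (∏ p ∈ u, p).divisors.card = 2 ^ u.card := by
  induction u using Finset.cons_induction with
  | empty => simp
  | cons p u hp ih =>
    rw [forall_mem_cons] at hu
    rw [prod_cons, card_cons, Nat.Coprime.card_divisors_mul, ih hu.2, hu.1.divisors, card_pair hu.1.one_lt.ne, pow_succ']
    exact Nat.Coprime.prod_right fun q hq => (Nat.coprime_primes hu.1 (hu.2 q hq)).2 fun h => hp (h ▸ hq)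

/-- Reduction of the correlation sum to the distribution of primes in residue classes. -/
theorem abs_sum_theta_lamR_sub_le {R X : ℝ} (hR : 1 ≤ R) {h₀ : ℕ} {s : Finset ℕ} (hs : ∀ n ∈ s, 0 < n ∧ ⌊R⌋₊ < n + h₀) {E : ℕ → ℝ}
    (hE0 : ∀ q, 0 ≤ E q) (hE : ∀ q ∈ Ioc 0 (⌊R⌋₊ ^ 2), ∀ c : ZMod q, IsUnit c →
      |∑ m ∈ (s.map (addRightEmbedding h₀)).filter (fun m : ℕ => (m : ZMod q) = c), theta m - X / q.totient| ≤ E q)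
    (H₁ H₂ : Finset ℕ) (a b : ℕ) :
    |∑ n ∈ s, theta (n + h₀) * lamR R n H₁ a * lamR R n H₂ b -
      X * sieveFunctional (Real.log R) a b (∏ p ∈ ⌊R⌋₊.primesLE, correlationFactor p h₀ H₁ H₂)| ≤
    (1 + Real.log R) ^ (a + b) * ∑ q ∈ Ioc 0 (⌊R⌋₊ ^ 2), (q.divisors.card : ℝ) ^ (2 * H₁.card + H₂.card) * E q := by
  have hL := Real.log_nonneg hR
  have hK : Real.exp (Real.log R) < ⌊R⌋₊ + 1 := by rw [Real.exp_log (by linarith)]; exact Nat.lt_floor_add_one R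
  have hpr {u} (h : u ∈ ⌊R⌋₊.primesLE.powerset) p (hp : p ∈ u) : p.Prime := Nat.prime_of_mem_primesLE (mem_powerset.1 h hp)
  have h1 : ∑ n ∈ s, theta (n + h₀) * lamR R n H₁ a * lamR R n H₂ b = ∑ u ∈ ⌊R⌋₊.primesLE.powerset,
      ∑ m ∈ s.map (addRightEmbedding h₀), theta m * sieveFunctional (Real.log R) a b (∏ p ∈ u, localWeight p h₀ H₁ H₂ m) := by
    rw [sum_comm, sum_map]
    refine sum_congr rfl fun n hn => ?_
    rw [addRightEmbedding_apply, ← mul_sum, ← map_sum, ← prod_one_add, mul_assoc]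
    by_cases hp : (n + h₀).Prime
    · rw [lamR_mul_lamR (by linarith) (hs n hn).1 fun p hp' h => ?_]
      rw [Nat.mem_primesLE] at hp'
      have := (Nat.prime_dvd_prime_iff_eq hp'.2 hp).1 h
      have := (hs n hn).2
      lia
    · simp [theta, hp]
  have h2 : ∏ p ∈ ⌊R⌋₊.primesLE, correlationFactor p h₀ H₁ H₂ =
      ∑ u ∈ ⌊R⌋₊.primesLE.powerset, ∏ p ∈ u, (correlationFactor p h₀ H₁ H₂ - 1) := by
    rw [← prod_one_add]; simp
  rw [h1, h2, map_sum, mul_sum, ← sum_sub_distrib]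
  refine (abs_sum_le_sum_abs _ _).trans ((sum_le_sum fun u hu => abs_sum_sieveFunctional_sub_le hL hK (hpr hu) a b h₀ H₁ H₂
    (hE0 _) fun h => hE _ (mem_Ioc.2 ⟨prod_pos fun p hp => (hpr hu p hp).pos, h⟩)).trans ?_)
  rw [← sum_filter, mul_sum]
  refine (sum_le_sum (g := fun u => (1 + Real.log R) ^ (a + b) *
    (((∏ p ∈ u, p).divisors.card : ℝ) ^ (2 * H₁.card + H₂.card) * E (∏ p ∈ u, p))) fun u hu => ?_).trans ?_
  · rw [card_divisors_prod (hpr (mem_filter.1 hu).1), mul_assoc]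
    refine mul_le_mul_of_nonneg_left (mul_le_mul_of_nonneg_right ?_ (hE0 _)) (by positivity)
    rw [Nat.cast_pow, pow_right_comm]
    exact pow_le_pow_left₀ (by positivity) (by exact_mod_cast Nat.lt_two_pow_self.le) _
  · rw [← sum_image (g := fun u : Finset ℕ => ∏ p ∈ u, p)
      (f := fun q => (1 + Real.log R) ^ (a + b) * ((q.divisors.card : ℝ) ^ (2 * H₁.card + H₂.card) * E q))]
    · refine sum_le_sum_of_subset_of_nonneg (image_subset_iff.2 fun u hu => ?_) fun q _ _ =>
        mul_nonneg (by positivity) (mul_nonneg (by positivity) (hE0 q))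
      rw [mem_filter] at hu
      exact mem_Ioc.2 ⟨prod_pos fun p hp => (hpr hu.1 p hp).pos, hu.2⟩
    · intro u hu v hv h
      rw [← Nat.primeFactors_prod (hpr (mem_filter.1 hu).1), ← Nat.primeFactors_prod (hpr (mem_filter.1 hv).1)]
      exact congrArg _ h

/-- The Bombieri-Vinogradov theorem for primes in a shifted dyadic interval. -/
theorem exists_theta_dyadic (A j : ℕ) : ∃ B : ℕ, ∃ C : ℝ, 0 ≤ C ∧ ∀ (N : ℝ) (h₀ Q : ℕ), 1 ≤ N → 0 < h₀ → (h₀ : ℝ) ≤ N →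
    (Q : ℝ) ^ 2 * (3 * (1 + Real.log N)) ^ (2 * B) ≤ N → ∃ E : ℕ → ℝ, (∀ q, 0 ≤ E q) ∧
    (∀ q ∈ Ioc 0 Q, ∀ a : ZMod q, IsUnit a →
      |∑ m ∈ ((Ioc ⌊N⌋₊ ⌊2 * N⌋₊).map (addRightEmbedding h₀)).filter (fun m : ℕ => (m : ZMod q) = a), theta m -
        N / q.totient| ≤ E q) ∧
    ∑ q ∈ Ioc 0 Q, (q.divisors.card : ℝ) ^ j * E q ≤ C * N / (1 + Real.log N) ^ A := by
  obtain ⟨B, C, hC, h⟩ := exists_bombieriVinogradov A j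
  obtain ⟨C₃, hC₃, h₃⟩ := one_add_log_pow_le (A + 2 ^ (j + 1)) one_pos
  refine ⟨B, 6 * C + C₃, by positivity, fun N h₀ Q hN hh₀ hh hQ => ?_⟩
  have hL := Real.log_nonneg hN
  have f0 := Nat.floor_le (by linarith : 0 ≤ N)
  have f1 := Nat.lt_floor_add_one N
  have f2 := Nat.floor_le (by linarith : 0 ≤ 2 * N)
  have f3 := Nat.lt_floor_add_one (2 * N)
  have f4 : ⌊N⌋₊ ≤ ⌊2 * N⌋₊ := Nat.floor_le_floor (by linarith)
  have hh1 : (1 : ℝ) ≤ h₀ := by exact_mod_cast hh₀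
  have f5 : (⌊N⌋₊ : ℝ) ≤ ⌊2 * N⌋₊ := by exact_mod_cast f4
  have key (x : ℕ) (h1 : N ≤ x) (h2 : x ≤ 3 * N) : ∃ E : ℕ → ℝ, (∀ q, 0 ≤ E q) ∧
      (∀ q ∈ Ioc 0 Q, ∀ a : ZMod q, IsUnit a →
        |∑ n ∈ (Ioc 0 x).filter (fun n : ℕ => (n : ZMod q) = a), theta n - x / q.totient| ≤ E q) ∧
      ∑ q ∈ Ioc 0 Q, (q.divisors.card : ℝ) ^ j * E q ≤ 3 * C * N / (1 + Real.log N) ^ A := by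
    have e1 : Real.log N ≤ Real.log x := Real.log_le_log (by linarith) h1
    have e2 : Real.log x ≤ 2 + Real.log N := by
      have := Real.log_le_log (by linarith) h2
      rw [Real.log_mul three_ne_zero (by linarith)] at this
      linarith [Real.log_le_sub_one_of_pos three_pos]
    obtain ⟨E, a, b, c⟩ := h x Q (by exact_mod_cast hN.trans h1) ((mul_le_mul_of_nonneg_left
      (pow_le_pow_left₀ (by linarith) (by linarith) _) (by positivity)).trans (hQ.trans h1))
    refine ⟨E, a, b, c.trans (div_le_div₀ (by positivity) ?_ (by positivity) (pow_le_pow_left₀ (by linarith) (by linarith) _))⟩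
    linarith [mul_le_mul_of_nonneg_left h2 hC]
  obtain ⟨E₁, a₁, b₁, c₁⟩ := key (⌊N⌋₊ + h₀) (by push_cast; linarith) (by push_cast; linarith)
  obtain ⟨E₂, a₂, b₂, c₂⟩ := key (⌊2 * N⌋₊ + h₀) (by push_cast; linarith) (by push_cast; linarith)
  refine ⟨fun q => E₁ q + E₂ q + q.divisors.card / q, fun q => add_nonneg (add_nonneg (a₁ q) (a₂ q)) (by positivity),
    fun q hq a ha => ?_, ?_⟩
  · have g₁ := b₁ q hq a ha
    have g₂ := b₂ q hq a ha
    rw [map_add_right_Ioc, sum_filter]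
    rw [sum_filter] at g₁ g₂
    rw [← sum_Ioc_consecutive _ (Nat.zero_le _) (add_le_add_left f4 h₀)] at g₂
    have g₃ := one_div_totient_le (mem_Ioc.1 hq).1
    have g₄ : |(⌊2 * N⌋₊ - ⌊N⌋₊ - N) / (q.totient : ℝ)| ≤ 1 / q.totient := by
      rw [abs_div, Nat.abs_cast]
      exact div_le_div_of_nonneg_right (abs_le.2 ⟨by linarith, by linarith⟩) (Nat.cast_nonneg _)
    rw [abs_le] at *
    push_cast at g₁ g₂
    simp only [add_div, sub_div] at *
    constructor <;> linarith
  · simp only [mul_add, sum_add_distrib]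
    have hQN : (Q : ℝ) ≤ N := by
      have h1 : (Q : ℝ) ^ 2 ≤ N := le_trans (le_mul_of_one_le_right (by positivity) (one_le_pow₀ (by linarith))) hQ
      exact le_trans (by exact_mod_cast Nat.le_self_pow two_ne_zero Q) h1
    have h1 := sum_card_divisors_pow_div_le (j + 1) Q
    simp only [pow_succ, mul_div_assoc] at h1
    have h2 : (1 + Real.log Q) ^ 2 ^ (j + 1) ≤ C₃ * N / (1 + Real.log N) ^ A := by
      rw [le_div_iff₀ (by positivity)]
      have := h₃ N hN
      rw [Real.rpow_one, pow_add, mul_comm] at this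
      refine le_trans (mul_le_mul_of_nonneg_right (pow_le_pow_left₀ (by linarith [Real.log_natCast_nonneg Q]) ?_ _) (by positivity)) this
      rcases Nat.eq_zero_or_pos Q with rfl | hQ0
      · simpa
      · linarith [Real.log_le_log (by exact_mod_cast hQ0) hQN]
    rw [pow_succ] at h2
    have h3 : (6 * C + C₃) * N / (1 + Real.log N) ^ A = 3 * C * N / (1 + Real.log N) ^ A + 3 * C * N / (1 + Real.log N) ^ A +
      C₃ * N / (1 + Real.log N) ^ A := by ring
    linarith

/-- Proposition 2 of Goldston–Pintz–Yıldırım: asymptotic for the sum of θ(n+h₀) times a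
product of two sieve weights, for h₀ outside H₁ ∪ H₂. -/
theorem two_lambda_theta_correlation (M : ℕ) (ε : ℝ) (hε : 0 < ε) :
    ∃ B N₀ R₀ : ℝ, ∀ (N R : ℝ) (h : ℕ) (H₁ H₂ : Finset ℕ) (h₀ k₁ k₂ r l₁ l₂ : ℕ),
      N₀ ≤ N → R₀ ≤ R → R ≤ N ^ ((1 : ℝ) / 4) * (Real.log N) ^ (-B) →
      0 < h → (h : ℝ) ≤ R →
      H₁ ⊆ Finset.Icc 1 h → H₂ ⊆ Finset.Icc 1 h →
      h₀ ∈ Finset.Icc 1 h → h₀ ∉ H₁ ∪ H₂ →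
      H₁.card = k₁ → H₂.card = k₂ → (H₁ ∩ H₂).card = r →
      k₁ + k₂ + l₁ + l₂ ≤ M →
      |(∑ n ∈ (Finset.Icc 1 ⌊2 * N⌋₊).filter (fun n : ℕ => N < (n : ℝ) ∧ (n : ℝ) ≤ 2 * N),
            theta (n + h₀) * lamR R n H₁ (k₁ + l₁) * lamR R n H₂ (k₂ + l₂)) -
          (Nat.choose (l₁ + l₂) l₁ : ℝ) *
            ((Real.log R) ^ (r + l₁ + l₂) / (Nat.factorial (r + l₁ + l₂) : ℝ)) *
            singSeries (H₁ ∪ H₂ ∪ {h₀}) * N| ≤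
        ε * N * (Real.log R) ^ (r + l₁ + l₂) := by
  obtain ⟨B, C, hC, hBV⟩ := exists_theta_dyadic (M + 1) (3 * M)
  have hmain : ∀ᶠ R : ℝ in Filter.atTop, ∀ k₁ k₂ l₁ l₂ r : Fin (M + 1), ∀ (h h₀ : ℕ) (H₁ H₂ : Finset ℕ), (h : ℝ) ≤ R →
      H₁ ⊆ Icc 1 h → H₂ ⊆ Icc 1 h → h₀ ∈ Icc 1 h → h₀ ∉ H₁ ∪ H₂ → H₁.card = k₁ → H₂.card = k₂ → (H₁ ∩ H₂).card = r →
      |sieveFunctional (Real.log R) (k₁ + l₁) (k₂ + l₂) (∏ p ∈ ⌊R⌋₊.primesLE, correlationFactor p h₀ H₁ H₂) -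
        ((l₁ + l₂ : ℕ).choose l₁ : ℝ) * (Real.log R ^ (l₁ + l₂ + r : ℕ) / (l₁ + l₂ + r : ℕ).factorial) *
          singSeries (H₁ ∪ H₂ ∪ {h₀})| ≤ ε / 2 * Real.log R ^ (l₁ + l₂ + r : ℕ) := by
    simp only [Filter.eventually_all]
    intro k₁ k₂ l₁ l₂ r
    obtain ⟨R₀, h⟩ := exists_abs_shiftFunctional_correlation_sub_le k₁ k₂ l₁ l₂ r (half_pos hε)
    filter_upwards [Filter.eventually_ge_atTop R₀] with R hR h' h₀ H₁ H₂
    exact h R h' h₀ H₁ H₂ hR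
  obtain ⟨R₀, hR₀⟩ := Filter.eventually_atTop.1 hmain
  refine ⟨B, Real.exp (2 * C / ε + 6), max R₀ (Real.exp 1), fun N R h H₁ H₂ h₀ k₁ k₂ r l₁ l₂ hN hR hRN hh hhR hH₁ hH₂ hh₀ hh₀' c₁ c₂ c₃ hM => ?_⟩
  obtain ⟨hR1, hR2⟩ := max_le_iff.1 hR
  have hN0 : 0 < N := (Real.exp_pos _).trans_le hN
  have hlN : 2 * C / ε + 6 ≤ Real.log N := (Real.le_log_iff_exp_le hN0).2 hN
  have hCε : 0 ≤ 2 * C / ε := by positivity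
  have hRpos : 0 < R := (Real.exp_pos _).trans_le hR2
  have hL : 1 ≤ Real.log R := (Real.le_log_iff_exp_le hRpos).2 hR2
  have hRone : 1 ≤ R := (Real.one_le_exp zero_le_one).trans hR2
  have hr : r ≤ k₁ := c₃ ▸ c₁ ▸ card_le_card inter_subset_left
  have hpow : R ^ 4 * Real.log N ^ (4 * B) ≤ N := by
    rw [Real.rpow_neg (by linarith), Real.rpow_natCast, ← div_eq_mul_inv, le_div_iff₀ (pow_pos (by linarith) _)] at hRN
    have := pow_le_pow_left₀ (mul_nonneg hRpos.le (pow_nonneg (by linarith) _)) hRN 4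
    rwa [← Real.rpow_mul_natCast hN0.le, mul_pow, ← pow_mul, mul_comm B, Nat.cast_ofNat, one_div_mul_cancel four_ne_zero, Real.rpow_one] at this
  have hRN' : R ≤ N := (le_self_pow₀ hRone four_ne_zero).trans
    ((le_mul_of_one_le_right (by positivity) (one_le_pow₀ (by linarith))).trans hpow)
  have hfl := Nat.floor_le hRpos.le
  have hh₀1 := mem_Icc.1 hh₀
  obtain ⟨E, hE0, hE, hEs⟩ := hBV N h₀ (⌊R⌋₊ ^ 2) (hRone.trans hRN') hh₀1.1
    ((by exact_mod_cast hh₀1.2 : (h₀ : ℝ) ≤ h).trans (hhR.trans hRN')) (by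
      refine le_trans ?_ hpow
      rw [Nat.cast_pow, ← pow_mul, show 4 * B = 2 * (2 * B) by ring, pow_mul _ 2 (2 * B)]
      exact mul_le_mul (pow_le_pow_left₀ (by positivity) hfl 4)
        (pow_le_pow_left₀ (by linarith) (by nlinarith) _) (pow_nonneg (by linarith) _) (by positivity))
  have hset : (Icc 1 ⌊2 * N⌋₊).filter (fun n : ℕ => N < (n : ℝ) ∧ (n : ℝ) ≤ 2 * N) = Ioc ⌊N⌋₊ ⌊2 * N⌋₊ := by
    ext n
    rw [mem_filter, mem_Icc, mem_Ioc, Nat.floor_lt hN0.le, ← Nat.le_floor_iff (by positivity)]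
    refine ⟨fun h => h.2, fun h => ⟨⟨?_, h.2⟩, h⟩⟩
    exact_mod_cast hN0.trans h.1
  have h1 := abs_sum_theta_lamR_sub_le hRone (s := Ioc ⌊N⌋₊ ⌊2 * N⌋₊) (fun n hn => ?_) hE0 hE H₁ H₂ (k₁ + l₁) (k₂ + l₂)
  swap
  · have := (mem_Ioc.1 hn).1
    have := Nat.floor_le_floor hRN'
    constructor <;> lia
  have h2 : (1 + Real.log R) ^ (k₁ + l₁ + (k₂ + l₂)) * ∑ q ∈ Ioc 0 (⌊R⌋₊ ^ 2), (q.divisors.card : ℝ) ^ (2 * H₁.card + H₂.card) * E q ≤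
      ε / 2 * N := by
    have h3 : ∑ q ∈ Ioc 0 (⌊R⌋₊ ^ 2), (q.divisors.card : ℝ) ^ (2 * H₁.card + H₂.card) * E q ≤ C * N / (1 + Real.log N) ^ (M + 1) := by
      refine (sum_le_sum fun q hq => mul_le_mul_of_nonneg_right (pow_le_pow_right₀ ?_ (by lia)) (hE0 q)).trans hEs
      exact_mod_cast card_pos.2 (Nat.nonempty_divisors.2 (mem_Ioc.1 hq).1.ne')
    have h4 : (1 + Real.log R) ^ (k₁ + l₁ + (k₂ + l₂)) ≤ (1 + Real.log N) ^ M :=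
      (pow_le_pow_right₀ (by linarith) (by lia)).trans
        (pow_le_pow_left₀ (by linarith) (by linarith [Real.log_le_log hRpos hRN']) M)
    have h5 : 0 < 1 + Real.log N := by linarith
    refine (mul_le_mul h4 h3 (sum_nonneg fun q _ => mul_nonneg (by positivity) (hE0 q)) (by positivity)).trans ?_
    rw [pow_succ, mul_div_assoc', mul_div_mul_left _ _ (by positivity), div_le_iff₀ h5]
    have h6 : 2 * C ≤ Real.log N * ε := (div_le_iff₀ hε).1 (by linarith)
    nlinarith
  have h3 := hR₀ R hR1 ⟨k₁, by lia⟩ ⟨k₂, by lia⟩ ⟨l₁, by lia⟩ ⟨l₂, by lia⟩ ⟨r, by lia⟩ h h₀ H₁ H₂ hhR hH₁ hH₂ hh₀ hh₀' c₁ c₂ c₃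
  dsimp only at h3
  rw [show l₁ + l₂ + r = r + l₁ + l₂ by ring] at h3
  rw [hset]
  have h4 := mul_le_mul_of_nonneg_left h3 hN0.le
  rw [← abs_of_pos hN0, ← abs_mul, abs_of_pos hN0] at h4
  have h5 : ε / 2 * N ≤ ε / 2 * N * Real.log R ^ (r + l₁ + l₂) := le_mul_of_one_le_right (by positivity) (one_le_pow₀ hL)
  have h6 := (abs_add_le _ _).trans (add_le_add (h1.trans (h2.trans h5)) h4)
  refine le_of_eq_of_le (congrArg abs ?_) (h6.trans_eq ?_) <;> ring
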